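/- For every ε > 0 there exists M such that for every odd integer m ≥ M there exist μ ∈ (m + 1 − ε, m + 1), σ ∈ (0, ε), and a nontrivial μ-homogeneous solution u of the thin obstacle problem in ℝ³ whose contact set is exactly Z(u) = {(r·cos θ, r·sin θ, 0) : r ≥ 0, θ ∈ ℝ, and |θ − 2πk/m| ≤ σπ/m for some integer k}. In other words, the homogeneities μ_m and slit sizes σ_m of Theorem 1.1 can be chosen so that m + 1 − μ_m → 0 and σ_m → 0 as m → ∞ along odd integers. -/

import Mathlib

open Real Set Filter

/-- Partial derivative of `f : ℝⁿ → ℝ` in the `i`-th coordinate direction. -/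
noncomputable def pd {n : ℕ} (i : Fin n) (f : (Fin n → ℝ) → ℝ) (x : Fin n → ℝ) : ℝ :=
  fderiv ℝ f x (Pi.single i 1)

/-- The Laplacian of `f : ℝⁿ → ℝ`. -/
noncomputable def lap {n : ℕ} (f : (Fin n → ℝ) → ℝ) (x : Fin n → ℝ) : ℝ :=
  ∑ i, pd i (pd i f) x

/-- The contact set `Z(u) = {xᵢ = 0} ∩ {u = 0}`, `i` being the distinguished coordinate. -/
def contactSet {n : ℕ} (u : (Fin n → ℝ) → ℝ) (i : Fin n) : Set (Fin n → ℝ) :=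
  {x | x i = 0 ∧ u x = 0}

/-- `d` is the one-sided derivative `∂ᵢ⁺u(x) = lim_{t→0⁺} (u(x+t eᵢ) - u(x))/t`. -/
def HasUpperDeriv {n : ℕ} (u : (Fin n → ℝ) → ℝ) (i : Fin n) (x : Fin n → ℝ) (d : ℝ) : Prop :=
  Filter.Tendsto (fun t : ℝ => (u (x + t • (Pi.single i 1 : Fin n → ℝ)) - u x) / t)
    (nhdsWithin 0 (Set.Ioi 0)) (nhds d)

/-- `u` is a `μ`-homogeneous solution of the thin obstacle problem in `ℝⁿ`,
with thin space `{xᵢ = 0}`. -/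
structure IsTOPSol {n : ℕ} (μ : ℝ) (u : (Fin n → ℝ) → ℝ) (i : Fin n) : Prop where
  cont : Continuous u
  symm : ∀ x, u (Function.update x i (-(x i))) = u x
  homog : ∀ r : ℝ, 0 < r → ∀ x, u (r • x) = r ^ μ * u x
  smooth : ContDiffOn ℝ 2 u (contactSet u i)ᶜ
  harm : ∀ x ∈ (contactSet u i)ᶜ, lap u x = 0
  nonneg : ∀ x, x i = 0 → 0 ≤ u x
  upper : ∀ x, x i = 0 → ∃ d, d ≤ 0 ∧ HasUpperDeriv u i x d


/-- The closed cone in the thin space consisting of `2m` evenly spaced slits of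
angular half-width `σπ/m`. -/
def slitCone (m : ℕ) (σ : ℝ) : Set (Fin 3 → ℝ) :=
  {x | ∃ r : ℝ, 0 ≤ r ∧ ∃ θ : ℝ, (∃ k : ℤ, |θ - 2 * π * k / m| ≤ σ * π / m) ∧
      x = ![r * Real.cos θ, r * Real.sin θ, 0]}

namespace TO

/-- raw hypergeometric coefficients -/
noncomputable def craw (M : ℝ) : ℕ → ℝ
  | 0 => 1
  | (l+1) => ((l:ℝ) * (l+1) - M) / ((l:ℝ)+1)^2 * craw M l

lemma craw_succ (M : ℝ) (l : ℕ) :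
    ((l:ℝ)+1)^2 * craw M (l+1) = ((l:ℝ) * (l+1) - M) * craw M l := by
  have : ((l:ℝ)+1) ≠ 0 := by positivity
  rw [craw]; field_simp

lemma craw_ne (M : ℝ) (hM : ∀ j : ℕ, M ≠ (j:ℝ) * (j+1)) (l : ℕ) : craw M l ≠ 0 := by
  induction l with
  | zero => simp [craw]
  | succ l ih =>
    have h1 : ((l:ℝ)+1) ≠ 0 := by positivity
    rw [craw]
    have := hM l
    have h2 : (l:ℝ) * (l+1) - M ≠ 0 := fun h => this (by linarith)
    positivity

/-- scaled -/
lemma eraw_succ (M : ℝ) (l : ℕ) (hl : 1 ≤ l) :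
    ((l+1:ℕ):ℝ) * craw M (l+1) = (l * craw M l) * (1 - M / ((l:ℝ) * (l+1))) := by
  have h1 : ((l:ℝ)+1) ≠ 0 := by positivity
  have h0 : (l:ℝ) ≠ 0 := by positivity
  rw [craw]; push_cast; field_simp

/-- For a base point `l ≥ 2 * M`, the ratio stays between. -/
lemma eraw_ratio (M : ℝ) (hM0 : 0 < M) (l : ℕ) (hl1 : 1 ≤ l) (hl : 2 * M ≤ l) (i : ℕ) :
    let f : ℕ → ℝ := fun i => ((l+i:ℕ):ℝ) * craw M (l+i)
    ∃ r : ℝ, f i = f 0 * r ∧ 1 - M * (1 / l - 1 / ((l:ℝ)+i)) ≤ r ∧ r ≤ 1 := by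
  intro f
  induction i with
  | zero => exact ⟨1, by simp, by simp, le_rfl⟩
  | succ i ih =>
    obtain ⟨r, h1, h2, h3⟩ := ih
    have hl0 : (0:ℝ) < l := by positivity
    have hL : (0:ℝ) < (l:ℝ)+i := by positivity
    have hfs : f (i+1) = f i * (1 - M / (((l:ℝ)+i) * ((l:ℝ)+i+1))) := by
      have := eraw_succ M (l+i) (by omega)
      simp only [f]
      rw [show l + (i+1) = l+i+1 by ring, this]; push_cast; rfl
    have hx : M / (((l:ℝ)+i) * ((l:ℝ)+i+1)) = M * (1/((l:ℝ)+i) - 1/((l:ℝ)+i+1)) := by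
      field_simp; ring
    have hi : 1 / ((l:ℝ)+i) ≤ 1 / l := one_div_le_one_div_of_le hl0 (by linarith [Nat.cast_nonneg (α:=ℝ) i])
    have hx0 : 0 ≤ M / (((l:ℝ)+i) * ((l:ℝ)+i+1)) := by positivity
    have hMl : M * (1/(l:ℝ)) ≤ 1/2 := by
      rw [mul_one_div, div_le_iff₀ hl0]; linarith
    have hpos : 0 ≤ r := by
      have : 0 ≤ M * (1 / ((l:ℝ)+i)) := by positivity
      nlinarith
    set x := M / (((l:ℝ)+i) * ((l:ℝ)+i+1)) with hxd
    refine ⟨r * (1 - x), by rw [hfs, h1]; ring, ?_, ?_⟩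
    · push_cast
      have : r * x ≤ 1 * x := mul_le_mul_of_nonneg_right h3 hx0
      rw [← add_assoc]
      nlinarith
    · nlinarith [mul_nonneg hpos hx0]

lemma exists_coeff (M : ℝ) (hM0 : 0 < M) (hM : ∀ j : ℕ, M ≠ (j:ℝ) * (j+1)) :
    ∃ c : ℕ → ℝ, (∀ l : ℕ, ((l:ℝ)+1)^2 * c (l+1) = ((l:ℝ) * (l+1) - M) * c l) ∧
      ∃ C : ℝ, 0 ≤ C ∧ ∀ l : ℕ, 1 ≤ l → |c l - 1 / l| ≤ C / (l:ℝ)^2 := by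
  obtain ⟨J, hJ⟩ := exists_nat_ge (2*M+1)
  have hJ1 : 1 ≤ J := by
    have : (1:ℝ) ≤ J := by linarith
    exact_mod_cast this
  set e : ℕ → ℝ := fun l => (l:ℝ) * craw M l with he
  -- limit
  have hlim : ∃ E : ℝ, Tendsto e atTop (nhds E) := by
    -- monotone ratio
    have hr : ∀ i, ∃ r : ℝ, e (J+i) = e J * r ∧ 1 - M * (1 / J - 1 / ((J:ℝ)+i)) ≤ r ∧ r ≤ 1 := by
      intro i
      have := eraw_ratio M hM0 J hJ1 (by linarith) i
      simpa [he] using this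
    choose r hr1 hr2 hr3 using hr
    have heJ : e J ≠ 0 := mul_ne_zero (by positivity) (craw_ne M hM J)
    have hrpos : ∀ i, 0 ≤ r i := by
      intro i
      have h0 : (0:ℝ) < J := by positivity
      have hMl : M * (1/(J:ℝ)) ≤ 1/2 := by
        rw [mul_one_div, div_le_iff₀ h0]; linarith
      have : 0 ≤ M * (1 / ((J:ℝ)+i)) := by positivity
      nlinarith [hr2 i]
    have hanti : Antitone r := by
      apply antitone_nat_of_succ_le
      intro i
      have h1 := eraw_ratio M hM0 (J+i) (by omega) (by push_cast; linarith [Nat.cast_nonneg (α:=ℝ) i]) 1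
      obtain ⟨ρ, h2, -, h4⟩ := h1
      have h2' : e (J+(i+1)) = e (J+i) * ρ := by
        have : J + (i+1) = J+i+1 := by ring
        rw [this]; simpa [he] using h2
      rw [hr1, hr1] at h2'
      have h2'' : e J * r (i+1) = e J * (r i * ρ) := by rw [h2']; ring
      have := mul_left_cancel₀ heJ h2''
      rw [this]
      nlinarith [hrpos i]
    have hb : BddBelow (range r) := ⟨0, by rintro _ ⟨i, rfl⟩; exact hrpos i⟩
    have ht := tendsto_atTop_ciInf hanti hb
    refine ⟨e J * ⨅ i, r i, ?_⟩
    rw [← tendsto_add_atTop_iff_nat J]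
    have := ht.const_mul (e J)
    refine this.congr (fun i => ?_)
    rw [add_comm i J, hr1]
  obtain ⟨E, hE⟩ := hlim
  have key : ∀ l, J ≤ l → ∃ r : ℝ, E = e l * r ∧ 1 - M / l ≤ r ∧ r ≤ 1 := by
    intro l hl
    have hl1 : 1 ≤ l := le_trans hJ1 hl
    have hel : e l ≠ 0 := mul_ne_zero (by positivity) (craw_ne M hM l)
    have hlJ : (J:ℝ) ≤ l := by exact_mod_cast hl
    refine ⟨E / e l, by field_simp, ?_⟩
    have ht : Tendsto (fun i => e (l+i) / e l) atTop (nhds (E / e l)) := by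
      have := ((tendsto_add_atTop_iff_nat l).2 hE).div_const (e l)
      refine this.congr (fun i => by rw [add_comm])
    have hb : ∀ i, 1 - M / l ≤ e (l+i)/e l ∧ e (l+i)/e l ≤ 1 := by
      intro i
      obtain ⟨r, h1, h2, h3⟩ := eraw_ratio M hM0 l hl1 (by linarith) i
      have h1' : e (l+i) = e l * r := by simpa [he] using h1
      have : e (l+i)/e l = r := by rw [h1']; field_simp
      rw [this]
      refine ⟨?_, h3⟩
      have hl0 : (0:ℝ) < l := by positivity
      have : 0 ≤ M * (1 / ((l:ℝ)+i)) := by positivity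
      have h5 : M * (1/(l:ℝ)) = M / l := by ring
      nlinarith
    exact ⟨ge_of_tendsto' ht (fun i => (hb i).1), le_of_tendsto' ht (fun i => (hb i).2)⟩
  have hMl : ∀ l, J ≤ l → M / l ≤ 1/2 := by
    intro l hl
    have hlJ : (J:ℝ) ≤ l := by exact_mod_cast hl
    have : (0:ℝ) < l := by linarith
    rw [div_le_iff₀ this]; linarith
  have hE0 : E ≠ 0 := by
    obtain ⟨r, h1, h2, h3⟩ := key J le_rfl
    have := hMl J le_rfl
    rw [h1]
    exact mul_ne_zero (mul_ne_zero (by positivity) (craw_ne M hM J)) (by linarith)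
  refine ⟨fun l => craw M l / E, fun l => ?_, ?_⟩
  · rw [mul_div_assoc', craw_succ, mul_div_assoc]
  · set S : ℝ := ∑ l ∈ Finset.range J, |craw M l / E - 1/l| * (l:ℝ)^2 with hS
    have hS0 : 0 ≤ S := Finset.sum_nonneg (fun _ _ => by positivity)
    refine ⟨S + 2*M, by positivity, fun l hl => ?_⟩
    have hl0 : (0:ℝ) < l := by positivity
    rw [le_div_iff₀ (by positivity)]
    rcases lt_or_ge l J with h | h
    · have : |craw M l / E - 1/l| * (l:ℝ)^2 ≤ S :=
        Finset.single_le_sum (f := fun l : ℕ => |craw M l / E - 1/l| * (l:ℝ)^2)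
          (fun _ _ => by positivity) (Finset.mem_range.2 h)
      linarith
    · obtain ⟨r, h1, h2, h3⟩ := key l h
      have h4 := hMl l h
      have hr : 0 < r := by linarith
      have hcr : craw M l ≠ 0 := craw_ne M hM l
      have : craw M l / E - 1/l = (1 - r) / (r * l) := by
        rw [h1]; simp only [he]; field_simp
      rw [this, abs_of_nonneg (div_nonneg (by linarith) (by positivity))]
      rw [div_mul_eq_mul_div, div_le_iff₀ (by positivity)]
      have h5 : (1 - r) * l ≤ M := by
        have : M / l * l = M := by field_simp
        nlinarith
      have h6 : (1 - r) * (l:ℝ)^2 ≤ M * l := by nlinarith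
      have h7 : M * l ≤ 2 * M * (r * l) := by
        have : 1/2 ≤ r := by linarith
        have : 0 ≤ M * l * (2 * r - 1) := mul_nonneg (by positivity) (by linarith)
        nlinarith
      have h8 : 0 ≤ S * (r * l) := by positivity
      linarith
end TO

namespace TO

/-- normalized binomials -/
noncomputable def Bn (l n : ℕ) : ℝ := (Nat.choose (2*l) (l+n) : ℝ) / 4^l

lemma Bn_nonneg (l n : ℕ) : 0 ≤ Bn l n := by unfold Bn; positivity

lemma Bn_eq_zero {l n : ℕ} (h : l < n) : Bn l n = 0 := by
  unfold Bn; rw [Nat.choose_eq_zero_of_lt (by omega)]; simp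

lemma Bn_ratio (l n : ℕ) : ((l:ℝ)+n+1) * Bn l (n+1) = ((l:ℝ)-n) * Bn l n := by
  rcases le_or_gt n l with h | h
  · have h1 := Nat.choose_succ_right_eq (2*l) (l+n)
    have h2 : 2*l - (l+n) = l - n := by omega
    rw [h2] at h1
    have h3 : ((Nat.choose (2*l) (l+n+1) : ℕ):ℝ) * (l+n+1) = (Nat.choose (2*l) (l+n)) * ((l:ℝ)-n) := by
      rw [← Nat.cast_sub h]; exact_mod_cast h1
    unfold Bn
    rw [← add_assoc]
    rw [mul_div_assoc', mul_div_assoc']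
    congr 1
    linarith
  · rw [Bn_eq_zero h, Bn_eq_zero (by omega)]; simp

lemma Bn_succ_mul (l n : ℕ) :
    ((l:ℝ)+1+n) * ((l:ℝ)+1-n) * Bn (l+1) n = (l+1) * (2*l+1) / 2 * Bn l n := by
  rcases le_or_gt n l with h | h
  · have h1 := Nat.add_one_mul_choose_eq (2*l+1) (l+n)
    have h2 := Nat.choose_mul_succ_eq (2*l) (l+n)
    have h3 : 2*l+1 - (l+n) = l+1-n := by omega
    rw [h3] at h2
    have h2' : ((Nat.choose (2*l) (l+n) : ℕ):ℝ) * (2*l+1) = (Nat.choose (2*l+1) (l+n)) * ((l:ℝ)+1-n) := by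
      have : ((l+1-n:ℕ):ℝ) = (l:ℝ)+1-n := by rw [Nat.cast_sub (by omega)]; push_cast; ring
      rw [← this]; exact_mod_cast h2
    have h1' : (2*(l:ℝ)+1+1) * (Nat.choose (2*l+1) (l+n) : ℕ) = (Nat.choose (2*l+1+1) (l+n+1) : ℕ) * ((l:ℝ)+n+1) := by
      exact_mod_cast h1
    unfold Bn
    rw [show 2*(l+1) = 2*l+1+1 by ring, show l+1+n = l+n+1 by ring, pow_succ]
    field_simp
    linear_combination (-2)*((l:ℝ)+1-n) * h1' - 2*(2*(l:ℝ)+2)*h2'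
  · rw [Bn_eq_zero h]
    rcases Nat.lt_or_ge (l+1) n with h' | h'
    · rw [Bn_eq_zero h']; simp
    · have : n = l+1 := by omega
      subst this; push_cast; ring

lemma Bn_tele (l n : ℕ) :
    ((n:ℝ)+1) * ((n+2) * Bn (l+1) (n+2) - n * Bn (l+1) n)
      = ((l:ℝ)+1)*(l+2) * (Bn (l+1) (n+2) - Bn (l+1) n)
        - ((l:ℝ)+1)^2 * (Bn l (n+2) - Bn l n) := by
  have h1 := Bn_succ_mul l n
  have h2 := Bn_succ_mul l (n+2)
  have h3 := Bn_ratio (l+1) n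
  have h4 := Bn_ratio (l+1) (n+1)
  rw [show n+1+1 = n+2 by ring] at h4
  push_cast at h1 h2 h3 h4
  have hl : (2*(l:ℝ)+1) ≠ 0 := by positivity
  have e1 : ((l:ℝ)+1) * Bn l n = 2 * ((l:ℝ)+1+n) * ((l:ℝ)+1-n) * Bn (l+1) n / (2*l+1) := by
    rw [eq_div_iff hl]; linear_combination (-2)*h1
  have e2 : ((l:ℝ)+1) * Bn l (n+2) = 2 * ((l:ℝ)+1+(n+2)) * ((l:ℝ)+1-(n+2)) * Bn (l+1) (n+2) / (2*l+1) := by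
    rw [eq_div_iff hl]; linear_combination (-2)*h2
  have e3 : ((l:ℝ)+1-n)*((l:ℝ)-n) * Bn (l+1) n = ((l:ℝ)+n+3)*((l:ℝ)+n+2) * Bn (l+1) (n+2) := by
    linear_combination (-((l:ℝ)-n)) * h3 - ((l:ℝ)+n+2) * h4
  have e4 : ((l:ℝ)+1)^2 * (Bn l (n+2) - Bn l n) = ((l:ℝ)+1) * (((l:ℝ)+1) * Bn l (n+2)) - ((l:ℝ)+1) * (((l:ℝ)+1) * Bn l n) := by ring
  rw [e4, e1, e2]
  field_simp
  linear_combination e3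

lemma Bn_diff (l n : ℕ) : Bn l n - Bn l (n+1) = Bn l n * (2*n+1) / ((l:ℝ)+n+1) := by
  have h : ((l:ℝ)+n+1) ≠ 0 := by positivity
  rw [eq_div_iff h]; linear_combination (-1)*Bn_ratio l n

lemma Bn_succ_le (l n : ℕ) : Bn l (n+1) ≤ Bn l n := by
  have := Bn_diff l n
  have h2 : 0 ≤ Bn l n * (2*n+1) / ((l:ℝ)+n+1) := by have := Bn_nonneg l n; positivity
  linarith

lemma Bn_zero_sq (l : ℕ) : (Bn l 0)^2 * (2*l+1) ≤ 1 := by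
  induction l with
  | zero => simp [Bn]
  | succ l ih =>
    have h := Bn_succ_mul l 0
    have e : Bn (l+1) 0 = (2*l+1)/(2*(l+1)) * Bn l 0 := by
      field_simp; push_cast at h
      have h1 : ((l:ℝ)+1) ≠ 0 := by positivity
      apply mul_left_cancel₀ h1
      linear_combination 2*h
    rw [e]; push_cast
    have h0 := sq_nonneg (Bn l 0)
    rw [mul_pow, div_pow, div_mul_eq_mul_div, div_mul_eq_mul_div, div_le_one (by positivity)]
    have : (2*(l:ℝ)+1)^2 * Bn l 0^2 * (2*(l+1)+1) = (Bn l 0^2 * (2*l+1)) * ((2*l+1)*(2*l+3)) := by ring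
    rw [this]
    have : (Bn l 0^2 * (2*l+1)) * ((2*(l:ℝ)+1)*(2*l+3)) ≤ 1 * ((2*l+1)*(2*l+3)) :=
      mul_le_mul_of_nonneg_right ih (by positivity)
    nlinarith

lemma Bn_le_zero (l n : ℕ) : Bn l n ≤ Bn l 0 := by
  induction n with
  | zero => exact le_rfl
  | succ n ih => exact (Bn_succ_le l n).trans ih

lemma Bn_le (l n : ℕ) : Bn l n ≤ 1 / √((l:ℝ)+1) := by
  refine (Bn_le_zero l n).trans ?_
  rw [le_div_iff₀ (by positivity)]
  have h := Bn_zero_sq l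
  have h0 := Bn_nonneg l 0
  apply abs_le_of_sq_le_sq' _ (by norm_num) |>.2
  rw [mul_pow, Real.sq_sqrt (by positivity)]
  nlinarith [sq_nonneg (Bn l 0), Nat.cast_nonneg (α:=ℝ) l, mul_nonneg (sq_nonneg (Bn l 0)) (Nat.cast_nonneg (α:=ℝ) l)]

lemma Bn_diff2 (l n : ℕ) : |Bn l (n+2) - Bn l n| ≤ (4*n+4) / ((l:ℝ)+1) * (1 / √((l:ℝ)+1)) := by
  have h1 := Bn_diff l n
  have h2 := Bn_diff l (n+1)
  rw [show n+1+1 = n+2 by ring] at h2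
  have k1 := Bn_succ_le l n
  have k2 := Bn_succ_le l (n+1)
  rw [show n+1+1 = n+2 by ring] at k2
  rw [abs_of_nonpos (by linarith)]
  have b0 := Bn_nonneg l n
  have b1 := Bn_nonneg l (n+1)
  have e1 : Bn l n * (2*n+1) / ((l:ℝ)+n+1) ≤ (2*n+1)/((l:ℝ)+1) * (1 / √((l:ℝ)+1)) := by
    rw [mul_div_assoc, mul_comm]
    apply mul_le_mul _ (Bn_le l n) b0 (by positivity)
    apply div_le_div_of_nonneg_left (by positivity) (by positivity); linarith [Nat.cast_nonneg (α:=ℝ) n]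
  have e2 : Bn l (n+1) * (2*(n+1:ℕ)+1) / ((l:ℝ)+(n+1:ℕ)+1) ≤ (2*n+3)/((l:ℝ)+1) * (1 / √((l:ℝ)+1)) := by
    rw [mul_div_assoc, mul_comm]
    apply mul_le_mul _ (Bn_le l (n+1)) b1 (by positivity)
    push_cast
    rw [show 2*((n:ℝ)+1)+1 = 2*n+3 by ring]
    apply div_le_div_of_nonneg_left (by positivity) (by positivity); linarith [Nat.cast_nonneg (α:=ℝ) n]
  have : (4*n+4) / ((l:ℝ)+1) * (1 / √((l:ℝ)+1)) = (2*n+1)/((l:ℝ)+1) * (1 / √((l:ℝ)+1)) + (2*n+3)/((l:ℝ)+1) * (1 / √((l:ℝ)+1)) := by ring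
  linarith

/-- cosine expansion -/
lemma cos_pow_expand (l : ℕ) (θ : ℝ) :
    (Real.cos (θ/2))^(2*l) = ∑ i ∈ Finset.range (2*l+1),
      ((Nat.choose (2*l) i : ℝ) / 4^l) * Real.cos (((i:ℝ) - l) * θ) := by
  have key : ((Complex.cos ((θ:ℂ)/2))^(2*l)) = ∑ i ∈ Finset.range (2*l+1),
      ((Nat.choose (2*l) i : ℂ) / 4^l) * Complex.exp (((i:ℂ) - l) * θ * Complex.I) := by
    rw [Complex.cos, div_pow, add_pow, Finset.sum_div]
    apply Finset.sum_congr rfl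
    intro i hi
    have hi' : i ≤ 2*l := by simp at hi; omega
    rw [← Complex.exp_nat_mul, ← Complex.exp_nat_mul, ← Complex.exp_add, Nat.cast_sub hi']
    rw [pow_mul, show (2:ℂ)^2 = 4 by norm_num]
    have e : ((i:ℕ):ℂ) * ((θ:ℂ)/2 * Complex.I) + (((2*l:ℕ):ℂ) - i) * (-((θ:ℂ)/2) * Complex.I) = ((i:ℂ) - l) * θ * Complex.I := by
      push_cast; ring
    rw [e]; ring
  have h2 := congrArg Complex.re key
  have h3 : ((Complex.cos ((θ:ℂ)/2))^(2*l)).re = (Real.cos (θ/2))^(2*l) := by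
    have : (Complex.cos ((θ:ℂ)/2))^(2*l) = (((Real.cos (θ/2))^(2*l) : ℝ) : ℂ) := by push_cast; rfl
    rw [this, Complex.ofReal_re]
  rw [h3] at h2
  rw [h2, Complex.re_sum]
  apply Finset.sum_congr rfl
  intro i _
  have h4 : ((Nat.choose (2*l) i : ℂ) / 4^l) = (((Nat.choose (2*l) i : ℝ) / 4^l : ℝ) : ℂ) := by push_cast; rfl
  have h5 : (((i:ℂ) - l) * θ * Complex.I) = (((((i:ℝ) - l) * θ : ℝ)):ℂ) * Complex.I := by push_cast; rfl
  rw [h4, h5, Complex.re_ofReal_mul, Complex.exp_ofReal_mul_I_re]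

end TO

namespace TO

/-- summable majorant -/
noncomputable def hS (l : ℕ) : ℝ := 1 / (((l:ℝ)+1) * √((l:ℝ)+1))

lemma hS_nonneg (l : ℕ) : 0 ≤ hS l := by unfold hS; positivity

lemma hS_summable : Summable hS := by
  have h : Summable (fun n : ℕ => 1 / (n:ℝ)^(3/2:ℝ)) := Real.summable_one_div_nat_rpow.mpr (by norm_num)
  have h2 := (summable_nat_add_iff 1).mpr h
  refine h2.congr (fun l => ?_)
  unfold hS
  push_cast
  rw [show (3/2:ℝ) = 1 + 1/2 by norm_num, Real.rpow_add (by positivity), Real.rpow_one, Real.sqrt_eq_rpow]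

/-- Fourier coefficient -/
noncomputable def an (c : ℕ → ℝ) (n : ℕ) : ℝ := ∑' l, c l * Bn l n

lemma cB_bound {c : ℕ → ℝ} {K : ℝ} (hK : ∀ l, |c l| ≤ K / ((l:ℝ)+1)) (l n : ℕ) :
    |c l * Bn l n| ≤ K * hS l := by
  rw [abs_mul, abs_of_nonneg (Bn_nonneg l n)]
  have : K * hS l = K / ((l:ℝ)+1) * (1 / √((l:ℝ)+1)) := by
    unfold hS; field_simp
  rw [this]
  exact mul_le_mul (hK l) (Bn_le l n) (Bn_nonneg l n) ((abs_nonneg _).trans (hK l))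

lemma cB_summable {c : ℕ → ℝ} {K : ℝ} (hK : ∀ l, |c l| ≤ K / ((l:ℝ)+1)) (n : ℕ) :
    Summable (fun l => c l * Bn l n) :=
  Summable.of_norm_bounded (hS_summable.mul_left K) (fun l => by
    rw [Real.norm_eq_abs]; exact cB_bound hK l n)

lemma an_rec {c : ℕ → ℝ} {K M : ℝ} (hK : ∀ l, |c l| ≤ K / ((l:ℝ)+1)) (n : ℕ)
    (hrec : ∀ l : ℕ, (1 ≤ l ∨ n = 0) → ((l:ℝ)+1)^2 * c (l+1) = ((l:ℝ)*(l+1) - M) * c l) :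
    (((n:ℝ)+1)*(n+2) - M) * an c (n+2) = ((n:ℝ)*(n+1) - M) * an c n := by
  let T : ℕ → ℝ := fun l => (l:ℝ)^2 * c l * (Bn (l-1) (n+2) - Bn (l-1) n)
  have hterm : ∀ l : ℕ, (((n:ℝ)+1)*(n+2) - M) * (c l * Bn l (n+2)) - ((n:ℝ)*(n+1) - M) * (c l * Bn l n)
      = T (l+1) - T l := by
    intro l
    rcases l with _ | l
    · simp only [T]
      rcases Nat.eq_zero_or_pos n with h | h
      · subst h
        have := hrec 0 (Or.inr rfl)
        have e1 : Bn 0 2 = 0 := Bn_eq_zero (by norm_num)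
        have e2 : Bn 0 0 = 1 := by simp [Bn]
        push_cast at this
        simp [e1, e2]
        norm_num at this
        linarith
      · have e1 : Bn 0 (n+2) = 0 := Bn_eq_zero (by omega)
        have e2 : Bn 0 n = 0 := Bn_eq_zero (by omega)
        simp [e1, e2]
    · have h1 := hrec (l+1) (Or.inl (by omega))
      have h2 := Bn_tele l n
      simp only [T, Nat.add_sub_cancel]
      push_cast at h1 ⊢
      linear_combination (c (l+1)) * h2 - (Bn (l+1) (n+2) - Bn (l+1) n) * h1
  have hs := ((cB_summable hK (n+2)).hasSum.mul_left (((n:ℝ)+1)*(n+2) - M)).sub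
    ((cB_summable hK n).hasSum.mul_left ((n:ℝ)*(n+1) - M))
  have ht := hs.tendsto_sum_nat
  simp_rw [hterm] at ht
  simp_rw [Finset.sum_range_sub] at ht
  have hT0 : T 0 = 0 := by simp [T]
  have hTlim : Tendsto (fun L => T L - T 0) atTop (nhds 0) := by
    rw [hT0]; simp only [sub_zero]
    have hb : ∀ L : ℕ, |T L| ≤ K * (4*n+4) * (1 / √(L:ℝ)) := by
      intro L
      rcases L with _ | l
      · simp [hT0]
      · simp only [T, Nat.add_sub_cancel]
        rw [abs_mul, abs_mul]
        have h1 := hK (l+1)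
        have h2 := Bn_diff2 l n
        have hK0 : 0 ≤ K := by
          have := (abs_nonneg _).trans (hK 0); simpa using this
        have h3 : |((l+1:ℕ):ℝ)^2| * |c (l+1)| ≤ K * ((l:ℝ)+1) := by
          rw [abs_of_nonneg (by positivity)]
          calc ((l+1:ℕ):ℝ)^2 * |c (l+1)| ≤ ((l+1:ℕ):ℝ)^2 * (K / (((l+1:ℕ):ℝ)+1)) := by gcongr
            _ ≤ K * ((l:ℝ)+1) := by
              push_cast
              rw [mul_div_assoc', div_le_iff₀ (by positivity)]
              nlinarith [mul_nonneg hK0 (Nat.cast_nonneg (α:=ℝ) l)]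
        calc _ ≤ K * ((l:ℝ)+1) * ((4*n+4) / ((l:ℝ)+1) * (1 / √((l:ℝ)+1))) := by
              apply mul_le_mul h3 h2 (abs_nonneg _) (by positivity)
          _ = _ := by push_cast; field_simp
    have h0 : Tendsto (fun L : ℕ => K * (4*n+4) * (1 / √(L:ℝ))) atTop (nhds 0) := by
      have : Tendsto (fun L : ℕ => 1 / √(L:ℝ)) atTop (nhds 0) := by
        simp_rw [one_div]
        exact tendsto_inv_atTop_zero.comp (Real.tendsto_sqrt_atTop.comp tendsto_natCast_atTop_atTop)
      simpa using this.const_mul (K * (4*n+4))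
    exact squeeze_zero_norm hb h0
  have := tendsto_nhds_unique ht hTlim
  unfold an
  linarith

/-- the logarithmic coefficients -/
lemma log_hK (l : ℕ) : |(fun l : ℕ => 1 / (l:ℝ)) l| ≤ 2 / ((l:ℝ)+1) := by
  rcases l with _ | l
  · simp
  · push_cast
    rw [abs_of_nonneg (by positivity), div_le_div_iff₀ (by positivity) (by positivity)]
    nlinarith [Nat.cast_nonneg (α:=ℝ) l]

lemma log_an_one : an (fun l : ℕ => 1 / (l:ℝ)) 1 = 1 := by
  have hs := (cB_summable log_hK 1).hasSum.tendsto_sum_nat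
  have hs' := (tendsto_add_atTop_iff_nat 1).mpr hs
  have e : ∀ L : ℕ, ∑ l ∈ Finset.range (L+1), 1 / (l:ℝ) * Bn l 1 = 1 - 2 * Bn (L+1) 0 := by
    intro L
    induction L with
    | zero => simp [Bn]; norm_num
    | succ L ih =>
      rw [Finset.sum_range_succ, ih]
      have h1 := Bn_succ_mul (L+1) 0
      have h2 := Bn_ratio (L+1) 0
      push_cast at h1 h2 ⊢
      have hp : ((L:ℝ)+1) ≠ 0 := by positivity
      have hp2 : ((L:ℝ)+2) ≠ 0 := by positivity
      have h1' : Bn (L+1+1) 0 = (2*L+3)/(2*(L+2)) * Bn (L+1) 0 := by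
        field_simp
        apply mul_left_cancel₀ hp2
        linear_combination 2*h1
      have h2' : Bn (L+1) 1 = (L+1)/(L+2) * Bn (L+1) 0 := by
        field_simp
        linear_combination h2
      rw [h1', h2']; field_simp; ring
  simp_rw [e] at hs'
  have hB : Tendsto (fun L : ℕ => Bn (L+1) 0) atTop (nhds 0) := by
    have : Tendsto (fun L : ℕ => 1 / √(((L+1:ℕ):ℝ)+1)) atTop (nhds 0) := by
      simp_rw [one_div]
      refine tendsto_inv_atTop_zero.comp (Real.tendsto_sqrt_atTop.comp ?_)
      exact tendsto_atTop_add_const_right _ _ (tendsto_natCast_atTop_atTop.comp (tendsto_add_atTop_nat 1))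
    exact squeeze_zero (fun L => Bn_nonneg _ _) (fun L => Bn_le _ _) this
  have h3 : Tendsto (fun L : ℕ => 1 - 2 * Bn (L+1) 0) atTop (nhds (1 - 2*0)) :=
    (hB.const_mul 2).const_sub 1
  have := tendsto_nhds_unique hs' h3
  unfold an; linarith

lemma log_an (n : ℕ) (hn : 1 ≤ n) : an (fun l : ℕ => 1 / (l:ℝ)) n = 1 / n := by
  set a := an (fun l : ℕ => 1 / (l:ℝ)) with ha
  have hrec : ∀ n : ℕ, 1 ≤ n → ((n:ℝ)+2) * a (n+2) = n * a n := by
    intro n hn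
    have h := an_rec (M := 0) log_hK n (by
      intro l hl
      have hl : 1 ≤ l := by omega
      have : (l:ℝ) ≠ 0 := by positivity
      push_cast; field_simp; ring)
    have hp : ((n:ℝ)+1) ≠ 0 := by positivity
    apply mul_left_cancel₀ hp
    linear_combination h
  have hmono : ∀ n, a (n+1) ≤ a n := by
    intro n
    apply Summable.tsum_le_tsum _ (cB_summable log_hK _) (cB_summable log_hK _)
    intro l
    exact mul_le_mul_of_nonneg_left (Bn_succ_le l n) (by positivity)
  have hodd : ∀ k : ℕ, ((2*k+1:ℕ):ℝ) * a (2*k+1) = 1 := by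
    intro k
    induction k with
    | zero => rw [ha]; simpa using log_an_one
    | succ k ih =>
      have := hrec (2*k+1) (by omega)
      rw [ih] at this
      rw [show 2*(k+1)+1 = 2*k+1+2 by ring]; rw [← this]; push_cast; ring
  have heven : ∀ k : ℕ, ((2*k+2:ℕ):ℝ) * a (2*k+2) = 2 * a 2 := by
    intro k
    induction k with
    | zero => simp
    | succ k ih =>
      have := hrec (2*k+2) (by omega)
      rw [ih] at this
      rw [show 2*(k+1)+2 = 2*k+2+2 by ring]; rw [← this]; push_cast; ring
  have h2 : 2 * a 2 = 1 := by
    have lo : ∀ k : ℕ, (2*(k:ℝ)+2) / (2*k+3) ≤ 2 * a 2 := by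
      intro k
      have h1 := hmono (2*k+2)
      have h3 := hodd (k+1)
      rw [show 2*(k+1)+1 = 2*k+2+1 by ring] at h3
      push_cast at h3
      have h4 := heven k
      push_cast at h4
      rw [div_le_iff₀ (by positivity), ← h4]
      have : (2*(k:ℝ)+2) * ((2*k+3) * a (2*k+2+1)) ≤ (2*(k:ℝ)+2) * ((2*k+3) * a (2*k+2)) := by gcongr
      have e : (2*(k:ℝ)+3) * a (2*k+2+1) = 1 := by linarith
      rw [e] at this; nlinarith
    have hi : ∀ k : ℕ, 2 * a 2 ≤ (2*(k:ℝ)+2) / (2*k+1) := by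
      intro k
      have h1 := hmono (2*k+1)
      have h3 := hodd k
      push_cast at h3
      have h4 := heven k
      push_cast at h4
      rw [le_div_iff₀ (by positivity), ← h4]
      have : (2*(k:ℝ)+2) * ((2*k+1) * a (2*k+1+1)) ≤ (2*(k:ℝ)+2) * ((2*k+1) * a (2*k+1)) := by gcongr
      rw [h3] at this; nlinarith
    have t0 : Tendsto (fun k : ℕ => 1 / (2*(k:ℝ)+1)) atTop (nhds 0) := by
      simp_rw [one_div]
      apply tendsto_inv_atTop_zero.comp
      apply tendsto_atTop_add_const_right
      exact tendsto_natCast_atTop_atTop.const_mul_atTop (by norm_num)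
    apply le_antisymm
    · have : Tendsto (fun k : ℕ => 1 + 1 / (2*(k:ℝ)+1)) atTop (nhds (1+0)) := t0.const_add 1
      rw [add_zero] at this
      apply ge_of_tendsto' this
      intro k
      refine (hi k).trans (le_of_eq ?_)
      field_simp; ring
    · have : Tendsto (fun k : ℕ => 1 - 1 / (2*(k:ℝ)+1)) atTop (nhds (1-0)) := t0.const_sub 1
      rw [sub_zero] at this
      apply le_of_tendsto' this
      intro k
      refine le_trans ?_ (lo k)
      rw [← sub_nonneg]
      have : (2*(k:ℝ)+2) / (2*k+3) - (1 - 1 / (2*(k:ℝ)+1)) = 2 / ((2*k+3)*(2*k+1)) := by field_simp; ring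
      rw [this]; positivity
  have hn0 : (n:ℝ) ≠ 0 := by positivity
  rw [eq_div_iff hn0, mul_comm]
  rcases Nat.even_or_odd' n with ⟨k, rfl | rfl⟩
  · obtain ⟨j, rfl⟩ : ∃ j, k = j+1 := ⟨k-1, by omega⟩
    rw [show 2*(j+1) = 2*j+2 by ring, heven j, h2]
  · exact hodd k

/-- abstract characterization of the coefficients -/
def IsA (M : ℝ) (a : ℕ → ℝ) : Prop :=
  (∀ n : ℕ, (((n:ℝ)+1)*(n+2) - M) * a (n+2) = ((n:ℝ)*(n+1) - M) * a n) ∧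
  Tendsto (fun n : ℕ => (n:ℝ) * a n) atTop (nhds 1)

/-- the data of the kernel -/
structure IsC (M : ℝ) (c : ℕ → ℝ) : Prop where
  hrec : ∀ l : ℕ, ((l:ℝ)+1)^2 * c (l+1) = ((l:ℝ)*(l+1) - M) * c l
  hC : ∃ C, 0 ≤ C ∧ ∀ l : ℕ, |c l - 1 / (l:ℝ)| ≤ C / ((l:ℝ)+1)^2

lemma exists_isC (M : ℝ) (hM0 : 0 < M) (hM : ∀ j : ℕ, M ≠ (j:ℝ) * (j+1)) : ∃ c, IsC M c := by
  obtain ⟨c, h1, C, hC0, h2⟩ := exists_coeff M hM0 hM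
  refine ⟨c, h1, 4*C + |c 0|, by positivity, ?_⟩
  intro l
  rcases Nat.eq_zero_or_pos l with rfl | hl
  · simp; linarith
  · refine (h2 l hl).trans ?_
    have hl' : (1:ℝ) ≤ l := by exact_mod_cast hl
    rw [div_le_div_iff₀ (by positivity) (by positivity)]
    have : ((l:ℝ)+1)^2 ≤ 4 * l^2 := by nlinarith
    have h3 : 0 ≤ |c 0| * (l:ℝ)^2 := by positivity
    nlinarith

lemma IsC.bound {M : ℝ} {c : ℕ → ℝ} (h : IsC M c) : ∃ K, ∀ l, |c l| ≤ K / ((l:ℝ)+1) := by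
  obtain ⟨C, hC0, hC⟩ := h.hC
  refine ⟨C + 2, fun l => ?_⟩
  have h1 := hC l
  have h2 := log_hK l
  simp only at h2
  have h3 : C / ((l:ℝ)+1)^2 ≤ C / ((l:ℝ)+1) := by
    apply div_le_div_of_nonneg_left hC0 (by positivity)
    nlinarith [Nat.cast_nonneg (α:=ℝ) l]
  have : |c l| ≤ |c l - 1/(l:ℝ)| + |1/(l:ℝ)| := by
    have := abs_add_le (c l - 1/(l:ℝ)) (1/(l:ℝ)); simpa using this
  rw [add_div]; linarith

lemma IsC.isA {M : ℝ} {c : ℕ → ℝ} (h : IsC M c) : IsA M (an c) := by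
  obtain ⟨K, hK⟩ := h.bound
  obtain ⟨C, hC0, hC⟩ := h.hC
  refine ⟨fun n => an_rec hK n (fun l _ => h.hrec l), ?_⟩
  have hd : Tendsto (fun n : ℕ => ∑' l, (n:ℝ) * ((c l - 1/(l:ℝ)) * Bn l n)) atTop (nhds (∑' l : ℕ, (0:ℝ))) := by
    apply tendsto_tsum_of_dominated_convergence (bound := fun l => C * hS l) (hS_summable.mul_left C)
    · intro l
      apply tendsto_const_nhds.congr'
      filter_upwards [eventually_gt_atTop l] with n hn
      rw [Bn_eq_zero hn]; simp
    · refine Eventually.of_forall (fun n l => ?_)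
      rcases lt_or_ge l n with hl | hl
      · rw [Bn_eq_zero hl]; simp; exact mul_nonneg hC0 (hS_nonneg l)
      · rw [Real.norm_eq_abs, abs_mul, abs_mul, abs_of_nonneg (Bn_nonneg l n), abs_of_nonneg (Nat.cast_nonneg n)]
        have hln : (n:ℝ) ≤ (l:ℝ)+1 := by
          have : (n:ℝ) ≤ l := by exact_mod_cast hl
          linarith
        calc (n:ℝ) * (|c l - 1/(l:ℝ)| * Bn l n) ≤ ((l:ℝ)+1) * (C / ((l:ℝ)+1)^2 * (1/√((l:ℝ)+1))) := by
              have := hC l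
              have := Bn_le l n
              have := Bn_nonneg l n
              gcongr
          _ = C * hS l := by unfold hS; field_simp
  rw [tsum_zero] at hd
  have h1 : Tendsto (fun n : ℕ => 1 + ∑' l, (n:ℝ) * ((c l - 1/(l:ℝ)) * Bn l n)) atTop (nhds (1+0)) := hd.const_add 1
  rw [add_zero] at h1
  refine h1.congr' ?_
  filter_upwards [eventually_ge_atTop 1] with n hn
  rw [tsum_mul_left]
  have : ∑' l, (c l - 1/(l:ℝ)) * Bn l n = an c n - 1 / n := by
    rw [← log_an n hn]
    unfold an
    rw [← (cB_summable hK n).tsum_sub (cB_summable log_hK n)]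
    congr 1; ext l; ring
  rw [this]
  have hn0 : (n:ℝ) ≠ 0 := by positivity
  field_simp; ring

end TO

namespace TO

noncomputable def MM (m : ℕ) (δ : ℝ) : ℝ := ((m:ℝ)+1-δ)*((m:ℝ)+2-δ)
noncomputable def pp (m : ℕ) (δ : ℝ) (n : ℕ) : ℝ := (n:ℝ)*(n+1) - MM m δ

lemma pp_fac (m : ℕ) (δ : ℝ) (n : ℕ) : pp m δ n = ((n:ℝ)-m-1+δ)*((n:ℝ)+m+2-δ) := by
  unfold pp MM; ring

lemma pp_pos {m : ℕ} {δ : ℝ} (h0 : 0 < δ) (h1 : δ ≤ 1/2) {n : ℕ} (hn : m+1 ≤ n) : 0 < pp m δ n := by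
  have : (m:ℝ)+1 ≤ n := by exact_mod_cast hn
  rw [pp_fac]
  have := Nat.cast_nonneg (α:=ℝ) m
  apply mul_pos <;> linarith

lemma pp_neg {m : ℕ} {δ : ℝ} (h1 : δ ≤ 1/2) {n : ℕ} (hn : n ≤ m) : pp m δ n < 0 := by
  have : (n:ℝ) ≤ m := by exact_mod_cast hn
  rw [pp_fac]
  have := Nat.cast_nonneg (α:=ℝ) m
  have := Nat.cast_nonneg (α:=ℝ) n
  apply mul_neg_of_neg_of_pos <;> linarith

lemma pp_ne {m : ℕ} {δ : ℝ} (h0 : 0 < δ) (h1 : δ ≤ 1/2) (n : ℕ) : pp m δ n ≠ 0 := by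
  rcases Nat.lt_or_ge m n with h | h
  · exact (pp_pos h0 h1 h).ne'
  · exact (pp_neg h1 h).ne

lemma MM_pos {m : ℕ} {δ : ℝ} (h1 : δ ≤ 1/2) : 0 < MM m δ := by
  unfold MM; have := Nat.cast_nonneg (α:=ℝ) m; apply mul_pos <;> linarith

lemma MM_ne {m : ℕ} {δ : ℝ} (h0 : 0 < δ) (h1 : δ ≤ 1/2) (j : ℕ) : MM m δ ≠ (j:ℝ)*(j+1) := by
  have := pp_ne (m := m) h0 h1 j
  unfold pp at this; intro h; apply this; rw [h]; ring

lemma pp_logconc {m : ℕ} {δ : ℝ} (h1 : δ ≤ 1/2) (n : ℕ) :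
    pp m δ n * pp m δ (n+2) ≤ pp m δ (n+1)^2 := by
  have hM := MM_pos (m := m) h1
  have : pp m δ n * pp m δ (n+2) = pp m δ (n+1)^2 - 2*((n:ℝ)+3/2)^2 - 2*(MM m δ+1/4) + 1 := by
    unfold pp; push_cast; ring
  rw [this]
  nlinarith [Nat.cast_nonneg (α:=ℝ) n]

section
variable {m : ℕ} {δ : ℝ} {a : ℕ → ℝ}

lemma IsA.rec' (ha : IsA (MM m δ) a) (n : ℕ) : pp m δ (n+1) * a (n+2) = pp m δ n * a n := by
  have := ha.1 n
  unfold pp; push_cast; linear_combination this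

lemma pp_lim (m : ℕ) (δ : ℝ) : Tendsto (fun n : ℕ => pp m δ n / ((n:ℝ)*n)) atTop (nhds 1) := by
  have h : Tendsto (fun n : ℕ => (1:ℝ)/n) atTop (nhds 0) := tendsto_one_div_atTop_nhds_zero_nat
  have h2 : Tendsto (fun n : ℕ => 1 + (1:ℝ)/n - MM m δ * ((1:ℝ)/n*(1/n))) atTop (nhds (1+0-MM m δ*(0*0))) :=
    (h.const_add 1).sub ((h.mul h).const_mul _)
  simp only [mul_zero, add_zero, sub_zero] at h2
  refine h2.congr' ?_
  filter_upwards [eventually_ge_atTop 1] with n hn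
  have : (n:ℝ) ≠ 0 := by positivity
  unfold pp; field_simp

lemma IsA.lim1 (ha : IsA (MM m δ) a) : Tendsto (fun n : ℕ => a n * a (n+1) * pp m δ n) atTop (nhds 1) := by
  have h1 := ha.2
  have h2 := (tendsto_add_atTop_iff_nat 1).mpr h1
  have h3 := pp_lim m δ
  have h4 : Tendsto (fun n : ℕ => 1 - 1/((n:ℝ)+1)) atTop (nhds (1-0)) :=
    tendsto_one_div_add_atTop_nhds_zero_nat.const_sub 1
  have := ((h1.mul h2).mul h3).mul h4
  simp only [sub_zero, mul_one] at this
  refine this.congr' ?_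
  filter_upwards [eventually_ge_atTop 1] with n hn
  have : (n:ℝ) ≠ 0 := by positivity
  have : (n:ℝ)+1 ≠ 0 := by positivity
  push_cast
  field_simp
  ring

lemma IsA.prod (ha : IsA (MM m δ) a) (n : ℕ) : a n * a (n+1) * pp m δ n = 1 := by
  have hstep : ∀ n, a (n+1) * a (n+2) * pp m δ (n+1) = a n * a (n+1) * pp m δ n := by
    intro n; linear_combination (a (n+1)) * ha.rec' n
  have hconst : ∀ k, a (n+k) * a (n+k+1) * pp m δ (n+k) = a n * a (n+1) * pp m δ n := by
    intro k
    induction k with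
    | zero => simp
    | succ k ih => rw [← ih, ← hstep (n+k)]; rfl
  have h1 := ha.lim1
  have h2 := (tendsto_add_atTop_iff_nat n).mpr h1
  have h3 : Tendsto (fun k : ℕ => a n * a (n+1) * pp m δ n) atTop (nhds 1) := by
    refine h2.congr (fun k => ?_)
    rw [← hconst k, add_comm k n]
  exact tendsto_nhds_unique tendsto_const_nhds h3

lemma IsA.ne (ha : IsA (MM m δ) a) (n : ℕ) : a n ≠ 0 := by
  intro h; have := ha.prod n; rw [h] at this; simp at this

/-- a quantity which is antitone in steps of two dominates its limit -/
lemma two_step_ge {f : ℕ → ℝ} {L : ℝ} {n0 : ℕ} (hf : ∀ n, n0 ≤ n → f (n+2) ≤ f n)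
    (hL : Tendsto f atTop (nhds L)) {n : ℕ} (hn : n0 ≤ n) : L ≤ f n := by
  have h1 : ∀ k : ℕ, f (n+2*k) ≤ f n := by
    intro k
    induction k with
    | zero => simp
    | succ k ih => exact (hf (n+2*k) (by omega)).trans ih
  have h2 : Tendsto (fun k : ℕ => n+2*k) atTop atTop :=
    tendsto_atTop_mono (fun k => by simp only [id]; omega) tendsto_id
  exact le_of_tendsto' (hL.comp h2) h1

lemma two_step_le {f : ℕ → ℝ} {L : ℝ} {n0 : ℕ} (hf : ∀ n, n0 ≤ n → f n ≤ f (n+2))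
    (hL : Tendsto f atTop (nhds L)) {n : ℕ} (hn : n0 ≤ n) : f n ≤ L := by
  have := two_step_ge (f := fun n => - f n) (L := -L) (n0 := n0) (fun n hn => neg_le_neg (hf n hn)) hL.neg hn
  linarith

lemma IsA.pos (ha : IsA (MM m δ) a) (h0 : 0 < δ) (h1 : δ ≤ 1/2) {n : ℕ} (hn : m+1 ≤ n) : 0 < a n := by
  have hev : ∀ᶠ n : ℕ in atTop, 0 < a n := by
    have := ha.2.eventually (lt_mem_nhds (show (0:ℝ) < 1 by norm_num))
    filter_upwards [this] with n hn
    exact pos_of_mul_pos_right hn (by positivity)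
  obtain ⟨N, hN⟩ := hev.exists_forall_of_atTop
  have hdown : ∀ k : ℕ, ∀ n, m+1 ≤ n → N ≤ n + 2*k → 0 < a n := by
    intro k
    induction k with
    | zero => intro n _ h; exact hN n (by omega)
    | succ k ih =>
      intro n hn h
      have h2 := ih (n+2) (by omega) (by omega)
      have h3 := ha.rec' n
      have p1 := pp_pos h0 h1 (m := m) (n := n) hn
      have p2 := pp_pos h0 h1 (m := m) (n := n+1) (by omega)
      have : 0 < pp m δ n * a n := by rw [← h3]; positivity
      exact pos_of_mul_pos_right this p1.le
  exact hdown N n hn (by omega)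

lemma IsA.t_ge (ha : IsA (MM m δ) a) (h0 : 0 < δ) (h1 : δ ≤ 1/2) {n : ℕ} (hn : m+1 ≤ n) :
    1 ≤ (n:ℝ) * a n := by
  refine two_step_ge (f := fun n : ℕ => (n:ℝ) * a n) (n0 := m+1) ?_ ha.2 hn
  intro n hn
  have h3 := ha.rec' n
  have p2 := pp_pos h0 h1 (m := m) (n := n+1) (by omega)
  have an := ha.pos h0 h1 hn
  have hM := MM_pos (m := m) h1
  push_cast
  have : pp m δ (n+1) * (((n:ℝ)+2) * a (n+2)) ≤ pp m δ (n+1) * (n * a n) := by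
    have e : pp m δ (n+1) * (((n:ℝ)+2) * a (n+2)) = ((n:ℝ)+2) * (pp m δ n * a n) := by rw [← h3]; ring
    rw [e]
    have e2 : pp m δ (n+1) * (n * a n) - ((n:ℝ)+2) * (pp m δ n * a n) = 2 * MM m δ * a n := by
      unfold pp; push_cast; ring
    have : 0 < 2 * MM m δ * a n := by positivity
    linarith
  exact le_of_mul_le_mul_left this p2

lemma IsA.t_le (ha : IsA (MM m δ) a) (h0 : 0 < δ) (h1 : δ ≤ 1/2) (hm : 1 ≤ m) {n : ℕ} (hn : 2*m ≤ n) :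
    (n:ℝ) * a n * (1 - 2 * MM m δ / (n:ℝ)^2) ≤ 1 := by
  have hM := MM_pos (m := m) h1
  refine two_step_le (f := fun n : ℕ => (n:ℝ) * a n * (1 - 2 * MM m δ / (n:ℝ)^2)) (n0 := 2*m) ?_ ?_ hn
  · intro n hn
    have h3 := ha.rec' n
    have p2 := pp_pos h0 h1 (m := m) (n := n+1) (by omega)
    have an := ha.pos h0 h1 (n := n) (by omega)
    have hnm : 2*(m:ℝ) ≤ n := by exact_mod_cast hn
    have hn0 : (0:ℝ) < n := by have : 0 < n := by omega
                               exact_mod_cast this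
    have hMle : MM m δ ≤ ((n:ℝ)+2)*(n+4)/4 := by
      unfold MM
      have : ((m:ℝ)+1-δ)*((m:ℝ)+2-δ) ≤ ((n:ℝ)/2+1)*((n:ℝ)/2+2) := by
        have := Nat.cast_nonneg (α:=ℝ) m
        apply mul_le_mul <;> linarith
      linarith
    have hp : ((n:ℝ)+2)*(3*n/4) ≤ pp m δ (n+1) := by
      unfold pp; push_cast; nlinarith
    have key : 2*MM m δ/(n * pp m δ (n+1)) ≤ 2*MM m δ/(n:ℝ)^2 - 2*MM m δ/((n:ℝ)+2)^2 := by
      have : 2*MM m δ/(n:ℝ)^2 - 2*MM m δ/((n:ℝ)+2)^2 = 2*MM m δ * ((4*n+4)/(n^2*(n+2)^2)) := by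
        field_simp; ring
      rw [this, div_eq_mul_inv]
      apply mul_le_mul_of_nonneg_left _ (by positivity)
      rw [inv_eq_one_div, div_le_div_iff₀ (by positivity) (by positivity)]
      have : (n:ℝ)^2*(n+2)^2 ≤ (4*n+4)*(n*(((n:ℝ)+2)*(3*n/4))) := by
        have : (4*n+4)*(n*(((n:ℝ)+2)*(3*n/4))) - (n:ℝ)^2*(n+2)^2 = n^2*(n+2)*(2*n+1) := by ring
        have : 0 ≤ (n:ℝ)^2*(n+2)*(2*n+1) := by positivity
        linarith
      have h5 : (4*n+4)*(n*(((n:ℝ)+2)*(3*n/4))) ≤ (4*n+4)*(n*pp m δ (n+1)) := by gcongr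
      linarith
    have e : ((n:ℝ)+2) * a (n+2) = n * a n * (1 - 2*MM m δ/(n * pp m δ (n+1))) := by
      have : a (n+2) = pp m δ n * a n / pp m δ (n+1) := by rw [eq_div_iff p2.ne']; linarith
      rw [this]; field_simp; unfold pp; push_cast; ring
    push_cast
    rw [e, mul_assoc ((n:ℝ) * a n)]
    apply mul_le_mul_of_nonneg_left _ (by positivity)
    set x := 2*MM m δ/(n * pp m δ (n+1))
    have hx : 0 ≤ x := by positivity
    have hy : 0 ≤ 2*MM m δ/((n:ℝ)+2)^2 := by positivity
    nlinarith
  · have h : Tendsto (fun n : ℕ => (1:ℝ)/n) atTop (nhds 0) := tendsto_one_div_atTop_nhds_zero_nat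
    have h2 : Tendsto (fun n : ℕ => 1 - 2*MM m δ * ((1:ℝ)/n*(1/n))) atTop (nhds (1-2*MM m δ*(0*0))) :=
      ((h.mul h).const_mul _).const_sub _
    have := ha.2.mul h2
    simp only [mul_zero, sub_zero, mul_one] at this
    refine this.congr (fun n => ?_)
    congr 2; field_simp

/-- second comparison -/
lemma IsA.y_ge (ha : IsA (MM m δ) a) (h0 : 0 < δ) (h1 : δ ≤ 1/2) {n : ℕ} (hn : m+1 ≤ n) :
    1 ≤ a n ^ 2 * pp m δ n := by
  refine two_step_ge (f := fun n : ℕ => a n ^ 2 * pp m δ n) (n0 := m+1) ?_ ?_ hn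
  · intro n hn
    have h3 := ha.rec' n
    have p0 := pp_pos h0 h1 (m := m) (n := n) (by omega)
    have p2 := pp_pos h0 h1 (m := m) (n := n+1) (by omega)
    have e : a (n+2)^2 * pp m δ (n+1)^2 = pp m δ n ^2 * a n^2 := by
      rw [← mul_pow, ← mul_pow, mul_comm (a (n+2)), h3]
    have hl := pp_logconc (m := m) h1 n
    have : pp m δ (n+1)^2 * (a (n+2)^2 * pp m δ (n+2)) ≤ pp m δ (n+1)^2 * (a n^2 * pp m δ n) := by
      calc _ = (pp m δ n * a n^2) * (pp m δ n * pp m δ (n+2)) := by linear_combination (pp m δ (n+2)) * e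
        _ ≤ (pp m δ n * a n^2) * pp m δ (n+1)^2 := by gcongr
        _ = _ := by ring
    exact le_of_mul_le_mul_left this (by positivity)
  · have := (ha.2.mul ha.2).mul (pp_lim m δ)
    simp only [mul_one] at this
    refine this.congr' ?_
    filter_upwards [eventually_ge_atTop 1] with n hn
    have : (n:ℝ) ≠ 0 := by positivity
    field_simp

lemma IsA.z_le (ha : IsA (MM m δ) a) (h0 : 0 < δ) (h1 : δ ≤ 1/2) {n : ℕ} (hn : m+1 ≤ n) :
    a (n+1) ^ 2 * pp m δ n ≤ 1 := by
  have h := ha.y_ge h0 h1 hn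
  have h2 := ha.prod n
  have p := pp_pos h0 h1 hn
  have e : (a (n+1)^2 * pp m δ n) * (a n^2 * pp m δ n) = 1 := by
    calc _ = (a n * a (n+1) * pp m δ n)^2 := by ring
      _ = 1 := by rw [h2]; norm_num
  have : 0 ≤ a (n+1)^2 * pp m δ n := by positivity
  nlinarith

lemma IsA.a1_sq_ge (ha : IsA (MM m δ) a) (h0 : 0 < δ) (h1 : δ ≤ 1/2) :
    pp m δ (m+2)^2 ≤ a (m+1)^2 * (pp m δ (m+1)^2 * pp m δ (m+3)) := by
  have h := ha.y_ge h0 h1 (n := m+3) (by omega)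
  have h3 := ha.rec' (m+1)
  have e : a (m+3)^2 * pp m δ (m+2)^2 = pp m δ (m+1) ^2 * a (m+1)^2 := by
    rw [← mul_pow, ← mul_pow, mul_comm (a (m+3)), h3]
  have : pp m δ (m+2)^2 * 1 ≤ pp m δ (m+2)^2 * (a (m+3)^2 * pp m δ (m+3)) := by gcongr
  calc _ ≤ pp m δ (m+2)^2 * (a (m+3)^2 * pp m δ (m+3)) := by linarith
    _ = _ := by linear_combination (pp m δ (m+3)) * e

lemma IsA.a1_sq_le (ha : IsA (MM m δ) a) (h0 : 0 < δ) (h1 : δ ≤ 1/2) :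
    a (m+1)^2 * pp m δ (m+1)^2 ≤ pp m δ (m+2) := by
  have h := ha.z_le h0 h1 (n := m+2) (by omega)
  have p := pp_pos h0 h1 (m := m) (n := m+2) (by omega)
  have h3 := ha.rec' (m+1)
  have e : a (m+3)^2 * pp m δ (m+2)^2 = pp m δ (m+1) ^2 * a (m+1)^2 := by
    rw [← mul_pow, ← mul_pow, mul_comm (a (m+3)), h3]
  calc _ = (a (m+3)^2 * pp m δ (m+2)) * pp m δ (m+2) := by linear_combination (-1) * e
    _ ≤ 1 * pp m δ (m+2) := by gcongr
    _ = _ := by ring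

/-- even chain facts -/
lemma IsA.even_pos (ha : IsA (MM m δ) a) (h0 : 0 < δ) (h1 : δ ≤ 1/2) {j : ℕ} (hj : m = 2*j+1) :
    ∀ k, k ≤ j+1 → 0 < a (2*(j+1-k)) := by
  intro k
  induction k with
  | zero => intro _; exact ha.pos h0 h1 (by omega)
  | succ k ih =>
    intro hk
    have h2 := ih (by omega)
    have h3 := ha.rec' (2*(j+1-(k+1)))
    rw [show 2*(j+1-(k+1))+2 = 2*(j+1-k) by omega] at h3
    have p1 := pp_neg (m := m) h1 (n := 2*(j+1-(k+1))+1) (by omega)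
    have p2 := pp_neg (m := m) h1 (n := 2*(j+1-(k+1))) (by omega)
    have : pp m δ (2*(j+1-(k+1))) * a (2*(j+1-(k+1))) < 0 := by
      rw [← h3]; exact mul_neg_of_neg_of_pos p1 h2
    by_contra hc
    push Not at hc
    have := mul_nonneg_of_nonpos_of_nonpos p2.le hc
    linarith

lemma IsA.a0_pos (ha : IsA (MM m δ) a) (h0 : 0 < δ) (h1 : δ ≤ 1/2) (hm : Odd m) : 0 < a 0 := by
  obtain ⟨j, hj⟩ := hm
  have := ha.even_pos h0 h1 hj (j+1) le_rfl
  simpa using this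

lemma IsA.a0_lower (ha : IsA (MM m δ) a) (h0 : 0 < δ) (h1 : δ ≤ 1/2) (hm : Odd m) :
    a (m+1)^2 * pp m δ m^2 ≤ a 0^2 * MM m δ * (-pp m δ (m-1)) := by
  obtain ⟨j, hj⟩ := hm
  have hchain : ∀ k, k ≤ j → a (2*k)^2 * (-pp m δ (2*k)) ≤ a 0^2 * MM m δ := by
    intro k
    induction k with
    | zero => intro _; simp [pp]
    | succ k ih =>
      intro hk
      refine le_trans ?_ (ih (by omega))
      have h3 := ha.rec' (2*k)
      have p0 := pp_neg (m := m) h1 (n := 2*k) (by omega)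
      have p1 := pp_neg (m := m) h1 (n := 2*k+1) (by omega)
      have e : a (2*k+2)^2 * pp m δ (2*k+1)^2 = pp m δ (2*k) ^2 * a (2*k)^2 := by
        rw [← mul_pow, ← mul_pow, mul_comm (a (2*k+2)), h3]
      have hl := pp_logconc (m := m) h1 (2*k)
      rw [show 2*(k+1) = 2*k+2 by ring]
      have p1' : 0 < pp m δ (2*k+1)^2 := by nlinarith
      have hq : 0 ≤ -pp m δ (2*k) * a (2*k)^2 := by
        have := sq_nonneg (a (2*k)); nlinarith
      have : pp m δ (2*k+1)^2 * (a (2*k+2)^2 * (-pp m δ (2*k+2))) ≤ pp m δ (2*k+1)^2 * (a (2*k)^2 * (-pp m δ (2*k))) := by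
        calc _ = (-pp m δ (2*k) * a (2*k)^2) * (pp m δ (2*k) * pp m δ (2*k+2)) := by
              linear_combination (-pp m δ (2*k+2)) * e
          _ ≤ (-pp m δ (2*k) * a (2*k)^2) * pp m δ (2*k+1)^2 := by gcongr
          _ = _ := by ring
      exact le_of_mul_le_mul_left this p1'
  have h := hchain j le_rfl
  have h3 := ha.rec' (2*j)
  rw [show 2*j+1 = m by omega, show 2*j+2 = m+1 by omega] at h3
  rw [show m-1 = 2*j by omega]
  have e : a (m+1)^2 * pp m δ m^2 = pp m δ (2*j) ^2 * a (2*j)^2 := by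
    rw [← mul_pow, ← mul_pow, mul_comm (a (m+1)), h3]
  have p0 := pp_neg (m := m) h1 (n := 2*j) (by omega)
  rw [e]
  calc _ = (a (2*j)^2 * (-pp m δ (2*j))) * (-pp m δ (2*j)) := by ring
    _ ≤ _ := mul_le_mul_of_nonneg_right h (by linarith)

lemma IsA.a0_upper (ha : IsA (MM m δ) a) (h0 : 0 < δ) (h1 : δ ≤ 1/2) (hm : Odd m) :
    a 0^2 * MM m δ ≤ a (m+1)^2 * (-pp m δ m) := by
  obtain ⟨j, hj⟩ := hm
  have hM := MM_pos (m := m) h1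
  -- strong form
  have step : ∀ k, k ≤ j → a (2*k)^2 * (-(((2*k:ℕ):ℝ)*(((2*k:ℕ):ℝ)-1) - MM m δ)) ≤ a (2*k+2)^2 * (-pp m δ (2*k+1)) := by
    intro k hk
    have h3 := ha.rec' (2*k)
    have p1 := pp_neg (m := m) h1 (n := 2*k+1) (by omega)
    have e : a (2*k+2)^2 * pp m δ (2*k+1)^2 = pp m δ (2*k) ^2 * a (2*k)^2 := by
      rw [← mul_pow, ← mul_pow, mul_comm (a (2*k+2)), h3]
    have hl : (((2*k:ℕ):ℝ)*(((2*k:ℕ):ℝ)-1) - MM m δ) * pp m δ (2*k+1) ≤ pp m δ (2*k)^2 := by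
      have : (((2*k:ℕ):ℝ)*(((2*k:ℕ):ℝ)-1) - MM m δ) * pp m δ (2*k+1) = pp m δ (2*k)^2 - 2*(2*(k:ℝ)+1/2)^2 - 2*(MM m δ+1/4)+1 := by
        unfold pp; push_cast; ring
      rw [this]; nlinarith [Nat.cast_nonneg (α:=ℝ) k]
    have p1' : 0 < -pp m δ (2*k+1) := by linarith
    have : (-pp m δ (2*k+1)) * (a (2*k)^2 * (-(((2*k:ℕ):ℝ)*(((2*k:ℕ):ℝ)-1) - MM m δ))) ≤ (-pp m δ (2*k+1)) * (a (2*k+2)^2 * (-pp m δ (2*k+1))) := by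
      calc _ = a (2*k)^2 * ((((2*k:ℕ):ℝ)*(((2*k:ℕ):ℝ)-1) - MM m δ) * pp m δ (2*k+1)) := by ring
        _ ≤ a (2*k)^2 * pp m δ (2*k)^2 := by gcongr
        _ = _ := by linear_combination (-1)*e
    exact le_of_mul_le_mul_left this p1'
  have hchain : ∀ k, k ≤ j → a 0^2 * MM m δ ≤ a (2*k+2)^2 * (-pp m δ (2*k+1)) := by
    intro k
    induction k with
    | zero => intro h; have := step 0 h; simpa using this
    | succ k ih =>
      intro hk
      refine (ih (by omega)).trans ?_
      refine le_trans (le_of_eq ?_) (step (k+1) hk)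
      rw [show 2*(k+1) = 2*k+2 by ring]
      unfold pp; push_cast; ring
  have := hchain j le_rfl
  rwa [show 2*j+1 = m by omega, show 2*j+2 = m+1 by omega] at this

end
end TO

namespace TO

section
variable {m : ℕ} {δ : ℝ} {a : ℕ → ℝ}

lemma MM_le (h0 : 0 < δ) (h1 : δ ≤ 1/2) (hm : 20 ≤ m) : MM m δ ≤ 5/4*(m:ℝ)^2 := by
  have hm' : (20:ℝ) ≤ m := by exact_mod_cast hm
  unfold MM
  have : ((m:ℝ)+1-δ)*((m:ℝ)+2-δ) ≤ ((m:ℝ)+1)*((m:ℝ)+2) := by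
    apply mul_le_mul <;> linarith
  nlinarith

lemma IsA.beta_nonneg (ha : IsA (MM m δ) a) (h0 : 0 < δ) (h1 : δ ≤ 1/2) (hm : 20 ≤ m) {k : ℕ} (hk : 2 ≤ k) :
    0 ≤ m * a (k*m) - 1/(k:ℝ) := by
  have hk0 : (0:ℝ) < k := by positivity
  have h := ha.t_ge h0 h1 (n := k*m) (by nlinarith)
  push_cast at h
  rw [sub_nonneg, div_le_iff₀ hk0]
  linarith

lemma IsA.beta_le (ha : IsA (MM m δ) a) (h0 : 0 < δ) (h1 : δ ≤ 1/2) (hm : 20 ≤ m) {k : ℕ} (hk : 2 ≤ k) :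
    m * a (k*m) - 1/(k:ℝ) ≤ 7/(k:ℝ)^3 := by
  have hk0 : (2:ℝ) ≤ k := by exact_mod_cast hk
  have hm0 : (20:ℝ) ≤ m := by exact_mod_cast hm
  have h := ha.t_le h0 h1 (by omega) (n := k*m) (by nlinarith)
  have hge := ha.t_ge h0 h1 (n := k*m) (by nlinarith)
  have hM := MM_le h0 h1 hm
  push_cast at h hge
  set t := (k:ℝ)*m*a (k*m) with ht
  have hx : 2*MM m δ/((k:ℝ)*m)^2 ≤ 5/2/(k:ℝ)^2 := by
    rw [div_le_div_iff₀ (by positivity) (by positivity)]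
    have : 2 * MM m δ * (k:ℝ)^2 ≤ 2*(5/4*(m:ℝ)^2)*(k:ℝ)^2 := by gcongr
    nlinarith
  have h4 : t * (1 - 5/2/(k:ℝ)^2) ≤ 1 := by
    refine le_trans ?_ h
    apply mul_le_mul_of_nonneg_left _ (by linarith)
    linarith
  have h5 : (t - 1) * (k:ℝ)^2 ≤ 7 := by
    have : t * ((k:ℝ)^2 - 5/2) ≤ (k:ℝ)^2 := by
      have : t * (1 - 5/2/(k:ℝ)^2) * (k:ℝ)^2 ≤ 1 * (k:ℝ)^2 := by gcongr
      have e : t * (1 - 5/2/(k:ℝ)^2) * (k:ℝ)^2 = t * ((k:ℝ)^2 - 5/2) := by field_simp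
      linarith
    have hk2 : (4:ℝ) ≤ (k:ℝ)^2 := by nlinarith
    nlinarith
  rw [le_div_iff₀ (by positivity)]
  have : (m * a (k*m) - 1/(k:ℝ)) * (k:ℝ)^3 = (t-1)*(k:ℝ)^2 := by rw [ht]; field_simp
  linarith

/-- bundle of simple bounds for the coefficients -/
lemma pp_bounds (h0 : 0 < δ) (h1 : δ ≤ 1/2) (hm : 20 ≤ m) :
    (2*δ*m ≤ pp m δ (m+1) ∧ pp m δ (m+1) ≤ 3*δ*m) ∧ (2*(m:ℝ) ≤ pp m δ (m+2) ∧ pp m δ (m+2) ≤ 9/2*m) ∧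
    (0 < pp m δ (m+3) ∧ pp m δ (m+3) ≤ 15/2*m) ∧ ((m:ℝ) ≤ -pp m δ m ∧ -pp m δ m ≤ 3*m) ∧
    (0 < -pp m δ (m-1) ∧ -pp m δ (m-1) ≤ 6*m) ∧ ((m:ℝ)^2 ≤ MM m δ ∧ MM m δ ≤ 2*(m:ℝ)^2) := by
  have hm0 : (20:ℝ) ≤ m := by exact_mod_cast hm
  have e1 : ((m-1:ℕ):ℝ) = m - 1 := by rw [Nat.cast_sub (by omega)]; simp
  refine ⟨⟨?_,?_⟩,⟨?_,?_⟩,⟨?_,?_⟩,⟨?_,?_⟩,⟨?_,?_⟩,⟨?_,?_⟩⟩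
  all_goals (try rw [pp_fac]); (try rw [e1]); (try unfold MM); push_cast; nlinarith

lemma IsA.alpha0_ge (ha : IsA (MM m δ) a) (h0 : 0 < δ) (h1 : δ ≤ 1/2) (hm : 20 ≤ m) (ho : Odd m) :
    1/(15*δ) ≤ m * a 0 := by
  have hm0 : (20:ℝ) ≤ m := by exact_mod_cast hm
  obtain ⟨⟨b1,b2⟩,⟨b3,b4⟩,⟨b5,b6⟩,⟨b7,b8⟩,⟨b9,b10⟩,⟨b11,b12⟩⟩ := pp_bounds h0 h1 hm
  have h2 := ha.a1_sq_ge h0 h1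
  have h3 := ha.a0_lower h0 h1 ho
  have hp := ha.a0_pos h0 h1 ho
  have g1 : (2*(m:ℝ))^2 ≤ a (m+1)^2 * ((3*δ*m)^2 * (15/2*m)) := by
    calc (2*(m:ℝ))^2 ≤ pp m δ (m+2)^2 := by gcongr
      _ ≤ _ := h2
      _ ≤ _ := by gcongr; nlinarith
  have g2 : a (m+1)^2 * (m:ℝ)^2 ≤ a 0^2 * (2*(m:ℝ)^2) * (6*m) := by
    calc a (m+1)^2 * (m:ℝ)^2 ≤ a (m+1)^2 * (-pp m δ m)^2 := by gcongr
      _ = a (m+1)^2 * (pp m δ m)^2 := by ring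
      _ ≤ _ := h3
      _ ≤ _ := by gcongr
  have g3 : (2*(m:ℝ))^2 * (m:ℝ)^2 ≤ (a 0^2 * (2*(m:ℝ)^2) * (6*m)) * ((3*δ*m)^2 * (15/2*m)) := by
    calc _ ≤ a (m+1)^2 * ((3*δ*m)^2 * (15/2*m)) * (m:ℝ)^2 := by gcongr
      _ = (a (m+1)^2 * (m:ℝ)^2) * ((3*δ*m)^2 * (15/2*m)) := by ring
      _ ≤ _ := by gcongr
  have g4 : 4 ≤ 810 * (m * a 0 * δ)^2 := by
    have hm4 : (0:ℝ) < (m:ℝ)^4 := by positivity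
    have : 4 * (m:ℝ)^4 ≤ (810 * (m * a 0 * δ)^2) * (m:ℝ)^4 := by
      calc _ = (2*(m:ℝ))^2 * (m:ℝ)^2 := by ring
        _ ≤ _ := g3
        _ = _ := by ring
    exact le_of_mul_le_mul_right this hm4
  rw [div_le_iff₀ (by positivity)]
  have : 0 < m * a 0 * δ := by positivity
  nlinarith

lemma IsA.alpha0_le (ha : IsA (MM m δ) a) (h0 : 0 < δ) (h1 : δ ≤ 1/2) (hm : 20 ≤ m) (ho : Odd m) :
    m * a 0 ≤ 2/δ := by
  have hm0 : (20:ℝ) ≤ m := by exact_mod_cast hm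
  obtain ⟨⟨b1,b2⟩,⟨b3,b4⟩,⟨b5,b6⟩,⟨b7,b8⟩,⟨b9,b10⟩,⟨b11,b12⟩⟩ := pp_bounds h0 h1 hm
  have h2 := ha.a1_sq_le h0 h1
  have h3 := ha.a0_upper h0 h1 ho
  have hp := ha.a0_pos h0 h1 ho
  have g1 : a (m+1)^2 * (2*δ*m)^2 ≤ 9/2*m := by
    calc _ ≤ a (m+1)^2 * pp m δ (m+1)^2 := by gcongr
      _ ≤ _ := h2.trans b4
  have g2 : a 0^2 * (m:ℝ)^2 ≤ a (m+1)^2 * (3*m) := by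
    calc _ ≤ a 0^2 * MM m δ := by gcongr
      _ ≤ _ := h3
      _ ≤ _ := by gcongr
  have g3 : (m * a 0 * δ)^2 * 4 ≤ 27/2 := by
    have : ((m * a 0 * δ)^2 * 4) * (m:ℝ)^2 ≤ 27/2 * (m:ℝ)^2 := by
      calc _ = (a 0^2 * (m:ℝ)^2) * (2*δ*m)^2 := by ring
        _ ≤ (a (m+1)^2 * (3*m)) * (2*δ*m)^2 := by gcongr
        _ = (a (m+1)^2 * (2*δ*m)^2) * (3*m) := by ring
        _ ≤ (9/2*m) * (3*m) := by gcongr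
        _ = _ := by ring
    exact le_of_mul_le_mul_right this (by positivity)
  rw [le_div_iff₀ h0]
  nlinarith

lemma IsA.am_neg (ha : IsA (MM m δ) a) (h0 : 0 < δ) (h1 : δ ≤ 1/2) : a m < 0 := by
  have h := ha.prod m
  have p := ha.pos h0 h1 (n := m+1) le_rfl
  have q := pp_neg (m := m) h1 (n := m) le_rfl
  by_contra hc
  push Not at hc
  have : a m * a (m+1) * pp m δ m ≤ 0 := mul_nonpos_of_nonneg_of_nonpos (by positivity) q.le
  linarith

lemma IsA.B_ge (ha : IsA (MM m δ) a) (h0 : 0 < δ) (h1 : δ ≤ 1/2) (hm : 20 ≤ m) :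
    δ * √m / 4 ≤ 1 - m * a m := by
  have hm0 : (20:ℝ) ≤ m := by exact_mod_cast hm
  obtain ⟨⟨b1,b2⟩,⟨b3,b4⟩,⟨b5,b6⟩,⟨b7,b8⟩,⟨b9,b10⟩,⟨b11,b12⟩⟩ := pp_bounds h0 h1 hm
  have hn := ha.am_neg h0 h1
  have h := ha.prod m
  have h2 := ha.a1_sq_le h0 h1
  have g1 : a (m+1)^2 * (2*δ*m)^2 ≤ 9/2*m := by
    calc _ ≤ a (m+1)^2 * pp m δ (m+1)^2 := by gcongr
      _ ≤ _ := h2.trans b4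
  have g2 : 1 ≤ (a m)^2 * a (m+1)^2 * (3*m)^2 := by
    calc (1:ℝ) = (a m * a (m+1) * pp m δ m)^2 := by rw [h]; norm_num
      _ = (a m)^2 * a (m+1)^2 * (-pp m δ m)^2 := by ring
      _ ≤ _ := by gcongr; linarith
  have g3 : δ^2*m ≤ 16 * (m * a m)^2 := by
    have : (2*δ*m)^2 ≤ (a m)^2 * (9/2*m) * (3*m)^2 := by
      calc (2*δ*m)^2 = 1 * (2*δ*m)^2 := by ring
        _ ≤ ((a m)^2 * a (m+1)^2 * (3*m)^2) * (2*δ*m)^2 := by gcongr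
        _ = (a m)^2 * (a (m+1)^2 * (2*δ*m)^2) * (3*m)^2 := by ring
        _ ≤ _ := by gcongr
    have : (δ^2*m)*(m:ℝ) ≤ (16 * (m * a m)^2)*m := by
      nlinarith [mul_nonneg (sq_nonneg ((m:ℝ)*a m)) (by linarith : (0:ℝ) ≤ m)]
    exact le_of_mul_le_mul_right this (by positivity)
  have hy : 0 < -(m * a m) := by have : (0:ℝ) < m := by linarith
                                 nlinarith
  have : δ * √m / 4 ≤ -(m * a m) := by
    apply abs_le_of_sq_le_sq' _ hy.le |>.2
    rw [div_pow, mul_pow, Real.sq_sqrt (by positivity)]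
    nlinarith
  linarith

lemma IsA.B_le (ha : IsA (MM m δ) a) (h0 : 0 < δ) (h1 : δ ≤ 1/2) (hm : 20 ≤ m) :
    1 - m * a m ≤ 1 + 5 * δ * √m := by
  have hm0 : (20:ℝ) ≤ m := by exact_mod_cast hm
  obtain ⟨⟨b1,b2⟩,⟨b3,b4⟩,⟨b5,b6⟩,⟨b7,b8⟩,⟨b9,b10⟩,⟨b11,b12⟩⟩ := pp_bounds h0 h1 hm
  have h := ha.prod m
  have h2 := ha.a1_sq_ge h0 h1
  have g1 : (2*(m:ℝ))^2 ≤ a (m+1)^2 * ((3*δ*m)^2 * (15/2*m)) := by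
    calc (2*(m:ℝ))^2 ≤ pp m δ (m+2)^2 := by gcongr
      _ ≤ _ := h2
      _ ≤ _ := by gcongr; nlinarith
  have g2 : (a m)^2 * a (m+1)^2 * (m:ℝ)^2 ≤ 1 := by
    calc _ ≤ (a m)^2 * a (m+1)^2 * (-pp m δ m)^2 := by gcongr
      _ = (a m * a (m+1) * pp m δ m)^2 := by ring
      _ = 1 := by rw [h]; norm_num
  have g3 : (m * a m)^2 ≤ (5 * δ * √m)^2 := by
    rw [mul_pow, mul_pow, mul_pow, Real.sq_sqrt (by positivity)]
    have : (a m)^2 * (2*(m:ℝ))^2 * (m:ℝ)^2 ≤ (3*δ*m)^2 * (15/2*m) := by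
      calc _ ≤ (a m)^2 * (a (m+1)^2 * ((3*δ*m)^2 * (15/2*m))) * (m:ℝ)^2 := by gcongr
        _ = ((a m)^2 * a (m+1)^2 * (m:ℝ)^2) * ((3*δ*m)^2 * (15/2*m)) := by ring
        _ ≤ 1 * ((3*δ*m)^2 * (15/2*m)) := by gcongr
        _ = _ := by ring
    have : ((m:ℝ)^2 * a m^2) * (m:ℝ)^2 ≤ (5^2 * δ^2 * m) * (m:ℝ)^2 := by
      have : 0 ≤ δ^2 * (m:ℝ)^3 := by positivity
      nlinarith
    exact le_of_mul_le_mul_right this (by positivity)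
  have := abs_le_of_sq_le_sq' g3 (by positivity)
  linarith [this.1]

end

/-- explicit continuous approximations -/
noncomputable def PJ (m n J : ℕ) (δ : ℝ) : ℝ :=
  (∏ j ∈ Finset.range J, pp m δ (n+2*j+1) / pp m δ (n+2*j)) / ((n+2*J:ℕ):ℝ)

lemma pp_cont (m n : ℕ) : Continuous (fun δ => pp m δ n) := by unfold pp MM; fun_prop

lemma PJ_cont (m n J : ℕ) : ContinuousOn (PJ m n J) (Ioc 0 (1/2)) := by
  unfold PJ
  apply ContinuousOn.div_const
  apply continuousOn_finsetProd
  intro j _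
  apply ContinuousOn.div (pp_cont _ _).continuousOn (pp_cont _ _).continuousOn
  intro δ hδ; exact pp_ne hδ.1 hδ.2 _

lemma PJ_eq {m : ℕ} {δ : ℝ} {a : ℕ → ℝ} (ha : IsA (MM m δ) a) (h0 : 0 < δ) (h1 : δ ≤ 1/2) (n J : ℕ) (hJ : 1 ≤ J) :
    a n = PJ m n J δ * (((n+2*J:ℕ):ℝ) * a (n+2*J)) := by
  have h : ∀ J, a n = (∏ j ∈ Finset.range J, pp m δ (n+2*j+1) / pp m δ (n+2*j)) * a (n+2*J) := by
    intro J
    induction J with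
    | zero => simp
    | succ J ih =>
      rw [Finset.prod_range_succ, ih]
      have := ha.rec' (n+2*J)
      have hne := pp_ne (m := m) h0 h1 (n+2*J)
      rw [show n+2*(J+1) = n+2*J+2 by ring, mul_assoc]
      congr 1
      field_simp
      linarith
  unfold PJ
  have : ((n+2*J:ℕ):ℝ) ≠ 0 := by
    have : 0 < n+2*J := by omega
    positivity
  rw [h J]; field_simp

lemma a_cont {m : ℕ} (hm : 20 ≤ m) {a : ℝ → ℕ → ℝ}
    (ha : ∀ δ ∈ Ioc (0:ℝ) (1/2), IsA (MM m δ) (a δ)) (n : ℕ) :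
    ContinuousOn (fun δ => a δ n) (Ioc 0 (1/2)) := by
  intro δ0 hδ0
  rw [ContinuousWithinAt, Metric.tendsto_nhds]
  intro ε hε
  have hm0 : (20:ℝ) ≤ m := by exact_mod_cast hm
  -- uniform closeness
  have hunif : ∀ η : ℝ, 0 < η → ∃ J : ℕ, 1 ≤ J ∧ ∀ δ ∈ Ioc (0:ℝ) (1/2),
      1 ≤ ((n+2*J:ℕ):ℝ) * a δ (n+2*J) ∧ ((n+2*J:ℕ):ℝ) * a δ (n+2*J) ≤ 1 + η := by
    intro η hη
    have hlim : Tendsto (fun J : ℕ => (1+η) * (1 - 5/2*(m:ℝ)^2 * (1/((n+2*J:ℕ):ℝ)*(1/((n+2*J:ℕ):ℝ))))) atTop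
        (nhds ((1+η)*(1 - 5/2*(m:ℝ)^2*(0*0)))) := by
      have h2 : Tendsto (fun k : ℕ => n+2*k) atTop atTop :=
        tendsto_atTop_mono (fun k => by simp only [id]; omega) tendsto_id
      have h3 : Tendsto (fun J : ℕ => 1/((n+2*J:ℕ):ℝ)) atTop (nhds 0) :=
        tendsto_one_div_atTop_nhds_zero_nat.comp h2
      exact (((h3.mul h3).const_mul _).const_sub _).const_mul _
    simp only [mul_zero, sub_zero, mul_one] at hlim
    have hev := hlim.eventually (lt_mem_nhds (show (1:ℝ) < 1+η by linarith))
    obtain ⟨J, hJ, hJ2⟩ := (hev.and (eventually_ge_atTop (2*m+1))).exists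
    refine ⟨J, by omega, fun δ hδ => ?_⟩
    have h1 := (ha δ hδ).t_ge hδ.1 hδ.2 (n := n+2*J) (by omega)
    have h2 := (ha δ hδ).t_le hδ.1 hδ.2 (by omega) (n := n+2*J) (by omega)
    refine ⟨h1, ?_⟩
    set N : ℝ := ((n+2*J:ℕ):ℝ) with hN
    have hN0 : 0 < N := by rw [hN]; have : 0 < n+2*J := by omega
                           exact_mod_cast this
    have hM := MM_le hδ.1 hδ.2 hm
    have h3 : 1 - 5/2*(m:ℝ)^2*(1/N*(1/N)) ≤ 1 - 2*MM m δ/N^2 := by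
      have : 2*MM m δ/N^2 ≤ 2*(5/4*(m:ℝ)^2)/N^2 := by gcongr
      have e : 5/2*(m:ℝ)^2*(1/N*(1/N)) = 2*(5/4*(m:ℝ)^2)/N^2 := by field_simp; ring
      linarith
    set w := 1 - 5/2*(m:ℝ)^2*(1/N*(1/N))
    have hw : 0 < w := by by_contra hc; push Not at hc; nlinarith
    have h4 : N * a δ (n+2*J) * w ≤ 1 := by
      refine le_trans ?_ h2
      apply mul_le_mul_of_nonneg_left h3; linarith
    have : N * a δ (n+2*J) * w ≤ (1+η) * w := by linarith
    exact le_of_mul_le_mul_right this hw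
  set A := |a δ0 n| with hA
  obtain ⟨J, hJ1, hJ⟩ := hunif (min 1 (ε/(2*(A+1)))) (by positivity)
  have hP := PJ_cont m n J δ0 hδ0
  rw [ContinuousWithinAt, Metric.tendsto_nhds] at hP
  have hP' := hP (ε/4) (by positivity)
  filter_upwards [hP', self_mem_nhdsWithin] with δ hδP hδ
  rw [Real.dist_eq] at hδP ⊢
  have e1 := PJ_eq (ha δ hδ) hδ.1 hδ.2 n J hJ1
  have e0 := PJ_eq (ha δ0 hδ0) hδ0.1 hδ0.2 n J hJ1
  obtain ⟨l1, u1⟩ := hJ δ hδ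
  obtain ⟨l0, u0⟩ := hJ δ0 hδ0
  set t1 := ((n+2*J:ℕ):ℝ) * a δ (n+2*J)
  set t0 := ((n+2*J:ℕ):ℝ) * a δ0 (n+2*J)
  have hAle : |PJ m n J δ0| ≤ A := by
    rw [hA, e0, abs_mul, abs_of_pos (by linarith : 0 < t0)]
    exact le_mul_of_one_le_right (abs_nonneg _) l0
  have hη1 : min 1 (ε/(2*(A+1))) ≤ 1 := min_le_left _ _
  have hη2 : min 1 (ε/(2*(A+1))) ≤ ε/(2*(A+1)) := min_le_right _ _
  have hA0 : 0 ≤ A := abs_nonneg _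
  have d1 : |t1 - t0| ≤ ε/(2*(A+1)) := by rw [abs_le]; constructor <;> linarith
  rw [e1, e0]
  have : PJ m n J δ * t1 - PJ m n J δ0 * t0 = (PJ m n J δ - PJ m n J δ0) * t1 + PJ m n J δ0 * (t1 - t0) := by ring
  rw [this]
  calc _ ≤ |(PJ m n J δ - PJ m n J δ0) * t1| + |PJ m n J δ0 * (t1 - t0)| := abs_add_le _ _
    _ = |PJ m n J δ - PJ m n J δ0| * t1 + |PJ m n J δ0| * |t1 - t0| := by
        rw [abs_mul _ t1, abs_mul _ (t1-t0), abs_of_pos (by linarith : 0 < t1)]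
    _ ≤ |PJ m n J δ - PJ m n J δ0| * 2 + A * (ε/(2*(A+1))) := by
        gcongr; linarith
    _ < ε/4*2 + ε/2 := by
        have : A * (ε/(2*(A+1))) ≤ ε/2 := by
          rw [mul_div_assoc', div_le_div_iff₀ (by positivity) (by norm_num)]; nlinarith
        linarith
    _ = ε := by ring

end TO

namespace TO

/-- Fourier weights -/
noncomputable def wt (n : ℕ) : ℝ := if n = 0 then 1 else 2

lemma wt_nonneg (n : ℕ) : 0 ≤ wt n := by unfold wt; split_ifs <;> norm_num

lemma cos_hasSum (l : ℕ) (θ : ℝ) :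
    HasSum (fun n : ℕ => wt n * Bn l n * Real.cos (n*θ)) ((Real.cos (θ/2))^(2*l)) := by
  have h : (Real.cos (θ/2))^(2*l) = ∑ n ∈ Finset.range (l+1), wt n * Bn l n * Real.cos (n*θ) := by
    rw [cos_pow_expand, show 2*l+1 = l+(l+1) by ring, Finset.sum_range_add, Finset.sum_range_succ',
      Finset.sum_range_succ', ← Finset.sum_range_reflect, ← add_assoc, ← Finset.sum_add_distrib]
    congr 1
    · apply Finset.sum_congr rfl
      intro j hj
      have hj' : j < l := by simpa using hj
      have e1 : (Nat.choose (2*l) (l-1-j)) = Nat.choose (2*l) (l+(j+1)) := by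
        apply Nat.choose_symm_of_eq_add; omega
      have e2 : ((l-1-j:ℕ):ℝ) - l = -((j+1:ℕ):ℝ) := by
        rw [Nat.cast_sub (by omega), Nat.cast_sub (by omega)]; push_cast; ring
      have e3 : ((l+(j+1):ℕ):ℝ) - l = ((j+1:ℕ):ℝ) := by push_cast; ring
      rw [e1, e2, e3, neg_mul, Real.cos_neg]
      simp only [wt, Bn]
      rw [if_neg (by omega)]; ring
    · simp [wt, Bn]
  rw [h]
  apply hasSum_sum_of_ne_finset_zero
  intro n hn
  rw [Bn_eq_zero (by simpa using hn)]; simp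

lemma wB_hasSum (l : ℕ) : HasSum (fun n : ℕ => wt n * Bn l n) 1 := by
  have := cos_hasSum l 0
  simpa using this

/-- root of unity filter -/
lemma cos_filter (m : ℕ) (hm : 0 < m) (n : ℕ) (s : ℝ) :
    ∑ j ∈ Finset.range m, Real.cos (n * ((s + 2*π*j)/m)) = if m ∣ n then m * Real.cos (n*s/m) else 0 := by
  have hm0 : (m:ℝ) ≠ 0 := by positivity
  split_ifs with hd
  · obtain ⟨k, rfl⟩ := hd
    have : ∀ j ∈ Finset.range m, Real.cos (((m*k:ℕ):ℝ) * ((s + 2*π*j)/m)) = Real.cos (((m*k:ℕ):ℝ)*s/m) := by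
      intro j _
      have e : ((m*k:ℕ):ℝ) * ((s + 2*π*j)/m) = ((m*k:ℕ):ℝ)*s/m + ((k*j:ℕ):ℝ) * (2*π) := by
        push_cast; field_simp
      rw [e, Real.cos_add_nat_mul_two_pi]
    rw [Finset.sum_congr rfl this]; simp
  · have hmC : (m:ℂ) ≠ 0 := by exact_mod_cast hm0
    set ζ := Complex.exp (2*π*Complex.I/m) with hζ
    have hprim : IsPrimitiveRoot ζ m := Complex.isPrimitiveRoot_exp m hm.ne'
    have hne : ζ^n ≠ 1 := fun h => hd (hprim.dvd_of_pow_eq_one n h)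
    have hg : ∑ j ∈ Finset.range m, (ζ^n)^j = 0 := by
      rw [geom_sum_eq hne, ← pow_mul, mul_comm n m, pow_mul, hprim.pow_eq_one]; simp
    have e : ∀ j ∈ Finset.range m, Real.cos (n * ((s + 2*π*j)/m)) =
        (Complex.exp (n*s/m*Complex.I) * (ζ^n)^j).re := by
      intro j _
      rw [hζ, ← Complex.exp_nat_mul, ← Complex.exp_nat_mul, ← Complex.exp_add]
      have : (n*s/m*Complex.I + j*(n*(2*π*Complex.I/m)) : ℂ) = ((n * ((s + 2*π*j)/m) : ℝ):ℂ) * Complex.I := by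
        push_cast; ring
      rw [this, Complex.exp_ofReal_mul_I_re]
    rw [Finset.sum_congr rfl e, ← Complex.re_sum, ← Finset.mul_sum, hg]; simp

lemma prod_two_sub_cos (m : ℕ) (hm : 0 < m) (s : ℝ) :
    ∏ j ∈ Finset.range m, (2 - 2*Real.cos ((s + 2*π*j)/m)) = 2 - 2*Real.cos s := by
  have hns : ∀ θ : ℝ, 2 - 2*Real.cos θ = Complex.normSq (1 - Complex.exp (θ*Complex.I)) := by
    intro θ
    rw [Complex.normSq_apply]
    simp [Complex.exp_ofReal_mul_I_re, Complex.exp_ofReal_mul_I_im]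
    nlinarith [Real.sin_sq_add_cos_sq θ]
  have hmC : (m:ℂ) ≠ 0 := by have : (m:ℝ) ≠ 0 := by positivity
                             exact_mod_cast this
  have hprim := Complex.isPrimitiveRoot_exp m hm.ne'
  have hp := X_pow_sub_C_eq_prod hprim (α := Complex.exp (s/m*Complex.I)) (a := Complex.exp (s*Complex.I)) hm (by
    rw [← Complex.exp_nat_mul]; congr 1; field_simp)
  have hp2 := congrArg (Polynomial.eval 1) hp
  rw [Polynomial.eval_prod] at hp2
  simp only [Polynomial.eval_sub, Polynomial.eval_pow, Polynomial.eval_X, Polynomial.eval_C, one_pow] at hp2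
  rw [hns s, hp2, map_prod]
  apply Finset.prod_congr rfl
  intro j _
  rw [hns]
  congr 2
  rw [← Complex.exp_nat_mul, ← Complex.exp_add]
  congr 1
  push_cast; field_simp; ring

lemma sum_log (m : ℕ) (hm : 0 < m) (s : ℝ) (hs : Real.cos s ≠ 1) :
    ∑ j ∈ Finset.range m, Real.log (1 - Real.cos ((s + 2*π*j)/m/2)^2) = Real.log (2 - 2*Real.cos s) - m * Real.log 4 := by
  have hp := prod_two_sub_cos m hm s
  have hne : ∀ j ∈ Finset.range m, (2 - 2*Real.cos ((s + 2*π*j)/m)) ≠ 0 := by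
    rw [← Finset.prod_ne_zero_iff, hp]
    intro h; apply hs; linarith
  rw [← hp, Real.log_prod hne]
  have : ∀ j ∈ Finset.range m, Real.log (1 - Real.cos ((s + 2*π*j)/m/2)^2) = Real.log (2 - 2*Real.cos ((s + 2*π*j)/m)) - Real.log 4 := by
    intro j hj
    rw [← Real.log_div (hne j hj) (by norm_num)]
    congr 1
    have := Real.cos_sq ((s + 2*π*j)/m/2)
    rw [show 2*((s + 2*π*j)/m/2) = (s + 2*π*j)/m by ring] at this
    linarith
  rw [Finset.sum_congr rfl this, Finset.sum_sub_distrib]; simp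

/-- zeroth log coefficient -/
lemma log_an_zero : an (fun l : ℕ => 1 / (l:ℝ)) 0 = Real.log 4 := by
  have hB : ∀ l, Bn l 0 = ∏ i ∈ Finset.range l, (2 * (i : ℝ) + 1) / (2 * i + 2) := by
    intro l
    induction l with
    | zero => simp [Bn]
    | succ l ih =>
      rw [Finset.prod_range_succ, ← ih]
      have h := Bn_succ_mul l 0
      push_cast at h
      have h1 : ((l:ℝ)+1) ≠ 0 := by positivity
      field_simp
      apply mul_left_cancel₀ h1
      linear_combination 2*h
  have hI : ∀ l : ℕ, ∫ x in (0:ℝ)..π/2, Real.cos x ^ (2*l) = π/2 * Bn l 0 := by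
    intro l
    rw [EulerSine.integral_cos_pow_eq, integral_sin_pow_even, hB]; ring
  let F : ℕ → ℝ → ℝ := fun l x => 1/(l:ℝ) * Real.cos x ^ (2*l)
  have hF : ∀ l, ∫ x in Ioc 0 (π/2), F l x = π/2 * (1/(l:ℝ) * Bn l 0) := by
    intro l
    rw [← intervalIntegral.integral_of_le (by positivity)]
    simp only [F]
    rw [intervalIntegral.integral_const_mul, hI]; ring
  have hs := MeasureTheory.hasSum_integral_of_summable_integral_norm (F := F)
    (μ := MeasureTheory.volume.restrict (Ioc 0 (π/2))) (by
      intro l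
      have : Continuous (F l) := by simp only [F]; fun_prop
      exact (this.intervalIntegrable 0 (π/2)).1) (by
      have : ∀ l, ∫ x in Ioc 0 (π/2), ‖F l x‖ = π/2 * (1/(l:ℝ) * Bn l 0) := by
        intro l
        rw [← hF]
        congr 1; ext x
        simp only [F]
        rw [Real.norm_eq_abs, abs_of_nonneg]
        rw [pow_mul]; positivity
      simp_rw [this]
      exact (cB_summable log_hK 0).mul_left _)
  simp_rw [hF] at hs
  have hs2 := (cB_summable log_hK 0).hasSum.mul_left (π/2)
  have e := hs2.unique hs
  have e2 : ∫ x in Ioc 0 (π/2), ∑' l, F l x = ∫ x in Ioc 0 (π/2), (-2) * Real.log (Real.sin x) := by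
    apply MeasureTheory.setIntegral_congr_fun measurableSet_Ioc
    intro x hx
    simp only
    have hsin : 0 < Real.sin x := Real.sin_pos_of_pos_of_lt_pi hx.1 (by linarith [hx.2, Real.pi_pos])
    have hsc := Real.sin_sq_add_cos_sq x
    have hc : |Real.cos x^2| < 1 := by rw [abs_of_nonneg (by positivity)]; nlinarith
    have h1 := Real.hasSum_pow_div_log_of_abs_lt_one hc
    have h2 : HasSum (fun l => F l x) (-Real.log (1 - Real.cos x^2)) := by
      rw [← hasSum_nat_add_iff' 1]
      simp only [F, Finset.range_one, Finset.sum_singleton]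
      simp only [Nat.cast_zero, div_zero, zero_mul, sub_zero]
      convert! h1 using 1
      ext n; rw [pow_mul]; push_cast; ring
    rw [h2.tsum_eq, show 1 - Real.cos x^2 = Real.sin x^2 by linarith, Real.log_pow]; push_cast; ring
  rw [e2, ← intervalIntegral.integral_of_le (by positivity), intervalIntegral.integral_const_mul,
    integral_log_sin_zero_pi_div_two] at e
  have h4 : Real.log 4 = 2 * Real.log 2 := by
    rw [show (4:ℝ) = 2^2 by norm_num, Real.log_pow]; push_cast; ring
  unfold an
  rw [h4]
  have hpi := Real.pi_pos
  apply mul_left_cancel₀ (show π/2 ≠ 0 by positivity)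
  linarith

/-- kernel -/
noncomputable def Ff (c : ℕ → ℝ) (X : ℝ) : ℝ := ∑' l, c l * X^l
noncomputable def Wf (c : ℕ → ℝ) (X : ℝ) : ℝ := ∑' l : ℕ, (c l - 1/(l:ℝ)) * X^l

lemma sq_summable : Summable (fun l : ℕ => 1/((l:ℝ)+1)^2) := by
  have h : Summable (fun n : ℕ => 1 / (n:ℝ)^2) := Real.summable_one_div_nat_pow.mpr (by norm_num)
  have h2 := (summable_nat_add_iff 1).mpr h
  simpa using h2

lemma Wterm_bound {M : ℝ} {c : ℕ → ℝ} {C : ℝ} (hC : ∀ l : ℕ, |c l - 1/(l:ℝ)| ≤ C/((l:ℝ)+1)^2)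
    {X : ℝ} (hX : |X| ≤ 1) (l : ℕ) : ‖(c l - 1/(l:ℝ)) * X^l‖ ≤ C * (1/((l:ℝ)+1)^2) := by
  rw [Real.norm_eq_abs, abs_mul, abs_pow]
  calc _ ≤ C/((l:ℝ)+1)^2 * 1 := mul_le_mul (hC l) (pow_le_one₀ (abs_nonneg _) hX) (by positivity) ((abs_nonneg _).trans (hC l))
    _ = _ := by ring

lemma IsC.W_hasSum {M : ℝ} {c : ℕ → ℝ} (h : IsC M c) {X : ℝ} (hX : |X| ≤ 1) :
    HasSum (fun l : ℕ => (c l - 1/(l:ℝ)) * X^l) (Wf c X) := by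
  obtain ⟨C, hC0, hC⟩ := h.hC
  exact (Summable.of_norm_bounded (sq_summable.mul_left C) (Wterm_bound (M := M) hC hX)).hasSum

lemma IsC.F_hasSum {M : ℝ} {c : ℕ → ℝ} (h : IsC M c) {X : ℝ} (hX : |X| < 1) :
    HasSum (fun l : ℕ => c l * X^l) (-Real.log (1-X) + Wf c X) := by
  have h1 := Real.hasSum_pow_div_log_of_abs_lt_one hX
  have h2 : HasSum (fun l : ℕ => 1/(l:ℝ) * X^l) (-Real.log (1 - X)) := by
    rw [← hasSum_nat_add_iff' 1]
    simp only [Finset.range_one, Finset.sum_singleton]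
    simp only [Nat.cast_zero, div_zero, zero_mul, sub_zero]
    convert! h1 using 1
    ext n; push_cast; ring
  have := h2.add (h.W_hasSum hX.le)
  convert! this using 1
  ext l; ring

lemma IsC.F_eq {M : ℝ} {c : ℕ → ℝ} (h : IsC M c) {X : ℝ} (hX : |X| < 1) :
    Ff c X = -Real.log (1-X) + Wf c X := (h.F_hasSum hX).tsum_eq

lemma IsC.W_cont {M : ℝ} {c : ℕ → ℝ} (h : IsC M c) : ContinuousOn (Wf c) (Icc (-1) 1) := by
  obtain ⟨C, hC0, hC⟩ := h.hC
  unfold Wf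
  apply continuousOn_tsum (u := fun l : ℕ => C * (1/((l:ℝ)+1)^2))
  · intro l; fun_prop
  · exact sq_summable.mul_left C
  · intro l X hX; exact Wterm_bound (M := M) hC (abs_le.mpr hX) l

/-- main Fourier identity for the regular part -/
lemma IsC.sum_W {M : ℝ} {c : ℕ → ℝ} (h : IsC M c) (m : ℕ) (hm : 0 < m) (s : ℝ) :
    HasSum (fun k : ℕ => 2 * (m * an c ((k+1)*m) - 1/((k:ℝ)+1)) * Real.cos (((k:ℝ)+1)*s))
      (∑ j ∈ Finset.range m, Wf c (Real.cos ((s + 2*π*j)/m/2)^2) - m * (an c 0 - Real.log 4)) := by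
  obtain ⟨C, hC0, hC⟩ := h.hC
  obtain ⟨K, hK⟩ := h.bound
  set χ : ℕ → ℝ := fun n => ∑ j ∈ Finset.range m, Real.cos (n * ((s + 2*π*j)/m)) with hχ
  have hχb : ∀ n, |χ n| ≤ m := by
    intro n
    calc |χ n| ≤ ∑ j ∈ Finset.range m, |Real.cos (n * ((s + 2*π*j)/m))| := Finset.abs_sum_le_sum_abs _ _
      _ ≤ ∑ j ∈ Finset.range m, (1:ℝ) := Finset.sum_le_sum (fun j _ => Real.abs_cos_le_one _)
      _ = m := by simp
  set d : ℕ → ℝ := fun l => c l - 1/(l:ℝ) with hd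
  let G : ℕ → ℕ → ℝ := fun l n => d l * (wt n * Bn l n * χ n)
  have hrow : ∀ l, HasSum (fun n => wt n * Bn l n * χ n) (∑ j ∈ Finset.range m, (Real.cos ((s + 2*π*j)/m/2))^(2*l)) := by
    intro l
    simp only [hχ, Finset.mul_sum]
    exact hasSum_sum (fun j _ => cos_hasSum l _)
  have hsum2 : Summable (Function.uncurry G) := by
    rw [← summable_norm_iff] 
    have hnn : 0 ≤ (fun x : ℕ × ℕ => ‖Function.uncurry G x‖) := fun x => norm_nonneg _
    have hterm : ∀ l n, ‖G l n‖ ≤ |d l| * m * (wt n * Bn l n) := by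
      intro l n
      have h1 := wt_nonneg n
      have h2 := Bn_nonneg l n
      simp only [G]
      rw [Real.norm_eq_abs, abs_mul, abs_mul, abs_of_nonneg (by positivity : 0 ≤ wt n * Bn l n)]
      calc |d l| * (wt n * Bn l n * |χ n|) ≤ |d l| * (wt n * Bn l n * m) := by gcongr; exact hχb n
        _ = _ := by ring
    have hr : ∀ l, Summable (fun n => ‖G l n‖) := fun l =>
      Summable.of_nonneg_of_le (fun n => norm_nonneg _) (hterm l) ((wB_hasSum l).summable.mul_left _)
    rw [summable_prod_of_nonneg hnn]
    refine ⟨hr, ?_⟩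
    refine Summable.of_nonneg_of_le (fun l => tsum_nonneg (fun n => norm_nonneg _)) (fun l => ?_)
      ((sq_summable.mul_left C).mul_right (m:ℝ))
    calc ∑' n, ‖G l n‖ ≤ ∑' n, |d l| * m * (wt n * Bn l n) :=
          (hr l).tsum_le_tsum (hterm l) ((wB_hasSum l).summable.mul_left _)
      _ = |d l| * m := by rw [tsum_mul_left, (wB_hasSum l).tsum_eq, mul_one]
      _ ≤ C * (1/((l:ℝ)+1)^2) * m := by
        have := hC l
        gcongr
        calc |d l| ≤ C/((l:ℝ)+1)^2 := this
          _ = _ := by ring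
  have hW : HasSum (fun l => d l * ∑ j ∈ Finset.range m, (Real.cos ((s + 2*π*j)/m/2))^(2*l))
      (∑ j ∈ Finset.range m, Wf c (Real.cos ((s + 2*π*j)/m/2)^2)) := by
    simp only [Finset.mul_sum]
    apply hasSum_sum
    intro j _
    have hX : |Real.cos ((s + 2*π*j)/m/2)^2| ≤ 1 := by
      rw [abs_of_nonneg (by positivity)]; exact Real.cos_sq_le_one _
    have := h.W_hasSum hX
    convert! this using 1
    ext l; rw [pow_mul]
  have htot := hsum2.hasSum
  have hA : ∑' p, Function.uncurry G p = ∑ j ∈ Finset.range m, Wf c (Real.cos ((s + 2*π*j)/m/2)^2) := by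
    have := htot.prod_fiberwise (fun l => (hrow l).mul_left (d l))
    exact this.unique hW
  have hswap : HasSum (fun p : ℕ × ℕ => G p.2 p.1) (∑' p, Function.uncurry G p) :=
    (Equiv.prodComm ℕ ℕ).hasSum_iff.mpr htot |> fun h => h
  have hcol : ∀ n, HasSum (fun l => G l n) (wt n * χ n * (an c n - an (fun l : ℕ => 1/(l:ℝ)) n)) := by
    intro n
    have h1 := ((cB_summable hK n).hasSum.sub (cB_summable log_hK n).hasSum).mul_left (wt n * χ n)
    convert! h1 using 1
    ext l; simp only [G, hd]; ring
  have hB := hswap.prod_fiberwise hcol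
  rw [hA] at hB
  -- restrict to multiples of m
  have hinj : Function.Injective (fun k : ℕ => k*m) := fun x y hxy => Nat.eq_of_mul_eq_mul_right hm hxy
  have hB2 := (hinj.hasSum_iff (f := fun n => wt n * χ n * (an c n - an (fun l : ℕ => 1/(l:ℝ)) n)) (by
    intro n hn
    have : ¬ m ∣ n := fun ⟨k, hk⟩ => hn ⟨k, by simp only []; rw [hk]; ring⟩
    simp only [hχ]
    rw [cos_filter m hm, if_neg this]; simp)).mpr hB
  rw [← hasSum_nat_add_iff' 1] at hB2
  have hm0 : (m:ℝ) ≠ 0 := by positivity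
  convert! hB2 using 1
  · ext k
    simp only [Function.comp, hχ]
    rw [cos_filter m hm, if_pos ⟨k+1, by ring⟩, log_an _ (by nlinarith)]
    have : wt ((k+1)*m) = 2 := by unfold wt; rw [if_neg]; positivity
    rw [this]
    have e : (((k+1)*m:ℕ):ℝ)*s/m = ((k:ℝ)+1)*s := by push_cast; field_simp
    rw [e]; push_cast; field_simp
  · simp only [Finset.range_one, Finset.sum_singleton, Function.comp, hχ]
    rw [zero_mul, log_an_zero]
    simp [wt]

/-- periodized kernel identity -/
lemma IsC.periodized {M : ℝ} {c : ℕ → ℝ} (h : IsC M c) (m : ℕ) (hm : 0 < m) (s : ℝ) (hs : Real.cos s ≠ 1) :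
    HasSum (fun k : ℕ => 2 * (m * an c ((k+1)*m) - 1/((k:ℝ)+1)) * Real.cos (((k:ℝ)+1)*s))
      (∑ j ∈ Finset.range m, Ff c (Real.cos ((s + 2*π*j)/m/2)^2) - (m * an c 0 - Real.log (2 - 2*Real.cos s))) := by
  have hsum := sum_log m hm s hs
  have hp := prod_two_sub_cos m hm s
  have hne : ∀ j ∈ Finset.range m, (2 - 2*Real.cos ((s + 2*π*j)/m)) ≠ 0 := by
    rw [← Finset.prod_ne_zero_iff, hp]
    intro h; apply hs; linarith
  have : ∀ j ∈ Finset.range m, Ff c (Real.cos ((s + 2*π*j)/m/2)^2) =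
      -Real.log (1 - Real.cos ((s + 2*π*j)/m/2)^2) + Wf c (Real.cos ((s + 2*π*j)/m/2)^2) := by
    intro j hj
    apply h.F_eq
    rw [abs_of_nonneg (by positivity)]
    apply lt_of_le_of_ne (Real.cos_sq_le_one _)
    intro heq
    apply hne j hj
    have := Real.cos_sq ((s + 2*π*j)/m/2)
    rw [show 2*((s + 2*π*j)/m/2) = (s + 2*π*j)/m by ring] at this
    linarith
  rw [Finset.sum_congr rfl this, Finset.sum_add_distrib, Finset.sum_neg_distrib, hsum]
  have := h.sum_W m hm s
  convert! this using 1
  ring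

end TO

namespace TO

/-- regularised log kernel -/
noncomputable def LA (r θ : ℝ) : ℝ := -Real.log (1 - 2*r*Real.cos θ + r^2)

lemma LA_one (θ : ℝ) : LA 1 θ = -Real.log (2 - 2*Real.cos θ) := by
  unfold LA; congr 2; ring

lemma LA_hasSum {r : ℝ} (h0 : 0 ≤ r) (h1 : r < 1) (θ : ℝ) :
    HasSum (fun n : ℕ => 2*r^n/(n:ℝ)*Real.cos (n*θ)) (LA r θ) := by
  set z : ℂ := (r:ℂ) * Complex.exp (θ * Complex.I) with hz
  have hn : ‖z‖ = r := by
    rw [hz, norm_mul, Complex.norm_exp_ofReal_mul_I, mul_one, Complex.norm_real, Real.norm_eq_abs, abs_of_nonneg h0]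
  have h := (Complex.hasSum_re (Complex.hasSum_taylorSeries_neg_log (z := z) (by rw [hn]; exact h1))).mul_left 2
  convert! h using 1
  · ext n
    have : z^n/(n:ℂ) = ((r^n/(n:ℝ) : ℝ):ℂ) * Complex.exp (((n*θ : ℝ):ℂ) * Complex.I) := by
      rw [hz, mul_pow, ← Complex.exp_nat_mul]; push_cast
      rw [show (n:ℂ) * (θ * Complex.I) = n * θ * Complex.I by ring]; ring
    rw [this, Complex.re_ofReal_mul, Complex.exp_ofReal_mul_I_re]; ring
  · rw [Complex.neg_re, Complex.log_re]
    have e : 1 - 2*r*Real.cos θ + r^2 = ‖1 - z‖^2 := by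
      rw [Complex.sq_norm, Complex.normSq_apply]
      have e1 : (1 - z).re = 1 - r * Real.cos θ := by
        rw [hz, Complex.sub_re, Complex.re_ofReal_mul, Complex.exp_ofReal_mul_I_re]; simp
      have e2 : (1 - z).im = - (r * Real.sin θ) := by
        rw [hz, Complex.sub_im, Complex.im_ofReal_mul, Complex.exp_ofReal_mul_I_im]; simp
      rw [e1, e2]; nlinarith [Real.sin_sq_add_cos_sq θ]
    unfold LA
    rw [e, Real.log_pow]; push_cast; ring

lemma LA_arg_ge (r θ : ℝ) : Real.sin θ ^2 ≤ 1 - 2*r*Real.cos θ + r^2 := by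
  nlinarith [Real.sin_sq_add_cos_sq θ, sq_nonneg (r - Real.cos θ)]

lemma LA_arg_le {r : ℝ} (h0 : 0 ≤ r) (h1 : r ≤ 1) (θ : ℝ) : 1 - 2*r*Real.cos θ + r^2 ≤ 4 := by
  nlinarith [Real.neg_one_le_cos θ]

/-- dominating function -/
noncomputable def Dm (θ : ℝ) : ℝ := 2*|Real.log (Real.sin θ)| + Real.log 4

lemma Dm_int (a b : ℝ) : IntervalIntegrable Dm MeasureTheory.volume a b := by
  have h : IntervalIntegrable (Real.log ∘ Real.sin) MeasureTheory.volume a b := intervalIntegrable_log_sin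
  exact (h.abs.const_mul 2).add intervalIntegrable_const

lemma Dm_nonneg (θ : ℝ) : 0 ≤ Dm θ := by
  unfold Dm; have := Real.log_nonneg (show (1:ℝ) ≤ 4 by norm_num); positivity

lemma LA_abs_le {r : ℝ} (h0 : 0 ≤ r) (h1 : r ≤ 1) {θ : ℝ} (h : Real.sin θ ≠ 0) : |LA r θ| ≤ Dm θ := by
  have hp : 0 < Real.sin θ^2 := by positivity
  have a1 := Real.log_le_log hp (LA_arg_ge r θ)
  have a2 := Real.log_le_log (lt_of_lt_of_le hp (LA_arg_ge r θ)) (LA_arg_le h0 h1 θ)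
  rw [Real.log_pow] at a1
  push_cast at a1
  have h4 := Real.log_nonneg (show (1:ℝ) ≤ 4 by norm_num)
  unfold LA Dm
  rw [abs_neg, abs_le]
  have := abs_le.mp (le_refl |Real.log (Real.sin θ)|)
  constructor
  · linarith
  · linarith [abs_nonneg (Real.log (Real.sin θ))]

lemma LA_ge {r : ℝ} (h0 : 0 ≤ r) (h1 : r ≤ 1) (θ : ℝ) : -Real.log 4 ≤ LA r θ := by
  unfold LA
  rw [neg_le_neg_iff]
  have h4 := Real.log_nonneg (show (1:ℝ) ≤ 4 by norm_num)
  rcases eq_or_lt_of_le (le_trans (sq_nonneg _) (LA_arg_ge r θ)) with h | h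
  · rw [← h]; simpa using h4
  · exact Real.log_le_log h (LA_arg_le h0 h1 θ)

lemma sin_ne_ae : ∀ᵐ θ : ℝ, Real.sin θ ≠ 0 := by
  have : {θ : ℝ | Real.sin θ = 0} ⊆ Set.range (fun n : ℤ => (n:ℝ) * π) := by
    intro θ h
    obtain ⟨n, hn⟩ := Real.sin_eq_zero_iff.mp h
    exact ⟨n, hn⟩
  have hc := (Set.countable_range (fun n : ℤ => (n:ℝ) * π)).mono this
  filter_upwards [hc.ae_notMem MeasureTheory.volume] with θ h1 h2
  exact h1 h2

lemma sin_sub_ne_ae (s : ℝ) : ∀ᵐ θ : ℝ, Real.sin (s - θ) ≠ 0 := by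
  have : {θ : ℝ | Real.sin (s - θ) = 0} ⊆ Set.range (fun n : ℤ => s - (n:ℝ) * π) := by
    intro θ h
    obtain ⟨n, hn⟩ := Real.sin_eq_zero_iff.mp h
    exact ⟨n, by simp only; linarith⟩
  have hc := (Set.countable_range (fun n : ℤ => s - (n:ℝ) * π)).mono this
  filter_upwards [hc.ae_notMem MeasureTheory.volume] with θ h1 h2
  exact h1 h2

lemma LA_meas (r : ℝ) : Measurable (LA r) := by unfold LA; fun_prop

lemma LA_per (r : ℝ) : Function.Periodic (LA r) (2*π) := by
  intro θ; simp [LA]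

lemma LA_int {r : ℝ} (h0 : 0 ≤ r) (h1 : r ≤ 1) (a b : ℝ) : IntervalIntegrable (LA r) MeasureTheory.volume a b := by
  apply (Dm_int a b).mono_fun (LA_meas r).aestronglyMeasurable
  apply MeasureTheory.ae_restrict_of_ae
  filter_upwards [sin_ne_ae] with θ h
  rw [Real.norm_eq_abs, Real.norm_eq_abs, abs_of_nonneg (Dm_nonneg θ)]
  exact LA_abs_le h0 h1 h

lemma LA_sub_int {r : ℝ} (h0 : 0 ≤ r) (h1 : r ≤ 1) (s a b : ℝ) :
    IntervalIntegrable (fun t => LA r (s - t)) MeasureTheory.volume a b := by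
  simpa using (LA_int h0 h1 (s - a) (s - b)).comp_sub_left s

lemma Dm_sub_int (s a b : ℝ) :
    IntervalIntegrable (fun t => Dm (s - t)) MeasureTheory.volume a b := by
  simpa using (Dm_int (s - a) (s - b)).comp_sub_left s

/-- limit `r → 1` -/
lemma LA_tendsto (s a b : ℝ) {f : ℝ → ℝ} (hf : Continuous f) :
    Tendsto (fun r => ∫ t in a..b, LA r (s - t) * f t) (nhdsWithin 1 (Iio 1)) (nhds (∫ t in a..b, LA 1 (s - t) * f t)) := by
  obtain ⟨C, hC⟩ := (isCompact_uIcc (a := a) (b := b)).exists_bound_of_continuousOn hf.continuousOn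
  apply intervalIntegral.tendsto_integral_filter_of_dominated_convergence (fun t => Dm (s - t) * C)
  · filter_upwards with r
    have := LA_meas r
    exact (by fun_prop : Measurable (fun t => LA r (s-t) * f t)).aestronglyMeasurable
  · have hev : ∀ᶠ r : ℝ in nhdsWithin 1 (Iio 1), r ∈ Ioo (0:ℝ) 1 := Ioo_mem_nhdsLT (by norm_num)
    filter_upwards [hev] with r hr
    filter_upwards [sin_sub_ne_ae s] with t ht htm
    rw [norm_mul]
    exact mul_le_mul (LA_abs_le hr.1.le hr.2.le ht) (hC t (uIoc_subset_uIcc htm)) (norm_nonneg _) (Dm_nonneg _)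
  · exact (Dm_sub_int s a b).mul_const C
  · filter_upwards [sin_sub_ne_ae s] with t ht htm
    apply Tendsto.mul_const
    apply Tendsto.mono_left _ nhdsWithin_le_nhds
    have : ContinuousAt (fun r => LA r (s - t)) 1 := by
      unfold LA
      have hp : 0 < Real.sin (s-t)^2 := by positivity
      have := LA_arg_ge 1 (s - t)
      exact (ContinuousAt.log (by fun_prop) (by linarith)).neg
    exact this

lemma integral_cos_nat (n : ℕ) (hn : n ≠ 0) : ∫ t in -π..π, Real.cos (n*t) = 0 := by
  have hn' : (n:ℝ) ≠ 0 := by exact_mod_cast hn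
  rw [intervalIntegral.integral_comp_mul_left (fun t => Real.cos t) hn', integral_cos]
  rw [show (n:ℝ) * -π = -(n*π) by ring, Real.sin_neg, Real.sin_nat_mul_pi]; simp

lemma integral_cos_cos (k n : ℕ) (hk : k ≠ 0) :
    ∫ t in -π..π, Real.cos (k*t) * Real.cos (n*t) = if k = n then π else 0 := by
  have e : ∀ t : ℝ, Real.cos (k*t) * Real.cos (n*t) = (1/2)*Real.cos (((k+n : ℕ):ℝ)*t) + (1/2)*Real.cos (((k:ℝ)-n)*t) := by
    intro t; push_cast; rw [add_mul, sub_mul, Real.cos_add, Real.cos_sub]; ring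
  simp_rw [e]
  rw [intervalIntegral.integral_add (by apply Continuous.intervalIntegrable; fun_prop) (by apply Continuous.intervalIntegrable; fun_prop),
    intervalIntegral.integral_const_mul, intervalIntegral.integral_const_mul, integral_cos_nat _ (by omega)]
  split_ifs with h
  · subst h; simp; ring
  · rcases lt_or_gt_of_ne h with h | h
    · have : ∀ t : ℝ, Real.cos (((k:ℝ)-n)*t) = Real.cos (((n-k : ℕ):ℝ)*t) := by
        intro t; rw [Nat.cast_sub h.le, ← Real.cos_neg]; ring_nf
      simp_rw [this]; rw [integral_cos_nat _ (by omega)]; simp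
    · have : ∀ t : ℝ, Real.cos (((k:ℝ)-n)*t) = Real.cos (((k-n : ℕ):ℝ)*t) := by
        intro t; rw [Nat.cast_sub h.le]
      simp_rw [this]; rw [integral_cos_nat _ (by omega)]; simp

/-- termwise integration for `r<1` -/
lemma LA_int_hasSum {r : ℝ} (h0 : 0 ≤ r) (h1 : r < 1) (s a b : ℝ) {f : ℝ → ℝ} (hf : Continuous f) :
    HasSum (fun n : ℕ => 2*r^n/(n:ℝ) * ∫ t in a..b, Real.cos (n*(s - t)) * f t) (∫ t in a..b, LA r (s - t) * f t) := by
  obtain ⟨C, hC⟩ := (isCompact_uIcc (a := a) (b := b)).exists_bound_of_continuousOn hf.continuousOn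
  have key := intervalIntegral.hasSum_integral_of_dominated_convergence (μ := MeasureTheory.volume) (a := a) (b := b)
    (F := fun (n:ℕ) t => 2*r^n/(n:ℝ)*Real.cos (n*(s-t)) * f t) (f := fun t => LA r (s - t) * f t)
    (fun n _ => 2*r^n * C) ?_ ?_ ?_ ?_ ?_
  · convert! key using 1
    ext n
    rw [← intervalIntegral.integral_const_mul]; congr 1; ext t; ring
  · intro n
    exact (by fun_prop : Continuous (fun t => 2*r^n/(n:ℝ)*Real.cos (n*(s-t)) * f t)).aestronglyMeasurable
  · intro n
    filter_upwards with t ht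
    rw [norm_mul]
    have hb := hC t (uIoc_subset_uIcc ht)
    apply mul_le_mul _ hb (norm_nonneg _) (by positivity)
    rw [Real.norm_eq_abs, abs_mul]
    have c1 := Real.abs_cos_le_one (n*(s-t))
    have c2 : |2*r^n/(n:ℝ)| ≤ 2*r^n := by
      rw [abs_of_nonneg (by positivity)]
      rcases Nat.eq_zero_or_pos n with h | h
      · subst h; simp
      · apply div_le_self (by positivity); exact_mod_cast h
    calc _ ≤ (2*r^n)*1 := by gcongr
      _ = _ := by ring
  · filter_upwards with t ht
    exact ((summable_geometric_of_lt_one h0 h1).mul_left 2).mul_right C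
  · simp
  · filter_upwards with t ht
    exact (LA_hasSum h0 h1 (s - t)).mul_right (f t)

lemma integral_cos_shift (k n : ℕ) (hk : k ≠ 0) (s : ℝ) :
    ∫ t in -π..π, Real.cos (k*(s-t)) * Real.cos (n*t) = if k = n then π*Real.cos (n*s) else 0 := by
  have e : ∀ t : ℝ, Real.cos (k*(s-t)) * Real.cos (n*t) =
      Real.cos (k*s) * (Real.cos (k*t) * Real.cos (n*t)) + Real.sin (k*s) * (Real.sin (k*t) * Real.cos (n*t)) := by
    intro t; rw [mul_sub, Real.cos_sub]; ring
  simp_rw [e]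
  rw [intervalIntegral.integral_add (by apply Continuous.intervalIntegrable; fun_prop) (by apply Continuous.intervalIntegrable; fun_prop),
    intervalIntegral.integral_const_mul, intervalIntegral.integral_const_mul, integral_cos_cos k n hk]
  have : ∫ t in -π..π, Real.sin (k*t) * Real.cos (n*t) = 0 := by
    have h := intervalIntegral.integral_comp_neg (a := -π) (b := π) (fun t : ℝ => Real.sin (k*t) * Real.cos (n*t))
    simp only [mul_neg, Real.sin_neg, Real.cos_neg, neg_mul, neg_neg, intervalIntegral.integral_neg] at h
    linarith
  rw [this]
  split_ifs with h
  · subst h; ring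
  · simp

lemma LA_coeff_lt {r : ℝ} (h0 : 0 ≤ r) (h1 : r < 1) (n : ℕ) (s : ℝ) :
    ∫ t in -π..π, LA r (s - t) * Real.cos (n*t) = 2*π*r^n/(n:ℝ)*Real.cos (n*s) := by
  have h := LA_int_hasSum h0 h1 s (-π) π (f := fun t => Real.cos (n*t)) (by fun_prop)
  refine (h.unique ?_)
  have : (fun k : ℕ => 2*r^k/(k:ℝ) * ∫ t in -π..π, Real.cos (k*(s-t)) * Real.cos (n*t)) = fun k => if k = n then 2*π*r^n/(n:ℝ)*Real.cos (n*s) else 0 := by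
    ext k
    rcases Nat.eq_zero_or_pos k with hk | hk
    · subst hk
      split_ifs with h
      · subst h; simp
      · simp
    · rw [integral_cos_shift k n hk.ne']
      split_ifs with h
      · subst h; ring
      · ring
  rw [this]
  exact hasSum_ite_eq n _

lemma LA_coeff {r : ℝ} (h0 : 0 ≤ r) (h1 : r ≤ 1) (n : ℕ) (s : ℝ) :
    ∫ t in -π..π, LA r (s - t) * Real.cos (n*t) = 2*π*r^n/(n:ℝ)*Real.cos (n*s) := by
  rcases lt_or_eq_of_le h1 with h | h
  · exact LA_coeff_lt h0 h n s
  subst h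
  have h2 := LA_tendsto s (-π) π (f := fun t => Real.cos (n*t)) (by fun_prop)
  refine tendsto_nhds_unique h2 ?_
  have h3 : Tendsto (fun r : ℝ => 2*π*r^n/(n:ℝ)*Real.cos (n*s)) (nhdsWithin 1 (Iio 1)) (nhds (2*π*1^n/(n:ℝ)*Real.cos (n*s))) := by
    apply Tendsto.mono_left _ nhdsWithin_le_nhds
    exact (by fun_prop : Continuous (fun r : ℝ => 2*π*r^n/(n:ℝ)*Real.cos (n*s))).tendsto 1
  apply h3.congr'
  have hev : ∀ᶠ r : ℝ in nhdsWithin 1 (Iio 1), r ∈ Ioo (0:ℝ) 1 := Ioo_mem_nhdsLT (by norm_num)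
  filter_upwards [hev] with r hr
  rw [LA_coeff_lt hr.1.le hr.2]

lemma log_cos_int (x a b : ℝ) : IntervalIntegrable (fun τ => Real.log (x - Real.cos τ)) MeasureTheory.volume a b := by
  have : AnalyticOnNhd ℝ (fun τ => x - Real.cos τ) (uIcc a b) := fun τ _ =>
    analyticAt_const.sub Real.analyticAt_cos
  exact this.meromorphicOn.intervalIntegrable_log

lemma log_half (x : ℝ) (n : ℕ) : ∫ τ in 0..π, Real.log (x - Real.cos τ) * Real.cos (n*τ) =
    (1/2) * ∫ τ in -π..π, Real.log (x - Real.cos τ) * Real.cos (n*τ) := by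
  have hi : ∀ a b, IntervalIntegrable (fun τ => Real.log (x - Real.cos τ) * Real.cos (n*τ)) MeasureTheory.volume a b :=
    fun a b => (log_cos_int x a b).mul_continuousOn (by fun_prop)
  rw [← intervalIntegral.integral_add_adjacent_intervals (hi (-π) 0) (hi 0 π)]
  have : ∫ τ in -π..0, Real.log (x - Real.cos τ) * Real.cos (n*τ) = ∫ τ in 0..π, Real.log (x - Real.cos τ) * Real.cos (n*τ) := by
    rw [← neg_zero, ← intervalIntegral.integral_comp_neg]; simp
  rw [this]; ring

lemma log_outside {r : ℝ} (h0 : 0 < r) (h1 : r ≤ 1) (n : ℕ) :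
    ∫ τ in 0..π, Real.log ((r + r⁻¹)/2 - Real.cos τ) * Real.cos (n*τ) = -π*(r^n/n) - (if n = 0 then π*(Real.log 2 + Real.log r) else 0) := by
  rw [log_half]
  have e : ∫ τ in -π..π, Real.log ((r + r⁻¹)/2 - Real.cos τ) * Real.cos (n*τ) =
      ∫ τ in -π..π, (-(LA r (0 - τ) * Real.cos (n*τ)) - (Real.log 2 + Real.log r) * Real.cos (n*τ)) := by
    apply intervalIntegral.integral_congr_ae
    filter_upwards [sin_ne_ae] with τ h _
    have hp : 0 < Real.sin τ^2 := by positivity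
    have := LA_arg_ge r τ
    have e2 : (r + r⁻¹)/2 - Real.cos τ = (1 - 2*r*Real.cos τ + r^2)/(2*r) := by field_simp; ring
    rw [e2, Real.log_div (by linarith) (by positivity), Real.log_mul (by norm_num) h0.ne']
    unfold LA; simp only [zero_sub, Real.cos_neg]; ring
  have hI := LA_int h0.le h1
  rw [e, intervalIntegral.integral_sub, intervalIntegral.integral_neg, LA_coeff h0.le h1, intervalIntegral.integral_const_mul]
  · split_ifs with h
    · subst h; simp; ring
    · rw [integral_cos_nat n h]; simp; ring
  · exact ((LA_sub_int h0.le h1 0 _ _).mul_continuousOn (by fun_prop)).neg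
  · apply Continuous.intervalIntegrable; fun_prop

lemma log_inside (φ : ℝ) (n : ℕ) :
    ∫ τ in 0..π, Real.log (Real.cos φ - Real.cos τ) * Real.cos (n*τ) = -π*(Real.cos (n*φ)/n) - (if n = 0 then π*Real.log 2 else 0) := by
  rw [log_half]
  have e : ∫ τ in -π..π, Real.log (Real.cos φ - Real.cos τ) * Real.cos (n*τ) =
      ∫ τ in -π..π, (-((1/2)*(LA 1 (φ - τ) * Real.cos (n*τ) + LA 1 (-φ - τ) * Real.cos (n*τ))) - Real.log 2 * Real.cos (n*τ)) := by
    apply intervalIntegral.integral_congr_ae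
    filter_upwards [sin_sub_ne_ae φ, sin_sub_ne_ae (-φ)] with τ h h2 _
    have hp : 0 < Real.sin (φ-τ)^2 := by positivity
    have hp2 : 0 < Real.sin (-φ-τ)^2 := by positivity
    have a1 := LA_arg_ge 1 (φ - τ)
    have a2 := LA_arg_ge 1 (-φ - τ)
    have e2 : (1 - 2*1*Real.cos (φ-τ) + 1^2)*(1 - 2*1*Real.cos (-φ-τ) + 1^2) = (2*(Real.cos φ - Real.cos τ))^2 := by
      rw [Real.cos_sub, Real.cos_sub, Real.cos_neg, Real.sin_neg]
      linear_combination (-4 + 4*Real.cos τ^2)*Real.sin_sq_add_cos_sq φ + (-4*Real.sin φ^2)*Real.sin_sq_add_cos_sq τ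
    have hne : Real.cos φ - Real.cos τ ≠ 0 := by
      intro h0; rw [h0] at e2
      have : 0 < (1 - 2*1*Real.cos (φ-τ) + 1^2)*(1 - 2*1*Real.cos (-φ-τ) + 1^2) := by
        apply mul_pos <;> linarith
      rw [e2] at this; simp at this
    have e3 := congrArg Real.log e2
    rw [Real.log_mul (by linarith) (by linarith), Real.log_pow, Real.log_mul (by norm_num) hne] at e3
    push_cast at e3
    have e4 : Real.log (Real.cos φ - Real.cos τ) = -((1/2)*(LA 1 (φ - τ) + LA 1 (-φ - τ))) - Real.log 2 := by
      rw [LA_one, LA_one]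
      have g1 : 1 - 2*1*Real.cos (φ-τ) + 1^2 = 2 - 2*Real.cos (φ-τ) := by ring
      have g2 : 1 - 2*1*Real.cos (-φ-τ) + 1^2 = 2 - 2*Real.cos (-φ-τ) := by ring
      rw [g1, g2] at e3
      linear_combination (-1/2)*e3
    rw [e4]; ring
  have i1 := (LA_sub_int (by norm_num) le_rfl φ (-π) π).mul_continuousOn (g := fun t => Real.cos (n*t)) (by fun_prop)
  have i2 := (LA_sub_int (by norm_num) le_rfl (-φ) (-π) π).mul_continuousOn (g := fun t => Real.cos (n*t)) (by fun_prop)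
  rw [e, intervalIntegral.integral_sub (by exact ((i1.add i2).const_mul (1/2)).neg) (by apply Continuous.intervalIntegrable; fun_prop),
    intervalIntegral.integral_neg, intervalIntegral.integral_const_mul, intervalIntegral.integral_add i1 i2,
    LA_coeff (by norm_num) le_rfl, LA_coeff (by norm_num) le_rfl, intervalIntegral.integral_const_mul]
  rw [show (n:ℝ) * -φ = -(n*φ) by ring, Real.cos_neg]
  split_ifs with h
  · subst h; simp; ring
  · rw [integral_cos_nat n h]; simp; ring
end TO

namespace TO
open Polynomial in
/-- divided difference -/
noncomputable def dd (F : Polynomial ℝ) (x y : ℝ) : ℝ := (F /ₘ (X - C x)).eval y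

/-- the transform -/
noncomputable def Sp (F : Polynomial ℝ) (x : ℝ) : ℝ := (1/π) * ∫ τ in 0..π, dd F x (Real.cos τ)

noncomputable def mean (F : Polynomial ℝ) : ℝ := (1/π) * ∫ τ in 0..π, F.eval (Real.cos τ)

noncomputable def Pot (q : ℝ → ℝ) (x : ℝ) : ℝ :=
  -(1/π) * ∫ τ in 0..π, Real.log (x - Real.cos τ) * (q (Real.cos τ) * Real.sin τ^2)

open Polynomial in
lemma dd_mul (F : Polynomial ℝ) (x y : ℝ) : (y - x) * dd F x y = F.eval y - F.eval x := by
  have h := modByMonic_add_div F (X - C x)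
  rw [modByMonic_X_sub_C_eq_C_eval] at h
  have h2 := congrArg (Polynomial.eval y) h
  simp at h2
  unfold dd; linarith

open Polynomial in
lemma dd_eq (F : Polynomial ℝ) (x : ℝ) : C (F.eval x) + (X - C x) * (F /ₘ (X - C x)) = F := by
  have h := modByMonic_add_div F (X - C x)
  rwa [modByMonic_X_sub_C_eq_C_eval] at h

open Polynomial in
lemma dd_unique {F q : Polynomial ℝ} {x r : ℝ} (h : C r + (X - C x) * q = F) (y : ℝ) : dd F x y = q.eval y := by
  have h := (div_modByMonic_unique (f := F) (g := X - C x) q (C r)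
    (monic_X_sub_C x) ⟨h, ?_⟩).1
  · unfold dd; rw [h]
  · rw [degree_X_sub_C]; exact lt_of_le_of_lt degree_C_le (by norm_num)

open Polynomial in
lemma dd_add (F G : Polynomial ℝ) (x y : ℝ) : dd (F + G) x y = dd F x y + dd G x y := by
  rw [dd_unique (F := F + G) (q := F /ₘ (X - C x) + G /ₘ (X - C x)) (r := F.eval x + G.eval x), Polynomial.eval_add]
  · rfl
  · rw [C_add]; linear_combination dd_eq F x + dd_eq G x

open Polynomial in
lemma dd_smul (c : ℝ) (F : Polynomial ℝ) (x y : ℝ) : dd (c • F) x y = c * dd F x y := by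
  rw [dd_unique (F := c • F) (q := C c * (F /ₘ (X - C x))) (r := c * F.eval x)]
  · simp [dd]
  · rw [C_mul, smul_eq_C_mul]; linear_combination C c * dd_eq F x

open Polynomial in
lemma dd_X_mul (F : Polynomial ℝ) (x y : ℝ) : dd (X * F) x y = F.eval y + x * dd F x y := by
  have h := (div_modByMonic_unique (f := X * F) (g := X - C x) (F + C x * (F /ₘ (X - C x))) (C (x * F.eval x))
    (monic_X_sub_C x) ⟨?_, ?_⟩).1
  · unfold dd; rw [h]; simp
  · have h := modByMonic_add_div F (X - C x)
    rw [modByMonic_X_sub_C_eq_C_eval] at h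
    conv_rhs => rw [← h]
    rw [C_mul]
    linear_combination (-X + C x) * h
  · rw [degree_X_sub_C]; exact lt_of_le_of_lt degree_C_le (by norm_num)

lemma dd_cont (F : Polynomial ℝ) (x : ℝ) : Continuous (fun τ => dd F x (Real.cos τ)) := by
  unfold dd; exact (Polynomial.continuous _).comp Real.continuous_cos

lemma eval_cont (F : Polynomial ℝ) : Continuous (fun τ => F.eval (Real.cos τ)) :=
  (Polynomial.continuous _).comp Real.continuous_cos

lemma Sp_add (F G : Polynomial ℝ) (x : ℝ) : Sp (F + G) x = Sp F x + Sp G x := by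
  unfold Sp; simp_rw [dd_add]
  rw [intervalIntegral.integral_add ((dd_cont F x).intervalIntegrable _ _) ((dd_cont G x).intervalIntegrable _ _)]; ring

lemma Sp_smul (c : ℝ) (F : Polynomial ℝ) (x : ℝ) : Sp (c • F) x = c * Sp F x := by
  unfold Sp; simp_rw [dd_smul]; rw [intervalIntegral.integral_const_mul]; ring

lemma Sp_X_mul (F : Polynomial ℝ) (x : ℝ) : Sp (Polynomial.X * F) x = mean F + x * Sp F x := by
  unfold Sp mean; simp_rw [dd_X_mul]
  rw [intervalIntegral.integral_add ((eval_cont F).intervalIntegrable _ _) (((dd_cont F x).intervalIntegrable _ _).const_mul _),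
    intervalIntegral.integral_const_mul]; ring

lemma Sp_zero (x : ℝ) : Sp 0 x = 0 := by
  have := Sp_smul 0 0 x; simpa using this

lemma Sp_one (x : ℝ) : Sp 1 x = 0 := by
  have h : (1 : Polynomial ℝ) /ₘ (Polynomial.X - Polynomial.C x) = 0 := by
    rw [Polynomial.divByMonic_eq_zero_iff (Polynomial.monic_X_sub_C x), Polynomial.degree_X_sub_C]; simp
  unfold Sp dd; rw [h]; simp

lemma mean_add (F G : Polynomial ℝ) : mean (F + G) = mean F + mean G := by
  unfold mean; simp_rw [Polynomial.eval_add]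
  rw [intervalIntegral.integral_add ((eval_cont F).intervalIntegrable _ _) ((eval_cont G).intervalIntegrable _ _)]; ring

lemma mean_smul (c : ℝ) (F : Polynomial ℝ) : mean (c • F) = c * mean F := by
  unfold mean; simp_rw [Polynomial.eval_smul, smul_eq_mul]; rw [intervalIntegral.integral_const_mul]; ring

open Polynomial in
lemma poly_span (P : Polynomial ℝ → Prop) (hadd : ∀ F G, P F → P G → P (F + G)) (hsmul : ∀ (c : ℝ) F, P F → P (c • F))
    (hT : ∀ n : ℕ, P (Chebyshev.T ℝ n)) (F : Polynomial ℝ) : P F := by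
  let W : Submodule ℝ (Polynomial ℝ) := Submodule.span ℝ (Set.range (fun n : ℕ => Chebyshev.T ℝ (n:ℤ)))
  have hWP : ∀ G ∈ W, P G := by
    intro G hG
    induction hG using Submodule.span_induction with
    | mem x hx => obtain ⟨n, rfl⟩ := hx; exact hT n
    | zero => have := hsmul 0 _ (hT 0); simpa using this
    | add x y _ _ hx hy => exact hadd _ _ hx hy
    | smul c x _ hx => exact hsmul _ _ hx
  have hX : ∀ G ∈ W, X * G ∈ W := by
    intro G hG
    induction hG using Submodule.span_induction with
    | mem x hx =>
      obtain ⟨n, rfl⟩ := hx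
      rcases Nat.eq_zero_or_pos n with h | h
      · subst h
        have : X * Chebyshev.T ℝ ((0:ℕ):ℤ) = Chebyshev.T ℝ ((1:ℕ):ℤ) := by simp
        simp only
        rw [this]; exact Submodule.subset_span ⟨1, rfl⟩
      · obtain ⟨k, rfl⟩ : ∃ k, n = k + 1 := ⟨n - 1, by omega⟩
        have h2 := Chebyshev.T_add_two ℝ (k:ℤ)
        have : X * Chebyshev.T ℝ ((k+1:ℕ):ℤ) = (1/2:ℝ) • (Chebyshev.T ℝ ((k+2:ℕ):ℤ) + Chebyshev.T ℝ ((k:ℕ):ℤ)) := by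
          push_cast
          rw [h2, smul_eq_C_mul]
          have hc : (C (1/2:ℝ)) * 2 = 1 := by
            rw [show (2:Polynomial ℝ) = C 2 by rfl, ← C_mul]; norm_num
          linear_combination (-X * Chebyshev.T ℝ ((k:ℤ)+1)) * hc
        simp only
        rw [this]
        exact W.smul_mem _ (W.add_mem (Submodule.subset_span ⟨k+2, rfl⟩) (Submodule.subset_span ⟨k, rfl⟩))
    | zero => simp
    | add x y _ _ hx hy => rw [mul_add]; exact W.add_mem hx hy
    | smul c x _ hx => rw [mul_smul_comm]; exact W.smul_mem _ hx
  have hpow : ∀ n : ℕ, (X:Polynomial ℝ)^n ∈ W := by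
    intro n
    induction n with
    | zero => exact Submodule.subset_span ⟨0, by simp⟩
    | succ n ih => rw [pow_succ']; exact hX _ ih
  apply hWP
  rw [F.as_sum_range_C_mul_X_pow]
  apply W.sum_mem
  intro i _
  rw [← smul_eq_C_mul]; exact W.smul_mem _ (hpow i)

open Polynomial in
lemma mean_T (n : ℕ) : mean (Chebyshev.T ℝ n) = if n = 0 then 1 else 0 := by
  unfold mean
  simp_rw [Chebyshev.T_real_cos]
  split_ifs with h
  · subst h; simp
  · have hn' : ((n:ℤ):ℝ) ≠ 0 := by exact_mod_cast h
    rw [intervalIntegral.integral_comp_mul_left (fun t => Real.cos t) hn', integral_cos]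
    push_cast
    rw [Real.sin_nat_mul_pi]; simp

open Polynomial in
lemma Sp_T (n : ℕ) (x : ℝ) : Sp (Chebyshev.T ℝ n) x = (Chebyshev.U ℝ ((n:ℤ)-1)).eval x ∧
    Sp (Chebyshev.T ℝ ((n+1:ℕ):ℤ)) x = (Chebyshev.U ℝ (n:ℤ)).eval x := by
  induction n with
  | zero =>
    constructor
    · simp [Sp_one]
    · have := Sp_X_mul 1 x
      rw [Sp_one] at this
      have hm := mean_T 0
      simp at hm this ⊢
      rw [this, hm]
  | succ n ih =>
    refine ⟨by push_cast; simpa using ih.2, ?_⟩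
    have h2 := Chebyshev.T_add_two ℝ (n:ℤ)
    have h3 : Chebyshev.T ℝ ((n:ℤ)+2) = (2:ℝ) • (X * Chebyshev.T ℝ ((n+1:ℕ):ℤ)) + (-1:ℝ) • Chebyshev.T ℝ (n:ℤ) := by
      rw [h2, smul_eq_C_mul, smul_eq_C_mul, show (C (2:ℝ):Polynomial ℝ) = 2 by rfl]; push_cast; simp; ring
    have h4 : ((n+1+1:ℕ):ℤ) = (n:ℤ)+2 := by push_cast; ring
    rw [h4, h3, Sp_add, Sp_smul, Sp_smul, Sp_X_mul, ih.1, ih.2, mean_T]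
    have h5 := congrArg (Polynomial.eval x) (Chebyshev.U_add_one ℝ (n:ℤ))
    simp at h5
    push_cast
    rw [h5]; simp; ring

lemma Sp_cont (F : Polynomial ℝ) : Continuous (Sp F) := by
  apply poly_span (fun F => Continuous (Sp F))
  · intro F G hF hG
    have : Sp (F + G) = fun x => Sp F x + Sp G x := by ext x; exact Sp_add F G x
    rw [this]; exact hF.add hG
  · intro c F hF
    have : Sp (c • F) = fun x => c * Sp F x := by ext x; exact Sp_smul c F x
    rw [this]; exact continuous_const.mul hF
  · intro n
    have : Sp (Polynomial.Chebyshev.T ℝ n) = fun x => (Polynomial.Chebyshev.U ℝ ((n:ℤ)-1)).eval x := by ext x; exact (Sp_T n x).1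
    rw [this]; exact Polynomial.continuous _
end TO

namespace TO

noncomputable def rho (x : ℝ) : ℝ := x - Real.sqrt (x^2 - 1)

lemma rho_mul {x : ℝ} (hx : 1 ≤ x) : rho x * (x + Real.sqrt (x^2-1)) = 1 := by
  have := Real.sq_sqrt (show 0 ≤ x^2 - 1 by nlinarith)
  unfold rho; nlinarith

lemma rho_pos {x : ℝ} (hx : 1 ≤ x) : 0 < rho x := by
  have := rho_mul hx
  have h2 : 0 < x + Real.sqrt (x^2-1) := by positivity
  by_contra h; push Not at h; nlinarith

lemma rho_inv {x : ℝ} (hx : 1 ≤ x) : (rho x)⁻¹ = x + Real.sqrt (x^2-1) := by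
  have h := rho_mul hx
  have h2 := (rho_pos hx).ne'
  field_simp; linarith

lemma rho_le {x : ℝ} (hx : 1 ≤ x) : rho x ≤ 1 := by
  have h := rho_mul hx
  have h2 := (rho_pos hx)
  nlinarith [Real.sqrt_nonneg (x^2-1)]

lemma rho_cont : Continuous rho := by unfold rho; fun_prop

lemma rho_deriv {x : ℝ} (hx : 1 < x) : HasDerivAt rho (-(rho x)/Real.sqrt (x^2-1)) x := by
  have hp : 0 < x^2 - 1 := by nlinarith
  have h1 : HasDerivAt (fun x : ℝ => x^2 - 1) (2*x) x := by
    simpa using (hasDerivAt_pow 2 x).sub_const 1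
  have h2 := (hasDerivAt_id x).sub (h1.sqrt hp.ne')
  convert! h2 using 1
  have : 0 < Real.sqrt (x^2-1) := by positivity
  unfold rho
  field_simp; ring

open Polynomial in
lemma T_rho {x : ℝ} (hx : 1 ≤ x) (n : ℕ) :
    (Chebyshev.T ℝ n).eval x - Real.sqrt (x^2-1) * (Chebyshev.U ℝ ((n:ℤ)-1)).eval x = rho x^n := by
  induction n with
  | zero => simp
  | succ n ih =>
    have h1 := congrArg (Polynomial.eval x) (Chebyshev.U_eq_X_mul_U_add_T ℝ ((n:ℤ)-1))
    have h2 := congrArg (Polynomial.eval x) (Chebyshev.T_eq_X_mul_T_sub_pol_U ℝ ((n:ℤ)-1))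
    simp only [sub_add_cancel, eval_add, eval_mul, eval_X, eval_sub, eval_pow, eval_one] at h1 h2
    rw [show (n:ℤ) - 1 + 2 = n + 1 by ring] at h2
    push_cast
    rw [show (n:ℤ) + 1 - 1 = n by ring, h1, h2, pow_succ (rho x) n, ← ih]
    unfold rho
    have := Real.sq_sqrt (show 0 ≤ x^2 - 1 by nlinarith)
    linear_combination (-(Chebyshev.U ℝ ((n:ℤ)-1)).eval x) * this

open Polynomial in
lemma Pot_T (k : ℕ) (x : ℝ) : Pot (Sp (Chebyshev.T ℝ ((k+1:ℕ):ℤ))) x =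
    -(1/(2*π)) * ((∫ τ in 0..π, Real.log (x - Real.cos τ) * Real.cos (k*τ)) -
      ∫ τ in 0..π, Real.log (x - Real.cos τ) * Real.cos ((k+2:ℕ)*τ)) := by
  unfold Pot
  rw [← intervalIntegral.integral_sub ((log_cos_int x _ _).mul_continuousOn (by fun_prop)) ((log_cos_int x _ _).mul_continuousOn (by fun_prop))]
  have e : ∀ τ, Sp (Chebyshev.T ℝ ((k+1:ℕ):ℤ)) (Real.cos τ) * Real.sin τ^2 = (1/2)*(Real.cos (k*τ) - Real.cos ((k+2:ℕ)*τ)) := by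
    intro τ
    rw [(Sp_T k _).2, pow_two, ← mul_assoc, Chebyshev.U_real_cos]
    push_cast
    rw [show (k:ℝ)*τ = ((k:ℝ)+1)*τ - τ by ring, show ((k:ℝ)+2)*τ = ((k:ℝ)+1)*τ + τ by ring, Real.cos_sub, Real.cos_add]
    ring
  simp_rw [e]
  have e2 : ∀ τ, Real.log (x - Real.cos τ) * ((1/2)*(Real.cos (k*τ) - Real.cos ((k+2:ℕ)*τ))) =
    (1/2) * (Real.log (x - Real.cos τ) * Real.cos (k*τ) - Real.log (x - Real.cos τ) * Real.cos ((k+2:ℕ)*τ)) := by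
    intro τ; ring
  simp_rw [e2]
  rw [intervalIntegral.integral_const_mul]
  generalize (∫ τ in 0..π, _ : ℝ) = Z
  field_simp

open Polynomial in
lemma Pot_T_in (k : ℕ) {x : ℝ} (h0 : -1 ≤ x) (h1 : x ≤ 1) : Pot (Sp (Chebyshev.T ℝ ((k+1:ℕ):ℤ))) x =
    (1/2)*((Chebyshev.T ℝ k).eval x/k - (Chebyshev.T ℝ ((k+2:ℕ):ℤ)).eval x/((k+2:ℕ):ℝ)) + (if k = 0 then (1/2)*Real.log 2 else 0) := by
  rw [Pot_T]
  have hx := Real.cos_arccos h0 h1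
  rw [← hx, log_inside, log_inside, Chebyshev.T_real_cos, Chebyshev.T_real_cos]
  have hpi := Real.pi_pos.ne'
  push_cast
  split_ifs <;> first | omega | (field_simp; ring)

open Polynomial in
lemma Pot_T_out (k : ℕ) {x : ℝ} (h1 : 1 ≤ x) : Pot (Sp (Chebyshev.T ℝ ((k+1:ℕ):ℤ))) x =
    (1/2)*(rho x^k/k - rho x^(k+2)/((k+2:ℕ):ℝ)) + (if k = 0 then (1/2)*(Real.log 2 + Real.log (rho x)) else 0) := by
  rw [Pot_T]
  have hx : (rho x + (rho x)⁻¹)/2 = x := by rw [rho_inv h1]; unfold rho; ring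
  conv_lhs => rw [← hx]
  rw [log_outside (rho_pos h1) (rho_le h1), log_outside (rho_pos h1) (rho_le h1)]
  have hpi := Real.pi_pos.ne'
  push_cast
  split_ifs <;> first | omega | (field_simp; ring)

/-- auxiliary primitive -/
lemma prim_deriv (k : ℕ) {r : ℝ} (hr : 0 < r) :
    HasDerivAt (fun r : ℝ => (1/2)*(r^k/k - r^(k+2)/((k+2:ℕ):ℝ)) + (if k = 0 then (1/2)*(Real.log 2 + Real.log r) else 0))
      ((1/2)*(r^k - r^(k+2))/r) r := by
  have hB : HasDerivAt (fun r : ℝ => r^(k+2)/((k+2:ℕ):ℝ)) (r^(k+2)/r) r := by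
    have := (hasDerivAt_pow (k+2) r).div_const ((k+2:ℕ):ℝ)
    convert! this using 1
    have : ((k+2:ℕ):ℝ) ≠ 0 := by positivity
    field_simp
    simp [pow_succ]; ring
  by_cases h : k = 0
  · subst h
    simp only [if_true]
    have hl := ((Real.hasDerivAt_log hr.ne').const_add (Real.log 2)).const_mul (1/2)
    have := ((hB.const_sub 0).const_mul (1/2)).add hl
    convert! this using 1
    · ext r; simp
    · field_simp; ring
  · simp only [if_neg h, add_zero]
    have hA : HasDerivAt (fun r : ℝ => r^k/(k:ℝ)) (r^k/r) r := by
      have := (hasDerivAt_pow k r).div_const (k:ℝ)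
      convert! this using 1
      have : (k:ℝ) ≠ 0 := by positivity
      obtain ⟨j, rfl⟩ : ∃ j, k = j + 1 := ⟨k - 1, by omega⟩
      field_simp
      simp [pow_succ]; ring
    have := (hA.sub hB).const_mul (1/2)
    convert! this using 1
    field_simp

/-- the key potential identity -/
def PotId (F : Polynomial ℝ) : Prop := ∀ x : ℝ, 0 ≤ x →
  Pot (Sp F) x = Pot (Sp F) 0 - (∫ y in 0..x, (F.eval y - mean F)) + ∫ y in 0..x, Real.sqrt (y^2-1) * Sp F y

lemma sqrt_cont_mul (F : Polynomial ℝ) : Continuous (fun y => Real.sqrt (y^2-1) * Sp F y) := by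
  have := Sp_cont F
  fun_prop

open Polynomial in
lemma PotId_T (n : ℕ) : PotId (Chebyshev.T ℝ n) := by
  rcases Nat.eq_zero_or_pos n with h | h
  · subst h
    intro x hx
    have hm := mean_T 0
    simp only [Nat.cast_zero, Chebyshev.T_zero, if_true] at hm ⊢
    have : Sp 1 = fun _ => 0 := by ext y; exact Sp_one y
    rw [this, hm]
    simp [Pot]
  obtain ⟨k, rfl⟩ : ∃ k, n = k + 1 := ⟨n - 1, by omega⟩
  have hin : ∀ x, 0 ≤ x → x ≤ 1 → Pot (Sp (Chebyshev.T ℝ ((k+1:ℕ):ℤ))) x = Pot (Sp (Chebyshev.T ℝ ((k+1:ℕ):ℤ))) 0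
      - (∫ y in 0..x, ((Chebyshev.T ℝ ((k+1:ℕ):ℤ)).eval y - mean (Chebyshev.T ℝ ((k+1:ℕ):ℤ)))) + ∫ y in 0..x, Real.sqrt (y^2-1) * Sp (Chebyshev.T ℝ ((k+1:ℕ):ℤ)) y := by
    intro x hx hx1
    have hz : ∫ y in 0..x, Real.sqrt (y^2-1) * Sp (Chebyshev.T ℝ ((k+1:ℕ):ℤ)) y = 0 := by
      rw [intervalIntegral.integral_congr (g := fun _ => (0:ℝ))]
      · simp
      · intro y hy
        rw [uIcc_of_le hx] at hy
        simp only
        rw [Real.sqrt_eq_zero_of_nonpos (by nlinarith [hy.1, hy.2]), zero_mul]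
    have hd : ∀ y : ℝ, HasDerivAt (fun y => (1/2)*((Chebyshev.T ℝ k).eval y/k - (Chebyshev.T ℝ ((k+2:ℕ):ℤ)).eval y/((k+2:ℕ):ℝ)))
        (-(Chebyshev.T ℝ ((k+1:ℕ):ℤ)).eval y) y := by
      intro y
      have hd := (((Chebyshev.T ℝ k).hasDerivAt y).div_const (k:ℝ)).sub (((Chebyshev.T ℝ ((k+2:ℕ):ℤ)).hasDerivAt y).div_const ((k+2:ℕ):ℝ))
      convert! hd.const_mul (1/2) using 1
      rw [Chebyshev.T_derivative_eq_U, Chebyshev.T_derivative_eq_U]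
      have h2 := congrArg (Polynomial.eval y) (Chebyshev.two_mul_T_eq_U_sub_U ℝ ((k:ℤ)-1))
      rw [show (k:ℤ) - 1 + 2 = k + 1 by ring] at h2
      push_cast
      rw [show (k:ℤ) + 2 - 1 = k + 1 by ring]
      simp at h2 ⊢
      rcases Nat.eq_zero_or_pos k with hk | hk
      · subst hk
        simp at h2 ⊢
      · have : (k:ℝ) ≠ 0 := by positivity
        field_simp
        linarith
    have hF := intervalIntegral.integral_eq_sub_of_hasDerivAt (a := 0) (b := x) (fun y _ => hd y)
      (((Polynomial.continuous _).neg).intervalIntegrable _ _)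
    rw [hz, mean_T, Pot_T_in k (by linarith) hx1, Pot_T_in k (by norm_num) (by norm_num)]
    rw [intervalIntegral.integral_neg] at hF
    simp only [Nat.add_eq_zero_iff, one_ne_zero, and_false, if_false, sub_zero]
    linarith
  intro x hx
  rcases le_total x 1 with h1 | h1
  · exact hin x hx h1
  have hone := hin 1 (by norm_num) le_rfl
  have hd : ∀ y ∈ Ioo 1 x, HasDerivAt (fun y => Pot (Sp (Chebyshev.T ℝ ((k+1:ℕ):ℤ))) y) (-((Chebyshev.T ℝ ((k+1:ℕ):ℤ)).eval y - mean (Chebyshev.T ℝ ((k+1:ℕ):ℤ)))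
      + Real.sqrt (y^2-1) * Sp (Chebyshev.T ℝ ((k+1:ℕ):ℤ)) y) y := by
    intro y hy
    have hp := rho_pos hy.1.le
    have hc := (prim_deriv k hp).comp y (rho_deriv hy.1)
    have hev : (fun y => Pot (Sp (Chebyshev.T ℝ ((k+1:ℕ):ℤ))) y) =ᶠ[nhds y] (fun r : ℝ => (1/2)*(r^k/k - r^(k+2)/((k+2:ℕ):ℝ)) + (if k = 0 then (1/2)*(Real.log 2 + Real.log r) else 0)) ∘ rho := by
      filter_upwards [Ioi_mem_nhds hy.1] with z hz
      exact Pot_T_out k (le_of_lt hz)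
    have := hc.congr_of_eventuallyEq hev
    convert! this using 1
    rw [mean_T, (Sp_T k y).2]
    have h3 := T_rho hy.1.le (k+1)
    rw [show (((k+1:ℕ):ℤ)-1) = k by push_cast; ring] at h3
    have hq : 0 < Real.sqrt (y^2-1) := Real.sqrt_pos.mpr (by nlinarith [hy.1])
    simp only [Nat.add_eq_zero_iff, one_ne_zero, and_false, if_false, sub_zero]
    have h4 : 1 - rho y^2 = 2 * rho y * Real.sqrt (y^2-1) := by
      have h5 := rho_mul hy.1.le
      have h6 : Real.sqrt (y^2-1) = y - rho y := by unfold rho; ring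
      rw [h6] at h5 ⊢
      linear_combination -h5
    have h7 : -(eval y (Chebyshev.T ℝ ((k+1:ℕ):ℤ))) + Real.sqrt (y^2-1) * eval y (Chebyshev.U ℝ (k:ℤ)) = -rho y^(k+1) := by linarith
    rw [h7]
    have h8 : rho y^k - rho y^(k+2) = rho y^k * (2 * rho y * Real.sqrt (y^2-1)) := by rw [← h4]; ring
    rw [h8]
    field_simp
    ring
  have hcont : ContinuousOn (fun y => Pot (Sp (Chebyshev.T ℝ ((k+1:ℕ):ℤ))) y) (Icc 1 x) := by
    have : ContinuousOn ((fun r : ℝ => (1/2)*(r^k/k - r^(k+2)/((k+2:ℕ):ℝ)) + (if k = 0 then (1/2)*(Real.log 2 + Real.log r) else 0)) ∘ rho) (Icc 1 x) := by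
      intro y hy
      exact ((prim_deriv k (rho_pos hy.1)).continuousAt.comp rho_cont.continuousAt).continuousWithinAt
    exact this.congr (fun y hy => Pot_T_out k hy.1)
  have c1 : Continuous (fun y => (Chebyshev.T ℝ ((k+1:ℕ):ℤ)).eval y - mean (Chebyshev.T ℝ ((k+1:ℕ):ℤ))) :=
    (Polynomial.continuous _).sub continuous_const
  have c2 := sqrt_cont_mul (Chebyshev.T ℝ ((k+1:ℕ):ℤ))
  have hF := intervalIntegral.integral_eq_sub_of_hasDerivAt_of_le h1 hcont hd ((c1.neg.add c2).intervalIntegrable _ _)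
  rw [intervalIntegral.integral_add (by exact c1.neg.intervalIntegrable _ _) (c2.intervalIntegrable _ _), intervalIntegral.integral_neg] at hF
  rw [← intervalIntegral.integral_add_adjacent_intervals (c1.intervalIntegrable 0 1) (c1.intervalIntegrable 1 x),
    ← intervalIntegral.integral_add_adjacent_intervals (c2.intervalIntegrable 0 1) (c2.intervalIntegrable 1 x)]
  linarith

lemma Pot_add {p q : ℝ → ℝ} (hp : Continuous p) (hq : Continuous q) (x : ℝ) : Pot (fun y => p y + q y) x = Pot p x + Pot q x := by
  unfold Pot
  rw [← mul_add, ← intervalIntegral.integral_add ((log_cos_int x _ _).mul_continuousOn (by fun_prop)) ((log_cos_int x _ _).mul_continuousOn (by fun_prop))]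
  refine congrArg (fun z => -(1/π)*z) (intervalIntegral.integral_congr fun τ _ => ?_)
  simp only; ring

lemma Pot_smul (c : ℝ) (q : ℝ → ℝ) (x : ℝ) : Pot (fun y => c * q y) x = c * Pot q x := by
  unfold Pot
  rw [mul_left_comm c, ← intervalIntegral.integral_const_mul c]
  refine congrArg (fun z => -(1/π)*z) (intervalIntegral.integral_congr fun τ _ => ?_)
  simp only; ring

lemma potId (F : Polynomial ℝ) : PotId F := by
  apply poly_span PotId
  · intro F G hF hG x hx
    have e : Sp (F + G) = fun y => Sp F y + Sp G y := by ext y; exact Sp_add F G y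
    rw [e, Pot_add (Sp_cont F) (Sp_cont G), Pot_add (Sp_cont F) (Sp_cont G), hF x hx, hG x hx, mean_add]
    have c1 := sqrt_cont_mul F
    have c2 := sqrt_cont_mul G
    have d1 : Continuous (fun y => F.eval y - mean F) := (Polynomial.continuous _).sub continuous_const
    have d2 : Continuous (fun y => G.eval y - mean G) := (Polynomial.continuous _).sub continuous_const
    have e1 : ∫ y in 0..x, ((F+G).eval y - (mean F + mean G)) = (∫ y in 0..x, (F.eval y - mean F)) + ∫ y in 0..x, (G.eval y - mean G) := by
      rw [← intervalIntegral.integral_add (d1.intervalIntegrable _ _) (d2.intervalIntegrable _ _)]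
      congr 1; ext y; rw [Polynomial.eval_add]; ring
    have e2 : ∫ y in 0..x, Real.sqrt (y^2-1) * (Sp F y + Sp G y) = (∫ y in 0..x, Real.sqrt (y^2-1) * Sp F y) + ∫ y in 0..x, Real.sqrt (y^2-1) * Sp G y := by
      rw [← intervalIntegral.integral_add (c1.intervalIntegrable _ _) (c2.intervalIntegrable _ _)]
      congr 1; ext y; ring
    rw [e1, e2]; ring
  · intro c F hF x hx
    have e : Sp (c • F) = fun y => c * Sp F y := by ext y; exact Sp_smul c F y
    rw [e, Pot_smul, Pot_smul, hF x hx, mean_smul]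
    have e1 : ∫ y in 0..x, ((c • F).eval y - (c * mean F)) = c * (∫ y in 0..x, (F.eval y - mean F)) := by
      rw [← intervalIntegral.integral_const_mul]
      congr 1; ext y; rw [Polynomial.eval_smul, smul_eq_mul]; ring
    have e2 : ∫ y in 0..x, Real.sqrt (y^2-1) * (c * Sp F y) = c * ∫ y in 0..x, Real.sqrt (y^2-1) * Sp F y := by
      rw [← intervalIntegral.integral_const_mul]
      congr 1; ext y; ring
    rw [e1, e2]; ring
  · exact PotId_T
end TO

namespace TO
open Polynomial in
noncomputable def Pk (k : ℕ) : Polynomial ℝ := (Chebyshev.T ℝ (k:ℤ)).comp (1 - 2 * X^2)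

open Polynomial in
noncomputable def Gk (k : ℕ) (b : ℝ) : Polynomial ℝ := b • (derivative (Pk k)).comp (C b * X)

open Polynomial in
lemma Pk_sin (k : ℕ) (u : ℝ) : (Pk k).eval (Real.sin u) = Real.cos (2 * k * u) := by
  unfold Pk
  rw [eval_comp]
  have : (1 - 2 * X^2 : Polynomial ℝ).eval (Real.sin u) = Real.cos (2*u) := by
    simp [Real.cos_two_mul]; have := Real.sin_sq_add_cos_sq u; linarith
  rw [this, Chebyshev.T_real_cos]; push_cast; ring_nf

open Polynomial in
lemma Pk_even (k : ℕ) (z : ℝ) : (Pk k).eval (-z) = (Pk k).eval z := by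
  unfold Pk; simp [eval_comp]

lemma Pk_zero (k : ℕ) : (Pk k).eval 0 = 1 := by
  have := Pk_sin k 0; simpa using this

open Polynomial in
lemma Pk_d1 (k : ℕ) (u : ℝ) : (derivative (Pk k)).eval (Real.sin u) * Real.cos u = -(2*k*Real.sin (2*k*u)) := by
  have h1 : HasDerivAt (fun u => (Pk k).eval (Real.sin u)) ((derivative (Pk k)).eval (Real.sin u) * Real.cos u) u :=
    ((Pk k).hasDerivAt (Real.sin u)).comp u (Real.hasDerivAt_sin u)
  have h2 : HasDerivAt (fun u => Real.cos (2*k*u)) (-Real.sin (2*k*u) * (2*k*1)) u :=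
    (Real.hasDerivAt_cos (2*k*u)).comp u ((hasDerivAt_id u).const_mul (2*(k:ℝ)))
  have e : (fun u => (Pk k).eval (Real.sin u)) = fun u => Real.cos (2*k*u) := by ext u; exact Pk_sin k u
  rw [e] at h1
  rw [h1.unique h2]; ring

open Polynomial in
lemma Pk_d2 (k : ℕ) (u : ℝ) : (derivative (derivative (Pk k))).eval (Real.sin u) * Real.cos u ^2
    - (derivative (Pk k)).eval (Real.sin u) * Real.sin u = -(4*k^2*Real.cos (2*k*u)) := by
  have h1 : HasDerivAt (fun u => (derivative (Pk k)).eval (Real.sin u) * Real.cos u)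
      (((derivative (derivative (Pk k))).eval (Real.sin u) * Real.cos u) * Real.cos u
       + (derivative (Pk k)).eval (Real.sin u) * (-Real.sin u)) u :=
    (((derivative (Pk k)).hasDerivAt (Real.sin u)).comp u (Real.hasDerivAt_sin u)).mul (Real.hasDerivAt_cos u)
  have h2 : HasDerivAt (fun u => -(2*k*Real.sin (2*k*u))) (-(2*k*(Real.cos (2*k*u) * (2*k*1)))) u :=
    (((Real.hasDerivAt_sin (2*k*u)).comp u ((hasDerivAt_id u).const_mul (2*(k:ℝ)))).const_mul (2*(k:ℝ))).neg
  have e : (fun u => (derivative (Pk k)).eval (Real.sin u) * Real.cos u) = fun u => -(2*k*Real.sin (2*k*u)) := by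
    ext u; exact Pk_d1 k u
  rw [e] at h1
  have := h1.unique h2
  linear_combination this

open Polynomial in
/-- bounds on derivatives for `z ^ 2 ≤ 1/2` -/
lemma Pk_bounds (k : ℕ) {z : ℝ} (hz : z^2 ≤ 1/2) : |(derivative (Pk k)).eval z| ≤ 3*k ∧
    |(derivative (derivative (Pk k))).eval z| ≤ 16*(k:ℝ)^2 := by
  have hz1 : |z| ≤ 1 := by rw [← sq_le_one_iff_abs_le_one]; linarith
  obtain ⟨h1, h2⟩ := abs_le.1 hz1
  set u := Real.arcsin z
  have hu : Real.sin u = z := Real.sin_arcsin h1 h2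
  have hc : 1/2 ≤ Real.cos u ^2 := by have := Real.sin_sq_add_cos_sq u; rw [hu] at this; linarith
  have hc1 : Real.cos u ^2 ≤ 1 := by have := Real.sin_sq_add_cos_sq u; nlinarith [sq_nonneg (Real.sin u)]
  have d1 := Pk_d1 k u
  have d2 := Pk_d2 k u
  rw [hu] at d1 d2
  set A := (derivative (Pk k)).eval z
  set B := (derivative (derivative (Pk k))).eval z
  have hk : (0:ℝ) ≤ k := Nat.cast_nonneg k
  have s1 := Real.sin_sq_le_one (2*k*u)
  have hA : |A| ≤ 3*k := by
    apply abs_le_of_sq_le_sq _ (by positivity)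
    have : A^2*Real.cos u^2 = 4*k^2*Real.sin (2*k*u)^2 := by rw [← mul_pow, d1]; ring
    have h3 : A^2*Real.cos u^2 ≤ 4*k^2 := by rw [this]; nlinarith [sq_nonneg (k:ℝ)]
    nlinarith [sq_nonneg A, mul_nonneg (sq_nonneg A) (sub_nonneg.2 hc)]
  refine ⟨hA, ?_⟩
  have hk2 : (k:ℝ) ≤ k^2 := by
    rcases Nat.eq_zero_or_pos k with h | h
    · simp [h]
    · have : (1:ℝ) ≤ k := by exact_mod_cast h
      nlinarith
  have h4 : |B * Real.cos u^2| ≤ 8*(k:ℝ)^2 := by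
    have e : B * Real.cos u^2 = A*z - 4*k^2*Real.cos (2*k*u) := by linear_combination d2
    rw [e]
    refine (abs_sub _ _).trans ?_
    rw [abs_mul, abs_mul, abs_of_nonneg (by positivity : (0:ℝ) ≤ 4*k^2)]
    have hzz : |z| ≤ 3/4 := by apply abs_le_of_sq_le_sq _ (by norm_num); linarith
    have := Real.abs_cos_le_one (2*k*u)
    have h5 : |A| *|z| ≤ 3*k*(3/4) := mul_le_mul hA hzz (abs_nonneg _) (by positivity)
    nlinarith [sq_nonneg (k:ℝ)]
  rw [abs_mul, abs_of_nonneg (sq_nonneg (Real.cos u))] at h4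
  nlinarith [abs_nonneg B]

open Polynomial in
lemma Gk_eval (k : ℕ) (b x : ℝ) : (Gk k b).eval x = b * (derivative (Pk k)).eval (b*x) := by
  simp [Gk, eval_comp]

open Polynomial in
lemma Gk_deriv (k : ℕ) (b x : ℝ) : HasDerivAt (fun x => (Pk k).eval (b*x)) ((Gk k b).eval x) x := by
  rw [Gk_eval]
  have := ((Pk k).hasDerivAt (b*x)).comp x ((hasDerivAt_id x).const_mul b)
  convert! this using 1; ring

open Polynomial in
lemma Gk_diff (k : ℕ) {b x y : ℝ} (hb : 0 ≤ b) (hx : (b*x)^2 ≤ 1/2) (hy : (b*y)^2 ≤ 1/2) :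
    |(Gk k b).eval y - (Gk k b).eval x| ≤ 16*(b*k) ∧ |(Gk k b).eval y - (Gk k b).eval x| ≤ 16*(b*k)*(b*k*|y-x|) := by
  rw [Gk_eval, Gk_eval, ← mul_sub, abs_mul, abs_of_nonneg hb]
  have hk : (0:ℝ) ≤ k := Nat.cast_nonneg k
  constructor
  · have h := abs_sub ((derivative (Pk k)).eval (b*y)) ((derivative (Pk k)).eval (b*x))
    have h1 := (Pk_bounds k hx).1
    have h2 := (Pk_bounds k hy).1
    have : |(derivative (Pk k)).eval (b*y) - (derivative (Pk k)).eval (b*x)| ≤ 16*k := by linarith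
    calc _ ≤ b*(16*k) := mul_le_mul_of_nonneg_left this hb
      _ = _ := by ring
  · have hconv : Convex ℝ (Icc (-√(1/2)) (√(1/2))) := convex_Icc _ _
    have hmem : ∀ z : ℝ, z^2 ≤ 1/2 → z ∈ Icc (-√(1/2)) (√(1/2)) := fun z hz => abs_le.1 (Real.abs_le_sqrt hz)
    have h := hconv.norm_image_sub_le_of_norm_hasDerivWithin_le (f := fun z => (derivative (Pk k)).eval z)
      (f' := fun z => (derivative (derivative (Pk k))).eval z) (C := 16*(k:ℝ)^2)
      (fun z _ => ((derivative (Pk k)).hasDerivAt z).hasDerivWithinAt)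
      (fun z hz => by
        have := abs_le.2 hz
        refine (Pk_bounds k ?_).2
        rw [← sq_abs]
        calc |z|^2 ≤ (√(1/2))^2 := by gcongr
          _ = 1/2 := Real.sq_sqrt (by norm_num)) (hmem _ hx) (hmem _ hy)
    simp only [Real.norm_eq_abs] at h
    rw [← mul_sub, abs_mul, abs_of_nonneg hb] at h
    calc _ ≤ b*(16*(k:ℝ)^2*(b*|y-x|)) := mul_le_mul_of_nonneg_left h hb
      _ = _ := by ring

lemma min_rpow {A d : ℝ} (hd : 0 ≤ d) (h1 : A ≤ 1) (h2 : A ≤ d) : A ≤ d^(3/4:ℝ) := by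
  rcases le_total d 1 with h | h
  · refine h2.trans ?_
    conv_lhs => rw [← Real.rpow_one d]
    exact Real.rpow_le_rpow_of_exponent_ge' hd h (by norm_num) (by norm_num)
  · exact h1.trans (Real.one_le_rpow h (by norm_num))

lemma dd_bound (k : ℕ) {b x y : ℝ} (hb : 0 ≤ b) (hx : (b*x)^2 ≤ 1/2) (hy : (b*y)^2 ≤ 1/2) (hxy : y ≠ x) :
    |dd (Gk k b) x y| ≤ 16*(b*k)^(7/4:ℝ) * |y-x|^(-(1/4):ℝ) := by
  obtain ⟨h1, h2⟩ := Gk_diff k hb hx hy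
  rw [← dd_mul, abs_mul] at h1 h2
  have hk : (0:ℝ) ≤ k := Nat.cast_nonneg k
  have hd : 0 < |y-x| := abs_pos.2 (sub_ne_zero.2 hxy)
  set D := |dd (Gk k b) x y|
  have hbk : 0 ≤ b*k := by positivity
  rcases hbk.eq_or_lt with h0 | h0
  · rw [← h0] at h1
    have : D ≤ 0 := by
      have hD : 0 ≤ D := abs_nonneg _
      by_contra hh; push Not at hh
      nlinarith [mul_pos hd hh]
    refine this.trans (by positivity)
  have h3 : (|y-x| *D)/(16*(b*k)) ≤ (b*k*|y-x|)^(3/4:ℝ) := by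
    apply min_rpow (by positivity)
    · rw [div_le_one (by positivity)]; exact h1
    · rw [div_le_iff₀ (by positivity)]; linarith
  rw [div_le_iff₀ (by positivity), Real.mul_rpow hbk hd.le] at h3
  have e1 : (b*k)^(7/4:ℝ) = (b*k)^(3/4:ℝ)*(b*k) := by
    rw [show (7/4:ℝ) = 3/4+1 by norm_num, Real.rpow_add_one h0.ne']
  have e2 : |y-x|^(3/4:ℝ) = |y-x|^(-(1/4):ℝ) * |y-x| := by
    rw [← Real.rpow_add_one hd.ne']; norm_num
  rw [e2] at h3
  have : |y-x| *D ≤ |y-x| *(16*(b*k)^(7/4:ℝ) * |y-x|^(-(1/4):ℝ)) := by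
    rw [e1]; calc _ ≤ _ := h3
      _ = _ := by ring
  exact le_of_mul_le_mul_left this hd

lemma cos_sub_ge {τ φ : ℝ} (h0 : 0 ≤ τ) (h1 : τ ≤ π) (g0 : 0 ≤ φ) (g1 : φ ≤ π) :
    2*(|τ-φ|/π)^2 ≤ |Real.cos τ - Real.cos φ| := by
  wlog h : φ ≤ τ generalizing τ φ
  · rw [abs_sub_comm, abs_sub_comm (Real.cos τ)]
    exact this g0 g1 h0 h1 (le_of_lt (not_le.1 h))
  have hπ := Real.pi_pos
  rw [abs_of_nonneg (sub_nonneg.2 h), Real.cos_sub_cos]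
  have s1 : 2/π*((τ-φ)/2) ≤ Real.sin ((τ-φ)/2) := Real.mul_le_sin (by linarith) (by linarith)
  have s2 : Real.sin ((τ-φ)/2) ≤ Real.sin ((τ+φ)/2) := by
    rcases le_total ((τ+φ)/2) (π/2) with h3 | h3
    · exact Real.sin_le_sin_of_le_of_le_pi_div_two (by linarith) h3 (by linarith)
    · rw [← Real.sin_pi_sub ((τ+φ)/2)]
      exact Real.sin_le_sin_of_le_of_le_pi_div_two (by linarith) (by linarith) (by linarith)
  have e : 2/π*((τ-φ)/2) = (τ-φ)/π := by field_simp
  rw [e] at s1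
  have p : 0 ≤ (τ-φ)/π := div_nonneg (by linarith) hπ.le
  rw [show -2 * Real.sin ((τ+φ)/2) * Real.sin ((τ-φ)/2) = -(2 * (Real.sin ((τ+φ)/2) * Real.sin ((τ-φ)/2))) by ring, abs_neg,
    abs_of_nonneg (by have := p.trans s1; have := this.trans s2; positivity)]
  nlinarith [mul_le_mul s1 s1 p (p.trans s1), mul_le_mul_of_nonneg_right s2 (p.trans s1)]

/-- every real `x` has a comparison angle -/
lemma cos_x_ge (x : ℝ) : ∃ φ, 0 ≤ φ ∧ φ ≤ π ∧ ∀ τ, 0 ≤ τ → τ ≤ π → 2*(|τ-φ|/π)^2 ≤ |Real.cos τ - x| := by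
  have hπ := Real.pi_pos
  rcases le_total x (-1) with h | h
  · refine ⟨π, hπ.le, le_rfl, fun τ a b => (cos_sub_ge a b hπ.le le_rfl).trans ?_⟩
    have := Real.neg_one_le_cos τ
    rw [Real.cos_pi, abs_of_nonneg (by linarith), abs_of_nonneg (by linarith)]; linarith
  rcases le_total x 1 with h' | h'
  · refine ⟨Real.arccos x, Real.arccos_nonneg _, Real.arccos_le_pi _, fun τ a b => ?_⟩
    have := cos_sub_ge a b (Real.arccos_nonneg x) (Real.arccos_le_pi x)
    rwa [Real.cos_arccos h h'] at this
  · refine ⟨0, le_rfl, hπ.le, fun τ a b => (cos_sub_ge a b le_rfl hπ.le).trans ?_⟩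
    have := Real.cos_le_one τ
    rw [Real.cos_zero, abs_of_nonpos (by linarith), abs_of_nonpos (by linarith)]; linarith

lemma abs_rpow_int (a b : ℝ) : IntervalIntegrable (fun v : ℝ => |v|^(-(1/2):ℝ)) MeasureTheory.volume a b := by
  have h : ∀ c : ℝ, 0 ≤ c → IntervalIntegrable (fun v : ℝ => |v|^(-(1/2):ℝ)) MeasureTheory.volume 0 c := by
    intro c hc
    refine (intervalIntegral.intervalIntegrable_rpow' (r := -(1/2)) (by norm_num)).congr ?_
    intro v hv
    rw [uIoc_of_le hc] at hv
    simp only; rw [abs_of_pos hv.1]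
  have h' : ∀ c : ℝ, IntervalIntegrable (fun v : ℝ => |v|^(-(1/2):ℝ)) MeasureTheory.volume 0 c := by
    intro c
    rcases le_total 0 c with hc | hc
    · exact h c hc
    · have := (h (-c) (by linarith)).comp_sub_left 0
      simpa using this
  exact (h' a).symm.trans (h' b)

noncomputable def C1 : ℝ := 16 * ∫ v in -π..π, √π * |v|^(-(1/2):ℝ)

lemma C1_nonneg : 0 ≤ C1 := by
  unfold C1
  refine mul_nonneg (by norm_num) (intervalIntegral.integral_nonneg (by linarith [Real.pi_pos]) fun v _ => by positivity)

lemma Sp_bound (k : ℕ) {b x : ℝ} (hb : 0 ≤ b) (hb1 : b ≤ 1/2) (hx : (b*x)^2 ≤ 1/2) :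
    |Sp (Gk k b) x| ≤ C1*(b*k)^(7/4:ℝ) := by
  have hπ := Real.pi_pos
  obtain ⟨φ, p0, p1, hφ⟩ := cos_x_ge x
  have hbk : (0:ℝ) ≤ b*k := by positivity
  have hI := abs_rpow_int
  have hi2 : ∀ a c, IntervalIntegrable (fun τ => 16*(b*k)^(7/4:ℝ) * (√π * |τ-φ|^(-(1/2):ℝ))) MeasureTheory.volume a c := by
    intro a c
    have := ((hI (a-φ) (c-φ)).comp_sub_right φ)
    simp only [sub_add_cancel] at this
    exact (this.const_mul _).const_mul _
  have key : |∫ τ in 0..π, dd (Gk k b) x (Real.cos τ)| ≤ ∫ τ in 0..π, 16*(b*k)^(7/4:ℝ) * (√π * |τ-φ|^(-(1/2):ℝ)) := by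
    rw [← Real.norm_eq_abs]
    refine intervalIntegral.norm_integral_le_of_norm_le hπ.le ?_ (hi2 _ _)
    have hae : ∀ᵐ τ : ℝ, τ ≠ φ := by
      have : MeasureTheory.volume ({φ} : Set ℝ) = 0 := by simp
      exact MeasureTheory.compl_mem_ae_iff.2 this
    filter_upwards [hae] with τ hτ hm
    rw [Real.norm_eq_abs]
    have hp := hφ τ hm.1.le hm.2
    have hd : 0 < |τ-φ| := abs_pos.2 (sub_ne_zero.2 hτ)
    have hpos : 0 < 2*(|τ-φ|/π)^2 := by positivity
    have hne : Real.cos τ ≠ x := by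
      intro h; rw [h, sub_self, abs_zero] at hp; linarith
    have hc : (b*Real.cos τ)^2 ≤ 1/2 := by
      have := Real.cos_sq_le_one τ
      rw [mul_pow]; nlinarith [sq_nonneg (Real.cos τ)]
    refine (dd_bound k hb hx hc hne).trans ?_
    refine mul_le_mul_of_nonneg_left ?_ (by positivity)
    calc |Real.cos τ - x|^(-(1/4):ℝ) ≤ ((|τ-φ|/π)^2)^(-(1/4):ℝ) := by
          apply Real.rpow_le_rpow_of_nonpos (by positivity) _ (by norm_num)
          have : 0 ≤ (|τ-φ|/π)^2 := by positivity
          linarith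
      _ = √π * |τ-φ|^(-(1/2):ℝ) := by
          rw [← Real.rpow_natCast, ← Real.rpow_mul (by positivity), Real.div_rpow hd.le hπ.le, Real.sqrt_eq_rpow]
          norm_num
          rw [Real.rpow_neg hπ.le, div_inv_eq_mul, mul_comm]
  have k2 : ∫ τ in 0..π, 16*(b*k)^(7/4:ℝ) * (√π * |τ-φ|^(-(1/2):ℝ)) ≤ C1*(b*k)^(7/4:ℝ) := by
    rw [intervalIntegral.integral_const_mul]
    have e := intervalIntegral.integral_comp_sub_right (a := 0) (b := π) (fun v : ℝ => √π * |v|^(-(1/2):ℝ)) φ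
    rw [e]
    have : ∫ v in (0-φ)..(π-φ), √π * |v|^(-(1/2):ℝ) ≤ ∫ v in -π..π, √π * |v|^(-(1/2):ℝ) := by
      apply intervalIntegral.integral_mono_interval (by linarith) (by linarith) (by linarith)
      · exact Filter.Eventually.of_forall fun v => by simp only [Pi.zero_apply]; positivity
      · exact (hI _ _).const_mul _
    unfold C1
    have h0 : 0 ≤ 16*(b*k)^(7/4:ℝ) := by positivity
    nlinarith [mul_le_mul_of_nonneg_left this h0]
  unfold Sp
  rw [abs_mul, abs_of_pos (by positivity)]
  have h1 : 1/π ≤ 1 := by rw [div_le_one hπ]; linarith [Real.pi_gt_three]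
  have h2 := key.trans k2
  calc _ ≤ 1 * |∫ τ in 0..π, dd (Gk k b) x (Real.cos τ)| := mul_le_mul_of_nonneg_right h1 (abs_nonneg _)
    _ ≤ _ := by linarith

open Polynomial in
lemma Gk_joint (k : ℕ) : Continuous (fun p : ℝ × ℝ => Sp (Gk k p.1) p.2) := by
  have h : ∀ P : Polynomial ℝ, Continuous (fun p : ℝ × ℝ => Sp (P.comp (C p.1 * X)) p.2) := by
    intro P
    induction P using Polynomial.induction_on' with
    | add p q hp hq =>
      simp only [add_comp, Sp_add]; exact hp.add hq
    | monomial n a =>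
      have : ∀ p : ℝ × ℝ, Sp ((monomial n a).comp (C p.1 * X)) p.2 = (a * p.1^n) * Sp (X^n) p.2 := by
        intro p
        rw [← Sp_smul]; congr 1
        rw [monomial_comp, mul_pow, ← C_pow, ← mul_assoc, ← C_mul, smul_eq_C_mul]
      simp only [this]
      have := Sp_cont (X^n)
      fun_prop
  have h2 := h (derivative (Pk k))
  simp only [Gk, Sp_smul]
  fun_prop

open Polynomial in
lemma Gk_odd (k : ℕ) (b x : ℝ) : (Gk k b).eval (-x) = - (Gk k b).eval x := by
  have h1 := Gk_deriv k b x
  have h2 := (Gk_deriv k b (-x)).comp x (hasDerivAt_neg x)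
  have e : (fun x => (Pk k).eval (b*x)) ∘ Neg.neg = fun x => (Pk k).eval (b*x) := by
    ext y; simp [Pk_even]
  rw [e] at h2
  have := h1.unique h2
  linarith

lemma mean_Gk (k : ℕ) (b : ℝ) : mean (Gk k b) = 0 := by
  unfold mean
  have h : ∫ τ in 0..π, (Gk k b).eval (Real.cos τ) = ∫ τ in 0..π, -(Gk k b).eval (Real.cos τ) := by
    have := intervalIntegral.integral_comp_sub_left (a := 0) (b := π) (fun τ => (Gk k b).eval (Real.cos τ)) π
    simp only [sub_self, sub_zero] at this
    rw [← this]
    refine intervalIntegral.integral_congr fun τ _ => ?_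
    rw [Real.cos_pi_sub, Gk_odd]
  rw [intervalIntegral.integral_neg] at h
  rw [show ∫ τ in 0..π, (Gk k b).eval (Real.cos τ) = 0 by linarith, mul_zero]

lemma dd_odd (k : ℕ) {b x y : ℝ} : dd (Gk k b) (-x) (-y) = dd (Gk k b) x y := by
  have h : ∀ y, y ≠ x → dd (Gk k b) (-x) (-y) = dd (Gk k b) x y := by
    intro y hy
    have h1 := dd_mul (Gk k b) x y
    have h2 := dd_mul (Gk k b) (-x) (-y)
    rw [Gk_odd, Gk_odd] at h2
    have : (y-x) * (dd (Gk k b) (-x) (-y) - dd (Gk k b) x y) = 0 := by linear_combination -h1 - h2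
    rcases mul_eq_zero.1 this with h | h
    · exact absurd (sub_eq_zero.1 h) hy
    · linarith
  have c1 : Continuous (fun y => dd (Gk k b) (-x) (-y)) := by unfold dd; exact (Polynomial.continuous _).comp continuous_neg
  have c2 : Continuous (fun y => dd (Gk k b) x y) := by unfold dd; exact (Polynomial.continuous _)
  have hd : Dense ({x}ᶜ : Set ℝ) := dense_compl_singleton x
  exact congrFun (c1.ext_on hd c2 (fun y hy => h y hy)) y

lemma Sp_even (k : ℕ) (b x : ℝ) : Sp (Gk k b) (-x) = Sp (Gk k b) x := by
  unfold Sp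
  congr 1
  have := intervalIntegral.integral_comp_sub_left (a := 0) (b := π) (fun τ => dd (Gk k b) (-x) (Real.cos τ)) π
  simp only [sub_self, sub_zero] at this
  rw [← this]
  refine intervalIntegral.integral_congr fun τ _ => ?_
  rw [Real.cos_pi_sub, dd_odd]

end TO

namespace TO

noncomputable def cb (b0 b : ℝ) : ℝ := max 0 (min b b0)
noncomputable def cx (b x : ℝ) : ℝ := x / max 1 (√2 * |b*x|)

lemma cb_cont (b0 : ℝ) : Continuous (cb b0) := by unfold cb; fun_prop
lemma cb_nonneg (b0 b : ℝ) : 0 ≤ cb b0 b := le_max_left _ _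
lemma cb_le {b0 : ℝ} (h : 0 ≤ b0) (b : ℝ) : cb b0 b ≤ b0 := max_le h (min_le_right _ _)
lemma cb_eq {b0 b : ℝ} (h : 0 ≤ b) (h' : b ≤ b0) : cb b0 b = b := by
  unfold cb; rw [min_eq_left h', max_eq_right h]

lemma cx_cont : Continuous (fun p : ℝ × ℝ => cx p.1 p.2) := by
  unfold cx
  refine continuous_snd.div (by fun_prop) fun p => ?_
  have := le_max_left 1 (√2 * |p.1*p.2|)
  linarith

lemma cx_sq (b x : ℝ) : (b * cx b x)^2 ≤ 1/2 := by
  unfold cx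
  have h1 := le_max_left 1 (√2 * |b*x|)
  have h2 := le_max_right 1 (√2 * |b*x|)
  set M := max 1 (√2 * |b*x|)
  rw [← mul_div_assoc, div_pow, div_le_iff₀ (by positivity)]
  have : (√2 * |b*x|)^2 ≤ M^2 := by gcongr
  rw [mul_pow, Real.sq_sqrt (by norm_num), sq_abs] at this
  linarith

lemma cx_eq {b x : ℝ} (h : (b*x)^2 ≤ 1/2) : cx b x = x := by
  unfold cx
  rw [max_eq_left, div_one]
  have : √2 * |b*x| ≤ 1 := by
    apply le_of_sq_le_sq _ (by norm_num)
    rw [mul_pow, Real.sq_sqrt (by norm_num), sq_abs]; linarith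
  exact this

lemma cx_neg (b x : ℝ) : cx b (-x) = -cx b x := by
  unfold cx; rw [mul_neg, abs_neg, neg_div]

noncomputable def ss (b0 : ℝ) (k : ℕ) (p : ℝ × ℝ) : ℝ := Sp (Gk k (cb b0 p.1)) (cx (cb b0 p.1) p.2)

lemma ss_cont (b0 : ℝ) (k : ℕ) : Continuous (ss b0 k) := by
  have h1 := cb_cont b0
  have h2 : Continuous (fun p : ℝ × ℝ => (cb b0 p.1, cx (cb b0 p.1) p.2)) := by
    refine Continuous.prodMk (by fun_prop) ?_
    exact cx_cont.comp (f := fun p : ℝ × ℝ => (cb b0 p.1, p.2)) (by fun_prop)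
  have h3 := (Gk_joint k).comp h2
  have e : ss b0 k = (fun p : ℝ × ℝ => Sp (Gk k p.1) p.2) ∘ (fun p : ℝ × ℝ => (cb b0 p.1, cx (cb b0 p.1) p.2)) := by
    ext p; simp only [ss, Function.comp_apply]
  rw [e]; exact h3

lemma ss_bound {b0 : ℝ} (h0 : 0 ≤ b0) (h1 : b0 ≤ 1/2) (k : ℕ) (p : ℝ × ℝ) : |ss b0 k p| ≤ C1*(b0*k)^(7/4:ℝ) := by
  refine (Sp_bound k (cb_nonneg _ _) ((cb_le h0 _).trans h1) (cx_sq _ _)).trans ?_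
  have := cb_le h0 p.1
  have := cb_nonneg b0 p.1
  exact mul_le_mul_of_nonneg_left (Real.rpow_le_rpow (by positivity) (by gcongr) (by norm_num)) C1_nonneg

noncomputable def yk (b0 : ℝ) (k : ℕ) (Q : ℝ × ℝ → ℝ) (b : ℝ) : ℝ :=
  ∫ τ in 0..π, (Pk k).eval (cb b0 b * Real.cos τ) * Q (b, Real.cos τ) * Real.sin τ^2

lemma Pk_abs (k : ℕ) {z : ℝ} (h : |z| ≤ 1) : |(Pk k).eval z| ≤ 1 := by
  obtain ⟨h1, h2⟩ := abs_le.1 h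
  rw [← Real.sin_arcsin h1 h2, Pk_sin]
  exact Real.abs_cos_le_one _

lemma yk_integrand_cont (b0 : ℝ) (k : ℕ) {Q : ℝ × ℝ → ℝ} (hQ : Continuous Q) :
    Continuous (fun p : ℝ × ℝ => (Pk k).eval (cb b0 p.1 * Real.cos p.2) * Q (p.1, Real.cos p.2) * Real.sin p.2^2) := by
  have h1 := cb_cont b0
  have h2 : Continuous (fun p : ℝ × ℝ => (Pk k).eval (cb b0 p.1 * Real.cos p.2)) :=
    (Polynomial.continuous _).comp (by fun_prop)
  fun_prop

lemma yk_cont (b0 : ℝ) (k : ℕ) {Q : ℝ × ℝ → ℝ} (hQ : Continuous Q) : Continuous (yk b0 k Q) := by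
  unfold yk
  exact intervalIntegral.continuous_parametric_intervalIntegral_of_continuous' (yk_integrand_cont b0 k hQ) 0 π

lemma cb_cos {b0 : ℝ} (h0 : 0 ≤ b0) (h1 : b0 ≤ 1/2) (b τ : ℝ) : |cb b0 b * Real.cos τ| ≤ 1 := by
  rw [abs_mul, abs_of_nonneg (cb_nonneg _ _)]
  have := cb_le h0 b
  have := cb_nonneg b0 b
  nlinarith [Real.abs_cos_le_one τ, abs_nonneg (Real.cos τ)]

lemma yk_bound {b0 : ℝ} (h0 : 0 ≤ b0) (h1 : b0 ≤ 1/2) (k : ℕ) {Q : ℝ × ℝ → ℝ} {B : ℝ} (hB : ∀ p, |Q p| ≤ B) (b : ℝ) :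
    |yk b0 k Q b| ≤ π * B := by
  have hπ := Real.pi_pos
  unfold yk
  have hB0 : 0 ≤ B := (abs_nonneg _).trans (hB (0,0))
  have := intervalIntegral.norm_integral_le_of_norm_le_const (a := 0) (b := π) (C := B)
    (f := fun τ => (Pk k).eval (cb b0 b * Real.cos τ) * Q (b, Real.cos τ) * Real.sin τ^2) (fun τ _ => by
      rw [Real.norm_eq_abs, abs_mul, abs_mul, abs_of_nonneg (sq_nonneg (Real.sin τ))]
      have a1 := Pk_abs k (cb_cos h0 h1 b τ)
      have a2 := hB (b, Real.cos τ)
      have a3 := Real.sin_sq_le_one τ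
      calc _ ≤ 1*B*1 := by gcongr
        _ = B := by ring)
  rw [Real.norm_eq_abs, sub_zero, abs_of_pos hπ] at this
  linarith

lemma yk_sub (b0 : ℝ) (k : ℕ) {Q Q' : ℝ × ℝ → ℝ} (hQ : Continuous Q) (hQ' : Continuous Q') (b : ℝ) :
    yk b0 k Q b - yk b0 k Q' b = yk b0 k (fun p => Q p - Q' p) b := by
  have c : ∀ {Q : ℝ × ℝ → ℝ}, Continuous Q → Continuous (fun τ => (Pk k).eval (cb b0 b * Real.cos τ) * Q (b, Real.cos τ) * Real.sin τ^2) := by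
    intro Q hQ
    exact (yk_integrand_cont b0 k hQ).comp (f := fun τ : ℝ => (b, τ)) (by fun_prop)
  unfold yk
  rw [← intervalIntegral.integral_sub ((c hQ).intervalIntegrable _ _) ((c hQ').intervalIntegrable _ _)]
  refine intervalIntegral.integral_congr fun τ _ => ?_
  simp only; ring

noncomputable def S2 : ℝ := ∑' k : ℕ, 7*(k:ℝ)^(-(5/4):ℝ)
lemma S2_summable : Summable (fun k : ℕ => 7*(k:ℝ)^(-(5/4):ℝ)) :=
  (Real.summable_nat_rpow.2 (by norm_num)).mul_left 7
lemma S2_nonneg : 0 ≤ S2 := tsum_nonneg fun k => by positivity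

lemma beta_rpow {β : ℕ → ℝ} (hβ : ∀ k, 0 ≤ β k ∧ β k ≤ 7/(k:ℝ)^3) {b0 : ℝ} (h0 : 0 ≤ b0) (k : ℕ) :
    β k * (b0*k)^(7/4:ℝ) ≤ b0^(7/4:ℝ) * (7*(k:ℝ)^(-(5/4):ℝ)) := by
  obtain ⟨h1, h2⟩ := hβ k
  rw [Real.mul_rpow h0 (Nat.cast_nonneg k)]
  rcases Nat.eq_zero_or_pos k with h | h
  · subst h
    have : β 0 = 0 := le_antisymm (by simpa using h2) h1
    rw [this, zero_mul]; positivity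
  have hk : (0:ℝ) < k := by exact_mod_cast h
  have e : (k:ℝ)^(-(5/4):ℝ) = (k:ℝ)^(7/4:ℝ)/(k:ℝ)^3 := by
    rw [← Real.rpow_natCast, ← Real.rpow_sub hk]; norm_num
  rw [e]
  calc _ ≤ 7/(k:ℝ)^3 * (b0^(7/4:ℝ) * (k:ℝ)^(7/4:ℝ)) := by gcongr
    _ = _ := by ring

lemma term_bound {β : ℕ → ℝ} (hβ : ∀ k, 0 ≤ β k ∧ β k ≤ 7/(k:ℝ)^3) {b0 : ℝ} (h0 : 0 ≤ b0) (h1 : b0 ≤ 1/2)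
    {Q : ℝ × ℝ → ℝ} {B : ℝ} (hB : ∀ p, |Q p| ≤ B) (k : ℕ) (p : ℝ × ℝ) :
    |(1/π)*(β k * yk b0 k Q p.1 * ss b0 k p)| ≤ B*(C1*b0^(7/4:ℝ)) * (7*(k:ℝ)^(-(5/4):ℝ)) := by
  have hπ := Real.pi_pos
  have hB0 : 0 ≤ B := (abs_nonneg _).trans (hB (0,0))
  obtain ⟨b1, b2⟩ := hβ k
  rw [abs_mul, abs_mul, abs_mul, abs_of_pos (by positivity : 0 < 1/π), abs_of_nonneg b1]
  have a1 := yk_bound h0 h1 k hB p.1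
  have a2 := ss_bound h0 h1 k p
  have a3 := beta_rpow hβ h0 k
  have := C1_nonneg
  calc _ ≤ 1/π*(β k * (π*B) * (C1*(b0*k)^(7/4:ℝ))) := by gcongr
    _ = (B*C1)*(β k*(b0*k)^(7/4:ℝ)) := by field_simp
    _ ≤ (B*C1)*(b0^(7/4:ℝ) * (7*(k:ℝ)^(-(5/4):ℝ))) := by gcongr
    _ = _ := by ring

lemma exists_Q {b0 : ℝ} (h0 : 0 ≤ b0) (h1 : b0 ≤ 1/2) (hC : C1*b0^(7/4:ℝ)*S2 ≤ 1/4) {β : ℕ → ℝ}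
    (hβ : ∀ k, 0 ≤ β k ∧ β k ≤ 7/(k:ℝ)^3) :
    ∃ Q : ℝ × ℝ → ℝ, Continuous Q ∧ (∀ p, 2/3 ≤ Q p ∧ Q p ≤ 4/3) ∧
      ∀ p, HasSum (fun k => (1/π)*(β k * yk b0 k Q p.1 * ss b0 k p)) (Q p - 1) := by
  classical
  let E := BoundedContinuousFunction (ℝ × ℝ) ℝ
  have hb : ∀ (Q : E) p, |Q p| ≤ ‖Q‖ := fun Q p => Q.norm_coe_le_norm p
  have hsm : ∀ B : ℝ, Summable (fun k : ℕ => B*(C1*b0^(7/4:ℝ)) * (7*(k:ℝ)^(-(5/4):ℝ))) := fun B => S2_summable.mul_left _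
  have hts : ∀ B : ℝ, ∑' k : ℕ, B*(C1*b0^(7/4:ℝ)) * (7*(k:ℝ)^(-(5/4):ℝ)) = B*(C1*b0^(7/4:ℝ)) * S2 := fun B => tsum_mul_left
  have hcont : ∀ Q : E, Continuous (fun p : ℝ × ℝ => 1 + ∑' k, (1/π)*(β k * yk b0 k Q p.1 * ss b0 k p)) := by
    intro Q
    refine continuous_const.add (continuous_tsum (fun k => ?_) (hsm ‖Q‖) (fun k p => ?_))
    · have := yk_cont b0 k Q.continuous
      have := ss_cont b0 k
      fun_prop
    · exact term_bound hβ h0 h1 (hb Q) k p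
  have hnorm : ∀ (Q : ℝ × ℝ → ℝ) (B : ℝ), (∀ p, |Q p| ≤ B) → ∀ p, |∑' k, (1/π)*(β k * yk b0 k Q p.1 * ss b0 k p)| ≤ B/4 := by
    intro Q B hB p
    have hB0 : 0 ≤ B := (abs_nonneg _).trans (hB (0,0))
    have h := tsum_of_norm_bounded ((hsm B).hasSum) (f := fun k => (1/π)*(β k * yk b0 k Q p.1 * ss b0 k p))
      (fun k => term_bound hβ h0 h1 hB k p)
    rw [hts] at h
    refine h.trans ?_
    calc _ = B*(C1*b0^(7/4:ℝ)*S2) := by ring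
      _ ≤ B*(1/4) := by gcongr
      _ = _ := by ring
  let T : E → E := fun Q => BoundedContinuousFunction.ofNormedAddCommGroup
    (fun p : ℝ × ℝ => 1 + ∑' k, (1/π)*(β k * yk b0 k Q p.1 * ss b0 k p)) (hcont Q) (1+‖Q‖/4) (fun p => by
      refine (norm_add_le _ _).trans ?_
      have := hnorm Q ‖Q‖ (hb Q) p
      rw [norm_one, Real.norm_eq_abs]; linarith)
  have hT : ∀ Q p, T Q p = 1 + ∑' k, (1/π)*(β k * yk b0 k Q p.1 * ss b0 k p) := fun Q p => rfl
  have hs : ∀ (Q : E) p, Summable (fun k => (1/π)*(β k * yk b0 k Q p.1 * ss b0 k p)) := fun Q p =>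
    Summable.of_norm_bounded (hsm ‖Q‖) (fun k => term_bound hβ h0 h1 (hb Q) k p)
  have hcon : ContractingWith (1/4) T := by
    refine ⟨by rw [← NNReal.coe_lt_coe]; norm_num, LipschitzWith.of_dist_le_mul fun Q Q' => ?_⟩
    rw [BoundedContinuousFunction.dist_le (by positivity)]
    intro p
    rw [hT, hT, Real.dist_eq, add_sub_add_left_eq_sub, ← (hs Q p).tsum_sub (hs Q' p)]
    have e : ∀ k, (1/π)*(β k * yk b0 k Q p.1 * ss b0 k p) - (1/π)*(β k * yk b0 k Q' p.1 * ss b0 k p)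
       = (1/π)*(β k * yk b0 k (fun p => Q p - Q' p) p.1 * ss b0 k p) := by
      intro k; rw [← yk_sub b0 k Q.continuous Q'.continuous]; ring
    simp_rw [e]
    have := hnorm (fun p => Q p - Q' p) (dist Q Q') (fun p => by
      rw [← Real.dist_eq]; exact BoundedContinuousFunction.dist_coe_le_dist p) p
    refine this.trans (le_of_eq ?_)
    push_cast; ring
  have : Nonempty E := ⟨0⟩
  set Q := ContractingWith.fixedPoint T hcon
  have hfix : T Q = Q := ContractingWith.fixedPoint_isFixedPt hcon
  have hQ : ∀ p, Q p = 1 + ∑' k, (1/π)*(β k * yk b0 k Q p.1 * ss b0 k p) := by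
    intro p; rw [← hT, hfix]
  have hnQ : ‖Q‖ ≤ 4/3 := by
    have : ‖Q‖ ≤ 1+‖Q‖/4 := by
      rw [BoundedContinuousFunction.norm_le (by positivity)]
      intro p
      rw [hQ p]
      refine (norm_add_le _ _).trans ?_
      have := hnorm Q ‖Q‖ (hb Q) p
      rw [norm_one, Real.norm_eq_abs]; linarith
    linarith
  refine ⟨Q, Q.continuous, fun p => ?_, fun p => ?_⟩
  · have h3 := hnorm Q ‖Q‖ (hb Q) p
    have h4 := hQ p
    obtain ⟨h5, h6⟩ := abs_le.1 h3
    constructor <;> linarith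
  · have := (hs Q p).hasSum
    rwa [show ∑' k, (1/π)*(β k * yk b0 k Q p.1 * ss b0 k p) = Q p - 1 by rw [hQ p]; simp] at this
end TO

namespace TO

structure IsQ (b0 : ℝ) (β : ℕ → ℝ) (Q : ℝ × ℝ → ℝ) : Prop where
  h0 : 0 < b0
  h1 : b0 ≤ 1/2
  hβ : ∀ k, 0 ≤ β k ∧ β k ≤ 7/(k:ℝ)^3
  cont : Continuous Q
  bd : ∀ p, 2/3 ≤ Q p ∧ Q p ≤ 4/3
  sum : ∀ p, HasSum (fun k => (1/π)*(β k * yk b0 k Q p.1 * ss b0 k p)) (Q p - 1)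

lemma IsQ.abs_le {b0 β Q} (h : IsQ b0 β Q) (p : ℝ × ℝ) : |Q p| ≤ 4/3 := by
  rw [_root_.abs_le]; have := h.bd p; constructor <;> linarith

lemma IsQ.even {b0 β Q} (h : IsQ b0 β Q) (b x : ℝ) : Q (b, -x) = Q (b, x) := by
  have h1 := h.sum (b,-x)
  have e : ∀ k, ss b0 k (b,-x) = ss b0 k (b,x) := by
    intro k; unfold ss; simp only; rw [cx_neg, Sp_even]
  simp only [e] at h1
  have := h1.unique (h.sum (b,x))
  linarith

noncomputable def DK (b0 : ℝ) (k : ℕ) : ℝ := 4/3*(C1*b0^(7/4:ℝ)) * (7*(k:ℝ)^(-(5/4):ℝ))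
lemma DK_summable (b0 : ℝ) : Summable (DK b0) := S2_summable.mul_left _

lemma IsQ.term {b0 β Q} (h : IsQ b0 β Q) (k : ℕ) (p : ℝ × ℝ) : |(1/π)*(β k * yk b0 k Q p.1 * ss b0 k p)| ≤ DK b0 k :=
  term_bound h.hβ h.h0.le h.h1 h.abs_le k p

/-- potential of `1` -/
lemma Pot_one {x : ℝ} (hx : 0 ≤ x) : Pot (fun _ => 1) x = Pot (fun _ => 1) 0 - x^2/2 + ∫ y in 0..x, √(y^2-1) := by
  have h := potId Polynomial.X x hx
  have e : Sp Polynomial.X = fun _ => 1 := by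
    ext y
    have := Sp_X_mul 1 y
    rw [mul_one, Sp_one] at this
    rw [this]; unfold mean; simp
  have e2 : mean Polynomial.X = 0 := by
    unfold mean; simp
  rw [e, e2] at h
  rw [h]
  simp

section
variable {b0 : ℝ} {β : ℕ → ℝ} {Q : ℝ × ℝ → ℝ}

lemma IsQ.ss_eq (h : IsQ b0 β Q) {b x : ℝ} (hb : 0 ≤ b) (hb' : b ≤ b0) (hx : (b*x)^2 ≤ 1/2) (k : ℕ) :
    ss b0 k (b,x) = Sp (Gk k b) x := by
  unfold ss; simp only; rw [cb_eq hb hb', cx_eq hx]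

lemma IsQ.bcos (h : IsQ b0 β Q) {b : ℝ} (hb : 0 ≤ b) (hb' : b ≤ b0) (τ : ℝ) : (b*Real.cos τ)^2 ≤ 1/2 := by
  have := h.h1
  have := Real.cos_sq_le_one τ
  rw [mul_pow]; nlinarith [sq_nonneg (Real.cos τ)]

lemma IsQ.qcont (h : IsQ b0 β Q) (b : ℝ) : Continuous (fun x => Q (b,x)) :=
  h.cont.comp (by fun_prop)

lemma Pot_int (x : ℝ) {q : ℝ → ℝ} (hq : Continuous q) (a c : ℝ) :
    IntervalIntegrable (fun τ => Real.log (x - Real.cos τ) * (q (Real.cos τ) * Real.sin τ^2)) MeasureTheory.volume a c :=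
  (log_cos_int x _ _).mul_continuousOn (by fun_prop)

lemma IsQ.Pot_sum (h : IsQ b0 β Q) {b : ℝ} (hb : 0 ≤ b) (hb' : b ≤ b0) (x : ℝ) :
    HasSum (fun k => (1/π)*(β k * yk b0 k Q b) * Pot (Sp (Gk k b)) x) (Pot (fun y => Q (b,y)) x - Pot (fun _ => 1) x) := by
  have hπ := Real.pi_pos
  have hc := Sp_cont
  have key := intervalIntegral.hasSum_integral_of_dominated_convergence (μ := MeasureTheory.volume) (a := 0) (b := π)
    (F := fun (k:ℕ) τ => Real.log (x - Real.cos τ) * (((1/π)*(β k * yk b0 k Q b)) * Sp (Gk k b) (Real.cos τ) * Real.sin τ^2))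
    (f := fun τ => Real.log (x - Real.cos τ) * ((Q (b, Real.cos τ) - 1) * Real.sin τ^2))
    (fun k τ => |Real.log (x - Real.cos τ)| * DK b0 k)
    (fun k => by
      have := hc (Gk k b)
      have h2 : Measurable (fun τ => Real.log (x - Real.cos τ)) := Real.measurable_log.comp (by fun_prop)
      exact (h2.mul (by fun_prop)).aestronglyMeasurable)
    (fun k => Filter.Eventually.of_forall fun τ _ => by
      rw [norm_mul, Real.norm_eq_abs]
      refine mul_le_mul_of_nonneg_left ?_ (abs_nonneg _)
      have h3 := h.term k (b, Real.cos τ)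
      rw [h.ss_eq hb hb' (h.bcos hb hb' τ)] at h3
      rw [norm_mul, Real.norm_eq_abs, Real.norm_eq_abs, abs_of_nonneg (sq_nonneg (Real.sin τ))]
      have h4 := Real.sin_sq_le_one τ
      simp only at h3
      rw [← mul_assoc] at h3
      nlinarith [abs_nonneg ((1/π)*(β k * yk b0 k Q b) * Sp (Gk k b) (Real.cos τ)), sq_nonneg (Real.sin τ)])
    (Filter.Eventually.of_forall fun τ _ => (DK_summable b0).mul_left _)
    (by simp_rw [tsum_mul_left]; exact ((log_cos_int x _ _).abs).mul_const _)
    (Filter.Eventually.of_forall fun τ _ => by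
      have h3 := h.sum (b, Real.cos τ)
      simp only at h3
      have := (h3.mul_right (Real.sin τ^2)).mul_left (Real.log (x - Real.cos τ))
      convert! this using 1
      ext k
      rw [h.ss_eq hb hb' (h.bcos hb hb' τ)]; ring)
  have := key.mul_left (-(1/π))
  convert! this using 1
  · ext k
    unfold Pot
    rw [← mul_assoc, mul_comm _ (-(1/π)), mul_assoc, ← intervalIntegral.integral_const_mul]
    refine congrArg (fun z => -(1/π)*z) (intervalIntegral.integral_congr fun τ _ => ?_)
    ring
  · unfold Pot
    rw [← mul_sub, ← intervalIntegral.integral_sub (Pot_int x (h.qcont b) _ _) (Pot_int x continuous_const _ _)]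
    refine congrArg (fun z => -(1/π)*z) (intervalIntegral.integral_congr fun τ _ => ?_)
    ring

lemma IsQ.out_sum (h : IsQ b0 β Q) {b : ℝ} (hb : 0 ≤ b) (hb' : b ≤ b0) {x : ℝ} (hx0 : 0 ≤ x) (hx : (b*x)^2 ≤ 1/2) :
    HasSum (fun k => (1/π)*(β k * yk b0 k Q b) * ∫ y in 0..x, √(y^2-1) * Sp (Gk k b) y)
      (∫ y in 0..x, √(y^2-1) * (Q (b,y) - 1)) := by
  have hc := Sp_cont
  have hy2 : ∀ y, y ∈ uIoc 0 x → (b*y)^2 ≤ 1/2 := by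
    intro y hy
    rw [uIoc_of_le hx0] at hy
    have : (b*y)^2 ≤ (b*x)^2 := by
      have := hy.1.le; have := hy.2; gcongr
    linarith
  have key := intervalIntegral.hasSum_integral_of_dominated_convergence (μ := MeasureTheory.volume) (a := 0) (b := x)
    (F := fun (k:ℕ) y => √(y^2-1) * (((1/π)*(β k * yk b0 k Q b)) * Sp (Gk k b) y))
    (f := fun y => √(y^2-1) * (Q (b, y) - 1))
    (fun k y => √(y^2-1) * DK b0 k)
    (fun k => by
      have := hc (Gk k b)
      exact (by fun_prop : Continuous _).aestronglyMeasurable)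
    (fun k => Filter.Eventually.of_forall fun y hy => by
      rw [norm_mul, Real.norm_eq_abs, abs_of_nonneg (Real.sqrt_nonneg _)]
      refine mul_le_mul_of_nonneg_left ?_ (Real.sqrt_nonneg _)
      have h3 := h.term k (b, y)
      rw [h.ss_eq hb hb' (hy2 y hy), ← mul_assoc] at h3
      exact h3)
    (Filter.Eventually.of_forall fun τ _ => (DK_summable b0).mul_left _)
    (by simp_rw [tsum_mul_left]; exact (by fun_prop : Continuous fun y : ℝ => √(y^2-1) * ∑' k, DK b0 k).intervalIntegrable _ _)
    (Filter.Eventually.of_forall fun y hy => by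
      have h3 := h.sum (b, y)
      simp only at h3
      have := h3.mul_left (√(y^2-1))
      convert! this using 1
      ext k
      rw [h.ss_eq hb hb' (hy2 y hy)]; ring)
  convert! key using 1
  ext k
  rw [← intervalIntegral.integral_const_mul]
  refine intervalIntegral.integral_congr fun τ _ => ?_
  ring

lemma Pot_Gk (k : ℕ) (b : ℝ) {x : ℝ} (hx : 0 ≤ x) : Pot (Sp (Gk k b)) x = Pot (Sp (Gk k b)) 0 - ((Pk k).eval (b*x) - 1)
    + ∫ y in 0..x, √(y^2-1) * Sp (Gk k b) y := by
  have h := potId (Gk k b) x hx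
  rw [h, mean_Gk]
  simp only [sub_zero]
  rw [intervalIntegral.integral_eq_sub_of_hasDerivAt (f := fun x => (Pk k).eval (b*x)) (fun y _ => Gk_deriv k b y)
    ((Polynomial.continuous _).intervalIntegrable _ _)]
  simp [Pk_zero]

lemma IsQ.Pot_id (h : IsQ b0 β Q) {b : ℝ} (hb : 0 ≤ b) (hb' : b ≤ b0) {x : ℝ} (hx0 : 0 ≤ x) (hx : (b*x)^2 ≤ 1/2) :
    HasSum (fun k => (1/π)*(β k * yk b0 k Q b) * ((Pk k).eval (b*x) - 1))
      (Pot (fun y => Q (b,y)) 0 - Pot (fun y => Q (b,y)) x - x^2/2 + ∫ y in 0..x, √(y^2-1) * Q (b,y)) := by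
  have h1 := h.Pot_sum hb hb' x
  have h2 := h.Pot_sum hb hb' 0
  have h3 := h.out_sum hb hb' hx0 hx
  have h4 := (h2.sub h1).add h3
  have h5 := Pot_one hx0
  have h6 := h.qcont b
  convert! h4 using 1
  · ext k; rw [Pot_Gk k b hx0]; ring
  · rw [h5]
    have : ∫ y in 0..x, √(y^2-1) * (Q (b,y) - 1) = (∫ y in 0..x, √(y^2-1) * Q (b,y)) - ∫ y in 0..x, √(y^2-1) := by
      rw [← intervalIntegral.integral_sub]
      · refine intervalIntegral.integral_congr fun τ _ => ?_
        ring
      · exact ((by fun_prop : Continuous fun y : ℝ => √(y^2-1)).mul h6).intervalIntegrable _ _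
      · exact (by fun_prop : Continuous fun y : ℝ => √(y^2-1)).intervalIntegrable _ _
    rw [this]; ring

end

/-- the density -/
noncomputable def gd (b : ℝ) (q : ℝ → ℝ) (t : ℝ) : ℝ :=
  Real.cos (t/2) * (b/π) * √(1 - (Real.sin (t/2)/b)^2) * q (Real.sin (t/2)/b)

lemma gd_zero {b : ℝ} (hb : 0 < b) (hb1 : b ≤ 1/2) (q : ℝ → ℝ) {t : ℝ} (ht : |t| ≤ π) (ha : 2*Real.arcsin b ≤ |t|) : gd b q t = 0 := by
  unfold gd
  have : 1 - (Real.sin (t/2)/b)^2 ≤ 0 := by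
    have h1 : b ≤ Real.sin (|t|/2) := by
      rw [← Real.sin_arcsin (by linarith : -1 ≤ b) (by linarith)]
      exact Real.sin_le_sin_of_le_of_le_pi_div_two (Real.neg_pi_div_two_le_arcsin b) (by linarith) (by linarith)
    have h2 : Real.sin (t/2)^2 = Real.sin (|t|/2)^2 := by
      rcases abs_cases t with h | h
      · rw [h.1]
      · rw [h.1, neg_div, Real.sin_neg]; ring
    rw [div_pow, h2, sub_nonpos, le_div_iff₀ (by positivity)]
    rw [one_mul]; gcongr
  rw [Real.sqrt_eq_zero_of_nonpos this]; ring

open MeasureTheory in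
/-- change of variables -/
lemma gd_cov {b : ℝ} (hb : 0 < b) (hb1 : b ≤ 1/2) (q : ℝ → ℝ) (f : ℝ → ℝ) :
    ∫ t in -π..π, f t * gd b q t = (2*b^2/π) * ∫ τ in 0..π, f (2*Real.arcsin (b*Real.cos τ)) * (q (Real.cos τ) * Real.sin τ^2) := by
  have hπ := Real.pi_pos
  set a := 2*Real.arcsin b with ha
  have ha0 : 0 < a := by have := Real.arcsin_pos.2 hb; linarith
  have haπ : a ≤ π := by have := Real.arcsin_le_pi_div_two b; linarith
  rw [intervalIntegral.integral_of_le (by linarith), intervalIntegral.integral_of_le hπ.le]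
  have e1 : ∫ t in Ioc (-π) π, f t * gd b q t = ∫ t in Ioo (-a) a, f t * gd b q t := by
    apply setIntegral_eq_of_subset_of_forall_sdiff_eq_zero measurableSet_Ioc
    · intro t ht; exact ⟨by linarith [ht.1], by linarith [ht.2]⟩
    · intro t ht
      rw [gd_zero hb hb1 q, mul_zero]
      · exact abs_le.2 ⟨ht.1.1.le, ht.1.2⟩
      · by_contra hh
        exact ht.2 (abs_lt.1 (not_le.1 hh))
  set φ : ℝ → ℝ := fun τ => 2*Real.arcsin (b*Real.cos τ) with hφ
  have hbc : ∀ τ, |b*Real.cos τ| ≤ 1/2 := by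
    intro τ
    rw [abs_mul, abs_of_pos hb]; nlinarith [Real.abs_cos_le_one τ, abs_nonneg (Real.cos τ)]
  have him : φ '' Ioo 0 π = Ioo (-a) a := by
    ext t
    constructor
    · rintro ⟨τ, hτ, rfl⟩
      have c1 : Real.cos τ < 1 := by
        rw [← Real.cos_zero]; exact Real.cos_lt_cos_of_nonneg_of_le_pi le_rfl hτ.2.le hτ.1
      have c2 : -1 < Real.cos τ := by
        rw [← Real.cos_pi]; exact Real.cos_lt_cos_of_nonneg_of_le_pi hτ.1.le le_rfl hτ.2
      have := abs_le.1 (hbc τ)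
      have s1 : Real.arcsin (b*Real.cos τ) < Real.arcsin b :=
        Real.strictMonoOn_arcsin ⟨by linarith, by linarith⟩ ⟨by linarith, by linarith⟩ (by nlinarith)
      have s2 : Real.arcsin (-b) < Real.arcsin (b*Real.cos τ) :=
        Real.strictMonoOn_arcsin ⟨by linarith, by linarith⟩ ⟨by linarith, by linarith⟩ (by nlinarith)
      rw [Real.arcsin_neg] at s2
      exact ⟨by simp only [hφ]; linarith, by simp only [hφ]; linarith⟩
    · intro ht
      have s1 : Real.sin (t/2) < b := by
        rw [← Real.sin_arcsin (by linarith : -1 ≤ b) (by linarith)]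
        exact Real.strictMonoOn_sin ⟨by linarith [ht.1], by linarith [ht.2]⟩ ⟨by linarith, by linarith⟩ (by linarith [ht.2])
      have s2 : -b < Real.sin (t/2) := by
        rw [← Real.sin_arcsin (by linarith : -1 ≤ b) (by linarith), ← Real.sin_neg]
        exact Real.strictMonoOn_sin ⟨by linarith, by linarith⟩ ⟨by linarith [ht.1], by linarith [ht.2]⟩ (by linarith [ht.1])
      refine ⟨Real.arccos (Real.sin (t/2)/b), ⟨?_, ?_⟩, ?_⟩
      · rw [Real.arccos_pos, div_lt_one hb]; exact s1
      · refine lt_of_le_of_ne (Real.arccos_le_pi _) fun hh => ?_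
        rw [Real.arccos_eq_pi, div_le_iff₀ hb] at hh; linarith
      · simp only [hφ]
        rw [Real.cos_arccos (by rw [le_div_iff₀ hb]; linarith) (by rw [div_le_one hb]; linarith), mul_div_cancel₀ _ hb.ne',
          Real.arcsin_sin (by linarith [ht.1]) (by linarith [ht.2])]
        ring
  have hinj : InjOn φ (Ioo 0 π) := by
    intro τ hτ τ' hτ' he
    have h1 := abs_le.1 (hbc τ)
    have h2 := abs_le.1 (hbc τ')
    have h3 : b*Real.cos τ = b*Real.cos τ' :=
      Real.injOn_arcsin ⟨by linarith, by linarith⟩ ⟨by linarith, by linarith⟩ (by simp only [hφ] at he; linarith)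
    exact Real.injOn_cos ⟨hτ.1.le, hτ.2.le⟩ ⟨hτ'.1.le, hτ'.2.le⟩ (mul_left_cancel₀ hb.ne' h3)
  have hder : ∀ τ ∈ Ioo 0 π, HasDerivWithinAt φ (2*(1/√(1-(b*Real.cos τ)^2) * (b*(-Real.sin τ)))) (Ioo 0 π) τ := by
    intro τ _
    have h1 := abs_le.1 (hbc τ)
    exact (((Real.hasDerivAt_arcsin (by linarith) (by linarith)).comp τ ((Real.hasDerivAt_cos τ).const_mul b)).const_mul 2).hasDerivWithinAt
  have key := integral_image_eq_integral_abs_deriv_smul measurableSet_Ioo hder hinj (fun t => f t * gd b q t)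
  rw [e1, ← him, key, ← integral_Ioc_eq_integral_Ioo, ← integral_const_mul]
  refine setIntegral_congr_fun measurableSet_Ioc fun τ hτ => ?_
  simp only [smul_eq_mul]
  have hs : 0 ≤ Real.sin τ := Real.sin_nonneg_of_nonneg_of_le_pi hτ.1.le hτ.2
  have h1 := abs_le.1 (hbc τ)
  have hp : 0 < 1-(b*Real.cos τ)^2 := by nlinarith
  have hsq := Real.sqrt_pos.2 hp
  rw [abs_of_nonpos (by
    have : 0 ≤ 1/√(1-(b*Real.cos τ)^2) * (b*(Real.sin τ)) := by positivity
    linarith)]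
  have hphi : φ τ / 2 = Real.arcsin (b*Real.cos τ) := by simp only [hφ]; ring
  unfold gd
  rw [hphi, Real.cos_arcsin, Real.sin_arcsin (by linarith) (by linarith), mul_div_cancel_left₀ _ hb.ne']
  have e3 : √(1 - Real.cos τ^2) = Real.sin τ := by
    rw [← Real.sin_sq, Real.sqrt_sq hs]
  rw [e3]
  set w := √(1-(b*Real.cos τ)^2)
  have e4 : f (2*Real.arcsin (b*Real.cos τ)) = f (φ τ) := rfl
  rw [e4]
  field_simp
end TO

namespace TO

lemma gd_cont (b : ℝ) {q : ℝ → ℝ} (hq : Continuous q) : Continuous (gd b q) := by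
  unfold gd; fun_prop

lemma gd_even (b : ℝ) {q : ℝ → ℝ} (hq : ∀ x, q (-x) = q x) (t : ℝ) : gd b q (-t) = gd b q t := by
  unfold gd
  rw [neg_div, Real.cos_neg, Real.sin_neg, neg_div, hq, neg_sq]

lemma gd_nonneg {b : ℝ} (hb : 0 < b) {q : ℝ → ℝ} (hq : ∀ x, 0 ≤ q x) {t : ℝ} (ht : |t| ≤ π) : 0 ≤ gd b q t := by
  have hπ := Real.pi_pos
  obtain ⟨h1, h2⟩ := abs_le.1 ht
  have := Real.cos_nonneg_of_neg_pi_div_two_le_of_le (x := t/2) (by linarith) (by linarith)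
  have := hq (Real.sin (t/2)/b)
  unfold gd; positivity

lemma even_int {g : ℝ → ℝ} (hg : ∀ t, g (-t) = g t) (f : ℝ → ℝ) :
    ∫ t in -π..π, f (-t) * g t = ∫ t in -π..π, f t * g t := by
  have := intervalIntegral.integral_comp_neg (a := -π) (b := π) (fun t => f t * g t)
  rw [neg_neg] at this
  rw [← this]
  refine intervalIntegral.integral_congr fun t _ => ?_
  simp only [hg]

lemma cos_shift_int {g : ℝ → ℝ} (hc : Continuous g) (hg : ∀ t, g (-t) = g t) (c s : ℝ) :
    ∫ t in -π..π, Real.cos (c*(s-t)) * g t = Real.cos (c*s) * ∫ t in -π..π, Real.cos (c*t) * g t := by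
  have h1 : ∫ t in -π..π, Real.sin (c*t) * g t = 0 := by
    have := even_int hg (fun t => Real.sin (c*t))
    simp only [mul_neg, Real.sin_neg, neg_mul, intervalIntegral.integral_neg] at this
    linarith
  have e : ∀ t, Real.cos (c*(s-t)) * g t = Real.cos (c*s) * (Real.cos (c*t) * g t) + Real.sin (c*s) * (Real.sin (c*t) * g t) := by
    intro t; rw [mul_sub, Real.cos_sub]; ring
  simp_rw [e]
  rw [intervalIntegral.integral_add (by exact (by fun_prop : Continuous _).intervalIntegrable _ _) (by exact (by fun_prop : Continuous _).intervalIntegrable _ _),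
    intervalIntegral.integral_const_mul, intervalIntegral.integral_const_mul, h1]
  ring

/-- remainder kernel -/
noncomputable def RR (β : ℕ → ℝ) (s : ℝ) : ℝ := ∑' k : ℕ, 2*β k*Real.cos (k*s)

lemma cube_summable : Summable (fun k : ℕ => 2*(7/(k:ℝ)^3)) := by
  have := (Real.summable_nat_pow_inv.2 (show 1 < 3 by norm_num)).mul_left 14
  convert! this using 1; ext k; ring

noncomputable def RB : ℝ := ∑' k : ℕ, 2*(7/(k:ℝ)^3)

lemma RB_nonneg : 0 ≤ RB := tsum_nonneg fun k => by positivity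

lemma RR_term {β : ℕ → ℝ} (hβ : ∀ k, 0 ≤ β k ∧ β k ≤ 7/(k:ℝ)^3) (k : ℕ) (s : ℝ) :
    ‖2*β k*Real.cos (k*s)‖ ≤ 2*(7/(k:ℝ)^3) := by
  obtain ⟨h1, h2⟩ := hβ k
  rw [norm_mul, Real.norm_eq_abs, Real.norm_eq_abs, abs_of_nonneg (by positivity)]
  have := Real.abs_cos_le_one (k*s)
  nlinarith [abs_nonneg (Real.cos (k*s))]

lemma RR_hasSum {β : ℕ → ℝ} (hβ : ∀ k, 0 ≤ β k ∧ β k ≤ 7/(k:ℝ)^3) (s : ℝ) :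
    HasSum (fun k : ℕ => 2*β k*Real.cos (k*s)) (RR β s) :=
  (Summable.of_norm_bounded cube_summable (fun k => RR_term hβ k s)).hasSum

lemma RR_cont {β : ℕ → ℝ} (hβ : ∀ k, 0 ≤ β k ∧ β k ≤ 7/(k:ℝ)^3) : Continuous (RR β) :=
  continuous_tsum (fun k => by fun_prop) cube_summable (fun k s => RR_term hβ k s)

lemma RR_bound {β : ℕ → ℝ} (hβ : ∀ k, 0 ≤ β k ∧ β k ≤ 7/(k:ℝ)^3) (s : ℝ) : |RR β s| ≤ RB :=
  tsum_of_norm_bounded cube_summable.hasSum (fun k => RR_term hβ k s)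

lemma RR_int {β : ℕ → ℝ} (hβ : ∀ k, 0 ≤ β k ∧ β k ≤ 7/(k:ℝ)^3) {g : ℝ → ℝ} (hc : Continuous g) (s : ℝ) :
    HasSum (fun k : ℕ => 2*β k * ∫ t in -π..π, Real.cos (k*(s-t)) * g t) (∫ t in -π..π, RR β (s-t) * g t) := by
  have key := intervalIntegral.hasSum_integral_of_dominated_convergence (μ := MeasureTheory.volume) (a := -π) (b := π)
    (F := fun (k:ℕ) t => 2*β k*Real.cos (k*(s-t)) * g t) (f := fun t => RR β (s-t) * g t)
    (fun k t => 2*(7/(k:ℝ)^3) * |g t|)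
    (fun k => (by fun_prop : Continuous fun t => 2*β k*Real.cos (k*(s-t)) * g t).aestronglyMeasurable)
    (fun k => Filter.Eventually.of_forall fun t _ => by
      rw [norm_mul, Real.norm_eq_abs (g t)]
      exact mul_le_mul_of_nonneg_right (RR_term hβ k (s-t)) (abs_nonneg _))
    (Filter.Eventually.of_forall fun t _ => cube_summable.mul_right _)
    (by simp_rw [tsum_mul_right]; exact (by fun_prop : Continuous _).intervalIntegrable _ _)
    (Filter.Eventually.of_forall fun t _ => (RR_hasSum hβ (s-t)).mul_right _)
  convert! key using 1
  ext k
  rw [← intervalIntegral.integral_const_mul]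
  refine intervalIntegral.integral_congr fun t _ => ?_
  ring

section
variable {b0 : ℝ} {β : ℕ → ℝ} {Q : ℝ × ℝ → ℝ}

noncomputable def nQ (Q : ℝ × ℝ → ℝ) (b : ℝ) : ℝ := (2/π) * ∫ τ in 0..π, Q (b, Real.cos τ) * Real.sin τ^2

noncomputable def kap (b0 : ℝ) (β : ℕ → ℝ) (Q : ℝ × ℝ → ℝ) (b : ℝ) : ℝ :=
  -1 - b^2*Real.log (4*b^2) * nQ Q b + 4*b^2*Pot (fun y => Q (b,y)) 0 + 4*b^2*((1/π)*∑' k, β k * yk b0 k Q b)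

lemma IsQ.mass (h : IsQ b0 β Q) {b : ℝ} (hb : 0 < b) (hb' : b ≤ b0) :
    ∫ t in -π..π, gd b (fun y => Q (b,y)) t = b^2 * nQ Q b := by
  have := gd_cov hb (hb'.trans h.h1) (fun y => Q (b,y)) (fun _ => 1)
  simp only [one_mul] at this
  rw [this]; unfold nQ; ring

lemma IsQ.cosint (h : IsQ b0 β Q) {b : ℝ} (hb : 0 < b) (hb' : b ≤ b0) (k : ℕ) :
    ∫ t in -π..π, Real.cos (k*t) * gd b (fun y => Q (b,y)) t = (2*b^2/π) * yk b0 k Q b := by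
  rw [gd_cov hb (hb'.trans h.h1) (fun y => Q (b,y)) (fun t => Real.cos (k*t))]
  unfold yk
  refine congrArg (fun z => (2*b^2/π)*z) (intervalIntegral.integral_congr fun τ _ => ?_)
  have h1 := _root_.abs_le.1 (cb_cos h.h0.le h.h1 b τ)
  rw [cb_eq hb.le hb'] at h1 ⊢
  rw [mul_assoc]
  congr 1
  have := Pk_sin k (Real.arcsin (b*Real.cos τ))
  rw [Real.sin_arcsin h1.1 h1.2] at this
  rw [this]; ring_nf

lemma cos_ne_ae (x : ℝ) : ∀ᵐ τ : ℝ, τ ∈ Ioc 0 π → Real.cos τ ≠ x := by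
  have : MeasureTheory.volume ({Real.arccos x} : Set ℝ) = 0 := by simp
  have h2 : ∀ᵐ τ : ℝ, τ ≠ Real.arccos x := MeasureTheory.compl_mem_ae_iff.2 this
  filter_upwards [h2] with τ hτ hm hc
  apply hτ
  rw [← hc, Real.arccos_cos hm.1.le hm.2]

lemma LA_pair {s t : ℝ} (h : Real.cos t ≠ Real.cos s) :
    LA 1 (s-t) + LA 1 (s+t) = -(2*Real.log (2*(Real.cos t - Real.cos s))) := by
  rw [LA_one, LA_one]
  have e : (2 - 2*Real.cos (s-t))*(2 - 2*Real.cos (s+t)) = (2*(Real.cos t - Real.cos s))^2 := by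
    rw [Real.cos_sub, Real.cos_add]
    linear_combination (-4*Real.sin t^2)*Real.sin_sq_add_cos_sq s + (4*Real.cos s^2-4)*Real.sin_sq_add_cos_sq t
  have hne : (2*(Real.cos t - Real.cos s))^2 ≠ 0 := by
    have := sub_ne_zero.2 h; positivity
  rw [← e] at hne
  have := Real.log_mul (left_ne_zero_of_mul hne) (right_ne_zero_of_mul hne)
  rw [e, Real.log_pow] at this
  push_cast at this
  linarith

lemma IsQ.LAint (h : IsQ b0 β Q) {b : ℝ} (hb : 0 < b) (hb' : b ≤ b0) {s : ℝ} :
    ∫ t in -π..π, LA 1 (s-t) * gd b (fun y => Q (b,y)) t =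
      - (b^2*Real.log (4*b^2) * nQ Q b) + 4*b^2*Pot (fun y => Q (b,y)) (Real.sin (s/2)/b) := by
  have hπ := Real.pi_pos
  set q : ℝ → ℝ := fun y => Q (b,y) with hq
  have hqc : Continuous q := h.qcont b
  have hqe : ∀ x, q (-x) = q x := fun x => h.even b x
  have hge := gd_even b hqe
  have hgc := gd_cont b hqc
  set x := Real.sin (s/2)/b with hx
  have hi : ∀ s, IntervalIntegrable (fun t => LA 1 (s-t) * gd b q t) MeasureTheory.volume (-π) π := fun s =>
    (LA_sub_int (by norm_num) le_rfl s _ _).mul_continuousOn hgc.continuousOn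
  have hi2 : IntervalIntegrable (fun t => LA 1 (s+t) * gd b q t) MeasureTheory.volume (-π) π := by
    have := (hi s).comp_sub_left 0
    simp only [zero_sub, sub_neg_eq_add, zero_add, hge] at this
    exact this.symm
  have e1 := even_int hge (fun t => LA 1 (s-t))
  simp only [sub_neg_eq_add] at e1
  have e2 : ∫ t in -π..π, LA 1 (s-t) * gd b q t = ∫ t in -π..π, (1/2*(LA 1 (s-t) + LA 1 (s+t))) * gd b q t := by
    have : ∀ t, (1/2*(LA 1 (s-t) + LA 1 (s+t))) * gd b q t = 1/2*(LA 1 (s-t) * gd b q t + LA 1 (s+t) * gd b q t) := by intro t; ring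
    simp_rw [this]
    rw [intervalIntegral.integral_const_mul, intervalIntegral.integral_add (hi s) hi2, e1]; ring
  rw [e2, gd_cov hb (hb'.trans h.h1) q (fun t => 1/2*(LA 1 (s-t) + LA 1 (s+t)))]
  have e3 : ∫ τ in 0..π, (1/2*(LA 1 (s-2*Real.arcsin (b*Real.cos τ)) + LA 1 (s+2*Real.arcsin (b*Real.cos τ)))) * (q (Real.cos τ) * Real.sin τ^2)
      = ∫ τ in 0..π, ((-Real.log (4*b^2)) * (q (Real.cos τ) * Real.sin τ^2) - (Real.log (x - Real.cos τ) * (q (Real.cos τ) * Real.sin τ^2)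
        + Real.log (-x - Real.cos τ) * (q (Real.cos τ) * Real.sin τ^2))) := by
    apply intervalIntegral.integral_congr_ae
    filter_upwards [cos_ne_ae x, cos_ne_ae (-x)] with τ h1 h2 hm
    rw [uIoc_of_le hπ.le] at hm
    have h1 := h1 hm
    have h2 := h2 hm
    have hc := _root_.abs_le.1 (cb_cos h.h0.le h.h1 b τ)
    rw [cb_eq hb.le hb'] at hc
    have e4 : Real.cos (2*Real.arcsin (b*Real.cos τ)) - Real.cos s = 2*b^2*((x-Real.cos τ)*(-(-x-Real.cos τ))) := by
      have hs : Real.cos s = 1 - 2*Real.sin (s/2)^2 := by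
        rw [show s = 2*(s/2) by ring, Real.cos_two_mul]; have := Real.sin_sq_add_cos_sq (s/2); ring_nf at this ⊢; linarith
      have ht : Real.cos (2*Real.arcsin (b*Real.cos τ)) = 1 - 2*(b*Real.cos τ)^2 := by
        rw [Real.cos_two_mul]; have := Real.sin_sq_add_cos_sq (Real.arcsin (b*Real.cos τ))
        rw [Real.sin_arcsin hc.1 hc.2] at this; linarith
      have : Real.sin (s/2) = b*x := by rw [hx]; field_simp
      rw [hs, ht, this]; ring
    have n1 : x - Real.cos τ ≠ 0 := sub_ne_zero.2 (Ne.symm h1)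
    have n2 : -x - Real.cos τ ≠ 0 := sub_ne_zero.2 (Ne.symm h2)
    have hne : Real.cos (2*Real.arcsin (b*Real.cos τ)) ≠ Real.cos s := by
      rw [← sub_ne_zero, e4]
      exact mul_ne_zero (by positivity) (mul_ne_zero n1 (neg_ne_zero.2 n2))
    rw [LA_pair hne, e4, ← mul_assoc 2, Real.log_mul (by positivity) (mul_ne_zero n1 (neg_ne_zero.2 n2)), Real.log_mul n1 (neg_ne_zero.2 n2),
      Real.log_neg_eq_log, show 2*(2*b^2) = 4*b^2 by ring]
    ring
  rw [e3]
  have e5 : ∫ τ in 0..π, Real.log (-x - Real.cos τ) * (q (Real.cos τ) * Real.sin τ^2) =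
      ∫ τ in 0..π, Real.log (x - Real.cos τ) * (q (Real.cos τ) * Real.sin τ^2) := by
    have := intervalIntegral.integral_comp_sub_left (a := 0) (b := π) (fun τ => Real.log (-x - Real.cos τ) * (q (Real.cos τ) * Real.sin τ^2)) π
    simp only [sub_self, sub_zero] at this
    rw [← this]
    refine intervalIntegral.integral_congr fun τ _ => ?_
    rw [Real.cos_pi_sub, Real.sin_pi_sub, hqe, show -x - -Real.cos τ = -(x - Real.cos τ) by ring, Real.log_neg_eq_log]
  rw [intervalIntegral.integral_sub (by exact (by fun_prop : Continuous _).intervalIntegrable _ _)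
      (by exact (Pot_int x hqc _ _).add (Pot_int (-x) hqc _ _)),
    intervalIntegral.integral_add (Pot_int x hqc _ _) (Pot_int (-x) hqc _ _), e5, intervalIntegral.integral_const_mul]
  unfold nQ Pot
  simp only [hq]
  field_simp
  ring

lemma IsQ.bysum (h : IsQ b0 β Q) : Summable (fun k : ℕ => β k * (π*(4/3))) := by
  refine Summable.mul_right _ (Summable.of_nonneg_of_le (fun k => (h.hβ k).1) (fun k => ?_) cube_summable)
  have h1 := (h.hβ k).2
  have : (0:ℝ) ≤ 7/(k:ℝ)^3 := by positivity
  linarith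

lemma IsQ.ybound (h : IsQ b0 β Q) (b : ℝ) (k : ℕ) : ‖β k * yk b0 k Q b‖ ≤ β k * (π*(4/3)) := by
  rw [norm_mul, Real.norm_eq_abs, Real.norm_eq_abs, abs_of_nonneg (h.hβ k).1]
  exact mul_le_mul_of_nonneg_left (yk_bound h.h0.le h.h1 k h.abs_le b) (h.hβ k).1

lemma IsQ.U_eq (h : IsQ b0 β Q) {b : ℝ} (hb : 0 < b) (hb' : b ≤ b0) (α : ℝ) {s : ℝ} (hs : 0 ≤ s) (hs' : s ≤ π/2) :
    ∫ t in -π..π, (LA 1 (s-t) + α + RR β (s-t)) * gd b (fun y => Q (b,y)) t =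
      Real.cos s + (α*(b^2*nQ Q b) + kap b0 β Q b) + 4*b^2*∫ y in 0..(Real.sin (s/2)/b), √(y^2-1)*Q (b,y) := by
  have hπ := Real.pi_pos
  have hqc : Continuous (fun y => Q (b,y)) := h.qcont b
  have hqe : ∀ x, (fun y => Q (b,y)) (-x) = (fun y => Q (b,y)) x := fun x => h.even b x
  have hge := gd_even b (q := fun y => Q (b,y)) hqe
  have hgc := gd_cont b hqc
  have hRc := RR_cont h.hβ
  have e : ∀ t, (LA 1 (s-t) + α + RR β (s-t)) * gd b (fun y => Q (b,y)) t = LA 1 (s-t) * gd b (fun y => Q (b,y)) t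
      + (α * gd b (fun y => Q (b,y)) t + RR β (s-t) * gd b (fun y => Q (b,y)) t) := by intro t; ring
  simp_rw [e]
  rw [intervalIntegral.integral_add ((LA_sub_int (by norm_num) le_rfl s _ _).mul_continuousOn hgc.continuousOn)
      (by exact (by fun_prop : Continuous _).intervalIntegrable _ _),
    intervalIntegral.integral_add (by exact (by fun_prop : Continuous _).intervalIntegrable _ _) (by exact (by fun_prop : Continuous _).intervalIntegrable _ _),
    intervalIntegral.integral_const_mul, h.mass hb hb', h.LAint hb hb']
  have hR := RR_int h.hβ hgc s
  simp_rw [cos_shift_int hgc hge, h.cosint hb hb'] at hR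
  set x := Real.sin (s/2)/b with hx
  have hbx : b*x = Real.sin (s/2) := by rw [hx]; field_simp
  have hsin : 0 ≤ Real.sin (s/2) := Real.sin_nonneg_of_nonneg_of_le_pi (by linarith) (by linarith)
  have hx0 : 0 ≤ x := div_nonneg hsin hb.le
  have hs2 : Real.cos s = 1 - 2*Real.sin (s/2)^2 := by
    rw [show s = 2*(s/2) by ring, Real.cos_two_mul]; have := Real.sin_sq_add_cos_sq (s/2); ring_nf at this ⊢; linarith
  have hcs : 0 ≤ Real.cos s := Real.cos_nonneg_of_neg_pi_div_two_le_of_le (by linarith) hs'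
  have hP := h.Pot_id hb.le hb' hx0 (by rw [hbx]; linarith)
  have hY : HasSum (fun k => β k * yk b0 k Q b) (∑' k, β k * yk b0 k Q b) :=
    (Summable.of_norm_bounded h.bysum (h.ybound b)).hasSum
  have hk : ∀ k : ℕ, (Pk k).eval (b*x) = Real.cos (k*s) := by
    intro k; rw [hbx, Pk_sin]; ring_nf
  simp_rw [hk] at hP
  have hfin := (hP.mul_left (4*b^2)).add (hY.mul_left (4*b^2*(1/π)))
  have := hR.unique (by convert! hfin using 1; ext k; ring)
  rw [this, hs2, ← hbx]
  unfold kap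
  ring
end
end TO

namespace TO

lemma sin_sq_int : ∫ τ in 0..π, Real.sin τ^2 = π/2 := by
  rw [integral_sin_sq]; simp

noncomputable def CP : ℝ := (4/3) * ((1/π) * ∫ τ in 0..π, |Real.log (0 - Real.cos τ)|)

lemma CP_nonneg : 0 ≤ CP := by
  unfold CP
  have := intervalIntegral.integral_nonneg (f := fun τ => |Real.log (0 - Real.cos τ)|) (μ := MeasureTheory.volume) Real.pi_pos.le
    (fun τ _ => abs_nonneg _)
  have := Real.pi_pos
  positivity

noncomputable def om (b : ℝ) : ℝ := (1/3)*|(4*b^2)*Real.log (4*b^2)| + 4*b^2*(CP+RB)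

lemma om_cont : Continuous om := by
  unfold om
  have : Continuous (fun b : ℝ => (4*b^2)*Real.log (4*b^2)) := Real.continuous_mul_log.comp (by fun_prop : Continuous fun b : ℝ => 4*b^2)
  fun_prop

lemma om_zero : om 0 = 0 := by simp [om]

section
variable {b0 : ℝ} {β : ℕ → ℝ} {Q : ℝ × ℝ → ℝ}

lemma IsQ.nQ_bd (h : IsQ b0 β Q) (b : ℝ) : 2/3 ≤ nQ Q b ∧ nQ Q b ≤ 4/3 := by
  have hπ := Real.pi_pos
  have hqc := h.qcont b
  have c : Continuous (fun τ => Q (b, Real.cos τ) * Real.sin τ^2) := (hqc.comp Real.continuous_cos).mul (by fun_prop)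
  have e : ∀ k : ℝ, ∫ τ in 0..π, k * Real.sin τ^2 = k*(π/2) := by
    intro k; rw [intervalIntegral.integral_const_mul, sin_sq_int]
  have h1 : ∫ τ in 0..π, (2/3) * Real.sin τ^2 ≤ ∫ τ in 0..π, Q (b, Real.cos τ) * Real.sin τ^2 :=
    intervalIntegral.integral_mono_on hπ.le ((by fun_prop : Continuous _).intervalIntegrable _ _) (c.intervalIntegrable _ _)
      (fun τ _ => mul_le_mul_of_nonneg_right (h.bd _).1 (sq_nonneg _))
  have h2 : ∫ τ in 0..π, Q (b, Real.cos τ) * Real.sin τ^2 ≤ ∫ τ in 0..π, (4/3) * Real.sin τ^2 :=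
    intervalIntegral.integral_mono_on hπ.le (c.intervalIntegrable _ _) ((by fun_prop : Continuous _).intervalIntegrable _ _)
      (fun τ _ => mul_le_mul_of_nonneg_right (h.bd _).2 (sq_nonneg _))
  rw [e] at h1 h2
  unfold nQ
  constructor
  · calc 2/3 = (2/π)*(2/3*(π/2)) := by field_simp
      _ ≤ _ := mul_le_mul_of_nonneg_left h1 (by positivity)
  · calc _ ≤ (2/π)*(4/3*(π/2)) := mul_le_mul_of_nonneg_left h2 (by positivity)
      _ = _ := by field_simp

lemma IsQ.Pot_bd (h : IsQ b0 β Q) (b : ℝ) : |Pot (fun y => Q (b,y)) 0| ≤ CP := by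
  have hπ := Real.pi_pos
  unfold Pot CP
  rw [abs_mul, abs_neg, abs_of_pos (by positivity : 0 < 1/π)]
  have : |∫ τ in 0..π, Real.log (0 - Real.cos τ) * (Q (b, Real.cos τ) * Real.sin τ^2)| ≤ ∫ τ in 0..π, |Real.log (0 - Real.cos τ)| * (4/3) := by
    rw [← Real.norm_eq_abs]
    refine intervalIntegral.norm_integral_le_of_norm_le hπ.le (Filter.Eventually.of_forall fun τ _ => ?_) ((log_cos_int 0 _ _).abs.mul_const _)
    rw [norm_mul, Real.norm_eq_abs]
    refine mul_le_mul_of_nonneg_left ?_ (abs_nonneg _)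
    rw [norm_mul, Real.norm_eq_abs, Real.norm_eq_abs, abs_of_nonneg (sq_nonneg (Real.sin τ))]
    have h1 := h.abs_le (b, Real.cos τ)
    have h2 := Real.sin_sq_le_one τ
    nlinarith [abs_nonneg (Q (b, Real.cos τ)), sq_nonneg (Real.sin τ)]
  rw [intervalIntegral.integral_mul_const] at this
  calc _ ≤ 1/π * ((∫ τ in 0..π, |Real.log (0 - Real.cos τ)|) * (4/3)) := mul_le_mul_of_nonneg_left this (by positivity)
    _ = _ := by ring

lemma IsQ.bsum_bd (h : IsQ b0 β Q) (b : ℝ) : |(1/π)*∑' k, β k * yk b0 k Q b| ≤ RB := by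
  have hπ := Real.pi_pos
  rw [abs_mul, abs_of_pos (by positivity : 0 < 1/π)]
  have h1 : |∑' k, β k * yk b0 k Q b| ≤ ∑' k : ℕ, (2*(7/(k:ℝ)^3)) * ((2/3)*π) := by
    refine tsum_of_norm_bounded (cube_summable.mul_right _).hasSum fun k => (h.ybound b k).trans ?_
    have := (h.hβ k).2
    calc β k * (π*(4/3)) ≤ 7/(k:ℝ)^3 * (π*(4/3)) := by gcongr
      _ = _ := by ring
  rw [tsum_mul_right] at h1
  have hRB : ∑' k : ℕ, (2*(7/(k:ℝ)^3)) = RB := rfl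
  rw [hRB] at h1
  have h2 := RB_nonneg
  calc _ ≤ 1/π*(RB*((2/3)*π)) := mul_le_mul_of_nonneg_left h1 (by positivity)
    _ = (2/3)*RB := by field_simp
    _ ≤ RB := by linarith

lemma IsQ.kap_bd (h : IsQ b0 β Q) (b : ℝ) : |kap b0 β Q b + 1| ≤ om b := by
  have h1 := h.nQ_bd b
  have h2 := h.Pot_bd b
  have h3 := h.bsum_bd b
  set P := Pot (fun y => Q (b,y)) 0
  set S := (1/π)*∑' k, β k * yk b0 k Q b with hS
  have e : kap b0 β Q b + 1 = -(((4*b^2)*Real.log (4*b^2)) * (nQ Q b/4)) + (4*b^2*P + 4*b^2*S) := by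
    unfold kap; ring
  rw [e]
  refine (abs_add_le _ _).trans ?_
  unfold om
  apply add_le_add
  · rw [abs_neg, abs_mul, mul_comm, abs_of_nonneg (by linarith : 0 ≤ nQ Q b/4)]
    exact mul_le_mul_of_nonneg_right (by linarith) (abs_nonneg _)
  · rw [← mul_add, abs_mul, abs_of_nonneg (by positivity : 0 ≤ 4*b^2)]
    exact mul_le_mul_of_nonneg_left ((abs_add_le _ _).trans (by linarith)) (by positivity)

lemma IsQ.nQ_cont (h : IsQ b0 β Q) : Continuous (nQ Q) := by
  unfold nQ
  have : Continuous (fun p : ℝ × ℝ => Q (p.1, Real.cos p.2) * Real.sin p.2^2) :=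
    (h.cont.comp (by fun_prop)).mul (by fun_prop)
  exact continuous_const.mul (intervalIntegral.continuous_parametric_intervalIntegral_of_continuous' this 0 π)

lemma IsQ.Pot_cont (h : IsQ b0 β Q) : Continuous (fun b => Pot (fun y => Q (b,y)) 0) := by
  unfold Pot
  refine continuous_const.mul ?_
  refine intervalIntegral.continuous_of_dominated_interval (bound := fun τ => |Real.log (0 - Real.cos τ)| * (4/3)) ?_ ?_ ?_ ?_
  · intro b
    have h1 : Measurable (fun τ => Real.log (0 - Real.cos τ)) := Real.measurable_log.comp (by fun_prop)
    have h2 : Continuous (fun τ => Q (b, Real.cos τ) * Real.sin τ^2) := (h.cont.comp (by fun_prop)).mul (by fun_prop)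
    exact (h1.mul h2.measurable).aestronglyMeasurable
  · intro b
    refine Filter.Eventually.of_forall fun τ _ => ?_
    rw [norm_mul, Real.norm_eq_abs]
    refine mul_le_mul_of_nonneg_left ?_ (abs_nonneg _)
    rw [norm_mul, Real.norm_eq_abs, Real.norm_eq_abs, abs_of_nonneg (sq_nonneg (Real.sin τ))]
    have h1 := h.abs_le (b, Real.cos τ)
    have h2 := Real.sin_sq_le_one τ
    nlinarith [abs_nonneg (Q (b, Real.cos τ)), sq_nonneg (Real.sin τ)]
  · exact (log_cos_int 0 _ _).abs.mul_const _
  · refine Filter.Eventually.of_forall fun τ _ => ?_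
    exact continuous_const.mul ((h.cont.comp (by fun_prop)).mul continuous_const)

lemma IsQ.kap_cont (h : IsQ b0 β Q) : Continuous (kap b0 β Q) := by
  have h1 := h.nQ_cont
  have h2 := h.Pot_cont
  have h3 : Continuous (fun b => ∑' k, β k * yk b0 k Q b) :=
    continuous_tsum (fun k => continuous_const.mul (yk_cont b0 k h.cont)) h.bysum (fun k b => h.ybound b k)
  have h4 : Continuous (fun b : ℝ => (4*b^2)*Real.log (4*b^2)) := Real.continuous_mul_log.comp (by fun_prop : Continuous fun b : ℝ => 4*b^2)
  have e : kap b0 β Q = fun b => -1 - ((4*b^2)*Real.log (4*b^2))*(nQ Q b/4) + 4*b^2*Pot (fun y => Q (b,y)) 0 + 4*b^2*((1/π)*∑' k, β k * yk b0 k Q b) := by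
    ext b; unfold kap; ring
  rw [e]
  fun_prop

lemma IsQ.out_zero (Q : ℝ × ℝ → ℝ) (b : ℝ) {x : ℝ} (hx0 : 0 ≤ x) (hx : x ≤ 1) : ∫ y in 0..x, √(y^2-1)*Q (b,y) = 0 := by
  have : ∫ y in 0..x, √(y^2-1)*Q (b,y) = ∫ y in 0..x, (0:ℝ) := by
    refine intervalIntegral.integral_congr fun y hy => ?_
    rw [uIcc_of_le hx0] at hy
    have : y^2-1 ≤ 0 := by nlinarith [hy.1, hy.2]
    simp [Real.sqrt_eq_zero_of_nonpos this]
  rw [this]; simp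

lemma IsQ.out_pos (h : IsQ b0 β Q) (b : ℝ) {x : ℝ} (hx : 1 < x) : 0 < ∫ y in 0..x, √(y^2-1)*Q (b,y) := by
  have hc : Continuous (fun y => √(y^2-1)*Q (b,y)) := (by fun_prop : Continuous fun y : ℝ => √(y^2-1)).mul (h.qcont b)
  rw [← intervalIntegral.integral_add_adjacent_intervals (hc.intervalIntegrable 0 1) (hc.intervalIntegrable 1 x),
    IsQ.out_zero Q b zero_le_one le_rfl, zero_add]
  refine intervalIntegral.intervalIntegral_pos_of_pos_on (hc.intervalIntegrable _ _) (fun y hy => ?_) hx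
  have h1 := (h.bd (b,y)).1
  have : 0 < y^2-1 := by nlinarith [hy.1]
  have := Real.sqrt_pos.2 this
  have : 0 < Q (b,y) := by linarith
  positivity
end

structure SlitSol (α : ℝ) (β : ℕ → ℝ) (a : ℝ) (g : ℝ → ℝ) : Prop where
  a_pos : 0 < a
  a_le : a ≤ π/3
  cont : Continuous g
  even : ∀ t, g (-t) = g t
  nonneg : ∀ t, |t| ≤ π → 0 ≤ g t
  zero : ∀ t, a ≤ |t| → |t| ≤ π → g t = 0
  eqn : ∀ s, |s| ≤ a → ∫ t in -π..π, (LA 1 (s-t) + α + RR β (s-t)) * g t = Real.cos s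
  gt : ∀ s, a < |s| → |s| ≤ π → Real.cos s < ∫ t in -π..π, (LA 1 (s-t) + α + RR β (s-t)) * g t
  mass_lo : 1/2 ≤ α * ∫ t in -π..π, g t
  mass_hi : α * ∫ t in -π..π, g t ≤ 3/2

lemma kernel_even (α : ℝ) (β : ℕ → ℝ) {g : ℝ → ℝ} (hg : ∀ t, g (-t) = g t) (s : ℝ) :
    ∫ t in -π..π, (LA 1 (-s-t) + α + RR β (-s-t)) * g t = ∫ t in -π..π, (LA 1 (s-t) + α + RR β (s-t)) * g t := by
  rw [← even_int hg (fun t => LA 1 (s-t) + α + RR β (s-t))]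
  refine intervalIntegral.integral_congr fun t _ => ?_
  have e : -s - t = -(s - -t) := by ring
  rw [e]
  have e1 : LA 1 (-(s - -t)) = LA 1 (s - -t) := by rw [LA_one, LA_one, Real.cos_neg]
  have e2 : RR β (-(s - -t)) = RR β (s - -t) := by unfold RR; simp only [mul_neg, Real.cos_neg]
  rw [e1, e2]

lemma IsQ.slit {b0 : ℝ} {β : ℕ → ℝ} {Q : ℝ × ℝ → ℝ} (h : IsQ b0 β Q) {b : ℝ} (hb : 0 < b) (hb' : b ≤ b0) {α : ℝ}
    (hα : Real.log 4 + RB < α) (hH : α*(b^2*nQ Q b) + kap b0 β Q b = 0) (hk : om b ≤ 1/2) :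
    SlitSol α β (2*Real.arcsin b) (gd b (fun y => Q (b,y))) := by
  have hπ := Real.pi_pos
  have hb1 : b ≤ 1/2 := hb'.trans h.h1
  have hasin : Real.arcsin b ≤ π/6 := by
    rw [Real.arcsin_le_iff_le_sin ⟨by linarith, by linarith⟩ ⟨by linarith, by linarith⟩, Real.sin_pi_div_six]; exact hb1
  have hsina : Real.sin (Real.arcsin b) = b := Real.sin_arcsin (by linarith) (by linarith)
  have hge : ∀ t, gd b (fun y => Q (b,y)) (-t) = gd b (fun y => Q (b,y)) t := gd_even b (q := fun y => Q (b,y)) (fun x => h.even b x)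
  have hgc := gd_cont b (h.qcont b)
  have hnn : ∀ t, |t| ≤ π → 0 ≤ gd b (fun y => Q (b,y)) t := fun t ht => gd_nonneg hb (fun x => by have := (h.bd (b,x)).1; linarith) ht
  have hmass := h.mass hb hb'
  have hn := h.nQ_bd b
  have hmpos : 0 < ∫ t in -π..π, gd b (fun y => Q (b,y)) t := by
    rw [hmass]; have : 0 < nQ Q b := by linarith
    positivity
  have hkb := _root_.abs_le.1 ((h.kap_bd b).trans hk)
  have hpos : 0 < Real.arcsin b := Real.arcsin_pos.2 hb
  constructor
  · linarith
  · linarith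
  · exact hgc
  · exact hge
  · exact hnn
  · intro t ht ht'; exact gd_zero hb hb1 _ ht' ht
  · have key : ∀ s, 0 ≤ s → s ≤ 2*Real.arcsin b → ∫ t in -π..π, (LA 1 (s-t) + α + RR β (s-t)) * gd b (fun y => Q (b,y)) t = Real.cos s := by
      intro s hs0 hs
      rw [h.U_eq hb hb' α hs0 (by linarith), hH]
      have : Real.sin (s/2)/b ≤ 1 := by
        rw [div_le_one hb, ← hsina]
        exact Real.sin_le_sin_of_le_of_le_pi_div_two (by linarith) (by linarith) (by linarith)
      have h0 : 0 ≤ Real.sin (s/2)/b := div_nonneg (Real.sin_nonneg_of_nonneg_of_le_pi (by linarith) (by linarith)) hb.le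
      rw [IsQ.out_zero Q b h0 this]; ring
    intro s hs
    rcases abs_cases s with ⟨e, _⟩ | ⟨e, _⟩
    · exact key s (by linarith) (by linarith)
    · rw [e] at hs
      rw [← Real.cos_neg s, ← key (-s) (by linarith) hs, kernel_even α β hge]
  · have key : ∀ s, 0 ≤ s → 2*Real.arcsin b < s → s ≤ π → Real.cos s < ∫ t in -π..π, (LA 1 (s-t) + α + RR β (s-t)) * gd b (fun y => Q (b,y)) t := by
      intro s hs0 hs hsπ
      rcases le_total s (π/2) with h2 | h2
      · rw [h.U_eq hb hb' α hs0 h2, hH]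
        have : 1 < Real.sin (s/2)/b := by
          rw [lt_div_iff₀ hb, one_mul]
          calc b = Real.sin (Real.arcsin b) := hsina.symm
            _ < _ := Real.sin_lt_sin_of_lt_of_le_pi_div_two (by linarith) (by linarith) (by linarith)
        have := h.out_pos b this
        have : 0 < 4*b^2*∫ y in 0..(Real.sin (s/2)/b), √(y^2-1)*Q (b,y) := by positivity
        linarith
      · have hc : Real.cos s ≤ 0 := Real.cos_nonpos_of_pi_div_two_le_of_le h2 (by linarith)
        have hRc := RR_cont h.hβ
        have h3 : ∫ t in -π..π, (α - Real.log 4 - RB) * gd b (fun y => Q (b,y)) t ≤ ∫ t in -π..π, (LA 1 (s-t) + α + RR β (s-t)) * gd b (fun y => Q (b,y)) t := by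
          refine intervalIntegral.integral_mono_on (by linarith) ((by fun_prop : Continuous _).intervalIntegrable _ _) ?_ (fun t ht => ?_)
          · exact (((LA_sub_int (by norm_num) le_rfl s _ _).add intervalIntegrable_const).add
              ((by fun_prop : Continuous fun t => RR β (s-t)).intervalIntegrable _ _)).mul_continuousOn hgc.continuousOn
          · refine mul_le_mul_of_nonneg_right ?_ (hnn t (_root_.abs_le.2 ht))
            have h4 := LA_ge (r := 1) (by norm_num) le_rfl (s-t)
            have h5 := _root_.abs_le.1 (RR_bound h.hβ (s-t))
            linarith [h5.1]
        rw [intervalIntegral.integral_const_mul] at h3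
        have : 0 < (α - Real.log 4 - RB) * ∫ t in -π..π, gd b (fun y => Q (b,y)) t := mul_pos (by linarith) hmpos
        linarith
    intro s hs hs'
    rcases abs_cases s with ⟨e, _⟩ | ⟨e, _⟩
    · exact key s (by linarith) (by linarith) (by linarith)
    · rw [e] at hs hs'
      rw [← Real.cos_neg s, ← kernel_even α β hge]
      exact key (-s) (by linarith) hs hs'
  · rw [hmass]; linarith [hkb.2]
  · rw [hmass]; linarith [hkb.1]

theorem exists_slit (ε : ℝ) (hε : 0 < ε) : ∃ A0 : ℝ, ∀ β : ℕ → ℝ, (∀ k, 0 ≤ β k ∧ β k ≤ 7/(k:ℝ)^3) → ∀ α, A0 ≤ α →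
    ∃ a g, a < ε*π ∧ SlitSol α β a g := by
  have hπ := Real.pi_pos
  have e1 : ∀ᶠ b in nhds (0:ℝ), om b < 1/2 := om_cont.continuousAt.eventually_lt_const (by rw [om_zero]; norm_num)
  have e2 : ∀ᶠ b in nhds (0:ℝ), C1*b^(7/4:ℝ)*S2 < 1/4 := by
    have : Continuous (fun b : ℝ => C1*b^(7/4:ℝ)*S2) := by
      have := Real.continuous_rpow_const (q := 7/4) (by norm_num)
      fun_prop
    refine this.continuousAt.eventually_lt_const ?_
    beta_reduce
    rw [Real.zero_rpow (by norm_num)]; norm_num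
  have e3 : ∀ᶠ b in nhds (0:ℝ), b < min (1/2) ε := Iio_mem_nhds (by positivity)
  obtain ⟨r, hr, hball⟩ := Metric.eventually_nhds_iff.1 ((e1.and e2).and e3)
  set b0 := r/2 with hb0
  have hb0p : 0 < b0 := by positivity
  have hall : ∀ b, 0 ≤ b → b ≤ b0 → om b < 1/2 ∧ C1*b^(7/4:ℝ)*S2 < 1/4 ∧ b < 1/2 ∧ b < ε := by
    intro b h0 h1
    have := hball (y := b) (by rw [Real.dist_eq, sub_zero, abs_of_nonneg h0]; linarith)
    exact ⟨this.1.1, this.1.2, lt_of_lt_of_le this.2 (min_le_left _ _), lt_of_lt_of_le this.2 (min_le_right _ _)⟩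
  have H0 := hall b0 hb0p.le le_rfl
  refine ⟨Real.log 4 + RB + 1 + 3/b0^2, fun β hβ α hα => ?_⟩
  obtain ⟨Q, q1, q2, q3⟩ := exists_Q hb0p.le H0.2.2.1.le H0.2.1.le hβ
  have hQ : IsQ b0 β Q := ⟨hb0p, H0.2.2.1.le, hβ, q1, q2, q3⟩
  have hRB := RB_nonneg
  have hl4 : 0 ≤ Real.log 4 := Real.log_nonneg (by norm_num)
  have hp3 : 0 < 3/b0^2 := by positivity
  set H : ℝ → ℝ := fun b => α*(b^2*nQ Q b) + kap b0 β Q b with hH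
  have hHc : Continuous H := by
    have := hQ.nQ_cont
    have := hQ.kap_cont
    fun_prop
  have H_0 : H 0 < 0 := by
    have := _root_.abs_le.1 (hQ.kap_bd 0)
    rw [om_zero] at this
    simp only [hH]; simp; linarith [this.2]
  have H_1 : 0 < H b0 := by
    have h1 := _root_.abs_le.1 ((hQ.kap_bd b0).trans H0.1.le)
    have h2 := hQ.nQ_bd b0
    have h3 : 2 ≤ α*(b0^2*nQ Q b0) := by
      calc 2 = (3/b0^2)*(b0^2*(2/3)) := by field_simp
        _ ≤ α*(b0^2*nQ Q b0) := mul_le_mul (by linarith) (mul_le_mul_of_nonneg_left h2.1 (by positivity)) (by positivity) (by linarith)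
    simp only [hH]; linarith [h1.1]
  obtain ⟨b, hb, hbH⟩ := intermediate_value_Ioo hb0p.le hHc.continuousOn ⟨H_0, H_1⟩
  have Hb := hall b hb.1.le hb.2.le
  refine ⟨_, _, ?_, hQ.slit hb.1 hb.2.le (by linarith) hbH Hb.1.le⟩
  have : Real.arcsin b ≤ π/2*b := by
    rw [Real.arcsin_le_iff_le_sin ⟨by linarith [hb.1], by linarith [Hb.2.2.1]⟩
      ⟨by nlinarith [hb.1], by nlinarith [Hb.2.2.1]⟩]
    have := Real.mul_le_sin (x := π/2*b) (by have := hb.1; positivity) (by nlinarith [Hb.2.2.1])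
    calc b = 2/π*(π/2*b) := by field_simp
      _ ≤ _ := this
  nlinarith [Hb.2.2.2]
end TO

namespace TO

lemma LA_cont {r : ℝ} (h0 : 0 ≤ r) (h1 : r < 1) : Continuous (LA r) := by
  unfold LA
  refine (Continuous.log (by fun_prop) fun θ => ?_).neg
  have : 0 < (1-r)^2 := by have : 0 < 1 - r := by linarith
                           positivity
  nlinarith [Real.cos_le_one θ]

lemma LAi_cont {r : ℝ} (h0 : 0 ≤ r) (h1 : r < 1) {g : ℝ → ℝ} (hg : Continuous g) :
    Continuous (fun s => ∫ t in -π..π, LA r (s-t) * g t) := by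
  refine intervalIntegral.continuous_parametric_intervalIntegral_of_continuous' ?_ _ _
  have := LA_cont h0 h1
  change Continuous (fun p : ℝ × ℝ => LA r (p.1-p.2) * g p.2)
  fun_prop

lemma Dm_per : Function.Periodic Dm (2*π) := by
  intro x; unfold Dm; rw [Real.sin_add_two_pi]

lemma Dm_shift (s : ℝ) : ∫ t in -π..π, Dm (s-t) = ∫ t in -π..π, Dm t := by
  rw [intervalIntegral.integral_comp_sub_left]
  have := Dm_per.intervalIntegral_add_eq (s-π) (-π)
  rw [show s - -π = s - π + 2*π by ring, this, show -π + 2*π = π by ring]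

lemma LAi_bound {r : ℝ} (h0 : 0 ≤ r) (h1 : r ≤ 1) {g : ℝ → ℝ} {G : ℝ} (hG : ∀ t, |t| ≤ π → |g t| ≤ G) (s : ℝ) :
    |∫ t in -π..π, LA r (s-t) * g t| ≤ (∫ t in -π..π, Dm t) * G := by
  have hπ := Real.pi_pos
  rw [← Dm_shift s, ← intervalIntegral.integral_mul_const, ← Real.norm_eq_abs]
  refine intervalIntegral.norm_integral_le_of_norm_le (by linarith) ?_ ((Dm_sub_int s _ _).mul_const _)
  filter_upwards [sin_sub_ne_ae s] with t ht ht'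
  rw [norm_mul]
  exact mul_le_mul (LA_abs_le h0 h1 ht) (hG t (_root_.abs_le.2 ⟨by linarith [ht'.1], ht'.2⟩)) (norm_nonneg _) (Dm_nonneg _)

lemma exists_bd {g : ℝ → ℝ} (hg : Continuous g) : ∃ G, 0 ≤ G ∧ ∀ t, |t| ≤ π → |g t| ≤ G := by
  obtain ⟨C, hC⟩ := isCompact_Icc.exists_bound_of_continuousOn (s := Icc (-π) π) hg.continuousOn
  have h0 := hC 0 ⟨by linarith [Real.pi_pos], Real.pi_pos.le⟩
  exact ⟨C, (norm_nonneg _).trans h0, fun t ht => hC t (_root_.abs_le.1 ht)⟩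

lemma near_one : ∀ᶠ r : ℝ in nhdsWithin 1 (Iio 1), 0 ≤ r ∧ r < 1 := by
  have h1 : ∀ᶠ r : ℝ in nhds 1, 0 < r := Ioi_mem_nhds one_pos
  filter_upwards [nhdsWithin_le_nhds h1, self_mem_nhdsWithin] with r h h' using ⟨h.le, h'⟩

lemma LAi_meas {g : ℝ → ℝ} (hg : Continuous g) :
    MeasureTheory.AEStronglyMeasurable (fun s => ∫ t in -π..π, LA 1 (s-t) * g t) MeasureTheory.volume := by
  have hs : Tendsto (fun n : ℕ => 1 - 1/((n:ℝ)+1)) atTop (nhdsWithin 1 (Iio 1)) := by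
    refine tendsto_nhdsWithin_iff.2 ⟨?_, Filter.Eventually.of_forall fun n => ?_⟩
    · simpa using (tendsto_const_nhds (x := (1:ℝ))).sub (tendsto_one_div_add_atTop_nhds_zero_nat (𝕜 := ℝ))
    · have : 0 < 1/((n:ℝ)+1) := by positivity
      simp only [mem_Iio]; linarith
  refine aestronglyMeasurable_of_tendsto_ae (u := atTop) (f := fun (n : ℕ) s => ∫ t in -π..π, LA (1 - 1/((n:ℝ)+1)) (s-t) * g t)
    (fun n => ?_) (Filter.Eventually.of_forall fun s => (LA_tendsto s (-π) π hg).comp hs)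
  refine (LAi_cont ?_ ?_ hg).aestronglyMeasurable
  · have : 1/((n:ℝ)+1) ≤ 1 := by rw [div_le_one (by positivity)]; linarith [(Nat.cast_nonneg n : (0:ℝ) ≤ n)]
    linarith
  · have : 0 < 1/((n:ℝ)+1) := by positivity
    linarith

lemma LAi_int {f g : ℝ → ℝ} (hf : Continuous f) (hg : Continuous g) :
    IntervalIntegrable (fun s => f s * ∫ t in -π..π, LA 1 (s-t) * g t) MeasureTheory.volume (-π) π := by
  obtain ⟨G, hG0, hG⟩ := exists_bd hg
  refine IntervalIntegrable.continuousOn_mul ?_ hf.continuousOn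
  refine (intervalIntegrable_const (c := (∫ t in -π..π, Dm t) * G)).mono_fun (LAi_meas hg).restrict (Filter.Eventually.of_forall fun s => ?_)
  exact (LAi_bound zero_le_one le_rfl hG s).trans (le_abs_self _)

lemma LAi_tendsto {f g : ℝ → ℝ} (hf : Continuous f) (hg : Continuous g) :
    Tendsto (fun r => ∫ s in -π..π, f s * ∫ t in -π..π, LA r (s-t) * g t) (nhdsWithin 1 (Iio 1))
      (nhds (∫ s in -π..π, f s * ∫ t in -π..π, LA 1 (s-t) * g t)) := by
  obtain ⟨G, hG0, hG⟩ := exists_bd hg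
  refine intervalIntegral.tendsto_integral_filter_of_dominated_convergence (fun s => |f s| * ((∫ t in -π..π, Dm t) * G)) ?_ ?_ ?_ ?_
  · filter_upwards [near_one] with r hr
    exact (hf.mul (LAi_cont hr.1 hr.2 hg)).aestronglyMeasurable
  · filter_upwards [near_one] with r hr
    refine Filter.Eventually.of_forall fun s _ => ?_
    rw [norm_mul]
    exact mul_le_mul_of_nonneg_left (LAi_bound hr.1 hr.2.le hG s) (abs_nonneg _)
  · exact (by fun_prop : Continuous _).intervalIntegrable _ _
  · exact Filter.Eventually.of_forall fun s _ => (LA_tendsto s _ _ hg).const_mul _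

/-- cosine coefficient -/
noncomputable def ch (f : ℝ → ℝ) (n : ℕ) : ℝ := ∫ t in -π..π, Real.cos (n*t) * f t

lemma ch_bound {g : ℝ → ℝ} {G : ℝ} (hG : ∀ t, |t| ≤ π → |g t| ≤ G) (n : ℕ) : |ch g n| ≤ G * (2*π) := by
  have hπ := Real.pi_pos
  unfold ch
  have := intervalIntegral.norm_integral_le_of_norm_le_const (a := -π) (b := π) (C := G) (f := fun t => Real.cos (n*t) * g t) (fun t ht => by
    rw [uIoc_of_le (by linarith)] at ht
    rw [norm_mul, ← one_mul G]
    exact mul_le_mul (Real.abs_cos_le_one _) (hG t (_root_.abs_le.2 ⟨by linarith [ht.1], ht.2⟩)) (norm_nonneg _) zero_le_one)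
  rw [Real.norm_eq_abs, show |π - -π| = 2*π by rw [abs_of_pos (by linarith)]; ring] at this
  exact this

lemma LAi_sum {r : ℝ} (h0 : 0 ≤ r) (h1 : r < 1) {f g : ℝ → ℝ} (hf : Continuous f) (hg : Continuous g)
    (hge : ∀ t, g (-t) = g t) :
    HasSum (fun n : ℕ => 2*r^n/n * (ch f n * ch g n)) (∫ s in -π..π, f s * ∫ t in -π..π, LA r (s-t) * g t) := by
  obtain ⟨G, hG0, hG⟩ := exists_bd hg
  have hπ := Real.pi_pos
  have e : ∀ n : ℕ, 2*r^n/n * (ch f n * ch g n) = ∫ s in -π..π, f s * (2*r^n/n * (Real.cos (n*s) * ch g n)) := by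
    intro n
    rw [ch, ← intervalIntegral.integral_mul_const, ← intervalIntegral.integral_const_mul]
    refine intervalIntegral.integral_congr fun s _ => ?_
    ring
  simp_rw [e]
  refine intervalIntegral.hasSum_integral_of_dominated_convergence (fun n s => |f s| * (2*r^n * (G*(2*π)))) ?_ ?_ ?_ ?_ ?_
  · intro n; exact (by fun_prop : Continuous _).aestronglyMeasurable
  · intro n
    refine Filter.Eventually.of_forall fun s _ => ?_
    rw [norm_mul]
    refine mul_le_mul_of_nonneg_left ?_ (abs_nonneg _)
    rw [norm_mul, norm_mul]
    refine mul_le_mul ?_ ?_ (by positivity) (by positivity)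
    · rw [Real.norm_eq_abs, abs_of_nonneg (by positivity)]
      rcases Nat.eq_zero_or_pos n with h | h
      · subst h; simp
      · refine div_le_self (by positivity) (by exact_mod_cast h)
    · rw [← one_mul (G*(2*π))]
      exact mul_le_mul (Real.abs_cos_le_one _) (ch_bound hG n) (norm_nonneg _) zero_le_one
  · refine Filter.Eventually.of_forall fun s _ => ?_
    exact (((summable_geometric_of_lt_one h0 h1).mul_left 2).mul_right _).mul_left _
  · have : (fun s => ∑' n : ℕ, |f s| * (2*r^n * (G*(2*π)))) = fun s => |f s| * ∑' n : ℕ, (2*r^n * (G*(2*π))) := by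
      ext s; rw [tsum_mul_left]
    rw [this]
    exact (by fun_prop : Continuous _).intervalIntegrable _ _
  · refine Filter.Eventually.of_forall fun s _ => ?_
    have := (LA_int_hasSum h0 h1 s (-π) π hg).mul_left (f s)
    simp_rw [cos_shift_int hg hge] at this
    exact this

lemma LAi_cauchy {f g : ℝ → ℝ} (hf : Continuous f) (hg : Continuous g) (hfe : ∀ t, f (-t) = f t)
    (hge : ∀ t, g (-t) = g t) :
    2 * (∫ s in -π..π, f s * ∫ t in -π..π, LA 1 (s-t) * g t) ≤
      (∫ s in -π..π, f s * ∫ t in -π..π, LA 1 (s-t) * f t) + ∫ s in -π..π, g s * ∫ t in -π..π, LA 1 (s-t) * g t := by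
  refine le_of_tendsto_of_tendsto ((LAi_tendsto hf hg).const_mul 2) ((LAi_tendsto hf hf).add (LAi_tendsto hg hg)) ?_
  filter_upwards [near_one] with r hr
  refine hasSum_le ?_ ((LAi_sum hr.1 hr.2 hf hg hge).mul_left 2) ((LAi_sum hr.1 hr.2 hf hf hfe).add (LAi_sum hr.1 hr.2 hg hg hge))
  intro n
  have : 0 ≤ 2*r^n/n := by have := hr.1; positivity
  nlinarith [mul_nonneg this (sq_nonneg (ch f n - ch g n))]


lemma RRi_cont {β : ℕ → ℝ} (hβ : ∀ k, 0 ≤ β k ∧ β k ≤ 7/(k:ℝ)^3) {g : ℝ → ℝ} (hg : Continuous g) : Continuous (fun s => ∫ t in -π..π, RR β (s-t) * g t) := by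
  refine intervalIntegral.continuous_parametric_intervalIntegral_of_continuous' ?_ _ _
  have := RR_cont hβ
  change Continuous (fun p : ℝ × ℝ => RR β (p.1-p.2) * g p.2)
  fun_prop

lemma RRi_sum {β : ℕ → ℝ} (hβ : ∀ k, 0 ≤ β k ∧ β k ≤ 7/(k:ℝ)^3) {f g : ℝ → ℝ} (hf : Continuous f) (hg : Continuous g)
    (hge : ∀ t, g (-t) = g t) :
    HasSum (fun n : ℕ => 2*β n * (ch f n * ch g n)) (∫ s in -π..π, f s * ∫ t in -π..π, RR β (s-t) * g t) := by
  obtain ⟨G, hG0, hG⟩ := exists_bd hg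
  have hπ := Real.pi_pos
  have e : ∀ n : ℕ, 2*β n * (ch f n * ch g n) = ∫ s in -π..π, f s * (2*β n * (Real.cos (n*s) * ch g n)) := by
    intro n
    rw [ch, ← intervalIntegral.integral_mul_const, ← intervalIntegral.integral_const_mul]
    refine intervalIntegral.integral_congr fun s _ => ?_
    ring
  simp_rw [e]
  refine intervalIntegral.hasSum_integral_of_dominated_convergence (fun n s => |f s| * (2*(7/(n:ℝ)^3) * (G*(2*π)))) ?_ ?_ ?_ ?_ ?_
  · intro n; exact (by fun_prop : Continuous _).aestronglyMeasurable
  · intro n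
    refine Filter.Eventually.of_forall fun s _ => ?_
    rw [norm_mul]
    refine mul_le_mul_of_nonneg_left ?_ (abs_nonneg _)
    rw [norm_mul (2*β n), norm_mul (Real.cos _)]
    refine mul_le_mul ?_ ?_ (by positivity) (by positivity)
    · rw [Real.norm_eq_abs, abs_of_nonneg (by have := (hβ n).1; positivity)]
      linarith [(hβ n).2]
    · rw [← one_mul (G*(2*π))]
      exact mul_le_mul (Real.abs_cos_le_one _) (ch_bound hG n) (norm_nonneg _) zero_le_one
  · refine Filter.Eventually.of_forall fun s _ => ?_
    exact (cube_summable.mul_right _).mul_left _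
  · have : (fun s => ∑' n : ℕ, |f s| * (2*(7/(n:ℝ)^3) * (G*(2*π)))) = fun s => |f s| * ∑' n : ℕ, (2*(7/(n:ℝ)^3) * (G*(2*π))) := by
      ext s; rw [tsum_mul_left]
    rw [this]
    exact (by fun_prop : Continuous _).intervalIntegrable _ _
  · refine Filter.Eventually.of_forall fun s _ => ?_
    have := (RR_int hβ hg s).mul_left (f s)
    simp_rw [cos_shift_int hg hge] at this
    exact this

lemma V_split {β : ℕ → ℝ} (hβ : ∀ k, 0 ≤ β k ∧ β k ≤ 7/(k:ℝ)^3) (α : ℝ) {g : ℝ → ℝ} (hg : Continuous g) (s : ℝ) :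
    ∫ t in -π..π, (LA 1 (s-t) + α + RR β (s-t)) * g t =
      (∫ t in -π..π, LA 1 (s-t) * g t) + α * (∫ t in -π..π, g t) + ∫ t in -π..π, RR β (s-t) * g t := by
  have hRc := RR_cont hβ
  have i1 := (LA_sub_int (r := 1) (by norm_num) le_rfl s (-π) π).mul_continuousOn hg.continuousOn
  have i2 : IntervalIntegrable (fun t => α * g t) MeasureTheory.volume (-π) π := (by fun_prop : Continuous _).intervalIntegrable _ _
  have i3 : IntervalIntegrable (fun t => RR β (s-t) * g t) MeasureTheory.volume (-π) π := (by fun_prop : Continuous _).intervalIntegrable _ _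
  rw [← intervalIntegral.integral_const_mul, ← intervalIntegral.integral_add i1 i2, ← intervalIntegral.integral_add (i1.add i2) i3]
  refine intervalIntegral.integral_congr fun t _ => ?_
  ring

lemma V_int {β : ℕ → ℝ} (hβ : ∀ k, 0 ≤ β k ∧ β k ≤ 7/(k:ℝ)^3) (α : ℝ) {f g : ℝ → ℝ} (hf : Continuous f) (hg : Continuous g) :
    IntervalIntegrable (fun s => f s * ∫ t in -π..π, (LA 1 (s-t) + α + RR β (s-t)) * g t) MeasureTheory.volume (-π) π := by
  simp_rw [V_split hβ α hg]
  have h3 := RRi_cont hβ hg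
  have i1 := LAi_int hf hg
  have i2 : IntervalIntegrable (fun s => f s * (α * (∫ t in -π..π, g t) + ∫ t in -π..π, RR β (s-t) * g t)) MeasureTheory.volume (-π) π :=
    (by fun_prop : Continuous _).intervalIntegrable _ _
  refine (i1.add i2).congr fun s _ => ?_
  ring

lemma V_eq {β : ℕ → ℝ} (hβ : ∀ k, 0 ≤ β k ∧ β k ≤ 7/(k:ℝ)^3) (α : ℝ) {f g : ℝ → ℝ} (hf : Continuous f) (hg : Continuous g) :
    ∫ s in -π..π, f s * ∫ t in -π..π, (LA 1 (s-t) + α + RR β (s-t)) * g t =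
      (∫ s in -π..π, f s * ∫ t in -π..π, LA 1 (s-t) * g t) + α * ((∫ t in -π..π, f t) * (∫ t in -π..π, g t))
       + ∫ s in -π..π, f s * ∫ t in -π..π, RR β (s-t) * g t := by
  simp_rw [V_split hβ α hg]
  have h3 := RRi_cont hβ hg
  have i1 := LAi_int hf hg
  have i2 : IntervalIntegrable (fun s => f s * (α * ∫ t in -π..π, g t)) MeasureTheory.volume (-π) π := (by fun_prop : Continuous _).intervalIntegrable _ _
  have i3 : IntervalIntegrable (fun s => f s * ∫ t in -π..π, RR β (s-t) * g t) MeasureTheory.volume (-π) π := (by fun_prop : Continuous _).intervalIntegrable _ _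
  rw [show α * ((∫ t in -π..π, f t) * (∫ t in -π..π, g t)) = (∫ t in -π..π, f t) * (α * ∫ t in -π..π, g t) by ring]
  rw [← intervalIntegral.integral_mul_const, ← intervalIntegral.integral_add i1 i2, ← intervalIntegral.integral_add (i1.add i2) i3]
  refine intervalIntegral.integral_congr fun t _ => ?_
  ring

lemma V_cauchy {β : ℕ → ℝ} (hβ : ∀ k, 0 ≤ β k ∧ β k ≤ 7/(k:ℝ)^3) {α : ℝ} (hα : 0 ≤ α) {f g : ℝ → ℝ} (hf : Continuous f) (hg : Continuous g) (hfe : ∀ t, f (-t) = f t)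
    (hge : ∀ t, g (-t) = g t) :
    2 * (∫ s in -π..π, f s * ∫ t in -π..π, (LA 1 (s-t) + α + RR β (s-t)) * g t) ≤
      (∫ s in -π..π, f s * ∫ t in -π..π, (LA 1 (s-t) + α + RR β (s-t)) * f t)
      + ∫ s in -π..π, g s * ∫ t in -π..π, (LA 1 (s-t) + α + RR β (s-t)) * g t := by
  rw [V_eq hβ α hf hg, V_eq hβ α hf hf, V_eq hβ α hg hg]
  have h1 := LAi_cauchy hf hg hfe hge
  have h2 : 2 * (∫ s in -π..π, f s * ∫ t in -π..π, RR β (s-t) * g t) ≤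
      (∫ s in -π..π, f s * ∫ t in -π..π, RR β (s-t) * f t) + ∫ s in -π..π, g s * ∫ t in -π..π, RR β (s-t) * g t := by
    refine hasSum_le ?_ ((RRi_sum hβ hf hg hge).mul_left 2) ((RRi_sum hβ hf hf hfe).add (RRi_sum hβ hg hg hge))
    intro n
    have : 0 ≤ 2*β n := by have := (hβ n).1; positivity
    nlinarith [mul_nonneg this (sq_nonneg (ch f n - ch g n))]
  nlinarith [mul_nonneg hα (sq_nonneg ((∫ t in -π..π, f t) - ∫ t in -π..π, g t))]

section
variable {α α' a a' : ℝ} {β β' : ℕ → ℝ} {g g' : ℝ → ℝ}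

lemma SlitSol.ge (h : SlitSol α β a g) {s : ℝ} (hs : |s| ≤ π) :
    Real.cos s ≤ ∫ t in -π..π, (LA 1 (s-t) + α + RR β (s-t)) * g t := by
  rcases le_or_gt |s| a with h1 | h1
  · exact (h.eqn s h1).ge
  · exact (h.gt s h1 hs).le

lemma SlitSol.self (h : SlitSol α β a g) {s : ℝ} (hs : |s| ≤ π) :
    g s * ∫ t in -π..π, (LA 1 (s-t) + α + RR β (s-t)) * g t = g s * Real.cos s := by
  rcases le_or_gt |s| a with h1 | h1
  · rw [h.eqn s h1]
  · rw [h.zero s h1.le hs]; ring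

lemma abs_le_pi {s : ℝ} (hs : s ∈ uIcc (-π) π) : |s| ≤ π := by
  rw [uIcc_of_le (by linarith [Real.pi_pos])] at hs; exact _root_.abs_le.2 hs

lemma SlitSol.compare (hβ : ∀ k, 0 ≤ β k ∧ β k ≤ 7/(k:ℝ)^3) (hβ' : ∀ k, 0 ≤ β' k ∧ β' k ≤ 7/(k:ℝ)^3) (hα : 0 ≤ α)
    (h : SlitSol α β a g) (h' : SlitSol α' β' a' g') {η : ℝ} (hη : ∀ s, |α - α' + (RR β s - RR β' s)| ≤ η) :
    (∫ t in -π..π, g' t * Real.cos t) - (∫ t in -π..π, g t * Real.cos t) ≤ η * (∫ t in -π..π, g' t)^2 := by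
  have hπ := Real.pi_pos
  have hc := h.cont
  have hc' := h'.cont
  have h1 := V_cauchy hβ hα hc' hc h'.even h.even
  have h2 : ∫ s in -π..π, g s * ∫ t in -π..π, (LA 1 (s-t) + α + RR β (s-t)) * g t = ∫ t in -π..π, g t * Real.cos t :=
    intervalIntegral.integral_congr fun s hs => h.self (abs_le_pi hs)
  have h3 : ∫ t in -π..π, g' t * Real.cos t ≤ ∫ s in -π..π, g' s * ∫ t in -π..π, (LA 1 (s-t) + α + RR β (s-t)) * g t := by
    refine intervalIntegral.integral_mono_on (by linarith) ((by fun_prop : Continuous _).intervalIntegrable _ _) (V_int hβ α hc' hc) fun s hs => ?_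
    have hs' := _root_.abs_le.2 hs
    exact mul_le_mul_of_nonneg_left (h.ge hs') (h'.nonneg s hs')
  have h4 : ∫ s in -π..π, g' s * ∫ t in -π..π, (LA 1 (s-t) + α + RR β (s-t)) * g' t ≤ ∫ s in -π..π, (g' s * Real.cos s + g' s * (η * ∫ t in -π..π, g' t)) := by
    refine intervalIntegral.integral_mono_on (by linarith) (V_int hβ α hc' hc') ((by fun_prop : Continuous _).intervalIntegrable _ _) fun s hs => ?_
    have hs' := _root_.abs_le.2 hs
    rw [← h'.self hs', ← mul_add]
    refine mul_le_mul_of_nonneg_left ?_ (h'.nonneg s hs')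
    have hR := RR_cont hβ
    have hR' := RR_cont hβ'
    rw [← intervalIntegral.integral_const_mul, ← intervalIntegral.integral_add]
    · refine intervalIntegral.integral_mono_on (by linarith) ?_ ?_ fun t ht => ?_
      · exact (((LA_sub_int (by norm_num) le_rfl s _ _).add intervalIntegrable_const).add
              ((by fun_prop : Continuous fun t => RR β (s-t)).intervalIntegrable _ _)).mul_continuousOn hc'.continuousOn
      · exact ((((LA_sub_int (by norm_num) le_rfl s _ _).add intervalIntegrable_const).add
              ((by fun_prop : Continuous fun t => RR β' (s-t)).intervalIntegrable _ _)).mul_continuousOn hc'.continuousOn).add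
              ((by fun_prop : Continuous _).intervalIntegrable _ _)
      · rw [← add_mul]
        refine mul_le_mul_of_nonneg_right ?_ (h'.nonneg t (_root_.abs_le.2 ht))
        have := (_root_.abs_le.1 (hη (s-t))).2
        linarith
    · exact (((LA_sub_int (by norm_num) le_rfl s _ _).add intervalIntegrable_const).add
              ((by fun_prop : Continuous fun t => RR β' (s-t)).intervalIntegrable _ _)).mul_continuousOn hc'.continuousOn
    · exact (by fun_prop : Continuous _).intervalIntegrable _ _
  rw [intervalIntegral.integral_add ((by fun_prop : Continuous _).intervalIntegrable _ _) ((by fun_prop : Continuous _).intervalIntegrable _ _),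
    intervalIntegral.integral_mul_const] at h4
  nlinarith

end
end TO

namespace TO

noncomputable def bet (m : ℕ) (a : ℕ → ℝ) (k : ℕ) : ℝ := if k < 2 then 0 else m * a (k*m) - 1/(k:ℝ)

lemma bet_bd {m : ℕ} {δ : ℝ} {a : ℕ → ℝ} (ha : IsA (MM m δ) a) (h0 : 0 < δ) (h1 : δ ≤ 1/2) (hm : 20 ≤ m) (k : ℕ) :
    0 ≤ bet m a k ∧ bet m a k ≤ 7/(k:ℝ)^3 := by
  unfold bet
  split_ifs with h
  · exact ⟨le_rfl, by positivity⟩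
  · exact ⟨ha.beta_nonneg h0 h1 hm (by omega), ha.beta_le h0 h1 hm (by omega)⟩

lemma RR_diff {β β' : ℕ → ℝ} (hβ : ∀ k, 0 ≤ β k ∧ β k ≤ 7/(k:ℝ)^3) (hβ' : ∀ k, 0 ≤ β' k ∧ β' k ≤ 7/(k:ℝ)^3) (s : ℝ) :
    |RR β s - RR β' s| ≤ ∑' k, 2*|β k - β' k| := by
  have hb : ∀ k, 2*|β k - β' k| ≤ 2*(7/(k:ℝ)^3) := by
    intro k
    have := hβ k
    have := hβ' k
    have : |β k - β' k| ≤ 7/(k:ℝ)^3 := by rw [_root_.abs_le]; constructor <;> linarith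
    linarith
  have hs : Summable (fun k => 2*|β k - β' k|) := Summable.of_nonneg_of_le (fun k => by positivity) hb cube_summable
  have := (RR_hasSum hβ s).sub (RR_hasSum hβ' s)
  rw [← this.tsum_eq]
  rw [← Real.norm_eq_abs]
  refine tsum_of_norm_bounded hs.hasSum fun k => ?_
  rw [show 2*β k*Real.cos (k*s) - 2*β' k*Real.cos (k*s) = (2*(β k - β' k))*Real.cos (k*s) by ring, norm_mul, norm_mul]
  rw [Real.norm_two, Real.norm_eq_abs, Real.norm_eq_abs]
  exact mul_le_of_le_one_right (by positivity) (Real.abs_cos_le_one _)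

section
variable {α a : ℝ} {β : ℕ → ℝ} {g : ℝ → ℝ}

lemma SlitSol.lam_le (h : SlitSol α β a g) : ∫ t in -π..π, g t * Real.cos t ≤ ∫ t in -π..π, g t := by
  have hπ := Real.pi_pos
  have hc := h.cont
  refine intervalIntegral.integral_mono_on (by linarith) ((by fun_prop : Continuous _).intervalIntegrable _ _) (hc.intervalIntegrable _ _) fun s hs => ?_
  exact mul_le_of_le_one_right (h.nonneg s (_root_.abs_le.2 hs)) (Real.cos_le_one _)

lemma SlitSol.lam_ge (h : SlitSol α β a g) : (∫ t in -π..π, g t)*(1/2) ≤ ∫ t in -π..π, g t * Real.cos t := by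
  have hπ := Real.pi_pos
  have hc := h.cont
  rw [← intervalIntegral.integral_mul_const]
  refine intervalIntegral.integral_mono_on (by linarith) ((by fun_prop : Continuous _).intervalIntegrable _ _) ((by fun_prop : Continuous _).intervalIntegrable _ _) fun s hs => ?_
  have hs' := _root_.abs_le.2 hs
  rcases le_total a |s| with h1 | h1
  · rw [h.zero s h1 hs']; simp
  · refine mul_le_mul_of_nonneg_left ?_ (h.nonneg s hs')
    rw [← Real.cos_pi_div_three, ← Real.cos_abs s]
    exact Real.cos_le_cos_of_nonneg_of_le_pi (abs_nonneg _) (by linarith) (h1.trans h.a_le)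

lemma SlitSol.mass_nonneg (h : SlitSol α β a g) : 0 ≤ ∫ t in -π..π, g t :=
  intervalIntegral.integral_nonneg (by linarith [Real.pi_pos]) fun t ht => h.nonneg t (_root_.abs_le.2 ht)
end

/-- main existence of parameters, first form -/
theorem exists_params0 (ε : ℝ) (hε : 0 < ε) : ∃ M : ℕ, ∀ m : ℕ, M ≤ m → Odd m → 20 ≤ m ∧
    ∃ (δ : ℝ) (c : ℕ → ℝ) (a : ℝ) (g : ℝ → ℝ), 0 < δ ∧ δ ≤ 1/2 ∧ δ < ε ∧ a < ε*π ∧ IsC (MM m δ) c ∧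
      SlitSol (m * an c 0) (bet m (an c)) a g ∧ 2*(1 - m * an c m)*(∫ t in -π..π, g t * Real.cos t) = 1 := by
  obtain ⟨A0, hA0⟩ := exists_slit ε hε
  set δ0 : ℝ := min (1/2) (min (ε/2) (1/(15*(|A0|+1)))) with hδ0
  have d0 : 0 < δ0 := by have := abs_nonneg A0; positivity
  have d1 : δ0 ≤ 1/2 := min_le_left _ _
  have d2 : δ0 ≤ ε/2 := (min_le_right _ _).trans (min_le_left _ _)
  have d3 : δ0 ≤ 1/(15*(|A0|+1)) := (min_le_right _ _).trans (min_le_right _ _)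
  obtain ⟨M, hM⟩ := exists_nat_ge ((16/δ0^2)^2)
  refine ⟨max 20 M, fun m hm ho => ?_⟩
  have hm20 : 20 ≤ m := (le_max_left _ _).trans hm
  refine ⟨hm20, ?_⟩
  have hmR : (20:ℝ) ≤ m := by exact_mod_cast hm20
  have hmM : 16/δ0^2 ≤ √m := by
    refine Real.le_sqrt_of_sq_le (hM.trans ?_)
    exact_mod_cast (le_max_right _ _).trans hm
  have ex : ∀ δ : ℝ, ∃ c, δ ∈ Ioc (0:ℝ) (1/2) → IsC (MM m δ) c := by
    intro δ
    by_cases h : δ ∈ Ioc (0:ℝ) (1/2)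
    · obtain ⟨c, hc⟩ := exists_isC (MM m δ) (MM_pos h.2) (MM_ne h.1 h.2)
      exact ⟨c, fun _ => hc⟩
    · exact ⟨0, fun h' => absurd h' h⟩
  choose c hc using ex
  have hA : ∀ δ ∈ Ioc (0:ℝ) (1/2), IsA (MM m δ) (an (c δ)) := fun δ h => (hc δ h).isA
  have acont := a_cont hm20 hA
  have ex2 : ∀ δ : ℝ, ∃ p : ℝ × (ℝ → ℝ), δ ∈ Ioc 0 δ0 → p.1 < ε*π ∧ SlitSol (m * an (c δ) 0) (bet m (an (c δ))) p.1 p.2 := by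
    intro δ
    by_cases h : δ ∈ Ioc 0 δ0
    · have hh : δ ∈ Ioc (0:ℝ) (1/2) := ⟨h.1, h.2.trans d1⟩
      obtain ⟨a, g, h1, h2⟩ := hA0 (bet m (an (c δ))) (bet_bd (hA δ hh) hh.1 hh.2 hm20) (m * an (c δ) 0) (by
        refine le_trans ?_ ((hA δ hh).alpha0_ge hh.1 hh.2 hm20 ho)
        have h3 := h.2.trans d3
        have hp : 0 < |A0| + 1 := by positivity
        rw [le_div_iff₀ (by positivity)] at h3
        rw [le_div_iff₀ (by have := h.1; positivity)]
        nlinarith [le_abs_self A0, h.1])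
      exact ⟨(a, g), fun _ => ⟨h1, h2⟩⟩
    · exact ⟨(0,0), fun h' => absurd h' h⟩
  choose p hp using ex2
  set L : ℝ → ℝ := fun δ => ∫ t in -π..π, (p δ).2 t * Real.cos t with hL
  have hh : ∀ {δ}, δ ∈ Ioc 0 δ0 → δ ∈ Ioc (0:ℝ) (1/2) := fun h => ⟨h.1, h.2.trans d1⟩
  have mhi : ∀ δ ∈ Ioc 0 δ0, ∫ t in -π..π, (p δ).2 t ≤ 45/2*δ := by
    intro δ h
    have h1 := (hp δ h).2.mass_hi
    have h2 := (hA δ (hh h)).alpha0_ge (hh h).1 (hh h).2 hm20 ho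
    have h3 := (hp δ h).2.mass_nonneg
    have h4 := mul_le_mul_of_nonneg_right h2 h3
    have h5 := h.1
    have : 1/(15*δ) * ∫ t in -π..π, (p δ).2 t ≤ 3/2 := h4.trans h1
    rw [div_mul_eq_mul_div, one_mul, div_le_iff₀ (by positivity)] at this
    linarith
  have mlo : ∀ δ ∈ Ioc 0 δ0, δ/4 ≤ ∫ t in -π..π, (p δ).2 t := by
    intro δ h
    have h1 := (hp δ h).2.mass_lo
    have h2 := (hA δ (hh h)).alpha0_le (hh h).1 (hh h).2 hm20 ho
    have h3 := (hp δ h).2.mass_nonneg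
    have h4 := mul_le_mul_of_nonneg_right h2 h3
    have h5 := h.1
    have : 1/2 ≤ 2/δ * ∫ t in -π..π, (p δ).2 t := h1.trans h4
    rw [div_mul_eq_mul_div, le_div_iff₀ (by positivity)] at this
    linarith
  have Lcont : ContinuousOn L (Ioc 0 δ0) := by
    intro δ h
    have hb : ∀ δ' ∈ Ioc 0 δ0, ∀ k, 0 ≤ bet m (an (c δ')) k ∧ bet m (an (c δ')) k ≤ 7/(k:ℝ)^3 := fun δ' h' =>
      bet_bd (hA δ' (hh h')) (hh h').1 (hh h').2 hm20
    have acw : ∀ n, Tendsto (fun δ' => an (c δ') n) (nhdsWithin δ (Ioc 0 δ0)) (nhds (an (c δ) n)) := fun n =>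
      ((acont n) δ (hh h)).mono (fun x hx => hh hx)
    set η : ℝ → ℝ := fun δ' => |m * an (c δ) 0 - m * an (c δ') 0| + ∑' k, 2*|bet m (an (c δ)) k - bet m (an (c δ')) k| with hη
    have ηt : Tendsto η (nhdsWithin δ (Ioc 0 δ0)) (nhds 0) := by
      have t1 : Tendsto (fun δ' => |m * an (c δ) 0 - m * an (c δ') 0|) (nhdsWithin δ (Ioc 0 δ0)) (nhds 0) := by
        have := ((tendsto_const_nhds (x := m * an (c δ) 0)).sub ((acw 0).const_mul (m:ℝ))).abs
        simpa using this
      have t2 : Tendsto (fun δ' => ∑' k, 2*|bet m (an (c δ)) k - bet m (an (c δ')) k|) (nhdsWithin δ (Ioc 0 δ0)) (nhds (∑' k : ℕ, (0:ℝ))) := by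
        refine tendsto_tsum_of_dominated_convergence cube_summable (fun k => ?_) ?_
        · by_cases hk : k < 2
          · simp only [bet, hk, if_true, sub_self, abs_zero, mul_zero]; exact tendsto_const_nhds
          · have := (((tendsto_const_nhds (x := m * an (c δ) (k*m) - 1/(k:ℝ))).sub (((acw (k*m)).const_mul (m:ℝ)).sub_const (1/(k:ℝ)))).abs).const_mul 2
            simpa [bet, hk] using this
        · filter_upwards [self_mem_nhdsWithin] with δ' h' k
          have q1 := hb δ h k
          have q2 := hb δ' h' k
          have : |bet m (an (c δ)) k - bet m (an (c δ')) k| ≤ 7/(k:ℝ)^3 := by rw [_root_.abs_le]; constructor <;> linarith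
          rw [Real.norm_eq_abs, abs_of_nonneg (by positivity)]
          linarith
      rw [tsum_zero] at t2
      simpa using t1.add t2
    have key : ∀ δ' ∈ Ioc 0 δ0, ‖L δ' - L δ‖ ≤ η δ' * 1000 := by
      intro δ' h'
      have e0 : ∀ s, |m * an (c δ) 0 - m * an (c δ') 0 + (RR (bet m (an (c δ))) s - RR (bet m (an (c δ'))) s)| ≤ η δ' := fun s =>
        (abs_add_le _ _).trans (add_le_add le_rfl (RR_diff (hb δ h) (hb δ' h') s))
      have e0' : ∀ s, |m * an (c δ') 0 - m * an (c δ) 0 + (RR (bet m (an (c δ'))) s - RR (bet m (an (c δ))) s)| ≤ η δ' := fun s => by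
        rw [← abs_neg]; convert e0 s using 2; ring
      have ηn : 0 ≤ η δ' := (abs_nonneg _).trans (e0 0)
      have pos : ∀ δ' ∈ Ioc 0 δ0, 0 ≤ m * an (c δ') 0 := fun δ' h' => by
        refine le_trans ?_ ((hA δ' (hh h')).alpha0_ge (hh h').1 (hh h').2 hm20 ho)
        have := h'.1; positivity
      have c1 := (hp δ h).2.compare (hb δ h) (hb δ' h') (pos δ h) (hp δ' h').2 e0
      have c2 := (hp δ' h').2.compare (hb δ' h') (hb δ h) (pos δ' h') (hp δ h).2 e0'
      have sq : ∀ δ' ∈ Ioc 0 δ0, (∫ t in -π..π, (p δ').2 t)^2 ≤ 1000 := by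
        intro δ' h'
        have := mhi δ' h'
        have n0 := (hp δ' h').2.mass_nonneg
        have : ∫ t in -π..π, (p δ').2 t ≤ 12 := by linarith [h'.2]
        nlinarith
      rw [Real.norm_eq_abs, _root_.abs_le]
      have s1 := mul_le_mul_of_nonneg_left (sq δ h) ηn
      have s2 := mul_le_mul_of_nonneg_left (sq δ' h') ηn
      constructor
      · linarith
      · linarith
    refine tendsto_iff_norm_sub_tendsto_zero.2 (squeeze_zero' (Filter.Eventually.of_forall fun _ => norm_nonneg _)
      (eventually_nhdsWithin_of_forall key) ?_)
    simpa using ηt.mul_const 1000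
  set δ1 : ℝ := min δ0 (1/(100*m)) with hδ1
  have h10 : 0 < δ1 := by positivity
  have h11 : δ1 ≤ δ0 := min_le_left _ _
  have h12 : δ1 ≤ 1/(100*m) := min_le_right _ _
  set ψ : ℝ → ℝ := fun δ => 2*(1 - m * an (c δ) m)*L δ with hψ
  have ψc : ContinuousOn ψ (Icc δ1 δ0) := by
    have s1 : Icc δ1 δ0 ⊆ Ioc 0 δ0 := fun x hx => ⟨h10.trans_le hx.1, hx.2⟩
    have := (acont m).mono (s1.trans fun x hx => hh hx)
    have := Lcont.mono s1
    fun_prop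
  have v0 : 1 ≤ ψ δ0 := by
    have hm0 : δ0 ∈ Ioc 0 δ0 := ⟨d0, le_rfl⟩
    have b := (hA δ0 (hh hm0)).B_ge d0 d1 hm20
    have l1 := (hp δ0 hm0).2.lam_ge
    have l2 := mlo δ0 hm0
    have l3 : δ0/8 ≤ L δ0 := by simp only [hL]; linarith
    have q : 16 ≤ √m*δ0^2 := by rwa [div_le_iff₀ (by positivity)] at hmM
    have : (δ0*√m/4)*(δ0/8) ≤ (1 - m * an (c δ0) m) * L δ0 := mul_le_mul b l3 (by positivity) (le_trans (by positivity) b)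
    simp only [hψ]
    nlinarith
  have v1 : ψ δ1 ≤ 1 := by
    have hm0 : δ1 ∈ Ioc 0 δ0 := ⟨h10, h11⟩
    have b := (hA δ1 (hh hm0)).B_le h10 (hh hm0).2 hm20
    have b' := (hA δ1 (hh hm0)).B_ge h10 (hh hm0).2 hm20
    have l1 := (hp δ1 hm0).2.lam_le
    have l1' := (hp δ1 hm0).2.lam_ge
    have l0 := (hp δ1 hm0).2.mass_nonneg
    have l2 := mhi δ1 hm0
    have l3 : L δ1 ≤ 45/2*δ1 := by simp only [hL]; linarith
    have l4 : 0 ≤ L δ1 := by simp only [hL]; linarith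
    have h13 : δ1*(100*m) ≤ 1 := by rwa [le_div_iff₀ (by positivity)] at h12
    have sm : √m ≤ m := by
      rw [Real.sqrt_le_left (by positivity)]; nlinarith
    have sm' : δ1*√m ≤ δ1*m := mul_le_mul_of_nonneg_left sm h10.le
    have b2 : 1 - m * an (c δ1) m ≤ 2 := by nlinarith
    have b3 : δ1 ≤ 1/2000 := by nlinarith
    have b4 : (1 - m * an (c δ1) m) * L δ1 ≤ 2*(45/2*δ1) := mul_le_mul b2 l3 l4 (by norm_num)
    simp only [hψ]
    nlinarith
  obtain ⟨δ, hδ, hψδ⟩ := intermediate_value_Icc h11 ψc ⟨v1, v0⟩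
  have hδ' : δ ∈ Ioc 0 δ0 := ⟨h10.trans_le hδ.1, hδ.2⟩
  exact ⟨δ, c δ, (p δ).1, (p δ).2, hδ'.1, (hh hδ').2, by linarith [hδ'.2], (hp δ hδ').1, hc δ (hh hδ'), (hp δ hδ').2, hψδ⟩

noncomputable def KK (m : ℕ) (c : ℕ → ℝ) (s : ℝ) : ℝ := ∑ j ∈ Finset.range m, Ff c (Real.cos ((s+2*π*j)/m/2)^2)

lemma KK_eq {m : ℕ} {δ : ℝ} {c : ℕ → ℝ} (hc : IsC (MM m δ) c) (h0 : 0 < δ) (h1 : δ ≤ 1/2) (hm : 20 ≤ m) {s : ℝ}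
    (hs : Real.cos s ≠ 1) :
    KK m c s = LA 1 s + m * an c 0 + RR (bet m (an c)) s - 2*(1 - m * an c m) * Real.cos s := by
  have h := hc.periodized m (by omega) s hs
  have hR := RR_hasSum (bet_bd hc.isA h0 h1 hm) s
  rw [← hasSum_nat_add_iff' 2] at hR
  rw [← hasSum_nat_add_iff' 1] at h
  have e : (fun n : ℕ => 2*(m*an c (((n+1)+1)*m) - 1/(((n+1:ℕ):ℝ)+1))*Real.cos ((((n+1:ℕ):ℝ)+1)*s)) = fun n : ℕ => 2*bet m (an c) (n+2)*Real.cos (((n+2:ℕ):ℝ)*s) := by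
    ext n
    unfold bet
    rw [if_neg (by omega)]
    push_cast
    rw [show (n:ℝ)+1+1 = n+2 by ring]
  rw [e] at h
  have := h.unique hR
  simp only [Finset.range_one, Finset.sum_singleton, Finset.sum_range_succ] at this
  simp only [bet] at this
  norm_num at this
  rw [LA_one]
  unfold KK
  linarith

lemma cos_sub_ne_ae (s : ℝ) : ∀ᵐ t : ℝ, Real.cos (s - t) ≠ 1 := by
  filter_upwards [sin_sub_ne_ae s] with t ht h
  apply ht
  have := Real.sin_sq_add_cos_sq (s-t)
  rw [h] at this
  nlinarith

/-- The data: `∫ KK (s-t) g(t) dt` vanishes on the slit and is positive outside. -/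
structure Data (m : ℕ) (δ : ℝ) (c : ℕ → ℝ) (a : ℝ) (g : ℝ → ℝ) : Prop where
  hm : 20 ≤ m
  δ_pos : 0 < δ
  δ_le : δ ≤ 1/2
  hc : IsC (MM m δ) c
  a_pos : 0 < a
  a_le : a ≤ π/3
  cont : Continuous g
  even : ∀ t, g (-t) = g t
  nonneg : ∀ t, |t| ≤ π → 0 ≤ g t
  zero : ∀ t, a ≤ |t| → |t| ≤ π → g t = 0
  eqn : ∀ s, |s| ≤ a → ∫ t in -π..π, KK m c (s-t) * g t = 0
  gt : ∀ s, a < |s| → |s| ≤ π → 0 < ∫ t in -π..π, KK m c (s-t) * g t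

theorem exists_data (ε : ℝ) (hε : 0 < ε) : ∃ M : ℕ, ∀ m : ℕ, M ≤ m → Odd m →
    ∃ (δ : ℝ) (c : ℕ → ℝ) (a : ℝ) (g : ℝ → ℝ), δ < ε ∧ a < ε*π ∧ Data m δ c a g := by
  obtain ⟨M, hM⟩ := exists_params0 ε hε
  refine ⟨M, fun m hm ho => ?_⟩
  obtain ⟨hm20, δ, c, a, g, h0, h1, h2, h3, hc, hS, hL⟩ := hM m hm ho
  have hcon := hS.cont
  have hRc := RR_cont (bet_bd hc.isA h0 h1 hm20)
  have key : ∀ s, ∫ t in -π..π, KK m c (s-t) * g t = (∫ t in -π..π, (LA 1 (s-t) + m * an c 0 + RR (bet m (an c)) (s-t)) * g t) - Real.cos s := by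
    intro s
    have e1 : ∫ t in -π..π, KK m c (s-t) * g t = ∫ t in -π..π, ((LA 1 (s-t) + m * an c 0 + RR (bet m (an c)) (s-t)) * g t - 2*(1 - m * an c m) * (Real.cos (1*(s-t)) * g t)) := by
      refine intervalIntegral.integral_congr_ae ?_
      filter_upwards [cos_sub_ne_ae s] with t ht _
      rw [KK_eq hc h0 h1 hm20 ht, one_mul]; ring
    rw [e1, intervalIntegral.integral_sub, intervalIntegral.integral_const_mul, cos_shift_int hcon hS.even]
    · have : ∫ t in -π..π, Real.cos (1*t) * g t = ∫ t in -π..π, g t * Real.cos t := by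
        refine intervalIntegral.integral_congr fun t _ => ?_
        rw [one_mul]; ring
      rw [this, one_mul, show 2*(1 - m * an c m)*(Real.cos s * ∫ t in -π..π, g t * Real.cos t) = Real.cos s * (2*(1 - m * an c m)*(∫ t in -π..π, g t * Real.cos t)) by ring, hL, mul_one]
    · exact (((LA_sub_int (by norm_num) le_rfl s _ _).add intervalIntegrable_const).add
              ((by fun_prop : Continuous fun t => RR (bet m (an c)) (s-t)).intervalIntegrable _ _)).mul_continuousOn hcon.continuousOn
    · exact (by fun_prop : Continuous _).intervalIntegrable _ _
  refine ⟨δ, c, a, g, h2, h3, ⟨hm20, h0, h1, hc, hS.a_pos, hS.a_le, hcon, hS.even, hS.nonneg, hS.zero, ?_, ?_⟩⟩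
  · intro s hs; rw [key, hS.eqn s hs, sub_self]
  · intro s hs hs'; rw [key]; linarith [hS.gt s hs hs']

end TO

namespace TO

/-- polynomial growth -/
def PG (c : ℕ → ℝ) : Prop := ∃ (K : ℝ) (p : ℕ), 0 ≤ K ∧ ∀ l : ℕ, |c l| ≤ K * ((l:ℝ)+1)^p

noncomputable def dc (c : ℕ → ℝ) (l : ℕ) : ℝ := ((l:ℝ)+1) * c (l+1)

lemma PG.dc {c : ℕ → ℝ} (h : PG c) : PG (dc c) := by
  obtain ⟨K, p, hK, h⟩ := h
  refine ⟨K*2^p, p+1, by positivity, fun l => ?_⟩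
  have h1 := h (l+1)
  unfold TO.dc
  rw [abs_mul, abs_of_nonneg (by positivity : (0:ℝ) ≤ (l:ℝ)+1)]
  push_cast at h1
  have h2 : ((l:ℝ)+1+1)^p ≤ (2*((l:ℝ)+1))^p := by
    have : (0:ℝ) ≤ l := Nat.cast_nonneg l
    gcongr; linarith
  calc ((l:ℝ)+1)*|c (l+1)| ≤ ((l:ℝ)+1)*(K*(2*((l:ℝ)+1))^p) := by
        refine mul_le_mul_of_nonneg_left (h1.trans ?_) (by positivity)
        exact mul_le_mul_of_nonneg_left h2 hK
    _ = _ := by rw [mul_pow, pow_succ]; ring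

lemma poly_geo_summable (p : ℕ) {ρ : ℝ} (h0 : 0 ≤ ρ) (h1 : ρ < 1) : Summable (fun l : ℕ => ((l:ℝ)+1)^p * ρ^l) := by
  have hr : 0 < (1+ρ)/2 := by linarith
  have h := summable_pow_mul_geometric_of_norm_lt_one (R := ℝ) p (r := (1+ρ)/2) (by rw [Real.norm_eq_abs, abs_of_pos hr]; linarith)
  have h2 := ((summable_nat_add_iff 1).2 h).mul_left (1/((1+ρ)/2))
  refine Summable.of_nonneg_of_le (fun l => by positivity) (fun l => ?_) h2
  calc ((l:ℝ)+1)^p * ρ^l ≤ ((l:ℝ)+1)^p * ((1+ρ)/2)^l := by gcongr; linarith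
    _ = _ := by push_cast; rw [pow_succ]; field_simp

lemma PG.hasSum {c : ℕ → ℝ} (h : PG c) {X : ℝ} (hX : |X| < 1) : HasSum (fun l => c l * X^l) (Ff c X) := by
  obtain ⟨K, p, hK, h⟩ := h
  refine Summable.hasSum (Summable.of_norm_bounded (g := fun l : ℕ => K*(((l:ℝ)+1)^p*|X|^l)) ((poly_geo_summable p (abs_nonneg X) hX).mul_left K) fun l => ?_)
  rw [norm_mul, norm_pow, Real.norm_eq_abs, Real.norm_eq_abs, ← mul_assoc]
  exact mul_le_mul_of_nonneg_right (h l) (by positivity)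

lemma PG.hasDerivAt {c : ℕ → ℝ} (h : PG c) {X : ℝ} (hX : |X| < 1) : HasDerivAt (Ff c) (Ff (TO.dc c) X) X := by
  obtain ⟨ρ, h1, h2⟩ := exists_between hX
  have h0 : 0 ≤ ρ := (abs_nonneg X).trans h1.le
  obtain ⟨K, p, hK, hb⟩ := h.dc
  have key := hasDerivAt_tsum_of_isPreconnected (𝕜 := ℝ) (u := fun l : ℕ => K*(((l:ℝ)+1)^p*ρ^l))
    (g := fun (l : ℕ) (y : ℝ) => c (l+1) * y^(l+1)) (g' := fun (l : ℕ) (y : ℝ) => TO.dc c l * y^l) (t := Ioo (-ρ) ρ) (y₀ := 0) (y := X)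
    ((poly_geo_summable p h0 h2).mul_left K) isOpen_Ioo isPreconnected_Ioo ?_ ?_ ?_ ?_ (_root_.abs_lt.1 h1)
  · have e : Ff c =ᶠ[nhds X] fun z => c 0 + ∑' l, c (l+1) * z^(l+1) := by
      have : ∀ᶠ z in nhds X, |z| < 1 := (continuous_abs.isOpen_preimage _ isOpen_Iio).mem_nhds hX
      filter_upwards [this] with z hz
      unfold Ff
      rw [(h.hasSum hz).summable.tsum_eq_zero_add]; simp
    refine HasDerivAt.congr_of_eventuallyEq ?_ e
    exact key.const_add (c 0)
  · intro n y _
    have := (hasDerivAt_pow (n+1) y).const_mul (c (n+1))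
    convert! this using 1
    simp only [TO.dc, Nat.add_sub_cancel]; push_cast; ring
  · intro n y hy
    rw [norm_mul, norm_pow, Real.norm_eq_abs, Real.norm_eq_abs, ← mul_assoc]
    have : |y| ≤ ρ := (_root_.abs_lt.2 hy).le
    exact mul_le_mul (hb n) (pow_le_pow_left₀ (abs_nonneg _) this n) (by positivity) (by positivity)
  · rw [mem_Ioo]; have := lt_of_le_of_lt (abs_nonneg X) h1; constructor <;> linarith
  · simp

lemma PG.contDiffOn (n : ℕ) : ∀ {c : ℕ → ℝ}, PG c → ContDiffOn ℝ n (Ff c) (Ioo (-1) 1) := by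
  induction n with
  | zero =>
    intro c h
    refine contDiffOn_zero.2 fun X hX => (h.hasDerivAt (_root_.abs_lt.2 hX)).continuousAt.continuousWithinAt
  | succ n ih =>
    intro c h
    push_cast
    rw [contDiffOn_succ_iff_deriv_of_isOpen isOpen_Ioo]
    refine ⟨fun X hX => (h.hasDerivAt (_root_.abs_lt.2 hX)).differentiableAt.differentiableWithinAt, by simp, ?_⟩
    exact (ih h.dc).congr fun X hX => (h.hasDerivAt (_root_.abs_lt.2 hX)).deriv

lemma PG.mulX {c : ℕ → ℝ} {X S : ℝ} (h : HasSum (fun l => c l * X^l) S) :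
    HasSum (fun l : ℕ => (if l = 0 then 0 else c (l-1)) * X^l) (X * S) := by
  rw [← hasSum_nat_add_iff' 1]
  simp only [Finset.range_one, Finset.sum_singleton, if_true, zero_mul, sub_zero]
  have := h.mul_left X
  convert! this using 1
  ext l
  simp; ring

lemma IsC.pg {M : ℝ} {c : ℕ → ℝ} (h : IsC M c) : PG c := by
  obtain ⟨K, hK⟩ := h.bound
  refine ⟨|K|, 0, abs_nonneg _, fun l => (hK l).trans ?_⟩
  rw [pow_zero, mul_one]
  refine (div_le_div_of_nonneg_right (le_abs_self K) (by positivity)).trans ?_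
  exact div_le_self (abs_nonneg _) (by linarith [(Nat.cast_nonneg l : (0:ℝ) ≤ l)])

lemma IsC.ode {M : ℝ} {c : ℕ → ℝ} (h : IsC M c) {X : ℝ} (hX : |X| < 1) :
    X*(1-X)*Ff (dc (dc c)) X + (1-2*X)*Ff (dc c) X + M * Ff c X = 0 := by
  have s0 := h.pg.hasSum hX
  have s1 := h.pg.dc.hasSum hX
  have s2 := h.pg.dc.dc.hasSum hX
  have t := (((PG.mulX s2).sub (PG.mulX (PG.mulX s2))).add (s1.sub ((PG.mulX s1).mul_left 2))).add (s0.mul_left M)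
  have : (fun l : ℕ => (0:ℝ)) = fun l => ((if l = 0 then 0 else dc (dc c) (l-1)) * X^l - (if l = 0 then 0 else if l - 1 = 0 then 0 else dc (dc c) (l-1-1)) * X^l) + (dc c l * X^l - 2*((if l = 0 then 0 else dc c (l-1)) * X^l)) + M*(c l * X^l) := by
    ext l
    have hr := h.hrec l
    rcases l with _ | l
    · simp [dc] at hr ⊢; linear_combination -hr
    · rcases l with _ | l
      · simp [dc] at hr ⊢; linear_combination -X*hr
      · simp [dc] at hr ⊢; linear_combination -X^(l+1+1)*hr
  rw [← this] at t
  have := t.unique hasSum_zero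
  linear_combination this

noncomputable def w1 (c : ℕ → ℝ) (l : ℕ) : ℝ := dc c l - 1

lemma IsC.w1_bound {M : ℝ} {c : ℕ → ℝ} (h : IsC M c) : ∃ K, 0 ≤ K ∧ ∀ l, |w1 c l| ≤ K/((l:ℝ)+1) := by
  obtain ⟨C, hC0, hC⟩ := h.hC
  refine ⟨C, hC0, fun l => ?_⟩
  have h1 := hC (l+1)
  have hl : (0:ℝ) ≤ l := Nat.cast_nonneg l
  push_cast at h1
  have e : w1 c l = ((l:ℝ)+1)*(c (l+1) - 1/((l:ℝ)+1)) := by unfold w1 dc; field_simp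
  rw [e, abs_mul, abs_of_pos (by positivity : (0:ℝ) < (l:ℝ)+1)]
  calc _ ≤ ((l:ℝ)+1)*(C/((l:ℝ)+1+1)^2) := mul_le_mul_of_nonneg_left h1 (by positivity)
    _ ≤ ((l:ℝ)+1)*(C/((l:ℝ)+1)^2) := by gcongr; linarith
    _ = _ := by field_simp

lemma IsC.dF_eq {M : ℝ} {c : ℕ → ℝ} (h : IsC M c) {X : ℝ} (hX : |X| < 1) : Ff (dc c) X = 1/(1-X) + Ff (w1 c) X := by
  have s1 := h.pg.dc.hasSum hX
  have s2 := hasSum_geometric_of_abs_lt_one hX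
  have := s1.sub s2
  have e : (fun l => dc c l * X^l - X^l) = fun l => w1 c l * X^l := by ext l; unfold w1; ring
  rw [e] at this
  have e2 : Ff (w1 c) X = _ := this.tsum_eq
  rw [e2]; ring

end TO

namespace TO

noncomputable def Nn (x : Fin 3 → ℝ) : ℝ := √(x 0^2 + x 1^2 + x 2^2)
noncomputable def ev (φ : ℝ) : Fin 3 → ℝ := ![Real.cos φ, Real.sin φ, 0]
noncomputable def qq (φ : ℝ) (x : Fin 3 → ℝ) : ℝ := x 0 * Real.cos φ + x 1 * Real.sin φ
noncomputable def Ph (μ : ℝ) (c : ℕ → ℝ) (φ : ℝ) (x : Fin 3 → ℝ) : ℝ := Nn x ^ μ * Ff c ((1 + qq φ x / Nn x)/2)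

lemma Nn_nonneg (x) : 0 ≤ Nn x := Real.sqrt_nonneg _
lemma Nn_sq (x) : Nn x^2 = x 0^2 + x 1^2 + x 2^2 := Real.sq_sqrt (by positivity)

lemma qq_abs (φ x) : |qq φ x| ≤ Nn x := by
  rw [← Real.sqrt_sq_eq_abs]
  refine Real.sqrt_le_sqrt ?_
  unfold qq
  have := Real.sin_sq_add_cos_sq φ
  nlinarith [sq_nonneg (x 0 * Real.sin φ - x 1 * Real.cos φ), sq_nonneg (x 2)]

lemma Nn_pos_of {φ : ℝ} {x : Fin 3 → ℝ} (h : qq φ x < Nn x) : 0 < Nn x := by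
  have := qq_abs φ x
  have := _root_.abs_le.1 this
  by_contra h'
  have : Nn x = 0 := le_antisymm (not_lt.1 h') (Nn_nonneg x)
  linarith

lemma X_bd (φ : ℝ) (x : Fin 3 → ℝ) : 0 ≤ (1 + qq φ x / Nn x)/2 ∧ (1 + qq φ x / Nn x)/2 ≤ 1 := by
  have h1 := _root_.abs_le.1 (qq_abs φ x)
  rcases (Nn_nonneg x).eq_or_lt with h | h
  · rw [← h]; norm_num
  · have a1 : -1 ≤ qq φ x / Nn x := by rw [le_div_iff₀ h]; linarith
    have a2 : qq φ x / Nn x ≤ 1 := by rw [div_le_iff₀ h]; linarith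
    constructor <;> linarith

lemma X_lt {φ : ℝ} {x : Fin 3 → ℝ} (h : qq φ x < Nn x) : |(1 + qq φ x / Nn x)/2| < 1 := by
  have h0 := Nn_pos_of h
  have h1 := X_bd φ x
  have : qq φ x / Nn x < 1 := by rw [div_lt_one h0]; exact h
  rw [abs_of_nonneg h1.1]; linarith

section
variable {x : Fin 3 → ℝ} {φ μ : ℝ} {c : ℕ → ℝ}

lemma Nn_line (hx : 0 < Nn x) (i : Fin 3) : HasDerivAt (fun s : ℝ => Nn (x + s • Pi.single i 1)) (x i / Nn x) 0 := by
  unfold Nn at *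
  have hx' : x 0^2 + x 1^2 + x 2^2 ≠ 0 := by intro h; rw [h] at hx; simp at hx
  have h1 : HasDerivAt (fun s : ℝ => (x + s • (Pi.single i 1 : Fin 3 → ℝ)) 0^2 + (x + s • (Pi.single i 1 : Fin 3 → ℝ)) 1^2 + (x + s • (Pi.single i 1 : Fin 3 → ℝ)) 2^2) (2*x i) 0 := by
    have hj : ∀ j : Fin 3, HasDerivAt (fun s : ℝ => (x + s • (Pi.single i 1 : Fin 3 → ℝ)) j^2) (2*x j*(Pi.single i 1 : Fin 3 → ℝ) j) 0 := by
      intro j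
      have : HasDerivAt (fun s : ℝ => x j + s * (Pi.single i 1 : Fin 3 → ℝ) j) ((Pi.single i 1 : Fin 3 → ℝ) j) 0 := by
        simpa using ((hasDerivAt_id (0:ℝ)).mul_const ((Pi.single i 1 : Fin 3 → ℝ) j)).const_add (x j)
      convert! this.pow 2 using 1
      simp
    convert! ((hj 0).add (hj 1)).add (hj 2) using 1
    fin_cases i <;> simp [Pi.single_apply]
  have := h1.sqrt (by simpa using hx')
  convert! this using 1
  simp
  field_simp

lemma qq_line (i : Fin 3) : HasDerivAt (fun s : ℝ => qq φ (x + s • Pi.single i 1)) (ev φ i) 0 := by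
  unfold qq
  have hj : ∀ j : Fin 3, HasDerivAt (fun s : ℝ => (x + s • (Pi.single i 1 : Fin 3 → ℝ)) j) ((Pi.single i 1 : Fin 3 → ℝ) j) 0 := by
    intro j
    simpa using ((hasDerivAt_id (0:ℝ)).mul_const ((Pi.single i 1 : Fin 3 → ℝ) j)).const_add (x j)
  convert! ((hj 0).mul_const (Real.cos φ)).add ((hj 1).mul_const (Real.sin φ)) using 1
  fin_cases i <;> simp [Pi.single_apply, ev]

lemma xi_line (i : Fin 3) : HasDerivAt (fun s : ℝ => (x + s • (Pi.single i 1 : Fin 3 → ℝ)) i) 1 0 := by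
  simpa using ((hasDerivAt_id (0:ℝ)).mul_const ((Pi.single i 1 : Fin 3 → ℝ) i)).const_add (x i)

lemma Npow_line (hx : 0 < Nn x) (i : Fin 3) : HasDerivAt (fun s : ℝ => Nn (x + s • Pi.single i 1) ^ μ) (μ * (Nn x ^ μ / Nn x^2) * x i) 0 := by
  have := (Nn_line hx i).rpow_const (p := μ) (Or.inl (by simpa using hx.ne'))
  convert! this using 1
  simp only [zero_smul, add_zero]
  rw [Real.rpow_sub_one hx.ne']; field_simp

lemma F_line (hc : PG c) (h : qq φ x < Nn x) (i : Fin 3) :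
    HasDerivAt (fun s : ℝ => Ff c ((1 + qq φ (x + s • Pi.single i 1) / Nn (x + s • Pi.single i 1))/2))
      (Ff (dc c) ((1 + qq φ x / Nn x)/2) * (ev φ i / (2*Nn x) - qq φ x * x i / (2*Nn x^3))) 0 := by
  have hx := Nn_pos_of h
  have h1 := ((((qq_line (x := x) (φ := φ) i).div (Nn_line hx i) (by simpa using hx.ne')).const_add 1).div_const 2)
  have h2 := hc.hasDerivAt (X_lt h)
  have h3 := HasDerivAt.comp (0:ℝ) (h₂ := Ff c) (h₂' := Ff (dc c) ((1 + qq φ x / Nn x)/2)) (by simpa using h2) h1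
  convert! h3 using 1
  simp only [zero_smul, add_zero]
  field_simp

/-- coefficient functions of the gradient -/
noncomputable def PA (μ : ℝ) (c : ℕ → ℝ) (φ : ℝ) (x : Fin 3 → ℝ) : ℝ :=
  μ * (Nn x ^ μ / Nn x^2 * Ff c ((1 + qq φ x / Nn x)/2)) - Nn x ^ μ / Nn x^3 * qq φ x * Ff (dc c) ((1 + qq φ x / Nn x)/2) / 2
noncomputable def PB (μ : ℝ) (c : ℕ → ℝ) (φ : ℝ) (x : Fin 3 → ℝ) : ℝ :=
  Nn x ^ μ / Nn x * Ff (dc c) ((1 + qq φ x / Nn x)/2) / 2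

lemma Ph_line (hc : PG c) (h : qq φ x < Nn x) (i : Fin 3) :
    HasDerivAt (fun s : ℝ => Ph μ c φ (x + s • Pi.single i 1)) (PA μ c φ x * x i + PB μ c φ x * ev φ i) 0 := by
  have hx := Nn_pos_of h
  have := (Npow_line (μ := μ) hx i).mul (F_line hc h i)
  convert! this using 1
  simp only [zero_smul, add_zero]
  unfold PA PB
  field_simp
  ring

lemma P_line (hc : PG c) (h : qq φ x < Nn x) (i : Fin 3) :
    HasDerivAt (fun s : ℝ => PA μ c φ (x + s • Pi.single i 1) * (x + s • (Pi.single i 1 : Fin 3 → ℝ)) i + PB μ c φ (x + s • Pi.single i 1) * ev φ i)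
      (Nn x^μ/Nn x^2 * (
        Ff c ((1 + qq φ x / Nn x)/2) * (μ + μ*(μ-2)*x i^2/Nn x^2)
        + Ff (dc c) ((1 + qq φ x / Nn x)/2) * (-qq φ x/(2*Nn x) + x i^2/Nn x^2*(qq φ x/Nn x)*(3/2-μ) + x i*ev φ i/Nn x*(μ-1))
        + Ff (dc (dc c)) ((1 + qq φ x / Nn x)/2) * (ev φ i/2 - qq φ x*x i/(2*Nn x^2))^2)) 0 := by
  have hx := Nn_pos_of h
  have hN := Nn_line hx i
  have hy := Npow_line (μ := μ) hx i
  have hF := F_line hc h i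
  have hF1 := F_line hc.dc h i
  have hq := qq_line (x := x) (φ := φ) i
  have hxi := xi_line (x := x) i
  have n0 : Nn (x + (0:ℝ) • Pi.single i 1) ≠ 0 := by simpa using hx.ne'
  have hA := (((hy.div (hN.pow 2) (pow_ne_zero 2 n0)).mul hF).const_mul μ).sub ((((hy.div (hN.pow 3) (pow_ne_zero 3 n0)).mul hq).mul hF1).div_const 2)
  have hB := ((hy.div hN n0).mul hF1).div_const 2
  have := (hA.mul hxi).add (hB.mul_const (ev φ i))
  convert! this using 1
  simp only [zero_smul, add_zero, Pi.pow_apply, Pi.div_apply, Pi.mul_apply, Pi.sub_apply, Nat.cast_ofNat]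
  field_simp
  ring

end
end TO

namespace TO

lemma Nn_cont : Continuous Nn := by unfold Nn; fun_prop
lemma qq_cont : Continuous (fun p : (Fin 3 → ℝ) × ℝ => qq p.2 p.1) := by unfold qq; fun_prop

lemma Nn_cd (n : ℕ) {x : Fin 3 → ℝ} (hx : 0 < Nn x) : ContDiffAt ℝ n Nn x := by
  unfold Nn at *
  have hx' : x 0^2 + x 1^2 + x 2^2 ≠ 0 := by intro h; rw [h] at hx; simp at hx
  refine ContDiffAt.sqrt ?_ hx'
  fun_prop

lemma Ph_cd (n : ℕ) {μ : ℝ} {c : ℕ → ℝ} (hc : PG c) {p : (Fin 3 → ℝ) × ℝ} (h : qq p.2 p.1 < Nn p.1) :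
    ContDiffAt ℝ n (fun p : (Fin 3 → ℝ) × ℝ => Ph μ c p.2 p.1) p := by
  have hx := Nn_pos_of h
  have hN : ContDiffAt ℝ n (fun p : (Fin 3 → ℝ) × ℝ => Nn p.1) p := ContDiffAt.comp (g := Nn) (f := Prod.fst) p (Nn_cd n hx) contDiffAt_fst
  have hq : ContDiffAt ℝ n (fun p : (Fin 3 → ℝ) × ℝ => qq p.2 p.1) p := by
    unfold qq
    have h2 : ∀ i : Fin 3, ContDiffAt ℝ n (fun p : (Fin 3 → ℝ) × ℝ => p.1 i) p := fun i => by fun_prop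
    exact ((h2 0).mul (Real.contDiff_cos.contDiffAt.comp p contDiffAt_snd)).add ((h2 1).mul (Real.contDiff_sin.contDiffAt.comp p contDiffAt_snd))
  have hX : ContDiffAt ℝ n (fun p : (Fin 3 → ℝ) × ℝ => (1 + qq p.2 p.1 / Nn p.1)/2) p :=
    (contDiffAt_const (c := (1:ℝ)).add (hq.div hN hx.ne')).div_const 2
  have hF : ContDiffAt ℝ n (Ff c) ((1 + qq p.2 p.1 / Nn p.1)/2) :=
    (hc.contDiffOn n).contDiffAt (isOpen_Ioo.mem_nhds (_root_.abs_lt.1 (X_lt h)))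
  have hc2 : ContDiffAt ℝ n (fun p : (Fin 3 → ℝ) × ℝ => Ff c ((1 + qq p.2 p.1 / Nn p.1)/2)) p :=
    ContDiffAt.comp p (g := Ff c) hF hX
  exact (hN.rpow_const_of_ne hx.ne').mul hc2

lemma Ph_cd' (n : ℕ) {μ : ℝ} {c : ℕ → ℝ} (hc : PG c) {φ : ℝ} {x : Fin 3 → ℝ} (h : qq φ x < Nn x) :
    ContDiffAt ℝ n (Ph μ c φ) x := by
  have h1 := Ph_cd n (μ := μ) hc (p := (x,φ)) h
  exact ContDiffAt.comp x (g := fun p : (Fin 3 → ℝ) × ℝ => Ph μ c p.2 p.1) (f := fun y => (y,φ)) h1 (by fun_prop)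

lemma pd_of_line {f : (Fin 3 → ℝ) → ℝ} {x : Fin 3 → ℝ} {i : Fin 3} {v : ℝ} (hd : DifferentiableAt ℝ f x)
    (h : HasDerivAt (fun s : ℝ => f (x + s • Pi.single i 1)) v 0) : pd i f x = v := by
  have hl : HasDerivAt (fun s : ℝ => x + s • (Pi.single i 1 : Fin 3 → ℝ)) (Pi.single i 1) 0 := by
    simpa using ((hasDerivAt_id (0:ℝ)).smul_const (Pi.single i 1 : Fin 3 → ℝ)).const_add x
  have h1 := HasFDerivAt.comp_hasDerivAt (0:ℝ) (l := f) (l' := fderiv ℝ f x) (by simpa using hd.hasFDerivAt) hl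
  exact h1.unique h

lemma line_tendsto (x : Fin 3 → ℝ) (i : Fin 3) : Tendsto (fun s : ℝ => x + s • (Pi.single i 1 : Fin 3 → ℝ)) (nhds 0) (nhds x) := by
  have : Continuous (fun s : ℝ => x + s • (Pi.single i 1 : Fin 3 → ℝ)) := by fun_prop
  simpa using this.tendsto 0

lemma open_reg (φ : ℝ) : IsOpen {x : Fin 3 → ℝ | qq φ x < Nn x} := by
  refine isOpen_lt ?_ Nn_cont
  unfold qq; fun_prop

lemma pd_Ph {μ : ℝ} {c : ℕ → ℝ} (hc : PG c) {φ : ℝ} {x : Fin 3 → ℝ} (h : qq φ x < Nn x) (i : Fin 3) :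
    pd i (Ph μ c φ) x = PA μ c φ x * x i + PB μ c φ x * ev φ i :=
  pd_of_line ((Ph_cd' 1 hc h).differentiableAt (by norm_num)) (Ph_line hc h i)

lemma pd_diff {f : (Fin 3 → ℝ) → ℝ} {x : Fin 3 → ℝ} (h : ContDiffAt ℝ 2 f x) (i : Fin 3) : DifferentiableAt ℝ (pd i f) x := by
  have h1 : ContDiffAt ℝ 1 (fderiv ℝ f) x := h.fderiv_right (by norm_num)
  have h2 := h1.differentiableAt (by norm_num)
  unfold pd
  exact h2.clm_apply (differentiableAt_const _)

lemma lap_Ph {μ M : ℝ} {c : ℕ → ℝ} (hc : IsC M c) (hM : M = μ*(μ+1)) {φ : ℝ} {x : Fin 3 → ℝ} (h : qq φ x < Nn x) :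
    lap (Ph μ c φ) x = 0 := by
  have hx := Nn_pos_of h
  have key : ∀ i, pd i (pd i (Ph μ c φ)) x = _ := fun i =>
    pd_of_line (pd_diff (Ph_cd' 2 hc.pg h) i) ((P_line (μ := μ) hc.pg h i).congr_of_eventuallyEq (by
      filter_upwards [(line_tendsto x i).eventually ((open_reg φ).mem_nhds h)] with s hs
      exact pd_Ph hc.pg hs i))
  unfold lap
  simp_rw [key]
  rw [Fin.sum_univ_three]
  have ode := hc.ode (X_lt h)
  set F0 := Ff c ((1 + qq φ x / Nn x)/2)
  set F1 := Ff (dc c) ((1 + qq φ x / Nn x)/2)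
  set F2 := Ff (dc (dc c)) ((1 + qq φ x / Nn x)/2)
  have e0 : ev φ 0 = Real.cos φ := rfl
  have e1 : ev φ 1 = Real.sin φ := rfl
  have e2 : ev φ 2 = 0 := rfl
  have q1 : qq φ x = x 0 * ev φ 0 + x 1 * ev φ 1 + x 2 * ev φ 2 := by rw [e0, e1, e2]; unfold qq; ring
  have q2 : ev φ 0^2 + ev φ 1^2 + ev φ 2^2 = 1 := by rw [e0, e1, e2]; nlinarith [Real.sin_sq_add_cos_sq φ]
  have q3 := Nn_sq x
  set q := qq φ x
  set N := Nn x
  rw [← mul_add, ← mul_add]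
  refine mul_eq_zero_of_right _ ?_
  rw [hM] at ode
  have s1 : x 0^2/N^2 + x 1^2/N^2 + x 2^2/N^2 = 1 := by rw [← add_div, ← add_div, ← q3]; field_simp
  have s2 : x 0 * ev φ 0/N + x 1 * ev φ 1/N + x 2 * ev φ 2/N = q/N := by rw [q1]; ring
  have s3 : (ev φ 0/2 - q*x 0/(2*N^2))^2 + (ev φ 1/2 - q*x 1/(2*N^2))^2 + (ev φ 2/2 - q*x 2/(2*N^2))^2 = (1-(q/N)^2)/4 := by
    have : (ev φ 0/2 - q*x 0/(2*N^2))^2 + (ev φ 1/2 - q*x 1/(2*N^2))^2 + (ev φ 2/2 - q*x 2/(2*N^2))^2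
      = (ev φ 0^2 + ev φ 1^2 + ev φ 2^2)/4 - (x 0 * ev φ 0/N + x 1 * ev φ 1/N + x 2 * ev φ 2/N)*(q/N)/2
        + (q/N)^2/4*(x 0^2/N^2 + x 1^2/N^2 + x 2^2/N^2) := by field_simp; ring
    rw [this, q2, s1, s2]; ring
  linear_combination ode + F0*μ*(μ-2)*s1 + F1*((q/N)*(3/2-μ)*s1 + (μ-1)*s2) + F2*s3

end TO

namespace TO

section
variable {E F : Type} [NormedAddCommGroup E] [NormedSpace ℝ E] [NormedAddCommGroup F] [NormedSpace ℝ F]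

lemma par_bound {a : ℝ} {f : E → ℝ → F} {x : E}
    (h : ∀ t ∈ Icc (-a) a, ContinuousAt (Function.uncurry f) (x,t)) :
    ∃ B, ∀ᶠ y in nhds x, ∀ t ∈ Icc (-a) a, ‖f y t‖ ≤ B := by
  have hc : ContinuousOn (fun t => f x t) (Icc (-a) a) := fun t ht =>
    (ContinuousAt.comp (g := Function.uncurry f) (f := fun t => (x,t)) (h t ht) (by fun_prop)).continuousWithinAt
  obtain ⟨B, hB⟩ := isCompact_Icc.exists_bound_of_continuousOn hc
  refine ⟨B+1, isCompact_Icc.eventually_forall_of_forall_eventually fun t ht => ?_⟩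
  have h1 : ContinuousAt (fun p => ‖Function.uncurry f p‖) (x,t) := (h t ht).norm
  have h2 : ‖Function.uncurry f (x,t)‖ < B+1 := by have := hB t ht; simp only [Function.uncurry]; linarith
  filter_upwards [h1.eventually (gt_mem_nhds h2)] with p hp
  exact hp.le

lemma par_slice {a : ℝ} {f : E → ℝ → F} {x : E} {G : ℝ → ℝ} (hG : Continuous G)
    (h : ∀ t ∈ Icc (-a) a, ContinuousAt (Function.uncurry f) (x,t)) :
    ContinuousOn (fun t => G t • f x t) (Icc (-a) a) := fun t ht =>
    (hG.continuousAt.smul (ContinuousAt.comp (g := Function.uncurry f) (f := fun t => (x,t)) (h t ht) (by fun_prop))).continuousWithinAt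

lemma par_bound' {a : ℝ} {f : E → ℝ → F} {x : E} {G : ℝ → ℝ} (hG : Continuous G)
    (h : ∀ t ∈ Icc (-a) a, ContinuousAt (Function.uncurry f) (x,t)) :
    ∃ B, ∀ᶠ y in nhds x, ∀ t ∈ Icc (-a) a, ‖G t • f y t‖ ≤ B :=
  par_bound (f := fun y t => G t • f y t) fun t ht => 
    ContinuousAt.smul (f := fun p : E × ℝ => G p.2) (by fun_prop) (h t ht)

lemma uI_sub {a : ℝ} (ha : 0 ≤ a) : Set.uIoc (-a) a ⊆ Icc (-a) a := by
  rw [uIoc_of_le (by linarith)]; exact Ioc_subset_Icc_self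

lemma par_cont {a : ℝ} (ha : 0 ≤ a) {f : E → ℝ → F} {O : Set E} (hO : IsOpen O) {G : ℝ → ℝ} (hG : Continuous G)
    (h : ∀ x ∈ O, ∀ t ∈ Icc (-a) a, ContinuousAt (Function.uncurry f) (x,t)) {x : E} (hx : x ∈ O) :
    ContinuousAt (fun x => ∫ t in -a..a, G t • f x t) x := by
  obtain ⟨B, hB⟩ := par_bound' hG (h x hx)
  refine intervalIntegral.continuousAt_of_dominated_interval (bound := fun _ => B) ?_ ?_ (by simp) ?_
  · filter_upwards [hO.mem_nhds hx] with y hy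
    exact ((par_slice hG (h y hy)).mono (uI_sub ha)).aestronglyMeasurable measurableSet_uIoc
  · filter_upwards [hB] with y hy
    exact Eventually.of_forall fun t ht => hy t (uI_sub ha ht)
  · refine Eventually.of_forall fun t ht => ?_
    exact (ContinuousAt.comp (g := Function.uncurry f) (f := fun y => (y,t)) (h x hx t (uI_sub ha ht)) (by fun_prop)).const_smul (G t)

lemma par_fd_cd {m n : WithTop ℕ∞} (hmn : m + 1 ≤ n) {f : E → ℝ → F} {x : E} {t : ℝ}
    (h : ContDiffAt ℝ n (Function.uncurry f) (x,t)) :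
    ContDiffAt ℝ m (Function.uncurry fun x t => fderiv ℝ (fun y => f y t) x) (x,t) := by
  refine ContDiffAt.fderiv (f := fun (p : E × ℝ) y => f y p.2) (g := fun p => p.1) (n := n) ?_ contDiffAt_fst hmn
  exact ContDiffAt.comp (g := Function.uncurry f) (f := fun q : (E × ℝ) × E => (q.2, q.1.2)) ((x,t),x) h (by fun_prop)

lemma par_diff {a : ℝ} (ha : 0 ≤ a) {f : E → ℝ → F} {O : Set E} (hO : IsOpen O) {G : ℝ → ℝ} (hG : Continuous G)
    (h : ∀ x ∈ O, ∀ t ∈ Icc (-a) a, ContDiffAt ℝ 1 (Function.uncurry f) (x,t)) {x : E} (hx : x ∈ O) :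
    HasFDerivAt (fun x => ∫ t in -a..a, G t • f x t) (∫ t in -a..a, G t • fderiv ℝ (fun y => f y t) x) x := by
  have hc : ∀ y ∈ O, ∀ t ∈ Icc (-a) a, ContinuousAt (Function.uncurry fun x t => fderiv ℝ (fun y => f y t) x) (y,t) :=
    fun y hy t ht => (par_fd_cd (m := 0) (by norm_num) (h y hy t ht)).continuousAt
  have hc0 : ∀ y ∈ O, ∀ t ∈ Icc (-a) a, ContinuousAt (Function.uncurry f) (y,t) :=
    fun y hy t ht => (h y hy t ht).continuousAt
  obtain ⟨B, hB⟩ := par_bound' hG (hc x hx)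
  refine intervalIntegral.hasFDerivAt_integral_of_dominated_of_fderiv_le (bound := fun _ => B)
    (F' := fun x t => G t • fderiv ℝ (fun y => f y t) x) (hB.and (hO.mem_nhds hx)) ?_ ?_ ?_ ?_ (by simp) ?_
  · filter_upwards [hO.mem_nhds hx] with y hy
    exact ((par_slice hG (hc0 y hy)).mono (uI_sub ha)).aestronglyMeasurable measurableSet_uIoc
  · refine ContinuousOn.intervalIntegrable ?_
    rw [uIcc_of_le (by linarith)]; exact par_slice hG (hc0 x hx)
  · exact ((par_slice hG (hc x hx)).mono (uI_sub ha)).aestronglyMeasurable measurableSet_uIoc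
  · exact Eventually.of_forall fun t ht y hy => hy.1 t (uI_sub ha ht)
  · refine Eventually.of_forall fun t ht y hy => HasFDerivAt.const_smul ?_ (G t)
    have : ContDiffAt ℝ 1 (fun y => f y t) y :=
      ContDiffAt.comp (g := Function.uncurry f) (f := fun y => (y,t)) y (h y hy.2 t (uI_sub ha ht)) (by fun_prop)
    exact (this.differentiableAt (by norm_num)).hasFDerivAt

lemma par_step {n : ℕ} {a : ℝ} (ha : 0 ≤ a) {f : E → ℝ → F} {O : Set E} (hO : IsOpen O) {G : ℝ → ℝ} (hG : Continuous G)
    (h : ∀ x ∈ O, ∀ t ∈ Icc (-a) a, ContDiffAt ℝ 1 (Function.uncurry f) (x,t))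
    (h2 : ContDiffOn ℝ n (fun x => ∫ t in -a..a, G t • fderiv ℝ (fun y => f y t) x) O) :
    ContDiffOn ℝ ((n:WithTop ℕ∞)+1) (fun x => ∫ t in -a..a, G t • f x t) O := by
  rw [contDiffOn_succ_iff_fderiv_of_isOpen hO]
  refine ⟨fun x hx => (par_diff ha hO hG h hx).differentiableAt.differentiableWithinAt, by simp, ?_⟩
  exact h2.congr fun x hx => (par_diff ha hO hG h hx).fderiv

lemma par_cd2 {a : ℝ} (ha : 0 ≤ a) {f : E → ℝ → F} {O : Set E} (hO : IsOpen O) {G : ℝ → ℝ} (hG : Continuous G)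
    (h : ∀ x ∈ O, ∀ t ∈ Icc (-a) a, ContDiffAt ℝ 2 (Function.uncurry f) (x,t)) :
    ContDiffOn ℝ 2 (fun x => ∫ t in -a..a, G t • f x t) O := by
  have h1 := fun x hx t ht => par_fd_cd (m := 1) (by norm_num) (h x hx t ht)
  have h2 := fun x hx t ht => par_fd_cd (m := 0) (by norm_num) (h1 x hx t ht)
  have s0 := contDiffOn_zero (𝕜 := ℝ) (s := O).2 fun x hx => (par_cont ha hO hG (fun x hx t ht => (h2 x hx t ht).continuousAt) hx).continuousWithinAt
  have s1 := par_step (n := 0) ha hO hG (fun x hx t ht => h1 x hx t ht) (by simpa using s0)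
  have s2 := par_step (n := 1) ha hO hG (fun x hx t ht => (h x hx t ht).of_le (by norm_num)) (by simpa using s1)
  have e : ((1:ℕ):WithTop ℕ∞) + 1 = 2 := by norm_num
  rw [e] at s2
  exact s2
end

lemma par_pd {a : ℝ} (ha : 0 ≤ a) {f : (Fin 3 → ℝ) → ℝ → ℝ} {O : Set (Fin 3 → ℝ)} (hO : IsOpen O) {G : ℝ → ℝ} (hG : Continuous G)
    (h : ∀ x ∈ O, ∀ t ∈ Icc (-a) a, ContDiffAt ℝ 1 (Function.uncurry f) (x,t)) {x : Fin 3 → ℝ} (hx : x ∈ O) (i : Fin 3) :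
    pd i (fun x => ∫ t in -a..a, G t • f x t) x = ∫ t in -a..a, G t • pd i (fun y => f y t) x := by
  unfold pd
  rw [(par_diff ha hO hG h hx).fderiv, ContinuousLinearMap.intervalIntegral_apply]
  · rfl
  · refine ContinuousOn.intervalIntegrable ?_
    rw [uIcc_of_le (by linarith)]
    exact par_slice hG fun t ht => (par_fd_cd (m := 0) (by norm_num) (h x hx t ht)).continuousAt

lemma par_pd_cd {f : (Fin 3 → ℝ) → ℝ → ℝ} {x : Fin 3 → ℝ} {t : ℝ} (h : ContDiffAt ℝ 2 (Function.uncurry f) (x,t)) (i : Fin 3) :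
    ContDiffAt ℝ 1 (Function.uncurry fun x t => pd i (fun y => f y t) x) (x,t) :=
  (par_fd_cd (m := 1) (by norm_num) h).clm_apply contDiffAt_const

lemma par_lap {a : ℝ} (ha : 0 ≤ a) {f : (Fin 3 → ℝ) → ℝ → ℝ} {O : Set (Fin 3 → ℝ)} (hO : IsOpen O) {G : ℝ → ℝ} (hG : Continuous G)
    (h : ∀ x ∈ O, ∀ t ∈ Icc (-a) a, ContDiffAt ℝ 2 (Function.uncurry f) (x,t))
    (hl : ∀ x ∈ O, ∀ t ∈ Icc (-a) a, lap (fun y => f y t) x = 0) {x : Fin 3 → ℝ} (hx : x ∈ O) :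
    lap (fun x => ∫ t in -a..a, G t • f x t) x = 0 := by
  have h1 := fun x hx t ht => (h x hx t ht).of_le (m := 1) (by norm_num)
  have h2 := fun i x hx t ht => par_pd_cd (h x hx t ht) i
  have key : ∀ i, pd i (pd i (fun x => ∫ t in -a..a, G t • f x t)) x = ∫ t in -a..a, G t • pd i (pd i (fun y => f y t)) x := by
    intro i
    rw [← par_pd ha hO hG (f := fun x t => pd i (fun y => f y t) x) (h2 i) hx i]
    unfold pd
    rw [Filter.EventuallyEq.fderiv_eq]
    filter_upwards [hO.mem_nhds hx] with y hy
    exact par_pd ha hO hG h1 hy i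
  have hii : ∀ i, IntervalIntegrable (fun t => G t • pd i (pd i (fun y => f y t)) x) MeasureTheory.volume (-a) a := by
    intro i
    refine ContinuousOn.intervalIntegrable ?_
    rw [uIcc_of_le (by linarith)]
    refine par_slice (f := fun x t => pd i (pd i (fun y => f y t)) x) hG fun t ht => ?_
    exact ((par_fd_cd (f := fun x t => pd i (fun y => f y t) x) (m := 0) (by norm_num) (h2 i x hx t ht)).clm_apply contDiffAt_const).continuousAt
  unfold lap at *
  simp_rw [key]
  rw [← intervalIntegral.integral_finsetSum (fun i _ => hii i)]
  rw [intervalIntegral.integral_congr (g := fun _ => (0:ℝ)) (fun t ht => ?_)]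
  · simp
  · rw [uIcc_of_le (by linarith)] at ht
    beta_reduce
    rw [← Finset.smul_sum, hl x hx t ht, smul_zero]

end TO

namespace TO

lemma integrable_tsum' {α : Type} [MeasurableSpace α] {ν : MeasureTheory.Measure α} {f : ℕ → α → ℝ}
    (hi : ∀ l, MeasureTheory.Integrable (f l) ν) (hs : Summable fun l => ∫ x, ‖f l x‖ ∂ν) :
    MeasureTheory.Integrable (fun x => ∑' l, f l x) ν := by
  refine ⟨(AEMeasurable.tsum fun l => (hi l).1.aemeasurable).aestronglyMeasurable, ?_⟩
  rw [MeasureTheory.hasFiniteIntegral_iff_enorm]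
  refine (MeasureTheory.lintegral_mono fun x => enorm_tsum_le_tsum_enorm).trans_lt ?_
  rw [MeasureTheory.lintegral_tsum fun l => (hi l).1.enorm]
  simp_rw [← fun l => MeasureTheory.ofReal_integral_norm_eq_lintegral_enorm (hi l)]
  rw [← ENNReal.ofReal_tsum_of_nonneg (fun l => MeasureTheory.integral_nonneg fun x => norm_nonneg _) hs]
  exact ENNReal.ofReal_lt_top

lemma Bn_prod (l : ℕ) : ∏ i ∈ Finset.range l, (2 * (i:ℝ) + 1) / (2 * i + 2) = Bn l 0 := by
  induction l with
  | zero => simp [Bn]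
  | succ l ih =>
    have h := Bn_succ_mul l 0
    have e : Bn (l+1) 0 = (2*l+1)/(2*(l+1)) * Bn l 0 := by
      field_simp; push_cast at h
      have h1 : ((l:ℝ)+1) ≠ 0 := by positivity
      apply mul_left_cancel₀ h1
      linear_combination 2*h
    rw [Finset.prod_range_succ, ih, e]; field_simp

lemma cos_pow_per (l : ℕ) (A : ℝ) : ∫ v in A..A+π, Real.cos v^(2*l) = π * Bn l 0 := by
  have hp : Function.Periodic (fun v => Real.cos v^(2*l)) π := fun v => by
    beta_reduce; rw [Real.cos_add_pi, pow_mul, pow_mul, neg_sq]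
  rw [hp.intervalIntegral_add_eq A (-(π/2)), ← Bn_prod, ← integral_sin_pow_even]
  have := intervalIntegral.integral_comp_sub_right (a := 0) (b := π) (fun v => Real.cos v^(2*l)) (π/2)
  simp_rw [Real.cos_sub_pi_div_two] at this
  rw [this]
  congr 1 <;> ring

lemma cos_pow_part (l : ℕ) {A B : ℝ} (h : A ≤ B) (h2 : B ≤ A + π) : ∫ v in A..B, Real.cos v^(2*l) ≤ π / √((l:ℝ)+1) := by
  have h1 : ∫ v in A..B, Real.cos v^(2*l) ≤ ∫ v in A..A+π, Real.cos v^(2*l) := by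
    refine intervalIntegral.integral_mono_interval le_rfl h h2 ?_ ((by fun_prop : Continuous _).intervalIntegrable _ _)
    exact Eventually.of_forall fun v => by simp only [pow_mul]; exact pow_nonneg (sq_nonneg _) _
  rw [cos_pow_per] at h1
  have := mul_le_mul_of_nonneg_left (Bn_le l 0) Real.pi_pos.le
  rw [mul_one_div] at this
  linarith

noncomputable def Xx (φ : ℝ) (x : Fin 3 → ℝ) : ℝ := (1 + qq φ x/Nn x)/2

lemma Xx_cont (x : Fin 3 → ℝ) : Continuous (fun φ => Xx φ x) := by unfold Xx qq; fun_prop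

lemma Xx_cont' (x : Fin 3 → ℝ) (m j : ℕ) : Continuous (fun t => Xx ((t-2*π*j)/m) x) :=
  (Xx_cont x).comp (by fun_prop)

lemma polar (a b : ℝ) : ∃ θ, a = √(a^2+b^2) * Real.cos θ ∧ b = √(a^2+b^2) * Real.sin θ := by
  refine ⟨Complex.arg ⟨a,b⟩, ?_, ?_⟩
  · have := Complex.norm_mul_cos_arg ⟨a,b⟩
    rw [Complex.norm_def, Complex.normSq_mk] at this
    simp only [← sq] at this
    exact this.symm
  · have := Complex.norm_mul_sin_arg ⟨a,b⟩
    rw [Complex.norm_def, Complex.normSq_mk] at this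
    simp only [← sq] at this
    exact this.symm

lemma Xpow_le (x : Fin 3 → ℝ) : ∃ θ, ∀ φ (l : ℕ), Xx φ x^l ≤ (1/2)^l + Real.cos ((θ-φ)/2)^(2*l) := by
  obtain ⟨θ, h0, h1⟩ := polar (x 0) (x 1)
  refine ⟨θ, fun φ l => ?_⟩
  set r := √(x 0^2 + x 1^2) with hr
  have hrN : r ≤ Nn x := by unfold Nn; exact Real.sqrt_le_sqrt (by nlinarith [sq_nonneg (x 2)])
  have hr0 : 0 ≤ r := Real.sqrt_nonneg _
  have hq : qq φ x = r * Real.cos (θ-φ) := by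
    unfold qq; rw [Real.cos_sub]; linear_combination Real.cos φ*h0 + Real.sin φ * h1
  have hρ : 0 ≤ r/Nn x ∧ r/Nn x ≤ 1 := ⟨div_nonneg hr0 (Nn_nonneg x), div_le_one_of_le₀ hrN (Nn_nonneg x)⟩
  set ρ := r/Nn x
  have hc : Real.cos (θ-φ) = 2*Real.cos ((θ-φ)/2)^2 - 1 := by rw [← Real.cos_two_mul]; ring_nf
  have hX : Xx φ x = (1-ρ) * (1/2) + ρ*Real.cos ((θ-φ)/2)^2 := by
    unfold Xx; rw [hq, mul_div_right_comm, hc]; simp only [ρ]; ring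
  have hcv := (convexOn_pow (𝕜 := ℝ) l).2 (by norm_num : (1/2:ℝ) ∈ Ici 0) (sq_nonneg (Real.cos ((θ-φ)/2)) : Real.cos ((θ-φ)/2)^2 ∈ Ici 0) (by linarith : 0 ≤ 1-ρ) hρ.1 (by ring)
  simp only [smul_eq_mul] at hcv
  rw [hX, pow_mul]
  have p1 : 0 ≤ (1/2:ℝ)^l := by positivity
  have p2 : 0 ≤ (Real.cos ((θ-φ)/2)^2)^l := by positivity
  nlinarith [mul_nonneg hρ.1 p1, mul_nonneg (sub_nonneg.2 hρ.2) p2]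

lemma half_pow_le (l : ℕ) : (1/2:ℝ)^l ≤ 1/√((l:ℝ)+1) := by
  rw [one_div_pow]
  refine one_div_le_one_div_of_le (by positivity) ?_
  have h1 : (l:ℝ)+1 ≤ 2^l := by exact_mod_cast Nat.lt_two_pow_self
  refine le_trans ?_ h1
  rw [Real.sqrt_le_left (by positivity)]
  nlinarith [Nat.cast_nonneg (α := ℝ) l]

noncomputable def Cm (m : ℕ) : ℝ := 2*π + 2*m*π
lemma Cm_nonneg (m : ℕ) : 0 ≤ Cm m := by unfold Cm; positivity

lemma Xpow_int {m : ℕ} (hm : 1 ≤ m) (j l : ℕ) (x : Fin 3 → ℝ) :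
    ∫ t in -π..π, Xx ((t-2*π*j)/m) x^l ≤ Cm m/√((l:ℝ)+1) := by
  obtain ⟨θ, h⟩ := Xpow_le x
  have hπ := Real.pi_pos
  have hm' : (1:ℝ) ≤ m := by exact_mod_cast hm
  have hX := Xx_cont' x m j
  have h1 : ∫ t in -π..π, Xx ((t-2*π*j)/m) x^l ≤ ∫ t in -π..π, ((1/2)^l + Real.cos ((θ-(t-2*π*j)/m)/2)^(2*l)) :=
    intervalIntegral.integral_mono_on (by linarith) ((by fun_prop : Continuous _).intervalIntegrable _ _) ((by fun_prop : Continuous _).intervalIntegrable _ _) fun t _ => h _ l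
  have h2 : ∫ t in -π..π, Real.cos ((θ-(t-2*π*j)/m)/2)^(2*l) = 2*m*∫ v in ((θ + 2*π*j/m)/2 - π/(2*m))..((θ + 2*π*j/m)/2 + π/(2*m)), Real.cos v^(2*l) := by
    have := intervalIntegral.integral_comp_sub_mul (a := -π) (b := π) (fun v => Real.cos v^(2*l)) (c := 1/(2*(m:ℝ))) (by positivity) ((θ + 2*π*j/m)/2)
    rw [smul_eq_mul] at this
    have e : (1/(2*(m:ℝ)))⁻¹ = 2*m := by simp
    rw [e] at this
    rw [show ((θ + 2*π*j/m)/2 - π/(2*m)) = (θ + 2*π*j/m)/2 - 1/(2*(m:ℝ))*π by ring, show ((θ + 2*π*j/m)/2 + π/(2*m)) = (θ + 2*π*j/m)/2 - 1/(2*(m:ℝ))*(-π) by ring, ← this]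
    refine intervalIntegral.integral_congr fun t _ => ?_
    congr 2; field_simp; ring
  have hb : π/(2*m) ≤ π/2 := by
    apply div_le_div_of_nonneg_left hπ.le (by norm_num) (by linarith)
  have h0 : 0 ≤ π/(2*m) := by positivity
  have h3 := cos_pow_part l (A := (θ + 2*π*j/m)/2 - π/(2*m)) (B := (θ + 2*π*j/m)/2 + π/(2*m)) (by linarith) (by linarith)
  rw [intervalIntegral.integral_add ((by fun_prop : Continuous _).intervalIntegrable _ _) ((by fun_prop : Continuous _).intervalIntegrable _ _), h2,
    intervalIntegral.integral_const, smul_eq_mul] at h1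
  have h4 := half_pow_le l
  refine h1.trans ?_
  have e : Cm m/√((l:ℝ)+1) = (π - -π)*(1/√((l:ℝ)+1)) + 2*m*(π/√((l:ℝ)+1)) := by unfold Cm; ring
  rw [e]
  gcongr
  linarith

section
variable {m : ℕ} {c : ℕ → ℝ} {K G : ℝ} {w : ℝ → ℝ}

lemma term_bd (hm : 1 ≤ m) (hc : ∀ l, |c l| ≤ K/((l:ℝ)+1)) (hw : Continuous w) (hG : ∀ t, |t| ≤ π → |w t| ≤ G) (hG0 : 0 ≤ G)
    (j l : ℕ) (x : Fin 3 → ℝ) :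
    ∫ t in -π..π, ‖c l * Xx ((t-2*π*j)/m) x^l * w t‖ ≤ K*Cm m*G*hS l := by
  have hπ := Real.pi_pos
  have hX := Xx_cont' x m j
  have h1 : ∫ t in -π..π, ‖c l * Xx ((t-2*π*j)/m) x^l * w t‖ ≤ ∫ t in -π..π, (|c l| * G) * Xx ((t-2*π*j)/m) x^l := by
    refine intervalIntegral.integral_mono_on (by linarith) ((by fun_prop : Continuous _).intervalIntegrable _ _) ((by fun_prop : Continuous _).intervalIntegrable _ _) fun t ht => ?_
    have hx : 0 ≤ Xx ((t-2*π*j)/m) x^l := pow_nonneg (X_bd _ _).1 _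
    rw [norm_mul, norm_mul, Real.norm_eq_abs, Real.norm_eq_abs, Real.norm_eq_abs, abs_of_nonneg hx]
    have := mul_le_mul_of_nonneg_left (hG t (_root_.abs_le.2 ht)) (mul_nonneg (abs_nonneg (c l)) hx)
    linarith
  rw [intervalIntegral.integral_const_mul] at h1
  refine h1.trans ?_
  have h2 := mul_le_mul_of_nonneg_left (Xpow_int hm j l x) (mul_nonneg (abs_nonneg (c l)) hG0)
  refine h2.trans ?_
  have h3 := mul_le_mul_of_nonneg_right (hc l) (mul_nonneg hG0 (div_nonneg (Cm_nonneg m) (Real.sqrt_nonneg ((l:ℝ)+1))))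
  have e : K*Cm m*G*hS l = K/((l:ℝ)+1)*(G*(Cm m/√((l:ℝ)+1))) := by unfold hS; field_simp
  rw [e, mul_assoc]; exact h3

lemma term_sum (hm : 1 ≤ m) (hc : ∀ l, |c l| ≤ K/((l:ℝ)+1)) (hw : Continuous w) (hG : ∀ t, |t| ≤ π → |w t| ≤ G) (hG0 : 0 ≤ G)
    (j : ℕ) (x : Fin 3 → ℝ) :
    IntervalIntegrable (fun t => Ff c (Xx ((t-2*π*j)/m) x) * w t) MeasureTheory.volume (-π) π ∧
    HasSum (fun l => ∫ t in -π..π, c l * Xx ((t-2*π*j)/m) x^l * w t) (∫ t in -π..π, Ff c (Xx ((t-2*π*j)/m) x) * w t) := by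
  have hπ : -π ≤ π := by linarith [Real.pi_pos]
  have hX := Xx_cont' x m j
  have hi : ∀ l, MeasureTheory.Integrable (fun t => c l * Xx ((t-2*π*j)/m) x^l * w t) (MeasureTheory.volume.restrict (Ioc (-π) π)) := fun l => by
    have : IntervalIntegrable (fun t => c l * Xx ((t-2*π*j)/m) x^l * w t) MeasureTheory.volume (-π) π :=
      (by fun_prop : Continuous _).intervalIntegrable _ _
    rwa [intervalIntegrable_iff_integrableOn_Ioc_of_le hπ] at this
  have hs : Summable fun l => ∫ t in Ioc (-π) π, ‖c l * Xx ((t-2*π*j)/m) x^l * w t‖ := by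
    refine Summable.of_nonneg_of_le (fun l => MeasureTheory.integral_nonneg fun x => norm_nonneg _) (fun l => ?_) (hS_summable.mul_left (K*Cm m*G))
    rw [← intervalIntegral.integral_of_le hπ]
    exact term_bd hm hc hw hG hG0 j l x
  have e : ∀ t, ∑' l, c l * Xx ((t-2*π*j)/m) x^l * w t = Ff c (Xx ((t-2*π*j)/m) x) * w t := fun t => tsum_mul_right
  constructor
  · rw [intervalIntegrable_iff_integrableOn_Ioc_of_le hπ]
    have := integrable_tsum' hi hs
    simp_rw [e] at this
    exact this
  · have := MeasureTheory.hasSum_integral_of_summable_integral_norm hi hs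
    simp_rw [e] at this
    simpa only [intervalIntegral.integral_of_le hπ] using this

lemma term_abs (hm : 1 ≤ m) (hc : ∀ l, |c l| ≤ K/((l:ℝ)+1)) (hw : Continuous w) (hG : ∀ t, |t| ≤ π → |w t| ≤ G) (hG0 : 0 ≤ G)
    (j l : ℕ) (x : Fin 3 → ℝ) : ‖∫ t in -π..π, c l * Xx ((t-2*π*j)/m) x^l * w t‖ ≤ K*Cm m*G*hS l :=
  (intervalIntegral.norm_integral_le_integral_norm (by linarith [Real.pi_pos])).trans (term_bd hm hc hw hG hG0 j l x)

lemma I_abs (hm : 1 ≤ m) (hc : ∀ l, |c l| ≤ K/((l:ℝ)+1)) (hw : Continuous w) (hG : ∀ t, |t| ≤ π → |w t| ≤ G) (hG0 : 0 ≤ G)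
    (j : ℕ) (x : Fin 3 → ℝ) : |∫ t in -π..π, Ff c (Xx ((t-2*π*j)/m) x) * w t| ≤ K*Cm m*G*∑' l, hS l := by
  rw [← (term_sum hm hc hw hG hG0 j x).2.tsum_eq, ← Real.norm_eq_abs]
  exact tsum_of_norm_bounded (hS_summable.hasSum.mul_left _) fun l => term_abs hm hc hw hG hG0 j l x

lemma I_cont (hm : 1 ≤ m) (hc : ∀ l, |c l| ≤ K/((l:ℝ)+1)) (hw : Continuous w) (hG : ∀ t, |t| ≤ π → |w t| ≤ G) (hG0 : 0 ≤ G)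
    (j : ℕ) : ContinuousOn (fun x => ∫ t in -π..π, Ff c (Xx ((t-2*π*j)/m) x) * w t) {x | 0 < Nn x} := by
  have h1 : ContinuousOn (fun x => ∑' l, ∫ t in -π..π, c l * Xx ((t-2*π*j)/m) x^l * w t) {x | 0 < Nn x} := by
    refine continuousOn_tsum (fun l => ?_) (hS_summable.mul_left (K*Cm m*G)) (fun l x _ => term_abs hm hc hw hG hG0 j l x)
    intro x hx
    have := par_cont (a := π) Real.pi_pos.le (f := fun x t => c l * Xx ((t-2*π*j)/m) x^l) (isOpen_lt continuous_const Nn_cont : IsOpen {x | 0 < Nn x}) hw (fun x hx t _ => ?_) hx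
    · refine (this.congr (Eventually.of_forall fun y => ?_)).continuousWithinAt
      refine intervalIntegral.integral_congr fun t _ => ?_
      rw [smul_eq_mul, mul_comm]
    · have hx' : Nn x ≠ 0 := ne_of_gt hx
      have hN : ContinuousAt (fun p : (Fin 3 → ℝ) × ℝ => Nn p.1) (x,t) := (Nn_cont.comp continuous_fst).continuousAt
      have hq : ContinuousAt (fun p : (Fin 3 → ℝ) × ℝ => qq ((p.2-2*π*j)/m) p.1) (x,t) := by
        unfold qq; fun_prop
      have : ContinuousAt (fun p : (Fin 3 → ℝ) × ℝ => c l * ((1 + qq ((p.2-2*π*j)/m) p.1/Nn p.1)/2)^l) (x,t) :=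
        ((((hq.div hN hx').const_add 1).div_const 2).pow l).const_mul _ |> fun h => by simpa using h
      exact this
  refine h1.congr fun x _ => (term_sum hm hc hw hG hG0 j x).2.tsum_eq.symm
end
end TO

namespace TO

noncomputable def uu (m : ℕ) (μ : ℝ) (c : ℕ → ℝ) (g : ℝ → ℝ) (x : Fin 3 → ℝ) : ℝ :=
  ∑ j ∈ Finset.range m, ∫ t in -π..π, Ph μ c ((t-2*π*j)/m) x * g t

noncomputable def Ij (m : ℕ) (c : ℕ → ℝ) (g : ℝ → ℝ) (j : ℕ) (x : Fin 3 → ℝ) : ℝ :=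
  ∫ t in -π..π, Ff c (Xx ((t-2*π*j)/m) x) * g t

lemma uu_eq (m : ℕ) (μ : ℝ) (c : ℕ → ℝ) (g : ℝ → ℝ) (x : Fin 3 → ℝ) :
    uu m μ c g x = Nn x^μ * ∑ j ∈ Finset.range m, Ij m c g j x := by
  unfold uu
  rw [Finset.mul_sum]
  refine Finset.sum_congr rfl fun j _ => ?_
  unfold Ij
  rw [← intervalIntegral.integral_const_mul]
  refine intervalIntegral.integral_congr fun t _ => ?_
  unfold Ph Xx
  ring

lemma Nn_eq_zero {x : Fin 3 → ℝ} (h : Nn x = 0) : x = 0 := by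
  have h1 := Nn_sq x
  rw [h] at h1
  have a0 : x 0 = 0 := by nlinarith [sq_nonneg (x 0), sq_nonneg (x 1), sq_nonneg (x 2)]
  have a1 : x 1 = 0 := by nlinarith [sq_nonneg (x 0), sq_nonneg (x 1), sq_nonneg (x 2)]
  have a2 : x 2 = 0 := by nlinarith [sq_nonneg (x 0), sq_nonneg (x 1), sq_nonneg (x 2)]
  ext i; fin_cases i <;> assumption

lemma Nn_zero : Nn 0 = 0 := by unfold Nn; simp

section
variable {m : ℕ} {δ a : ℝ} {c : ℕ → ℝ} {g : ℝ → ℝ} {μ : ℝ}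

lemma Data.m1 (D : Data m δ c a g) : 1 ≤ m := by have := D.hm; omega

lemma Data.Kc (D : Data m δ c a g) : ∃ K, ∀ l, |c l| ≤ K/((l:ℝ)+1) := D.hc.bound

lemma Data.Ij_bd (D : Data m δ c a g) : ∃ B, ∀ j x, |Ij m c g j x| ≤ B := by
  obtain ⟨K, hK⟩ := D.Kc
  obtain ⟨G, hG0, hG⟩ := exists_bd D.cont
  exact ⟨_, fun j x => I_abs D.m1 hK D.cont hG hG0 j x⟩

lemma Data.Ij_cont (D : Data m δ c a g) (j : ℕ) : ContinuousOn (Ij m c g j) {x | 0 < Nn x} := by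
  obtain ⟨K, hK⟩ := D.Kc
  obtain ⟨G, hG0, hG⟩ := exists_bd D.cont
  exact I_cont D.m1 hK D.cont hG hG0 j

lemma Data.Ij_int (D : Data m δ c a g) (j : ℕ) (x : Fin 3 → ℝ) :
    IntervalIntegrable (fun t => Ff c (Xx ((t-2*π*j)/m) x) * g t) MeasureTheory.volume (-π) π := by
  obtain ⟨K, hK⟩ := D.Kc
  obtain ⟨G, hG0, hG⟩ := exists_bd D.cont
  exact (term_sum D.m1 hK D.cont hG hG0 j x).1

lemma Data.uu_bd (D : Data m δ c a g) (μ : ℝ) : ∃ B, ∀ x, |uu m μ c g x| ≤ Nn x^μ * B := by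
  obtain ⟨B, hB⟩ := D.Ij_bd
  refine ⟨∑ j ∈ Finset.range m, B, fun x => ?_⟩
  rw [uu_eq, abs_mul, abs_of_nonneg (Real.rpow_nonneg (Nn_nonneg x) μ)]
  refine mul_le_mul_of_nonneg_left ?_ (Real.rpow_nonneg (Nn_nonneg x) μ)
  exact (Finset.abs_sum_le_sum_abs _ _).trans (Finset.sum_le_sum fun j _ => hB j x)

lemma uu_zero (hμ : 0 < μ) : uu m μ c g 0 = 0 := by
  rw [uu_eq, Nn_zero, Real.zero_rpow hμ.ne', zero_mul]

lemma Data.uu_cont (D : Data m δ c a g) (hμ : 0 < μ) : Continuous (uu m μ c g) := by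
  rw [continuous_iff_continuousAt]
  intro x
  have hN : Continuous (fun x => Nn x^μ) := Nn_cont.rpow_const fun x => Or.inr hμ.le
  rcases (Nn_nonneg x).eq_or_lt with h | h
  · have hx := Nn_eq_zero h.symm
    subst hx
    obtain ⟨B, hB⟩ := D.uu_bd μ
    unfold ContinuousAt
    rw [uu_zero hμ]
    refine squeeze_zero_norm hB ?_
    have hNB : Continuous (fun x => Nn x^μ * B) := hN.mul continuous_const
    have := hNB.tendsto 0
    simpa [Nn_zero, Real.zero_rpow hμ.ne'] using this
  · have h1 : ContinuousOn (fun x => Nn x^μ * ∑ j ∈ Finset.range m, Ij m c g j x) {x | 0 < Nn x} :=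
      hN.continuousOn.mul (continuousOn_finsetSum _ fun j _ => D.Ij_cont j)
    have h2 := h1.continuousAt ((isOpen_lt continuous_const Nn_cont).mem_nhds h)
    rwa [show uu m μ c g = fun x => Nn x^μ * ∑ j ∈ Finset.range m, Ij m c g j x from funext (uu_eq m μ c g)]

lemma Nn_symm (x : Fin 3 → ℝ) : Nn (Function.update x 2 (-(x 2))) = Nn x := by
  unfold Nn; simp [Function.update]

lemma qq_symm (φ : ℝ) (x : Fin 3 → ℝ) : qq φ (Function.update x 2 (-(x 2))) = qq φ x := by
  unfold qq; simp [Function.update]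

lemma uu_symm (x : Fin 3 → ℝ) : uu m μ c g (Function.update x 2 (-(x 2))) = uu m μ c g x := by
  unfold uu Ph; simp only [Nn_symm, qq_symm]

lemma Nn_smul {r : ℝ} (hr : 0 ≤ r) (x : Fin 3 → ℝ) : Nn (r • x) = r * Nn x := by
  unfold Nn
  rw [← Real.sqrt_sq hr, ← Real.sqrt_mul (sq_nonneg _), Real.sqrt_sq hr]
  congr 1; simp; ring

lemma Xx_smul {r : ℝ} (hr : 0 < r) (φ : ℝ) (x : Fin 3 → ℝ) : Xx φ (r • x) = Xx φ x := by
  unfold Xx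
  rw [Nn_smul hr.le, show qq φ (r • x) = r * qq φ x by unfold qq; simp; ring, mul_div_mul_left _ _ hr.ne']

lemma uu_homog {r : ℝ} (hr : 0 < r) (x : Fin 3 → ℝ) : uu m μ c g (r • x) = r^μ * uu m μ c g x := by
  rw [uu_eq, uu_eq, Nn_smul hr.le, Real.mul_rpow hr.le (Nn_nonneg x), mul_assoc]
  unfold Ij
  simp_rw [Xx_smul hr]

noncomputable def pl (r θ : ℝ) : Fin 3 → ℝ := ![r * Real.cos θ, r * Real.sin θ, 0]

lemma Nn_pl {r : ℝ} (hr : 0 ≤ r) (θ : ℝ) : Nn (pl r θ) = r := by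
  unfold Nn pl
  simp only [Matrix.cons_val_zero, Matrix.cons_val_one, Matrix.cons_val]
  rw [show (r*Real.cos θ)^2 + (r*Real.sin θ)^2 + 0^2 = r^2 by nlinarith [Real.sin_sq_add_cos_sq θ], Real.sqrt_sq hr]

lemma qq_pl (r θ φ : ℝ) : qq φ (pl r θ) = r * Real.cos (θ-φ) := by
  unfold qq pl
  simp only [Matrix.cons_val_zero, Matrix.cons_val_one]
  rw [Real.cos_sub]; ring

lemma pl_exists (x : Fin 3 → ℝ) (h : x 2 = 0) : ∃ r θ, 0 ≤ r ∧ x = pl r θ := by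
  obtain ⟨θ, h0, h1⟩ := polar (x 0) (x 1)
  refine ⟨√(x 0^2 + x 1^2), θ, Real.sqrt_nonneg _, ?_⟩
  ext i
  fin_cases i
  · exact h0
  · exact h1
  · exact h

lemma Data.uu_pl (D : Data m δ c a g) {r : ℝ} (hr : 0 < r) (θ : ℝ) :
    uu m μ c g (pl r θ) = r^μ * ∫ t in -π..π, KK m c (m*θ - t) * g t := by
  have hm : (m:ℝ) ≠ 0 := by have := D.m1; positivity
  rw [uu_eq, Nn_pl hr.le]
  congr 1
  unfold Ij
  rw [← intervalIntegral.integral_finsetSum fun j _ => D.Ij_int j _]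
  refine intervalIntegral.integral_congr fun t _ => ?_
  unfold KK
  rw [Finset.sum_mul]
  refine Finset.sum_congr rfl fun j _ => ?_
  congr 2
  unfold Xx
  rw [qq_pl, Nn_pl hr.le, mul_div_cancel_left₀ _ hr.ne', Real.cos_sq]
  rw [show 2*((m*θ-t+2*π*j)/m/2) = θ - (t-2*π*j)/m by field_simp; ring]; ring

lemma KK_per (hm : 1 ≤ m) : Function.Periodic (KK m c) (2*π) := by
  intro s
  have hm0 : (m:ℝ) ≠ 0 := by positivity
  unfold KK
  have h := Finset.sum_range_succ (fun j : ℕ => Ff c (Real.cos ((s + 2*π*j)/m/2)^2)) m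
  rw [Finset.sum_range_succ'] at h
  have e : Real.cos ((s + 2*π*m)/m/2)^2 = Real.cos ((s + 2*π*(0:ℕ))/m/2)^2 := by
    rw [show (s + 2*π*m)/m/2 = (s + 2*π*(0:ℕ))/m/2 + π by field_simp; push_cast; ring, Real.cos_add_pi, neg_sq]
  rw [e] at h
  have h' := add_right_cancel h
  rw [← h']
  refine Finset.sum_congr rfl fun j _ => ?_
  congr 5; push_cast; ring

noncomputable def Zs (m : ℕ) (c : ℕ → ℝ) (g : ℝ → ℝ) (s : ℝ) : ℝ := ∫ t in -π..π, KK m c (s - t) * g t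

lemma Zs_per (hm : 1 ≤ m) (s : ℝ) (k : ℤ) : Zs m c g (s - 2*π*k) = Zs m c g s := by
  unfold Zs
  refine intervalIntegral.integral_congr fun t _ => ?_
  rw [show s - 2*π*k - t = (s-t) - k*(2*π) by ring, (KK_per hm).sub_int_mul_eq]

lemma round_ex (s : ℝ) : ∃ k : ℤ, |s - 2*π*k| ≤ π := by
  refine ⟨round (s/(2*π)), ?_⟩
  have h := abs_sub_round (s/(2*π))
  have hπ := Real.pi_pos
  rw [show s - 2*π*(round (s/(2*π)):ℤ) = (2*π)*(s/(2*π) - (round (s/(2*π)):ℤ)) by field_simp, abs_mul, abs_of_pos (by positivity)]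
  nlinarith

lemma Data.Zs_cases (D : Data m δ c a g) (s : ℝ) :
    (Zs m c g s = 0 ∧ ∃ k : ℤ, |s - 2*π*k| ≤ a) ∨ (0 < Zs m c g s ∧ ¬ ∃ k : ℤ, |s - 2*π*k| ≤ a) := by
  by_cases h : ∃ k : ℤ, |s - 2*π*k| ≤ a
  · left
    refine ⟨?_, h⟩
    obtain ⟨k, hk⟩ := h
    rw [← Zs_per D.m1 s k]
    exact D.eqn _ hk
  · right
    refine ⟨?_, h⟩
    obtain ⟨k, hk⟩ := round_ex s
    rw [← Zs_per D.m1 s k]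
    exact D.gt _ (not_le.1 fun h' => h ⟨k, h'⟩) hk

lemma Data.slit_iff (D : Data m δ c a g) (θ : ℝ) (k : ℤ) : |θ - 2*π*k/m| ≤ a/π*π/m ↔ |m*θ - 2*π*k| ≤ a := by
  have hm : (0:ℝ) < m := by have := D.m1; positivity
  rw [div_mul_cancel₀ _ Real.pi_pos.ne', le_div_iff₀ hm]
  rw [← abs_of_pos hm, ← abs_mul, abs_of_pos hm, show (θ - 2*π*k/m)*m = m*θ-2*π*k by field_simp]

lemma Data.contact (D : Data m δ c a g) (hμ : 0 < μ) : contactSet (uu m μ c g) 2 = slitCone m (a/π) := by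
  ext x
  constructor
  · rintro ⟨h2, h0⟩
    obtain ⟨r, θ, hr, rfl⟩ := pl_exists x h2
    rcases hr.eq_or_lt with h | h
    · refine ⟨0, le_rfl, 0, ⟨0, ?_⟩, ?_⟩
      · rw [D.slit_iff]; simpa using D.a_pos.le
      · rw [← h]; unfold pl; simp
    · rw [D.uu_pl h] at h0
      have hz : Zs m c g (m*θ) = 0 := (mul_eq_zero.1 h0).resolve_left (Real.rpow_pos_of_pos h μ).ne'
      rcases D.Zs_cases (m*θ) with ⟨_, k, hk⟩ | ⟨h3, _⟩
      · exact ⟨r, hr, θ, ⟨k, (D.slit_iff θ k).2 hk⟩, rfl⟩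
      · exact absurd hz h3.ne'
  · rintro ⟨r, hr, θ, ⟨k, hk⟩, rfl⟩
    refine ⟨rfl, ?_⟩
    change uu m μ c g (pl r θ) = 0
    rcases hr.eq_or_lt with h | h
    · rw [← h, show pl 0 θ = 0 by unfold pl; simp, uu_zero hμ]
    · rw [D.uu_pl h]
      rw [D.slit_iff] at hk
      rcases D.Zs_cases (m*θ) with ⟨h3, _⟩ | ⟨_, h3⟩
      · exact mul_eq_zero_of_right _ h3
      · exact absurd ⟨k, hk⟩ h3

lemma Data.uu_nonneg (D : Data m δ c a g) (hμ : 0 < μ) (x : Fin 3 → ℝ) (h2 : x 2 = 0) : 0 ≤ uu m μ c g x := by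
  obtain ⟨r, θ, hr, rfl⟩ := pl_exists x h2
  rcases hr.eq_or_lt with h | h
  · rw [← h, show pl 0 θ = 0 by unfold pl; simp, uu_zero hμ]
  · rw [D.uu_pl h]
    refine mul_nonneg (Real.rpow_nonneg hr μ) ?_
    rcases D.Zs_cases (m*θ) with ⟨h3, _⟩ | ⟨h3, _⟩
    · exact h3.ge
    · exact h3.le

lemma Data.uu_ne (D : Data m δ c a g) : uu m μ c g ≠ 0 := by
  intro h
  have hm : (m:ℝ) ≠ 0 := by have := D.m1; positivity
  have h1 := D.uu_pl (μ := μ) one_pos (π/m)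
  rw [h, Real.one_rpow, one_mul, mul_div_cancel₀ _ hm] at h1
  have := D.gt π (by rw [abs_of_pos Real.pi_pos]; linarith [D.a_le, Real.pi_pos]) (by rw [abs_of_pos Real.pi_pos])
  simp only [Pi.zero_apply] at h1
  linarith
end
end TO

namespace TO

lemma lap_sum {ι : Type} (s : Finset ι) {f : ι → (Fin 3 → ℝ) → ℝ} {x : Fin 3 → ℝ} (h : ∀ k ∈ s, ContDiffAt ℝ 2 (f k) x) :
    lap (fun y => ∑ k ∈ s, f k y) x = ∑ k ∈ s, lap (f k) x := by
  have h1 : ∀ i, pd i (fun y => ∑ k ∈ s, f k y) =ᶠ[nhds x] fun y => ∑ k ∈ s, pd i (f k) y := by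
    intro i
    have he : ∀ᶠ y in nhds x, ∀ k ∈ s, ContDiffAt ℝ 2 (f k) y :=
      (Finset.eventually_all s).2 fun k hk => (h k hk).eventually (by simp)
    filter_upwards [he] with y hy
    unfold pd
    rw [fderiv_fun_sum fun k hk => (hy k hk).differentiableAt (by norm_num)]
    simp
  unfold lap
  rw [Finset.sum_comm]
  refine Finset.sum_congr rfl fun i _ => ?_
  have pdef : ∀ (f : (Fin 3 → ℝ) → ℝ) x, pd i f x = fderiv ℝ f x (Pi.single i 1) := fun _ _ => rfl
  rw [pdef, (h1 i).fderiv_eq, fderiv_fun_sum fun k hk => pd_diff (h k hk) i, ContinuousLinearMap.sum_apply]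
  rfl

section
variable {m : ℕ} {δ a : ℝ} {c : ℕ → ℝ} {g : ℝ → ℝ} {μ : ℝ}

lemma Data.restr (D : Data m δ c a g) {h : ℝ → ℝ} (hi : IntervalIntegrable (fun t => h t * g t) MeasureTheory.volume (-π) π) :
    ∫ t in -π..π, h t * g t = ∫ t in -a..a, h t * g t := by
  have ha := D.a_pos
  have ha' : a < π := by linarith [D.a_le, Real.pi_pos]
  have i1 : IntervalIntegrable (fun t => h t * g t) MeasureTheory.volume (-π) (-a) :=
    hi.mono_set (by rw [uIcc_of_le (by linarith), uIcc_of_le (by linarith)]; exact Icc_subset_Icc le_rfl (by linarith))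
  have i2 : IntervalIntegrable (fun t => h t * g t) MeasureTheory.volume (-a) a :=
    hi.mono_set (by rw [uIcc_of_le (by linarith), uIcc_of_le (by linarith)]; exact Icc_subset_Icc (by linarith) (by linarith))
  have i3 : IntervalIntegrable (fun t => h t * g t) MeasureTheory.volume a π :=
    hi.mono_set (by rw [uIcc_of_le (by linarith), uIcc_of_le (by linarith)]; exact Icc_subset_Icc (by linarith) le_rfl)
  rw [← intervalIntegral.integral_add_adjacent_intervals (i1.trans i2) i3, ← intervalIntegral.integral_add_adjacent_intervals i1 i2]
  have z1 : ∫ t in -π..-a, h t * g t = 0 := by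
    rw [intervalIntegral.integral_congr (g := fun _ => (0:ℝ))]
    · simp
    · intro t ht
      rw [uIcc_of_le (by linarith)] at ht
      have : |t| = -t := abs_of_nonpos (by linarith [ht.2])
      beta_reduce
      rw [D.zero t (by linarith [ht.2]) (by linarith [ht.1]), mul_zero]
  have z2 : ∫ t in a..π, h t * g t = 0 := by
    rw [intervalIntegral.integral_congr (g := fun _ => (0:ℝ))]
    · simp
    · intro t ht
      rw [uIcc_of_le (by linarith)] at ht
      have : |t| = t := abs_of_nonneg (by linarith [ht.1])
      beta_reduce
      rw [D.zero t (by linarith [ht.1]) (by linarith [ht.2]), mul_zero]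
  rw [z1, z2]; ring

lemma Data.off (D : Data m δ c a g) {x : Fin 3 → ℝ} (hx : x ∈ (slitCone m (a/π))ᶜ) {t : ℝ} (ht : t ∈ Icc (-a) a) (j : ℕ) :
    qq ((t-2*π*j)/m) x < Nn x := by
  by_contra hn
  apply hx
  have hm : (m:ℝ) ≠ 0 := by have := D.m1; positivity
  set φ := (t-2*π*j)/m with hφ
  have h1 := (_root_.abs_le.1 (qq_abs φ x)).2
  have h2 : qq φ x = Nn x := le_antisymm h1 (not_lt.1 hn)
  have h3 := Nn_sq x
  rw [← h2] at h3
  have hs := Real.sin_sq_add_cos_sq φ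
  have h4 : (x 0 * Real.sin φ - x 1 * Real.cos φ)^2 + x 2^2 = 0 := by
    unfold qq at h3
    linear_combination (-1)*h3 + (x 0^2 + x 1^2)*hs
  have h5 : x 2 = 0 := by nlinarith [sq_nonneg (x 0 * Real.sin φ - x 1 * Real.cos φ), sq_nonneg (x 2)]
  have h6 : x 0 * Real.sin φ - x 1 * Real.cos φ = 0 := by nlinarith [sq_nonneg (x 0 * Real.sin φ - x 1 * Real.cos φ), sq_nonneg (x 2)]
  refine ⟨Nn x, Nn_nonneg x, φ, ⟨-j, ?_⟩, ?_⟩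
  · rw [D.slit_iff]
    rw [show (m:ℝ)*φ - 2*π*((-j:ℤ):ℝ) = t by rw [hφ]; push_cast; field_simp; ring]
    exact _root_.abs_le.2 ht
  · rw [← h2]
    ext i
    unfold qq
    fin_cases i
    · simp only [Fin.zero_eta, Matrix.cons_val_zero]
      linear_combination (-(x 0))*hs + Real.sin φ*h6
    · simp only [Fin.mk_one, Matrix.cons_val_one, Matrix.cons_val_zero]
      linear_combination (-(x 1))*hs - Real.cos φ*h6
    · exact h5

noncomputable def wj (m : ℕ) (μ : ℝ) (c : ℕ → ℝ) (g : ℝ → ℝ) (j : ℕ) (x : Fin 3 → ℝ) : ℝ :=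
  ∫ t in -π..π, Ph μ c ((t-2*π*j)/m) x * g t

lemma Data.wj_int (D : Data m δ c a g) (j : ℕ) (x : Fin 3 → ℝ) :
    IntervalIntegrable (fun t => Ph μ c ((t-2*π*j)/m) x * g t) MeasureTheory.volume (-π) π := by
  have := (D.Ij_int j x).const_mul (Nn x^μ)
  refine this.congr_ae (Eventually.of_forall fun t => ?_)
  unfold Ph Xx; ring

lemma Data.wj_eq (D : Data m δ c a g) (j : ℕ) : wj m μ c g j = fun x => ∫ t in -a..a, g t • Ph μ c ((t-2*π*j)/m) x := by
  funext x
  unfold wj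
  rw [D.restr (h := fun t => Ph μ c ((t-2*π*j)/m) x) (D.wj_int j x)]
  refine intervalIntegral.integral_congr fun t _ => ?_
  rw [smul_eq_mul, mul_comm]

lemma Data.openC (D : Data m δ c a g) (hμ : 0 < μ) : IsOpen (slitCone m (a/π))ᶜ := by
  rw [← D.contact hμ]
  have h1 : IsClosed (contactSet (uu m μ c g) 2) :=
    (isClosed_eq (continuous_apply 2) continuous_const).inter (isClosed_eq (D.uu_cont hμ) continuous_const)
  exact h1.isOpen_compl

lemma Data.Ph_j (D : Data m δ c a g) (j : ℕ) : ∀ x ∈ (slitCone m (a/π))ᶜ, ∀ t ∈ Icc (-a) a,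
    ContDiffAt ℝ 2 (Function.uncurry fun x t => Ph μ c ((t-2*π*j)/m) x) (x,t) := by
  intro x hx t ht
  have h1 := Ph_cd 2 (μ := μ) D.hc.pg (p := (x,(t-2*π*j)/m)) (D.off hx ht j)
  exact ContDiffAt.comp (x,t) (g := fun p : (Fin 3 → ℝ) × ℝ => Ph μ c p.2 p.1) (f := fun p : (Fin 3 → ℝ) × ℝ => (p.1, (p.2-2*π*j)/m)) h1 (by fun_prop)

lemma Data.wj_cd (D : Data m δ c a g) (hμ : 0 < μ) (j : ℕ) : ContDiffOn ℝ 2 (wj m μ c g j) (slitCone m (a/π))ᶜ := by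
  rw [D.wj_eq]
  exact par_cd2 D.a_pos.le (D.openC hμ) D.cont (D.Ph_j j)

lemma Data.wj_lap (D : Data m δ c a g) (hμ : 0 < μ) (hM : MM m δ = μ*(μ+1)) (j : ℕ) {x} (hx : x ∈ (slitCone m (a/π))ᶜ) :
    lap (wj m μ c g j) x = 0 := by
  rw [D.wj_eq]
  exact par_lap D.a_pos.le (D.openC hμ) D.cont (D.Ph_j j) (fun x hx t ht => lap_Ph D.hc hM (D.off hx ht j)) hx

lemma Data.uu_cd (D : Data m δ c a g) (hμ : 0 < μ) : ContDiffOn ℝ 2 (uu m μ c g) (slitCone m (a/π))ᶜ :=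
  ContDiffOn.sum fun j _ => D.wj_cd hμ j

lemma Data.uu_lap (D : Data m δ c a g) (hμ : 0 < μ) (hM : MM m δ = μ*(μ+1)) {x} (hx : x ∈ (slitCone m (a/π))ᶜ) :
    lap (uu m μ c g) x = 0 := by
  have : uu m μ c g = fun y => ∑ j ∈ Finset.range m, wj m μ c g j y := rfl
  rw [this, lap_sum _ fun j _ => (D.wj_cd hμ j).contDiffAt ((D.openC hμ).mem_nhds hx)]
  exact Finset.sum_eq_zero fun j _ => D.wj_lap hμ hM j hx
end
end TO

namespace TO

noncomputable def pk (r q z : ℝ) : ℝ := z/(√(r^2+z^2) - r*q)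

lemma rz_sq (r z : ℝ) : √(r^2+z^2)^2 = r^2+z^2 := Real.sq_sqrt (by positivity)

lemma rz_lt {r z : ℝ} (hz : 0 < z) : r < √(r^2+z^2) := by
  refine Real.lt_sqrt_of_sq_lt ?_
  nlinarith

lemma rz_den {r z q : ℝ} (hr : 0 < r) (hz : 0 < z) (hq : q ≤ 1) : 0 < √(r^2+z^2) - r*q := by
  have := rz_lt (r := r) hz
  nlinarith

lemma pk_nonneg {r z q : ℝ} (hr : 0 < r) (hz : 0 < z) (hq : q ≤ 1) : 0 ≤ pk r q z :=
  div_nonneg hz.le (rz_den hr hz hq).le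

lemma pk_le {r z q q0 : ℝ} (hr : 0 < r) (hz : 0 < z) (hq : q ≤ q0) (h0 : q0 < 1) : pk r q z ≤ z/(r*(1-q0)) := by
  unfold pk
  have := rz_lt (r := r) hz
  refine div_le_div_of_nonneg_left hz.le (mul_pos hr (by linarith)) ?_
  nlinarith

lemma pk_cont {r z : ℝ} (hr : 0 < r) (hz : 0 < z) {q : ℝ → ℝ} (hq : Continuous q) (h : ∀ t, q t ≤ 1) : Continuous fun t => pk r (q t) z := by
  unfold pk
  exact continuous_const.div (by fun_prop) fun t => (rz_den hr hz (h t)).ne'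

lemma pk_unif {r : ℝ} (hr : 0 < r) {q : ℝ → ℝ} (hq : Continuous q) {K : Set ℝ} (hK : IsCompact K) (h : ∀ t ∈ K, q t < 1) :
    ∃ q0 < 1, ∀ t ∈ K, q t ≤ q0 := by
  rcases K.eq_empty_or_nonempty with rfl | hne
  · exact ⟨0, by norm_num, by simp⟩
  · obtain ⟨t, ht, hm⟩ := hK.exists_isMaxOn hne hq.continuousOn
    exact ⟨q t, h t ht, fun s hs => hm hs⟩

lemma z_lim (k : ℝ) : Tendsto (fun z : ℝ => z*k) (nhdsWithin 0 (Ioi 0)) (nhds 0) := by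
  have : Tendsto (fun z : ℝ => z*k) (nhds 0) (nhds (0*k)) := (by fun_prop : Continuous fun z : ℝ => z*k).tendsto 0
  rw [zero_mul] at this
  exact this.mono_left nhdsWithin_le_nhds

lemma pk_lim0 {r : ℝ} (hr : 0 < r) {q : ℝ → ℝ} (hq : Continuous q) (h1 : ∀ t, q t ≤ 1) (h : ∀ t ∈ Icc (-π) π, q t < 1) {w : ℝ → ℝ} (hw : Continuous w) :
    Tendsto (fun z => ∫ t in -π..π, pk r (q t) z * w t) (nhdsWithin 0 (Ioi 0)) (nhds 0) := by
  obtain ⟨q0, hq0, hq1⟩ := pk_unif hr hq isCompact_Icc h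
  obtain ⟨G, hG0, hG⟩ := exists_bd hw
  refine squeeze_zero_norm' ?_ (z_lim (1/(r*(1-q0))*G*|π - -π|))
  filter_upwards [self_mem_nhdsWithin] with z hz
  have hz : 0 < z := hz
  refine (intervalIntegral.norm_integral_le_of_norm_le_const (C := z/(r*(1-q0))*G) fun t ht => ?_).trans (le_of_eq (by ring))
  rw [uIoc_of_le (by linarith [Real.pi_pos])] at ht
  have ht' : t ∈ Icc (-π) π := ⟨ht.1.le, ht.2⟩
  rw [norm_mul, Real.norm_eq_abs, Real.norm_eq_abs, abs_of_nonneg (pk_nonneg hr hz (h1 t))]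
  exact mul_le_mul (pk_le hr hz (hq1 t ht') hq0) (hG t (_root_.abs_le.2 ht')) (abs_nonneg _) ((pk_nonneg hr hz (h1 t)).trans (pk_le hr hz (hq1 t ht') hq0))

lemma pk_anti {r z t0 : ℝ} {m : ℕ} (hm : 2 ≤ m) (hr : 0 < r) (hz : 0 < z) {t : ℝ} (ht : |t-t0| ≤ π) :
    HasDerivAt (fun t => 2*m*Real.arctan ((√(r^2+z^2)+r)/z * Real.tan ((t-t0)/(2*m)))) (pk r (Real.cos ((t-t0)/m)) z) t := by
  have hm' : (2:ℝ) ≤ m := by exact_mod_cast hm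
  have hc : 0 < Real.cos ((t-t0)/(2*m)) := by
    have h := _root_.abs_le.1 ht
    apply Real.cos_pos_of_mem_Ioo
    constructor
    · rw [lt_div_iff₀ (by positivity)]; nlinarith [Real.pi_pos]
    · rw [div_lt_iff₀ (by positivity)]; nlinarith [Real.pi_pos]
  have h0 : HasDerivAt (fun t => (t-t0)/(2*(m:ℝ))) (1/(2*m)) t := ((hasDerivAt_id t).sub_const t0).div_const _
  have h1 := ((((Real.hasDerivAt_tan hc.ne').comp t h0).const_mul ((√(r^2+z^2)+r)/z)).arctan).const_mul (2*(m:ℝ))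
  convert! h1 using 1
  have e : (t-t0)/m = 2*((t-t0)/(2*m)) := by field_simp
  have hN := rz_sq r z
  have hl := rz_lt (r := r) hz
  have hs := Real.sin_sq_add_cos_sq ((t-t0)/(2*m))
  simp only [Function.comp]
  rw [e, Real.cos_two_mul, Real.tan_eq_sin_div_cos]
  set C := Real.cos ((t-t0)/(2*m))
  set S := Real.sin ((t-t0)/(2*m))
  set N := √(r^2+z^2)
  have hC1 : C^2 ≤ 1 := by nlinarith [sq_nonneg S]
  unfold pk
  have hd : N - r*(2*C^2-1) ≠ 0 := by
    have : 0 < N - r*(2*C^2-1) := by nlinarith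
    exact this.ne'
  have hd2 : z^2*C^2 + (N+r)^2*S^2 ≠ 0 := by
    have : 0 < z^2*C^2 := by positivity
    have : 0 ≤ (N+r)^2*S^2 := by positivity
    linarith
  have e2 : 1 + ((N+r)/z*(S/C))^2 = (z^2*C^2 + (N+r)^2*S^2)/(z^2*C^2) := by field_simp
  have hS : S^2 = 1 - C^2 := by linarith
  rw [show √(r^2+z^2) = N from rfl, e2]
  have hzz : z^2 = N^2 - r^2 := by linarith
  have key : z^2*C^2 + (N+r)^2*S^2 = (N+r)*(N - r*(2*C^2-1)) := by rw [hzz, hS]; ring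
  rw [key]
  have : 0 < N + r := by linarith
  field_simp

lemma pk_int {r z t0 η : ℝ} {m : ℕ} (hm : 2 ≤ m) (hr : 0 < r) (hz : 0 < z) (hη : 0 < η) (hη' : η ≤ π) :
    ∫ t in (t0-η)..(t0+η), pk r (Real.cos ((t-t0)/m)) z = 4*m*Real.arctan ((√(r^2+z^2)+r)/z * Real.tan (η/(2*m))) := by
  rw [intervalIntegral.integral_eq_sub_of_hasDerivAt (f := fun t => 2*m*Real.arctan ((√(r^2+z^2)+r)/z * Real.tan ((t-t0)/(2*m))))]
  · rw [show t0+η-t0 = η by ring, show (t0-η-t0)/(2*(m:ℝ)) = -(η/(2*m)) by ring, Real.tan_neg, mul_neg, Real.arctan_neg]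
    ring
  · intro t ht
    rw [uIcc_of_le (by linarith)] at ht
    exact pk_anti hm hr hz (_root_.abs_le.2 ⟨by linarith [ht.1], by linarith [ht.2]⟩)
  · exact (pk_cont hr hz (by fun_prop) fun t => Real.cos_le_one _).intervalIntegrable _ _

lemma pk_int_lim {r t0 η : ℝ} {m : ℕ} (hm : 2 ≤ m) (hr : 0 < r) (hη : 0 < η) (hη' : η ≤ π) :
    Tendsto (fun z => ∫ t in (t0-η)..(t0+η), pk r (Real.cos ((t-t0)/m)) z) (nhdsWithin 0 (Ioi 0)) (nhds (2*π*m)) := by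
  have hm' : (2:ℝ) ≤ m := by exact_mod_cast hm
  have hT : 0 < Real.tan (η/(2*m)) := by
    apply Real.tan_pos_of_pos_of_lt_pi_div_two (by positivity)
    rw [div_lt_iff₀ (by positivity)]; nlinarith [Real.pi_pos]
  have h1 : Tendsto (fun z : ℝ => (√(r^2+z^2)+r)/z * Real.tan (η/(2*m))) (nhdsWithin 0 (Ioi 0)) atTop := by
    refine Tendsto.atTop_mul_const hT ?_
    refine tendsto_atTop_mono' _ ?_ (tendsto_inv_nhdsGT_zero.const_mul_atTop hr)
    filter_upwards [self_mem_nhdsWithin] with z hz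
    have hz : 0 < z := hz
    rw [div_eq_mul_inv]
    refine mul_le_mul_of_nonneg_right ?_ (by positivity)
    have := Real.sqrt_nonneg (r^2+z^2); linarith
  have h2 := ((tendsto_arctan_atTop.mono_right nhdsWithin_le_nhds).comp h1).const_mul (4*(m:ℝ))
  rw [show 4*(m:ℝ)*(π/2) = 2*π*m by ring] at h2
  refine h2.congr' ?_
  filter_upwards [self_mem_nhdsWithin] with z hz
  exact (pk_int hm hr hz hη hη').symm

lemma pk_lim1 {r t0 η : ℝ} {m : ℕ} (hm : 2 ≤ m) (hr : 0 < r) (hη : 0 < η) (h : |t0| + η ≤ π) {w : ℝ → ℝ} (hw : Continuous w) :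
    Tendsto (fun z => ∫ t in -π..π, pk r (Real.cos ((t-t0)/m)) z * w t) (nhdsWithin 0 (Ioi 0)) (nhds (2*π*m*w t0)) := by
  have hm' : (2:ℝ) ≤ m := by exact_mod_cast hm
  have hp := Real.pi_pos
  have ht0 := _root_.abs_le.1 (le_refl |t0|)
  have hP : 0 < 2*π*(m:ℝ) := by positivity
  have qc : Continuous fun t : ℝ => Real.cos ((t-t0)/m) := by fun_prop
  have main := tendsto_setIntegral_peak_smul_of_integrableOn_of_tendsto (μ := MeasureTheory.volume) (l := nhdsWithin (0:ℝ) (Ioi 0))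
    (s := Icc (-π) π) (t := Icc (t0-η) (t0+η)) (x₀ := t0) (φ := fun z t => pk r (Real.cos ((t-t0)/m)) z/(2*π*m)) (g := w) (a := w t0)
    measurableSet_Icc measurableSet_Icc (Icc_subset_Icc (by linarith) (by linarith))
    (mem_nhdsWithin_of_mem_nhds (Icc_mem_nhds (by linarith) (by linarith))) (by simp) ?_ ?_ ?_ ?_ ?_ ?_
  · have := main.const_mul (2*π*(m:ℝ))
    refine this.congr fun z => ?_
    rw [intervalIntegral.integral_of_le (by linarith), ← MeasureTheory.integral_Icc_eq_integral_Ioc, ← MeasureTheory.integral_const_mul]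
    refine MeasureTheory.setIntegral_congr_fun measurableSet_Icc fun t _ => ?_
    simp only [smul_eq_mul]
    field_simp
  · filter_upwards [self_mem_nhdsWithin] with z hz t _
    exact div_nonneg (pk_nonneg hr hz (Real.cos_le_one _)) hP.le
  · intro u hu h0
    obtain ⟨q0, hq0, hq1⟩ := pk_unif hr qc (K := Icc (-π) π \ u) (isCompact_Icc.diff hu) (by
      intro t ht
      refine lt_of_le_of_ne (Real.cos_le_one _) fun hc => ?_
      have h3 := (Real.cos_eq_one_iff_of_lt_of_lt (x := (t-t0)/m) (by rw [lt_div_iff₀ (by positivity)]; nlinarith [ht.1.1]) (by rw [div_lt_iff₀ (by positivity)]; nlinarith [ht.1.2])).1 hc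
      rw [div_eq_zero_iff] at h3
      rcases h3 with h3 | h3
      · exact ht.2 (by rwa [show t = t0 by linarith])
      · linarith)
    rw [Metric.tendstoUniformlyOn_iff]
    intro ε hε
    have := z_lim (1/(r*(1-q0))/(2*π*m))
    filter_upwards [self_mem_nhdsWithin, this.eventually_lt_const hε] with z hz hz2 t ht
    have hz : 0 < z := hz
    have h5 := pk_nonneg hr hz (Real.cos_le_one ((t-t0)/m))
    rw [Pi.zero_apply, dist_zero_left, Real.norm_eq_abs, abs_of_nonneg (div_nonneg h5 hP.le)]
    refine lt_of_le_of_lt ?_ hz2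
    refine (div_le_div_of_nonneg_right (pk_le hr hz (hq1 t ht) hq0) hP.le).trans (le_of_eq (by ring))
  · have := (pk_int_lim (t0 := t0) hm hr hη (by linarith [abs_nonneg t0])).div_const (2*π*(m:ℝ))
    rw [div_self hP.ne'] at this
    refine this.congr fun z => ?_
    rw [intervalIntegral.integral_of_le (by linarith), ← MeasureTheory.integral_Icc_eq_integral_Ioc, MeasureTheory.integral_div]
  · filter_upwards [self_mem_nhdsWithin] with z hz
    exact ((pk_cont hr hz qc fun t => Real.cos_le_one _).div_const _).aestronglyMeasurable
  · exact hw.continuousOn.integrableOn_compact isCompact_Icc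
  · exact (hw.tendsto t0).mono_left nhdsWithin_le_nhds

end TO

namespace TO

lemma Nn_up (r θ z : ℝ) : Nn (pl r θ + z • (Pi.single 2 1 : Fin 3 → ℝ)) = √(r^2+z^2) := by
  unfold Nn pl
  congr 1
  simp [Pi.single_apply]
  linear_combination r^2 * Real.sin_sq_add_cos_sq θ

lemma qq_up (φ r θ z : ℝ) : qq φ (pl r θ + z • (Pi.single 2 1 : Fin 3 → ℝ)) = r * Real.cos (θ-φ) := by
  rw [← qq_pl]
  unfold qq
  simp [Pi.single_apply]

noncomputable def XZ (r C z : ℝ) : ℝ := (1 + r*C/√(r^2+z^2))/2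

lemma Xx_up (φ r θ z : ℝ) : Xx φ (pl r θ + z • (Pi.single 2 1 : Fin 3 → ℝ)) = XZ r (Real.cos (θ-φ)) z := by
  unfold Xx XZ
  rw [Nn_up, qq_up]

lemma XZ_lt {r θ φ z : ℝ} (hr : 0 < r) (hz : 0 < z) : |XZ r (Real.cos (θ-φ)) z| < 1 := by
  rw [← Xx_up]
  refine X_lt ?_
  rw [Nn_up, qq_up]
  have := rz_den hr hz (Real.cos_le_one (θ-φ)); linarith

lemma XZ_deriv {r C z : ℝ} (hr : 0 < r) : HasDerivAt (XZ r C) (-(r*C*z/(2*√(r^2+z^2)^3))) z := by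
  have h0 : r^2+z^2 ≠ 0 := by positivity
  have h1 : HasDerivAt (fun z : ℝ => r^2+z^2) (2*z) z := by simpa using (hasDerivAt_pow 2 z).const_add (r^2)
  have h2 := h1.sqrt h0
  have hN : √(r^2+z^2) ≠ 0 := by positivity
  have h3 := (((h2.inv hN).const_mul (r*C)).const_add 1).div_const 2
  convert! h3 using 1
  field_simp

section
variable {m : ℕ} {δ a : ℝ} {c : ℕ → ℝ} {g : ℝ → ℝ} {μ : ℝ}

lemma XZ_cd (m j : ℕ) {r θ : ℝ} (hr : 0 < r) (p : ℝ × ℝ) :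
    ContDiffAt ℝ 1 (fun p : ℝ × ℝ => XZ r (Real.cos (θ-(p.2-2*π*j)/m)) p.1) p := by
  unfold XZ
  have h0 : r^2+p.1^2 ≠ 0 := by positivity
  have hN : √(r^2+p.1^2) ≠ 0 := by positivity
  have h1 : ContDiffAt ℝ 1 (fun p : ℝ × ℝ => √(r^2+p.1^2)) p := ContDiffAt.sqrt (by fun_prop) h0
  have h2 : ContDiffAt ℝ 1 (fun p : ℝ × ℝ => r*Real.cos (θ-(p.2-2*π*j)/m)) p := by fun_prop
  exact (contDiffAt_const.add (h2.div h1 hN)).div_const 2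

lemma Data.F_cd (D : Data m δ c a g) (j : ℕ) {r θ : ℝ} (hr : 0 < r) {z t : ℝ} (hz : 0 < z) :
    ContDiffAt ℝ 1 (Function.uncurry fun z t => Ff c (XZ r (Real.cos (θ-(t-2*π*j)/m)) z)) (z,t) := by
  have h1 : ContDiffAt ℝ 1 (Ff c) (XZ r (Real.cos (θ-(t-2*π*j)/m)) z) :=
    (D.hc.pg.contDiffOn 1).contDiffAt (isOpen_Ioo.mem_nhds (_root_.abs_lt.1 (XZ_lt hr hz)))
  exact ContDiffAt.comp (z,t) (g := Ff c) (f := fun p : ℝ × ℝ => XZ r (Real.cos (θ-(p.2-2*π*j)/m)) p.1) h1 (XZ_cd m j hr (z,t))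

lemma Data.y_deriv (D : Data m δ c a g) (j : ℕ) {r : ℝ} (θ : ℝ) (hr : 0 < r) {z : ℝ} (hz : 0 < z) :
    HasDerivAt (fun z => Ij m c g j (pl r θ + z • (Pi.single 2 1 : Fin 3 → ℝ)))
      (-(r/√(r^2+z^2)^2) * (∫ t in -π..π, pk r (Real.cos (θ-(t-2*π*j)/m)) z * (Real.cos (θ-(t-2*π*j)/m) * g t))
       - r*z/(2*√(r^2+z^2)^3) * ∫ t in -π..π, Ff (w1 c) (Xx ((t-2*π*j)/m) (pl r θ + z • (Pi.single 2 1 : Fin 3 → ℝ))) * (Real.cos (θ-(t-2*π*j)/m) * g t)) z := by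
  have e0 : (fun z => Ij m c g j (pl r θ + z • (Pi.single 2 1 : Fin 3 → ℝ))) = fun z => ∫ t in -π..π, g t • Ff c (XZ r (Real.cos (θ-(t-2*π*j)/m)) z) := by
    funext z
    unfold Ij
    refine intervalIntegral.integral_congr fun t _ => ?_
    rw [Xx_up, smul_eq_mul, mul_comm]
  rw [e0]
  have h1 := (par_diff (f := fun z t => Ff c (XZ r (Real.cos (θ-(t-2*π*j)/m)) z)) Real.pi_pos.le isOpen_Ioi D.cont
    (fun z hz t _ => D.F_cd (θ := θ) j hr hz) hz).hasDerivAt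
  convert! h1 using 1
  rw [ContinuousLinearMap.intervalIntegral_apply]
  · have hwc : Continuous fun t => Real.cos (θ-(t-2*π*j)/m) * g t := (by fun_prop : Continuous fun t : ℝ => Real.cos (θ-(t-2*π*j)/m)).mul D.cont
    obtain ⟨K, hK0, hK⟩ := D.hc.w1_bound
    obtain ⟨G, hG0, hG⟩ := exists_bd hwc
    have i1 : IntervalIntegrable (fun t => pk r (Real.cos (θ-(t-2*π*j)/m)) z * (Real.cos (θ-(t-2*π*j)/m) * g t)) MeasureTheory.volume (-π) π :=
      ((pk_cont hr hz (by fun_prop) fun t => Real.cos_le_one _).mul hwc).intervalIntegrable _ _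
    have i2 := (term_sum D.m1 hK hwc hG hG0 j (pl r θ + z • (Pi.single 2 1 : Fin 3 → ℝ))).1
    rw [← intervalIntegral.integral_const_mul, ← intervalIntegral.integral_const_mul, ← intervalIntegral.integral_sub (i1.const_mul _) (i2.const_mul _)]
    refine intervalIntegral.integral_congr fun t _ => ?_
    have hX := XZ_lt (θ := θ) (φ := (t-2*π*j)/m) hr hz
    have hd := ((D.hc.pg.hasDerivAt hX).comp z (XZ_deriv (C := Real.cos (θ-(t-2*π*j)/m)) hr)).hasFDerivAt.fderiv
    have hN : 0 < √(r^2+z^2) := by positivity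
    have hden := rz_den hr hz (Real.cos_le_one (θ-(t-2*π*j)/m))
    simp only [Function.comp_def] at hd
    beta_reduce
    rw [hd, Xx_up, D.hc.dF_eq hX]
    have e1 : 1/(1-XZ r (Real.cos (θ-(t-2*π*j)/m)) z) = 2*√(r^2+z^2)/(√(r^2+z^2) - r*Real.cos (θ-(t-2*π*j)/m)) := by
      unfold XZ
      have e2 : 1-(1 + r*Real.cos (θ-(t-2*π*j)/m)/√(r^2+z^2))/2 = (√(r^2+z^2) - r*Real.cos (θ-(t-2*π*j)/m))/(2*√(r^2+z^2)) := by
        field_simp; ring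
      rw [e2, one_div_div]
    rw [e1]
    unfold pk
    simp only [ContinuousLinearMap.smul_apply, ContinuousLinearMap.toSpanSingleton_apply, smul_eq_mul]
    field_simp
    ring
  · refine ContinuousOn.intervalIntegrable ?_
    rw [uIcc_of_le (by linarith [Real.pi_pos])]
    exact par_slice D.cont fun t ht => (par_fd_cd (m := 0) (by norm_num) (D.F_cd (θ := θ) (t := t) j hr hz)).continuousAt

lemma Data.pk_L (D : Data m δ c a g) (j : ℕ) {r θ : ℝ} (hr : 0 < r) {k : ℤ} (hk : |(m:ℝ)*θ-2*π*k| ≤ a) :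
    ∃ L, 0 ≤ L ∧ Tendsto (fun z => ∫ t in -π..π, pk r (Real.cos (θ-(t-2*π*j)/m)) z * (Real.cos (θ-(t-2*π*j)/m) * g t)) (nhdsWithin 0 (Ioi 0)) (nhds L) := by
  have hp := Real.pi_pos
  have ha := D.a_le
  have hm := D.hm
  have hm0 : (m:ℝ) ≠ 0 := by have := D.m1; positivity
  have hwc : Continuous fun t => Real.cos (θ-(t-2*π*j)/m) * g t := (by fun_prop : Continuous fun t : ℝ => Real.cos (θ-(t-2*π*j)/m)).mul D.cont
  by_cases hs : ∃ t ∈ Icc (-π) π, Real.cos (θ-(t-2*π*j)/m) = 1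
  · obtain ⟨t, ht, hc⟩ := hs
    obtain ⟨n, hn⟩ := (Real.cos_eq_one_iff _).1 hc
    -- t = mθ + 2πj − 2πmn
    have e1 : (m:ℝ)*θ - (t - 2*π*j) = m*(n*(2*π)) := by
      have : (m:ℝ)*(θ-(t-2*π*j)/m) = m*(n*(2*π)) := by rw [hn]
      rw [← this]; field_simp
    have e2 : ((m:ℝ)*θ-2*π*k) - t = 2*π*((m*n - j - k : ℤ):ℝ) := by push_cast; linarith
    have hk' := _root_.abs_le.1 hk
    have e3 : (m*n - j - k : ℤ) = 0 := by
      have b1 : ((m*n - j - k : ℤ):ℝ) < 1 := by nlinarith [ht.1]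
      have b2 : (-1:ℝ) < ((m*n - j - k : ℤ):ℝ) := by nlinarith [ht.2]
      have b1' : (m*n - j - k : ℤ) < 1 := by exact_mod_cast b1
      have b2' : -1 < (m*n - j - k : ℤ) := by exact_mod_cast b2
      omega
    rw [e3] at e2
    have e4 : t = (m:ℝ)*θ-2*π*k := by simp at e2; linarith
    have hta : |t| ≤ a := by rw [e4]; exact hk
    have ec : ∀ s : ℝ, Real.cos (θ-(s-2*π*j)/m) = Real.cos ((s-t)/m) := by
      intro s
      have : θ-(s-2*π*j)/m = -((s-t)/m) + n*(2*π) := by rw [hn]; ring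
      rw [this, Real.cos_add_int_mul_two_pi, Real.cos_neg]
    have hl := pk_lim1 (t0 := t) (η := π-a) (m := m) (by omega) hr (by linarith) (by linarith) hwc
    refine ⟨_, ?_, by simp only [ec] at hl ⊢; exact hl⟩
    rw [sub_self, zero_div, Real.cos_zero, one_mul]
    have := D.nonneg t (by linarith)
    positivity
  · push Not at hs
    exact ⟨0, le_rfl, pk_lim0 hr (by fun_prop) (fun t => Real.cos_le_one _) (fun t ht => lt_of_le_of_ne (Real.cos_le_one _) (hs t ht)) hwc⟩

lemma Data.y_right (D : Data m δ c a g) (j : ℕ) {r θ : ℝ} (hr : 0 < r) {k : ℤ} (hk : |(m:ℝ)*θ-2*π*k| ≤ a) :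
    ∃ d, d ≤ 0 ∧ HasDerivWithinAt (fun z : ℝ => Ij m c g j (pl r θ + z • (Pi.single 2 1 : Fin 3 → ℝ))) d (Ici 0) 0 := by
  obtain ⟨L, hL0, hL⟩ := D.pk_L j hr hk
  have hwc : Continuous fun t => Real.cos (θ-(t-2*π*j)/m) * g t := (by fun_prop : Continuous fun t : ℝ => Real.cos (θ-(t-2*π*j)/m)).mul D.cont
  obtain ⟨K, hK0, hK⟩ := D.hc.w1_bound
  obtain ⟨G, hG0, hG⟩ := exists_bd hwc
  have hB := I_abs D.m1 hK hwc hG hG0 j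
  set B := K*Cm m*G*∑' l, hS l with hBdef
  refine ⟨-(r/√(r^2+0^2)^2)*L - 0, ?_, ?_⟩
  · have : 0 ≤ (r/√(r^2+0^2)^2)*L := by positivity
    linarith
  refine hasDerivWithinAt_Ici_of_tendsto_deriv (s := Ioi 0) (fun z hz => (D.y_deriv j θ hr hz).differentiableAt.differentiableWithinAt) ?_ self_mem_nhdsWithin ?_
  · have h1 := (D.Ij_cont j).continuousAt (x := pl r θ + (0:ℝ) • (Pi.single 2 1 : Fin 3 → ℝ)) ((isOpen_lt continuous_const Nn_cont).mem_nhds (by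
      show 0 < Nn _
      rw [Nn_up]; positivity))
    exact (ContinuousAt.comp (f := fun z : ℝ => pl r θ + z • (Pi.single 2 1 : Fin 3 → ℝ)) h1 (by fun_prop)).continuousWithinAt
  · have hN : ∀ z, √(r^2+z^2) ≠ 0 := fun z => by positivity
    have l1 : Tendsto (fun z : ℝ => -(r/√(r^2+z^2)^2)) (nhdsWithin 0 (Ioi 0)) (nhds (-(r/√(r^2+0^2)^2))) := by
      have : Continuous fun z : ℝ => -(r/√(r^2+z^2)^2) := (continuous_const.div (by fun_prop) fun z => pow_ne_zero 2 (hN z)).neg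
      exact (this.tendsto 0).mono_left nhdsWithin_le_nhds
    have l2 : Tendsto (fun z : ℝ => |r*z/(2*√(r^2+z^2)^3)| * B) (nhdsWithin 0 (Ioi 0)) (nhds 0) := by
      have : Continuous fun z : ℝ => |r*z/(2*√(r^2+z^2)^3)| * B :=
        (Continuous.abs (Continuous.div (by fun_prop) (by fun_prop) fun z => mul_ne_zero two_ne_zero (pow_ne_zero 3 (hN z)))).mul_const B
      have := (this.tendsto 0).mono_left (nhdsWithin_le_nhds (s := Ioi 0))
      simpa using this
    refine Tendsto.congr' (f₁ := fun z => _) ?_ ((l1.mul hL).sub (squeeze_zero_norm (f := fun z => r*z/(2*√(r^2+z^2)^3) * ∫ t in -π..π, Ff (w1 c) (Xx ((t-2*π*j)/m) (pl r θ + z • (Pi.single 2 1 : Fin 3 → ℝ))) * (Real.cos (θ-(t-2*π*j)/m) * g t)) ?_ l2))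
    · filter_upwards [self_mem_nhdsWithin] with z hz
      exact (D.y_deriv j θ hr hz).deriv.symm
    · intro z
      rw [norm_mul, Real.norm_eq_abs, Real.norm_eq_abs]
      exact mul_le_mul_of_nonneg_left (hB _) (abs_nonneg _)

lemma Data.upper_slit (D : Data m δ c a g) (hμ : 0 < μ) {r θ : ℝ} (hr : 0 < r) {k : ℤ} (hk : |(m:ℝ)*θ-2*π*k| ≤ a) :
    ∃ d, d ≤ 0 ∧ HasUpperDeriv (uu m μ c g) 2 (pl r θ) d := by
  have h0 : uu m μ c g (pl r θ) = 0 := by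
    have : pl r θ ∈ contactSet (uu m μ c g) 2 := by
      rw [D.contact hμ]
      exact ⟨r, hr.le, θ, ⟨k, (D.slit_iff θ k).2 hk⟩, rfl⟩
    exact this.2
  choose d hd0 hd using fun j : ℕ => D.y_right j hr hk
  have hs : HasDerivWithinAt (fun z : ℝ => ∑ j ∈ Finset.range m, Ij m c g j (pl r θ + z • (Pi.single 2 1 : Fin 3 → ℝ))) (∑ j ∈ Finset.range m, d j) (Ici 0) 0 :=
    HasDerivWithinAt.fun_sum fun j _ => hd j
  have hp : ContinuousWithinAt (fun z : ℝ => √(r^2+z^2)^μ) (Ici 0) 0 := by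
    refine ContinuousWithinAt.rpow_const (by fun_prop) (Or.inr hμ.le)
  have hz : ∑ j ∈ Finset.range m, Ij m c g j (pl r θ) = 0 := by
    rw [uu_eq] at h0
    rcases mul_eq_zero.1 h0 with h | h
    · rw [Nn_pl hr.le] at h
      exact absurd h (by positivity)
    · exact h
  refine ⟨√(r^2+0^2)^μ * ∑ j ∈ Finset.range m, d j, mul_nonpos_of_nonneg_of_nonpos (by positivity) (Finset.sum_nonpos fun j _ => hd0 j), ?_⟩
  have h1 := (hasDerivWithinAt_iff_tendsto_slope.1 hs)
  rw [show Ici (0:ℝ) \ {0} = Ioi 0 by ext; simp [lt_iff_le_and_ne, eq_comm]] at h1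
  have h2 := (hp.mono (Ioi_subset_Ici_self)).tendsto.mul h1
  unfold HasUpperDeriv
  refine h2.congr fun z => ?_
  rw [h0, uu_eq, Nn_up, slope_def_field]
  simp only [zero_smul, add_zero, sub_zero, hz]
  ring

lemma Data.upper (D : Data m δ c a g) (hμ : 1 < μ) (x : Fin 3 → ℝ) (h2 : x 2 = 0) :
    ∃ d, d ≤ 0 ∧ HasUpperDeriv (uu m μ c g) 2 x d := by
  have hμ0 : 0 < μ := by linarith
  by_cases hx : x ∈ slitCone m (a/π)
  · obtain ⟨r, hr, θ, ⟨k, hk⟩, rfl⟩ := hx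
    rw [D.slit_iff] at hk
    rcases hr.eq_or_lt with rfl | hr
    · refine ⟨0, le_rfl, ?_⟩
      unfold HasUpperDeriv
      have e : (![0*Real.cos θ, 0*Real.sin θ, 0] : Fin 3 → ℝ) = 0 := by ext i; fin_cases i <;> simp
      rw [e, uu_zero hμ0]
      have h3 : Tendsto (fun t : ℝ => t^(μ-1) * uu m μ c g (Pi.single 2 1)) (nhdsWithin 0 (Ioi 0)) (nhds 0) := by
        have : Continuous fun t : ℝ => t^(μ-1) := Real.continuous_rpow_const (by linarith)
        have := ((this.tendsto 0).mono_left (nhdsWithin_le_nhds (s := Ioi 0))).mul_const (uu m μ c g (Pi.single 2 1))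
        rwa [Real.zero_rpow (by linarith), zero_mul] at this
      refine h3.congr' ?_
      filter_upwards [self_mem_nhdsWithin] with t ht
      have ht : 0 < t := ht
      rw [zero_add, uu_homog ht, Real.rpow_sub_one ht.ne']
      ring
    · exact D.upper_slit hμ0 hr hk
  · refine ⟨0, le_rfl, ?_⟩
    have hd : DifferentiableAt ℝ (uu m μ c g) x := ((D.uu_cd hμ0).contDiffAt ((D.openC hμ0).mem_nhds hx)).differentiableAt (by norm_num)
    have hl : HasDerivAt (fun t : ℝ => x + t • (Pi.single 2 1 : Fin 3 → ℝ)) (Pi.single 2 1) 0 := by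
      simpa using ((hasDerivAt_id (0:ℝ)).smul_const (Pi.single 2 1 : Fin 3 → ℝ)).const_add x
    have h1 : HasDerivAt (fun t : ℝ => uu m μ c g (x + t • (Pi.single 2 1 : Fin 3 → ℝ))) (fderiv ℝ (uu m μ c g) x (Pi.single 2 1)) 0 := by
      have h7 : HasFDerivAt (uu m μ c g) (fderiv ℝ (uu m μ c g) x) (x + (0:ℝ) • (Pi.single 2 1 : Fin 3 → ℝ)) := by
        simpa using hd.hasFDerivAt
      exact h7.comp_hasDerivAt (0:ℝ) hl
    have ev : ∀ t : ℝ, uu m μ c g (x + (-t) • (Pi.single 2 1 : Fin 3 → ℝ)) = uu m μ c g (x + t • (Pi.single 2 1 : Fin 3 → ℝ)) := by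
      intro t
      rw [← uu_symm]
      congr 1
      ext i
      fin_cases i <;> simp [h2, Pi.single_apply, Function.update]
    have h3 : HasDerivAt (fun t : ℝ => uu m μ c g (x + t • (Pi.single 2 1 : Fin 3 → ℝ))) (-(fderiv ℝ (uu m μ c g) x (Pi.single 2 1))) 0 := by
      have h4 : HasDerivAt (fun t : ℝ => uu m μ c g (x + t • (Pi.single 2 1 : Fin 3 → ℝ))) (fderiv ℝ (uu m μ c g) x (Pi.single 2 1)) (-0) := by rwa [neg_zero]
      have := HasDerivAt.scomp (0:ℝ) h4 (hasDerivAt_neg (0:ℝ))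
      simp only [Function.comp_def, ev] at this
      simpa using this
    have h5 : fderiv ℝ (uu m μ c g) x (Pi.single 2 1) = 0 := by have := h1.unique h3; linarith
    rw [h5] at h1
    have h6 := h1.tendsto_slope_zero_right
    unfold HasUpperDeriv
    refine h6.congr fun t => ?_
    simp only [zero_add, zero_smul, add_zero, smul_eq_mul]
    ring

lemma Data.isSol (D : Data m δ c a g) (hμ : 1 < μ) (hM : MM m δ = μ*(μ+1)) : IsTOPSol μ (uu m μ c g) 2 := by
  have hμ0 : 0 < μ := by linarith
  refine ⟨D.uu_cont hμ0, uu_symm, fun r hr x => uu_homog hr x, ?_, ?_, D.uu_nonneg hμ0, D.upper hμ⟩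
  · rw [D.contact hμ0]; exact D.uu_cd hμ0
  · rw [D.contact hμ0]; exact fun x hx => D.uu_lap hμ0 hM hx
end
end TO

/-- **Asymptotics in Theorem 1.1.** For every `ε > 0`, for all sufficiently large odd `m`
the homogeneity `μ` can be taken in `(m+1-ε, m+1)` and the slit size `σ` in `(0, ε)`:
`m + 1 - μ_m → 0` and `σ_m → 0` as `m → ∞` along odd integers. -/
theorem thin_obstacle_asymptotics (ε : ℝ) (hε : 0 < ε) :
    ∃ M : ℕ, ∀ m : ℕ, M ≤ m → Odd m →
      ∃ (μ σ : ℝ) (u : (Fin 3 → ℝ) → ℝ),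
        (m : ℝ) + 1 - ε < μ ∧ μ < m + 1 ∧ 0 < σ ∧ σ < ε ∧
        IsTOPSol μ u 2 ∧ u ≠ 0 ∧ contactSet u 2 = slitCone m σ := by
  obtain ⟨M, hM⟩ := TO.exists_data ε hε
  refine ⟨M, fun m hm ho => ?_⟩
  obtain ⟨δ, c, a, g, hδ, ha, D⟩ := hM m hm ho
  have hm1 : (20:ℝ) ≤ m := by exact_mod_cast D.hm
  have h1 : (1:ℝ) < (m:ℝ)+1-δ := by linarith [D.δ_le]
  have hδ0 := D.δ_pos
  refine ⟨(m:ℝ)+1-δ, a/π, TO.uu m ((m:ℝ)+1-δ) c g, by linarith, by linarith, div_pos D.a_pos Real.pi_pos, ?_,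
    D.isSol h1 ?_, D.uu_ne, D.contact (by linarith)⟩
  · rw [div_lt_iff₀ Real.pi_pos]; exact ha
  · unfold TO.MM; ring
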